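/- Let A be a finite abelian group of odd order m. Then there exist a real constant C and a real δ > 0 such that, as X → ∞, N_ℚ(S3×A, X) = C·X^{1/m} + O(X^{1/m − δ}). -/

import Mathlib

open scoped Classical
open Filter Asymptotics

noncomputable section

local notation "Qbar" => AlgebraicClosure ℚ

/-- The permutation of the embeddings of `K` into `Qbar` induced by an automorphism
of `Qbar` over `ℚ` (acting by post-composition). -/
def galPerm (K : IntermediateField ℚ Qbar) (σ : Qbar ≃ₐ[ℚ] Qbar) :
    Equiv.Perm (K →ₐ[ℚ] Qbar) where
  toFun f := σ.toAlgHom.comp f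
  invFun f := σ.symm.toAlgHom.comp f
  left_inv f := by ext x; simp
  right_inv f := by ext x; simp

/-- The action of the absolute Galois group of `ℚ` on the embeddings of `K`, as a
homomorphism to the permutation group of the embeddings.  Its image is the Galois group
of the Galois closure of `K`, viewed as a permutation group on the embeddings of `K`. -/
def galPermHom (K : IntermediateField ℚ Qbar) :
    (Qbar ≃ₐ[ℚ] Qbar) →* Equiv.Perm (K →ₐ[ℚ] Qbar) where
  toFun := galPerm K
  map_one' := by
    refine Equiv.ext fun f => AlgHom.ext fun x => ?_
    simp [galPerm]
  map_mul' σ τ := by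
    refine Equiv.ext fun f => AlgHom.ext fun x => ?_
    simp [galPerm]

/-- The absolute value of the discriminant of a number field `K` (junk value `0` if `K` is
infinite-dimensional over `ℚ`). -/
def absDisc (K : IntermediateField ℚ Qbar) : ℕ :=
  if h : FiniteDimensional ℚ K then
    haveI := h
    haveI : NumberField K := ⟨⟩
    (NumberField.discr K).natAbs
  else 0

/-- `K` is an `S3 × A`-number field of degree `3·|A|`: the Galois group of its Galois
closure, i.e. the image of the absolute Galois group of `ℚ` inside the permutation group of
the `3·|A|` embeddings of `K`, is isomorphic to `S3 × A` acting on `Fin 3 × A` via the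
product of the standard action of `S3` on three letters and the regular action of `A` on
itself. -/
def IsS3xAField (A : Type*) [CommGroup A] [Fintype A] (K : IntermediateField ℚ Qbar) : Prop :=
  Module.finrank ℚ K = 3 * Fintype.card A ∧
  ∃ (e : (K →ₐ[ℚ] Qbar) ≃ (Fin 3 × A))
    (φ : (Equiv.Perm (Fin 3) × A) ≃* (galPermHom K).range),
    ∀ (g : Equiv.Perm (Fin 3) × A) (f : K →ₐ[ℚ] Qbar),
      e ((φ g : Equiv.Perm (K →ₐ[ℚ] Qbar)) f) = (g.1 (e f).1, g.2 * (e f).2)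

/-- Two subfields of `Qbar` are identified when they are isomorphic over `ℚ`. -/
def isoSetoid : Setoid (IntermediateField ℚ Qbar) where
  r K L := Nonempty (K ≃ₐ[ℚ] L)
  iseqv := ⟨fun _ => ⟨AlgEquiv.refl⟩, fun ⟨e⟩ => ⟨e.symm⟩, fun ⟨e⟩ ⟨f⟩ => ⟨e.trans f⟩⟩

/-- `N_ℚ(S3 × A, X)`: the number of isomorphism classes of `S3 × A`-number fields of
degree `3|A|` with absolute discriminant at most `X`. -/
def NS3A (A : Type*) [CommGroup A] [Fintype A] (X : ℝ) : ℕ :=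
  Nat.card (Quotient (Setoid.comap
    (Subtype.val : {K : IntermediateField ℚ Qbar //
      IsS3xAField A K ∧ (absDisc K : ℝ) ≤ X} → _) isoSetoid))

open Finset Module Real

local notation "Form" => Fin 4 → ℤ
local notation "Fld" => IntermediateField ℚ Qbar
local notation:max "⟬" f "⟭" => fun i => (f i : ℝ)

variable {f g : Form} {s : Finset Form} {ε P Q R W : ℝ} {p N : ℕ}

section Forms
variable {R : Type*} [CommRing R]

/-- Discriminant of the binary cubic form with coefficients `f`. -/
def fdisc (f : Fin 4 → R) : R :=
  f 1 ^ 2 * f 2 ^ 2 - 4 * f 0 * f 2 ^ 3 - 4 * f 1 ^ 3 * f 3 - 27 * f 0 ^ 2 * f 3 ^ 2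
    + 18 * f 0 * f 1 * f 2 * f 3

def hesA (f : Fin 4 → R) : R := f 1 ^ 2 - 3 * f 0 * f 2
def hesB (f : Fin 4 → R) : R := f 1 * f 2 - 9 * f 0 * f 3
def hesC (f : Fin 4 → R) : R := f 2 ^ 2 - 3 * f 1 * f 3

/-- First Mathews polynomial of a binary cubic form. -/
def matA (f : Fin 4 → R) : R := f 1 * f 2 - f 0 * f 3
def matB (f : Fin 4 → R) : R := (f 0 - f 1) ^ 2 + f 0 * f 2 + f 0 * f 3 - f 1 * f 2
def matC (f : Fin 4 → R) : R := f 3 ^ 2 - f 0 ^ 2 + f 0 * f 2 - f 1 * f 3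

/-- The form `f(rx + sy, tx + uy)`. -/
def fact (r s t u : R) (f : Fin 4 → R) : Fin 4 → R :=
  ![f 0 * r ^ 3 + f 1 * r ^ 2 * t + f 2 * r * t ^ 2 + f 3 * t ^ 3,
    3 * f 0 * r ^ 2 * s + f 1 * (r ^ 2 * u + 2 * r * s * t) + f 2 * (2 * r * t * u + s * t ^ 2)
      + 3 * f 3 * t ^ 2 * u,
    3 * f 0 * r * s ^ 2 + f 1 * (2 * r * s * u + s ^ 2 * t) + f 2 * (r * u ^ 2 + 2 * s * t * u)
      + 3 * f 3 * t * u ^ 2,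
    f 0 * s ^ 3 + f 1 * s ^ 2 * u + f 2 * s * u ^ 2 + f 3 * u ^ 3]

lemma fdisc_fact (r s t u : R) (f : Fin 4 → R) :
    fdisc (fact r s t u f) = (r * u - s * t) ^ 6 * fdisc f := by
  simp [fdisc, fact]; ring

lemma hes_fact (r s t u : R) (f : Fin 4 → R) : hesA (fact r s t u f) =
      (r * u - s * t) ^ 2 * (hesA f * r ^ 2 + hesB f * r * t + hesC f * t ^ 2) ∧
    hesB (fact r s t u f) = (r * u - s * t) ^ 2 *
      (2 * hesA f * r * s + hesB f * (r * u + s * t) + 2 * hesC f * t * u) ∧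
    hesC (fact r s t u f) =
      (r * u - s * t) ^ 2 * (hesA f * s ^ 2 + hesB f * s * u + hesC f * u ^ 2) := by
  refine ⟨?_, ?_, ?_⟩ <;> simp [hesA, hesB, hesC, fact] <;> ring

lemma hes_disc (f : Fin 4 → R) : 4 * hesA f * hesC f - hesB f ^ 2 = 3 * fdisc f := by
  simp [hesA, hesB, hesC, fdisc]; ring

lemma hes_syzygy (f : Fin 4 → R) :
    (2 * f 1 ^ 3 - 9 * f 0 * f 1 * f 2 + 27 * f 0 ^ 2 * f 3) ^ 2 + 27 * fdisc f * f 0 ^ 2 =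
      4 * hesA f ^ 3 := by
  simp [hesA, fdisc]; ring

end Forms

section Reduced
variable {R : Type*} [CommRing R] [LinearOrder R]

/-- Strictly reduced binary cubic forms. -/
def SRed (f : Fin 4 → R) : Prop := (0 < fdisc f ∧ 0 < hesB f ∧ hesB f < hesA f ∧ hesA f < hesC f) ∨
  (fdisc f < 0 ∧ 0 < matA f ∧ 0 < matB f ∧ 0 < matC f)

/-- Reduced binary cubic forms, walls included. -/
def CRed (f : Fin 4 → R) : Prop := (0 < fdisc f ∧ 0 ≤ hesB f ∧ hesB f ≤ hesA f ∧ hesA f ≤ hesC f) ∨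
  (fdisc f < 0 ∧ 0 ≤ matA f ∧ 0 ≤ matB f ∧ 0 ≤ matC f)

end Reduced

local notation:max "Δ" f:max => ((fdisc f : ℤ) : ℝ)

/-- The product of the linear form `ux + vy` and the quadratic form `Px² + Qxy + Ry²`. -/
def linQuad (u v P Q R : ℝ) : Fin 4 → ℝ := ![u * P, u * Q + v * P, u * R + v * Q, v * R]

lemma quad_pos (hP : 0 < P) (hD : 0 < 4 * P * R - Q ^ 2) {x y : ℝ}
    (h : x ≠ 0 ∨ y ≠ 0) : 0 < P * x ^ 2 + Q * x * y + R * y ^ 2 := by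
  have e : 4 * P * (P * x ^ 2 + Q * x * y + R * y ^ 2) =
      (2 * P * x + Q * y) ^ 2 + (4 * P * R - Q ^ 2) * y ^ 2 := by ring
  by_cases hy : y = 0
  · subst hy
    have hx : x ≠ 0 := by simpa using h
    have : 0 < x ^ 2 := by positivity
    simp; positivity
  · have : 0 < y ^ 2 := by positivity
    have h2 : 0 < 4 * P * (P * x ^ 2 + Q * x * y + R * y ^ 2) := by rw [e]; positivity
    exact pos_of_mul_pos_right h2 (by positivity)

lemma linQuad_disc (u v P Q R : ℝ) : fdisc (linQuad u v P Q R) =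
    -((4 * P * R - Q ^ 2) * (P * v ^ 2 + Q * v * (-u) + R * (-u) ^ 2) ^ 2) := by
  simp [fdisc, linQuad]; ring

lemma linQuad_red {u v P Q R : ℝ} (hP : 0 < P) (hD : 0 < 4 * P * R - Q ^ 2) (h : u ≠ 0 ∨ v ≠ 0) :
    (SRed (linQuad u v P Q R) ↔ 0 < Q ∧ Q < P ∧ P < R) ∧
    (CRed (linQuad u v P Q R) ↔ 0 ≤ Q ∧ Q ≤ P ∧ P ≤ R) := by
  have hR : 0 < R := by nlinarith [sq_nonneg Q]
  have hd : fdisc (linQuad u v P Q R) < 0 := by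
    rw [linQuad_disc]
    have := quad_pos hP hD (x := v) (y := -u) (by simpa using h.symm)
    have := mul_pos hD (pow_pos this 2)
    linarith
  have h1 : 0 < P * v ^ 2 + Q * v * u + R * u ^ 2 := quad_pos hP hD h.symm
  have h2 : 0 < R * v ^ 2 + (-Q) * v * u + P * u ^ 2 := quad_pos hR (by linarith) h.symm
  have h3 : 0 < P * v ^ 2 + (Q - 2 * P) * v * u + (P - Q + R) * u ^ 2 :=
    quad_pos hP (by nlinarith) h.symm
  have e1 : matA (linQuad u v P Q R) = Q * (P * v ^ 2 + Q * v * u + R * u ^ 2) := by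
    simp [matA, linQuad]; ring
  have e2 : matC (linQuad u v P Q R) = (R - P) * (R * v ^ 2 + (-Q) * v * u + P * u ^ 2) := by
    simp [matC, linQuad]; ring
  have e3 : matB (linQuad u v P Q R) =
      (P - Q) * (P * v ^ 2 + (Q - 2 * P) * v * u + (P - Q + R) * u ^ 2) := by
    simp [matB, linQuad]; ring
  simp only [SRed, CRed, e1, e2, e3, hd, not_lt.mpr hd.le, mul_pos_iff_of_pos_right h1,
    mul_pos_iff_of_pos_right h2, mul_pos_iff_of_pos_right h3, mul_nonneg_iff_of_pos_right h1,
    mul_nonneg_iff_of_pos_right h2, mul_nonneg_iff_of_pos_right h3, sub_pos, sub_nonneg]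
  tauto

lemma fact_linQuad (r s t w u v P Q R : ℝ) : fact r s t w (linQuad u v P Q R) =
    linQuad (u * r + v * t) (u * s + v * w) (P * r ^ 2 + Q * r * t + R * t ^ 2)
      (2 * P * r * s + Q * (r * w + s * t) + 2 * R * t * w) (P * s ^ 2 + Q * s * w + R * w ^ 2) := by
  funext i
  fin_cases i <;> simp [fact, linQuad] <;> ring

lemma exists_root_monic_cubic (b c d : ℝ) : ∃ x : ℝ, x ^ 3 + b * x ^ 2 + c * x + d = 0 := by
  set M : ℝ := 1 + |b| + |c| + |d| with hM
  have hc : Continuous fun x : ℝ => x ^ 3 + b * x ^ 2 + c * x + d := by fun_prop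
  have hb := abs_nonneg b; have hcc := abs_nonneg c; have hd := abs_nonneg d
  have hM1 : 1 ≤ M := by linarith
  have key : |b * M ^ 2| + |c * M| + |d| ≤ M ^ 3 := by
    rw [abs_mul, abs_mul, abs_of_nonneg (by positivity : 0 ≤ M ^ 2), abs_of_pos (by linarith : 0 < M)]
    have h1 : |c| * M ≤ |c| * M ^ 2 := by gcongr; nlinarith
    have h2 : |d| ≤ |d| * M ^ 2 := by nlinarith [mul_nonneg hd (by nlinarith : 0 ≤ M ^ 2 - 1)]
    nlinarith [pow_pos (by linarith : 0 < M) 2]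
  have lo : (-M) ^ 3 + b * (-M) ^ 2 + c * (-M) + d ≤ 0 := by
    have := le_abs_self (b * M ^ 2); have := neg_abs_le (c * M); have := le_abs_self d
    nlinarith
  have hi : 0 ≤ M ^ 3 + b * M ^ 2 + c * M + d := by
    have := neg_abs_le (b * M ^ 2); have := neg_abs_le (c * M); have := neg_abs_le d
    nlinarith
  obtain ⟨x, -, hx⟩ := intermediate_value_Icc (by linarith : -M ≤ M) hc.continuousOn ⟨lo, hi⟩
  exact ⟨x, hx⟩

lemma exists_linQuad {f : Fin 4 → ℝ} (hf : fdisc f < 0) : ∃ u v P Q R : ℝ,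
    f = linQuad u v P Q R ∧ 0 < P ∧ 0 < 4 * P * R - Q ^ 2 ∧ (u ≠ 0 ∨ v ≠ 0) := by
  have main : ∃ u v P Q R : ℝ, f = linQuad u v P Q R := by
    by_cases ha : f 0 = 0
    · refine ⟨0, 1, f 1, f 2, f 3, ?_⟩
      funext i; fin_cases i <;> simp [linQuad, ha]
    · obtain ⟨x, hx⟩ := exists_root_monic_cubic (f 1 / f 0) (f 2 / f 0) (f 3 / f 0)
      refine ⟨1, -x, f 0, f 1 + f 0 * x, f 2 + f 1 * x + f 0 * x ^ 2, ?_⟩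
      have hx' : f 0 * x ^ 3 + f 1 * x ^ 2 + f 2 * x + f 3 = 0 := by field_simp at hx; linarith
      funext i
      fin_cases i <;> simp [linQuad]
      · ring
      · ring
      · linear_combination hx'
  obtain ⟨u, v, P, Q, R, rfl⟩ := main
  rw [linQuad_disc, neg_lt_zero] at hf
  have h2 : (P * v ^ 2 + Q * v * (-u) + R * (-u) ^ 2) ^ 2 ≠ 0 := fun h => by
    rw [h] at hf; simp at hf
  have hD : 0 < 4 * P * R - Q ^ 2 := pos_of_mul_pos_left hf (sq_nonneg _)
  have huv : u ≠ 0 ∨ v ≠ 0 := by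
    by_contra! h
    obtain ⟨rfl, rfl⟩ := h
    simp at h2
  have hP : P ≠ 0 := by rintro rfl; nlinarith [sq_nonneg Q]
  rcases lt_or_gt_of_ne hP with hP | hP
  · refine ⟨-u, -v, -P, -Q, -R, ?_, by linarith, by linarith, by simpa using huv⟩
    funext i; fin_cases i <;> simp [linQuad]
  · exact ⟨u, v, P, Q, R, rfl, hP, hD, huv⟩

lemma hes_pos {f : Fin 4 → ℝ} (hf : 0 < fdisc f) : 0 < hesA f := by
  by_cases ha : f 0 = 0
  · have : f 1 ≠ 0 := fun hb => by simp [fdisc, ha, hb] at hf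
    simp only [hesA, ha, mul_zero, zero_mul, sub_zero]; positivity
  · have : 0 < hesA f ^ 3 := by
      have key := hes_syzygy f
      have : 0 < fdisc f * f 0 ^ 2 := by positivity
      nlinarith [sq_nonneg (2 * f 1 ^ 3 - 9 * f 0 * f 1 * f 2 + 27 * f 0 ^ 2 * f 3)]
    exact (Odd.pow_pos_iff (by decide)).mp this

/-- The definite covariant of a binary cubic form decides reducedness of equivalent forms. -/
lemma exists_covariant {f : Fin 4 → ℝ} (hf : fdisc f ≠ 0) : ∃ P Q R : ℝ,
    0 < P ∧ 0 < 4 * P * R - Q ^ 2 ∧ ∀ r s t w : ℝ, (r * w - s * t) ^ 2 = 1 →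
    (SRed (fact r s t w f) ↔ 0 < 2 * P * r * s + Q * (r * w + s * t) + 2 * R * t * w ∧
      2 * P * r * s + Q * (r * w + s * t) + 2 * R * t * w < P * r ^ 2 + Q * r * t + R * t ^ 2 ∧
      P * r ^ 2 + Q * r * t + R * t ^ 2 < P * s ^ 2 + Q * s * w + R * w ^ 2) ∧
    (CRed (fact r s t w f) ↔ 0 ≤ 2 * P * r * s + Q * (r * w + s * t) + 2 * R * t * w ∧
      2 * P * r * s + Q * (r * w + s * t) + 2 * R * t * w ≤ P * r ^ 2 + Q * r * t + R * t ^ 2 ∧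
      P * r ^ 2 + Q * r * t + R * t ^ 2 ≤ P * s ^ 2 + Q * s * w + R * w ^ 2) := by
  rcases lt_or_gt_of_ne hf with hf | hf
  · obtain ⟨u, v, P, Q, R, rfl, hP, hD, huv⟩ := exists_linQuad hf
    refine ⟨P, Q, R, hP, hD, fun r s t w hdet => ?_⟩
    rw [fact_linQuad]
    have hne : r * w - s * t ≠ 0 := fun h => by simp [h] at hdet
    refine linQuad_red (quad_pos hP hD ?_) ?_ ?_
    · by_contra! h
      obtain ⟨rfl, rfl⟩ := h
      simp at hne
    · have : 4 * (P * r ^ 2 + Q * r * t + R * t ^ 2) * (P * s ^ 2 + Q * s * w + R * w ^ 2) -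
        (2 * P * r * s + Q * (r * w + s * t) + 2 * R * t * w) ^ 2 =
        (4 * P * R - Q ^ 2) * (r * w - s * t) ^ 2 := by ring
      rw [this, hdet]; linarith
    · by_contra! h
      have h1 : u * (r * w - s * t) = 0 := by linear_combination w * h.1 - t * h.2
      have h2 : v * (r * w - s * t) = 0 := by linear_combination r * h.2 - s * h.1
      simp only [mul_eq_zero, hne, or_false] at h1 h2
      exact huv.elim (· h1) (· h2)
  · have hD : 0 < 4 * hesA f * hesC f - hesB f ^ 2 := by rw [hes_disc]; linarith
    have hA : 0 < hesA f := hes_pos hf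
    refine ⟨hesA f, hesB f, hesC f, hA, hD, fun r s t w hdet => ?_⟩
    obtain ⟨e1, e2, e3⟩ := hes_fact r s t w f
    have e4 : 0 < fdisc (fact r s t w f) := by
      rw [fdisc_fact, show (r * w - s * t) ^ 6 = ((r * w - s * t) ^ 2) ^ 3 by ring, hdet]
      linarith
    simp only [SRed, CRed, e4, not_lt.mpr e4.le, e1, e2, e3, hdet, one_mul]
    tauto

lemma sq_ratio_bound {x y : ℝ} (hx : 0 ≤ x) (hy : 0 ≤ y) (h1 : 3 * (x - 1) ^ 2 ≤ 4 * y)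
    (h2 : 3 * (y - 1) ^ 2 ≤ 4 * x) : x ≤ 3 ∧ y ≤ 3 := by
  rcases le_total x y with h | h
  · have : y ≤ 3 := by nlinarith
    exact ⟨by linarith, this⟩
  · have : x ≤ 3 := by nlinarith
    exact ⟨this, by linarith⟩

set_option maxHeartbeats 1000000 in
/-- Size bounds for reduced forms. -/
lemma CRed.bounds {f : Fin 4 → ℝ} (hf : CRed f) (hW : |fdisc f| ≤ W) :
    ∃ P : ℝ, 0 < P ∧ P ^ 2 ≤ 8 * W ∧ f 0 ^ 2 ≤ 8 * P ∧ f 1 ^ 2 ≤ 8 * P ∧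
      f 2 ^ 2 * P ≤ 8 * W ∧ f 3 ^ 2 * P ^ 3 ≤ 8 * W ^ 2 ∧
      (|9 * f 0 * f 3 - f 1 * f 2| ≤ 8 * P ∨ |1 * f 0 * f 3 - f 1 * f 2| ≤ 8 * P) := by
  rcases hf with ⟨hD, hB, hBA, hAC⟩ | ⟨hD, hr⟩
  · rw [abs_of_pos hD] at hW
    have hA := hes_pos hD
    have hC : 0 < hesC f := by linarith
    have h4 := hes_disc f
    have hACD : hesA f * hesC f ≤ fdisc f := by nlinarith
    have ha : 27 * f 0 ^ 2 * hesC f ≤ 4 * hesA f ^ 2 := by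
      have h5 := hes_syzygy f
      have h6 : 27 * f 0 ^ 2 * (hesA f * hesC f) ≤ 4 * hesA f ^ 3 := by
        nlinarith [sq_nonneg (2 * f 1 ^ 3 - 9 * f 0 * f 1 * f 2 + 27 * f 0 ^ 2 * f 3),
          mul_le_mul_of_nonneg_left hACD (sq_nonneg (f 0))]
      refine le_of_mul_le_mul_left ?_ hA
      linarith
    have hd : 27 * f 3 ^ 2 * hesA f ≤ 4 * hesC f ^ 2 := by
      have h5 := hes_syzygy ![f 3, f 2, f 1, f 0]
      have e1 : fdisc ![f 3, f 2, f 1, f 0] = fdisc f := by simp [fdisc]; ring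
      have e2 : hesA ![f 3, f 2, f 1, f 0] = hesC f := by simp [hesA, hesC]; ring
      rw [e1, e2] at h5
      simp only [Matrix.cons_val] at h5
      have h6 : 27 * f 3 ^ 2 * (hesA f * hesC f) ≤ 4 * hesC f ^ 3 := by
        nlinarith [sq_nonneg (2 * f 2 ^ 3 - 9 * f 3 * f 2 * f 1 + 27 * f 3 ^ 2 * f 0),
          mul_le_mul_of_nonneg_left hACD (sq_nonneg (f 3))]
      refine le_of_mul_le_mul_left ?_ hC
      linarith
    have hbc : f 1 ^ 2 / hesA f ≤ 3 ∧ f 2 ^ 2 / hesC f ≤ 3 := by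
      apply sq_ratio_bound (by positivity) (by positivity)
      · have e : f 1 ^ 2 / hesA f - 1 = 3 * f 0 * f 2 / hesA f := by field_simp; simp [hesA]
        rw [e, div_pow, mul_div_assoc', mul_div_assoc', div_le_div_iff₀ (by positivity) hC]
        nlinarith [mul_le_mul_of_nonneg_right ha (sq_nonneg (f 2))]
      · have e : f 2 ^ 2 / hesC f - 1 = 3 * f 1 * f 3 / hesC f := by field_simp; simp [hesC]
        rw [e, div_pow, mul_div_assoc', mul_div_assoc', div_le_div_iff₀ (by positivity) hA]
        nlinarith [mul_le_mul_of_nonneg_right hd (sq_nonneg (f 1))]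
    rw [div_le_iff₀ hA, div_le_iff₀ hC] at hbc
    refine ⟨hesA f, hA, ?_, ?_, by linarith, ?_, ?_, Or.inl ?_⟩
    · nlinarith
    · refine le_of_mul_le_mul_right ?_ hC
      nlinarith
    · nlinarith
    · have h7 : (hesA f * hesC f) ^ 2 ≤ W ^ 2 := by gcongr; linarith
      nlinarith [mul_le_mul_of_nonneg_right hd (sq_nonneg (hesA f))]
    · have : 9 * f 0 * f 3 - f 1 * f 2 = - hesB f := by simp [hesB]
      rw [this, abs_neg, abs_of_nonneg hB]; linarith
  · obtain ⟨u, v, P, Q, R, rfl, hP, hD', huv⟩ := exists_linQuad hD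
    have hcr : CRed (linQuad u v P Q R) := Or.inr ⟨hD, hr⟩
    have hE : 0 < P * v ^ 2 + Q * v * (-u) + R * (-u) ^ 2 :=
      quad_pos hP hD' (by simpa using huv.symm)
    set E := P * v ^ 2 + Q * v * (-u) + R * (-u) ^ 2 with hEdef
    obtain ⟨hQ, hQP, hPR⟩ := (linQuad_red hP hD' huv).2.mp hcr
    have hR : 0 < R := by linarith
    have hDe := linQuad_disc u v P Q R
    rw [← hEdef] at hDe
    rw [abs_of_neg hD, hDe, neg_neg] at hW
    have hQ2 : Q ^ 2 ≤ P * R := by nlinarith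
    have hPRW : 3 * (P * R) * E ^ 2 ≤ W := by
      nlinarith [mul_le_mul_of_nonneg_right (show 3 * (P * R) ≤ 4 * P * R - Q ^ 2 by linarith)
        (sq_nonneg E)]
    have hE2 : P * v ^ 2 + R * u ^ 2 ≤ 2 * E := by
      have : 0 ≤ P * v ^ 2 + (-2 * Q) * v * u + R * u ^ 2 := by
        rcases le_total 0 (v * u) with h | h
        · have h1 : Q * (v * u) ≤ P * (v * u) := by gcongr
          nlinarith [sq_nonneg (v - u), mul_nonneg (sub_nonneg.2 hPR) (sq_nonneg u)]
        · nlinarith [mul_nonneg hQ (neg_nonneg.2 h), sq_nonneg v, sq_nonneg u]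
      rw [hEdef]; nlinarith
    have hv : P * v ^ 2 ≤ 2 * E := by nlinarith [mul_nonneg hR.le (sq_nonneg u)]
    have hu : R * u ^ 2 ≤ 2 * E := by nlinarith [mul_nonneg hP.le (sq_nonneg v)]
    have hW0 : 0 ≤ W := le_trans (by positivity) hPRW
    have hQu : (u * Q) ^ 2 ≤ 2 * E * P := by
      have : (u * Q) ^ 2 ≤ u ^ 2 * (P * R) := by rw [mul_pow]; gcongr
      nlinarith
    have hQv : (v * Q) ^ 2 ≤ 2 * E * R := by
      have : (v * Q) ^ 2 ≤ v ^ 2 * (P * R) := by rw [mul_pow]; gcongr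
      nlinarith
    have hPu : (u * P) ^ 2 ≤ 2 * E * P := by
      have : (u * P) ^ 2 ≤ u ^ 2 * (P * R) := by rw [mul_pow, sq P]; gcongr
      nlinarith
    have e0 : linQuad u v P Q R 0 = u * P := rfl
    have e1 : linQuad u v P Q R 1 = u * Q + v * P := rfl
    have e2 : linQuad u v P Q R 2 = u * R + v * Q := rfl
    have e3 : linQuad u v P Q R 3 = v * R := rfl
    rw [e0, e1, e2, e3]
    have hc2 : (u * R + v * Q) ^ 2 ≤ 8 * E * R := by
      nlinarith [add_sq_le (a := u * R) (b := v * Q), mul_le_mul_of_nonneg_left hu hR.le]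
    refine ⟨P * E, by positivity, ?_, by nlinarith, ?_, ?_, ?_, Or.inr ?_⟩
    · have : P ^ 2 * E ^ 2 ≤ P * R * E ^ 2 := by rw [sq P]; gcongr
      nlinarith
    · nlinarith [add_sq_le (a := u * Q) (b := v * P), mul_le_mul_of_nonneg_left hv hP.le]
    · have := mul_le_mul_of_nonneg_right hc2 (show 0 ≤ P * E by positivity)
      have h0 : 0 ≤ P * R * E ^ 2 := by positivity
      linarith only [this, h0, hPRW]
    · have h7 : (3 * (P * R) * E ^ 2) ^ 2 ≤ W ^ 2 := by gcongr
      have h8 := mul_le_mul_of_nonneg_right hv (show 0 ≤ R ^ 2 * P ^ 2 * E ^ 3 by positivity)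
      have h9 : (v * R) ^ 2 * (P * E) ^ 3 ≤ 2 * (P * R * E ^ 2) ^ 2 := by linarith only [h8]
      have h10 : 9 * (P * R * E ^ 2) ^ 2 ≤ W ^ 2 := by linarith only [h7]
      linarith only [h9, h10, sq_nonneg W]
    · have : 1 * (u * P) * (v * R) - (u * Q + v * P) * (u * R + v * Q) =
          -(Q * (P * v ^ 2 + Q * v * u + R * u ^ 2)) := by ring
      rw [this, abs_neg, abs_of_nonneg (mul_nonneg hQ (quad_pos hP hD' huv.symm).le)]
      have : P * v ^ 2 + Q * v * u + R * u ^ 2 ≤ 4 * E := by rw [hEdef]; rw [hEdef] at hE2; linarith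
      nlinarith [quad_pos hP hD' huv.symm]

lemma red_form_min (hQ : 0 ≤ Q) (hQP : Q ≤ P) (hPR : P ≤ R) (hP : 0 < P) {x y : ℤ}
    (hy : y ≠ 0) : R ≤ P * x ^ 2 + Q * x * y + R * y ^ 2 := by
  have key : P * (|x| : ℤ) ^ 2 - P * (|x| : ℤ) * (|y| : ℤ) + R * (|y| : ℤ) ^ 2 ≤
      P * x ^ 2 + Q * x * y + R * y ^ 2 := by
    push_cast
    rw [sq_abs, sq_abs, mul_assoc, mul_assoc, ← abs_mul]
    rcases le_total 0 ((x : ℝ) * y) with h | h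
    · rw [abs_of_nonneg h]; nlinarith
    · rw [abs_of_nonpos h]; nlinarith
  refine le_trans ?_ key
  have hx' : 0 ≤ |x| := abs_nonneg x
  have hy' : 1 ≤ |y| := Int.one_le_abs hy
  generalize |x| = u at *
  generalize |y| = v at *
  obtain rfl | hv := hy'.eq_or_lt
  · have : (0 : ℝ) ≤ (u : ℝ) ^ 2 - u := by
      have : 0 ≤ u ^ 2 - u := by nlinarith [mul_self_nonneg u, Int.le_self_sq u]
      exact_mod_cast this
    push_cast
    nlinarith
  · have h2 : (2 : ℝ) ≤ v := mod_cast hv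
    have h3 : (4 : ℝ) ≤ (v : ℝ) ^ 2 := by nlinarith
    have : P * (u : ℝ) ^ 2 - P * u * v + R * v ^ 2 =
      P * ((u : ℝ) - v / 2) ^ 2 + (R - P / 4) * v ^ 2 := by ring
    rw [this]
    have h4 : (R - P / 4) * 4 ≤ (R - P / 4) * (v : ℝ) ^ 2 :=
      mul_le_mul_of_nonneg_left h3 (by linarith)
    have := mul_nonneg hP.le (sq_nonneg ((u : ℝ) - v / 2))
    linarith

lemma red_form_min' (hQ : 0 ≤ Q) (hQP : Q ≤ P) (hPR : P ≤ R) (hP : 0 < P) {x y : ℤ}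
    (h : x ≠ 0 ∨ y ≠ 0) : P ≤ P * x ^ 2 + Q * x * y + R * y ^ 2 := by
  by_cases hy : y = 0
  · subst hy
    have hx : x ≠ 0 := by simpa using h
    have : (1 : ℝ) ≤ (x : ℝ) ^ 2 := by exact_mod_cast (pow_pos (abs_pos.2 hx) 2).trans_eq (sq_abs x)
    push_cast; nlinarith
  · exact hPR.trans (red_form_min hQ hQP hPR hP hy)

/-- A strictly reduced definite form is not equivalent to another one except via `±1`. -/
lemma red_form_unique (hQ : 0 < Q) (hQP : Q < P) (hPR : P < R) {r s t w : ℤ}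
    (hdet : (r * w - s * t) ^ 2 = 1)
    (hQ' : 0 < 2 * P * r * s + Q * (r * w + s * t) + 2 * R * t * w)
    (hQP' : 2 * P * r * s + Q * (r * w + s * t) + 2 * R * t * w < P * r ^ 2 + Q * r * t + R * t ^ 2)
    (hPR' : P * r ^ 2 + Q * r * t + R * t ^ 2 < P * s ^ 2 + Q * s * w + R * w ^ 2) :
    (r = 1 ∧ s = 0 ∧ t = 0 ∧ w = 1) ∨ (r = -1 ∧ s = 0 ∧ t = 0 ∧ w = -1) := by
  have hP : 0 < P := hQ.trans hQP
  have hwt : w ≠ 0 ∨ -t ≠ 0 := by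
    by_contra! h
    obtain ⟨h1, h2⟩ := h
    have : t = 0 := by lia
    subst h1 this
    simp at hdet
  have hinv := red_form_min' hQ'.le hQP'.le hPR'.le (hQ'.trans hQP') hwt
  have hdetR : ((r : ℝ) * w - s * t) ^ 2 = 1 := mod_cast hdet
  have hP2 : P * r ^ 2 + Q * r * t + R * t ^ 2 ≤ P := by
    refine hinv.trans (le_of_eq ?_)
    push_cast
    linear_combination P * hdetR
  have ht : t = 0 := by
    by_contra ht
    have := red_form_min hQ.le hQP.le hPR.le hP (x := r) ht
    linarith
  subst ht
  have hrw : (r * w) ^ 2 = 1 := by simpa using hdet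
  have hr : r = 1 ∨ r = -1 := by
    refine Int.isUnit_eq_one_or (isUnit_of_dvd_one ⟨r * w ^ 2, ?_⟩)
    rw [← hrw]; ring
  have hw : w = 1 ∨ w = -1 := by
    refine Int.isUnit_eq_one_or (isUnit_of_dvd_one ⟨w * r ^ 2, ?_⟩)
    rw [← hrw]; ring
  have big : ∀ k : ℤ, 0 < 2 * P * k + Q → 2 * P * k + Q < P → k = 0 := fun k h1 h2 => by
    have a : k < 1 := by
      by_contra! h
      have : (1 : ℝ) ≤ k := mod_cast h
      nlinarith
    have b : -1 < k := by
      by_contra! h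
      have : (k : ℝ) ≤ -1 := mod_cast h
      nlinarith
    lia
  have big' : ∀ k : ℤ, 0 < 2 * P * k - Q → 2 * P * k - Q < P → False := fun k h1 h2 => by
    rcases lt_or_ge k 1 with h | h
    · have : (k : ℝ) ≤ 0 := mod_cast Int.lt_add_one_iff.1 h
      nlinarith
    · have : (1 : ℝ) ≤ k := mod_cast h
      nlinarith
  rcases hr with rfl | rfl <;> rcases hw with rfl | rfl <;> push_cast at *
  · have := big s (by linarith) (by linarith)
    simp [this]
  · exact (big' s (by linarith) (by linarith)).elim
  · exact (big' (-s) (by push_cast; linarith) (by push_cast; linarith)).elim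
  · have := big (-s) (by push_cast; linarith) (by push_cast; linarith)
    right; simp; lia

lemma SRed.unique {f : Fin 4 → ℝ} (hf : SRed f) {r s t w : ℤ} (hdet : (r * w - s * t) ^ 2 = 1)
    (h : SRed (fact (r : ℝ) s t w f)) :
    (r = 1 ∧ s = 0 ∧ t = 0 ∧ w = 1) ∨ (r = -1 ∧ s = 0 ∧ t = 0 ∧ w = -1) := by
  have hd : fdisc f ≠ 0 := by
    rcases hf with h | h
    · exact h.1.ne'
    · exact h.1.ne
  obtain ⟨P, Q, R, hP, hD, hq⟩ := exists_covariant hd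
  have e : f = fact 1 0 0 1 f := by funext i; fin_cases i <;> simp [fact]
  rw [e] at hf
  have h1 := (hq 1 0 0 1 (by norm_num)).1.1 hf
  have h2 := (hq r s t w (mod_cast hdet)).1.1 h
  simp only [mul_zero, mul_one, zero_add, add_zero, one_pow, ne_eq, OfNat.ofNat_ne_zero,
    not_false_eq_true, zero_pow] at h1
  exact red_form_unique h1.1 h1.2.1 h1.2.2 hdet h2.1 h2.2.1 h2.2.2

set_option maxHeartbeats 1000000 in
lemma exists_red_form (hP : 0 < P) (hD : 0 < 4 * P * R - Q ^ 2) :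
    ∃ r s t w : ℤ, (r * w - s * t) ^ 2 = 1 ∧
      0 ≤ 2 * P * r * s + Q * (r * w + s * t) + 2 * R * t * w ∧
      2 * P * r * s + Q * (r * w + s * t) + 2 * R * t * w ≤ P * r ^ 2 + Q * r * t + R * t ^ 2 ∧
      P * r ^ 2 + Q * r * t + R * t ^ 2 ≤ P * s ^ 2 + Q * s * w + R * w ^ 2 := by
  set y := sqrt (4 * P * R - Q ^ 2) / (2 * P) with hy
  set x := -Q / (2 * P) with hx
  have hy0 : 0 < y := by have := sqrt_pos.2 hD; positivity
  have hQ : Q = -2 * P * x := by rw [hx]; field_simp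
  have hR : R = P * (x ^ 2 + y ^ 2) := by
    have := sq_sqrt hD.le
    rw [hx, hy, div_pow, div_pow, this]; field_simp; ring
  clear_value x y
  let z : UpperHalfPlane := ⟨⟨x, y⟩, hy0⟩
  obtain ⟨g, hg⟩ := ModularGroup.exists_smul_mem_fd z
  have hdet : g 0 0 * g 1 1 - g 0 1 * g 1 0 = 1 := by
    have := g.det_coe
    rwa [Matrix.det_fin_two] at this
  obtain ⟨h1, h2⟩ := hg
  set a := g 0 0
  set b := g 0 1
  set c := g 1 0
  set d := g 1 1
  have hz : ((g • z : UpperHalfPlane) : ℂ) = ((a : ℂ) * z + b) / ((c : ℂ) * z + d) := by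
    rw [UpperHalfPlane.coe_specialLinearGroup_apply]; simp [a, b, c, d]
  set N := (c * x + d) ^ 2 + (c * y) ^ 2 with hN
  have hzc : ((z : UpperHalfPlane) : ℂ) = ⟨x, y⟩ := rfl
  have hden : Complex.normSq ((c : ℂ) * z + d) = N := by
    rw [hzc, Complex.normSq_apply]; simp [hN]; ring
  have hnum : Complex.normSq ((a : ℂ) * z + b) = (a * x + b) ^ 2 + (a * y) ^ 2 := by
    rw [hzc, Complex.normSq_apply]; simp; ring
  have hN0 : 0 < N := by
    rw [← hden]
    have := (UpperHalfPlane.denom_ne_zero (g : GL (Fin 2) ℝ) z)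
    refine Complex.normSq_pos.2 ?_
    simpa [UpperHalfPlane.denom, c, d] using this
  have hre : (g • z : UpperHalfPlane).re * N = (a * x + b) * (c * x + d) + a * c * y ^ 2 := by
    rw [← UpperHalfPlane.coe_re, hz, Complex.div_re, hden, hzc]
    field_simp
    simp; ring
  rw [hz, map_div₀, hden, hnum, le_div_iff₀ hN0, one_mul] at h1
  have h2' : |(a * x + b) * (c * x + d) + a * c * y ^ 2| ≤ 1 / 2 * N := by
    rw [← hre, abs_mul, abs_of_pos hN0]; gcongr
  rw [abs_le] at h2'
  clear_value a b c d N
  have hPn : P * (d : ℝ) ^ 2 + Q * d * ((-c : ℤ) : ℝ) + R * ((-c : ℤ) : ℝ) ^ 2 = P * N := by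
    rw [hQ, hR, hN]; push_cast; ring
  have hRn : P * ((-b : ℤ) : ℝ) ^ 2 + Q * ((-b : ℤ) : ℝ) * a + R * (a : ℝ) ^ 2 =
      P * ((a * x + b) ^ 2 + (a * y) ^ 2) := by
    rw [hQ, hR]; push_cast; ring
  have hQn : 2 * P * d * ((-b : ℤ) : ℝ) + Q * (d * a + ((-b : ℤ) : ℝ) * ((-c : ℤ) : ℝ)) +
      2 * R * ((-c : ℤ) : ℝ) * a = -(2 * P * ((a * x + b) * (c * x + d) + a * c * y ^ 2)) := by
    rw [hQ, hR]; push_cast; ring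
  rcases le_total ((a * x + b) * (c * x + d) + a * c * y ^ 2) 0 with h | h
  · refine ⟨d, -b, -c, a, by linear_combination (a * d - b * c + 1) * hdet, ?_, ?_, ?_⟩
    · rw [hQn]; nlinarith
    · rw [hQn, hPn]; nlinarith
    · rw [hPn, hRn]; exact mul_le_mul_of_nonneg_left h1 hP.le
  · refine ⟨d, b, -c, -a, by linear_combination (a * d - b * c + 1) * hdet, ?_, ?_, ?_⟩
    · have : 2 * P * d * b + Q * (d * ((-a : ℤ) : ℝ) + b * ((-c : ℤ) : ℝ)) +
        2 * R * ((-c : ℤ) : ℝ) * ((-a : ℤ) : ℝ) =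
        2 * P * ((a * x + b) * (c * x + d) + a * c * y ^ 2) := by
        rw [hQ, hR]; push_cast; ring
      rw [this]; positivity
    · have : 2 * P * d * b + Q * (d * ((-a : ℤ) : ℝ) + b * ((-c : ℤ) : ℝ)) +
        2 * R * ((-c : ℤ) : ℝ) * ((-a : ℤ) : ℝ) =
        2 * P * ((a * x + b) * (c * x + d) + a * c * y ^ 2) := by
        rw [hQ, hR]; push_cast; ring
      rw [this, hPn]; nlinarith
    · have : P * (b : ℝ) ^ 2 + Q * b * ((-a : ℤ) : ℝ) + R * ((-a : ℤ) : ℝ) ^ 2 =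
        P * ((a * x + b) ^ 2 + (a * y) ^ 2) := by
        rw [hQ, hR]; push_cast; ring
      rw [hPn, this]; exact mul_le_mul_of_nonneg_left h1 hP.le

/-- Every form of nonzero discriminant is equivalent to a reduced one. -/
lemma exists_cred {f : Fin 4 → ℝ} (hf : fdisc f ≠ 0) :
    ∃ r s t w : ℤ, (r * w - s * t) ^ 2 = 1 ∧ CRed (fact (r : ℝ) s t w f) := by
  obtain ⟨P, Q, R, hP, hD, hq⟩ := exists_covariant hf
  obtain ⟨r, s, t, w, hdet, h⟩ := exists_red_form hP hD
  exact ⟨r, s, t, w, hdet, (hq r s t w (mod_cast hdet)).2.2 h⟩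

lemma exists_add_one_le_mul_two_pow (hε : 0 < ε) :
    ∃ C : ℝ, 1 ≤ C ∧ ∀ e : ℕ, (e + 1 : ℝ) ≤ C * ((2 : ℝ) ^ ε) ^ e := by
  have h1 : 1 < (2 : ℝ) ^ ε := one_lt_rpow (by norm_num) hε
  refine ⟨1 + 1 / ((2 : ℝ) ^ ε - 1), by
    have : 0 < (2 : ℝ) ^ ε - 1 := by linarith
    have := (one_div_pos.2 this).le
    linarith, fun e => ?_⟩
  generalize (2 : ℝ) ^ ε = q at h1
  have hq : 0 < q - 1 := by linarith
  have hb := one_add_mul_sub_le_pow (a := q) (by linarith) e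
  have h2 : (1 : ℝ) ≤ q ^ e := one_le_pow₀ h1.le
  have h3 : (e : ℝ) ≤ 1 / (q - 1) * q ^ e := by
    rw [div_mul_eq_mul_div, le_div_iff₀ hq]
    linarith
  linarith

/-- The divisor bound. -/
lemma exists_card_divisors_le (hε : 0 < ε) :
    ∃ C : ℝ, 1 ≤ C ∧ ∀ n : ℕ, n ≠ 0 → (#n.divisors : ℝ) ≤ C * (n : ℝ) ^ ε := by
  obtain ⟨C, hC, h⟩ := exists_add_one_le_mul_two_pow hε
  obtain ⟨B, hB⟩ := exists_nat_ge ((2 : ℝ) ^ (1 / ε))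
  refine ⟨C ^ B, one_le_pow₀ hC, fun n hn => ?_⟩
  have hnε : (n : ℝ) ^ ε = ∏ p ∈ n.primeFactors, ((p : ℝ) ^ ε) ^ (n.factorization p) := by
    conv_lhs => rw [← Nat.prod_factorization_pow_eq_self hn]
    rw [Finsupp.prod, Nat.support_factorization]
    push_cast
    rw [← finsetProd_rpow _ _ (fun i _ => by positivity)]
    refine prod_congr rfl fun p _ => ?_
    rw [← rpow_natCast, ← rpow_natCast, ← rpow_mul (by positivity),
      ← rpow_mul (by positivity), mul_comm]
  have hle : ∀ p ∈ n.primeFactors, ((n.factorization p : ℝ) + 1) ≤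
      (if p < B then C else 1) * ((p : ℝ) ^ ε) ^ (n.factorization p) := fun p hp => by
    have hp2 := (Nat.prime_of_mem_primeFactors hp).two_le
    split_ifs with hpB
    · refine (h _).trans ?_
      gcongr
      exact_mod_cast hp2
    · have : (2 : ℝ) ≤ (p : ℝ) ^ ε := by
        have hpB' : (B : ℝ) ≤ p := mod_cast not_lt.1 hpB
        calc (2 : ℝ) = ((2 : ℝ) ^ (1 / ε)) ^ ε := by
              rw [← rpow_mul (by norm_num), one_div_mul_cancel hε.ne', rpow_one]
          _ ≤ (p : ℝ) ^ ε := by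
              gcongr
              linarith
      rw [one_mul]
      calc ((n.factorization p : ℝ) + 1) ≤ 2 ^ (n.factorization p) := by
            have := one_add_mul_sub_le_pow (a := (2 : ℝ)) (by norm_num) (n.factorization p)
            linarith
        _ ≤ _ := by gcongr
  rw [Nat.card_divisors hn, hnε]
  push_cast
  calc (∏ p ∈ n.primeFactors, ((n.factorization p : ℝ) + 1)) ≤
      ∏ p ∈ n.primeFactors, ((if p < B then C else 1) * ((p : ℝ) ^ ε) ^ (n.factorization p)) :=
        Finset.prod_le_prod (fun _ _ => by positivity) hle
    _ = (∏ p ∈ n.primeFactors, (if p < B then C else 1)) *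
        ∏ p ∈ n.primeFactors, ((p : ℝ) ^ ε) ^ (n.factorization p) := prod_mul_distrib
    _ ≤ C ^ B * ∏ p ∈ n.primeFactors, ((p : ℝ) ^ ε) ^ (n.factorization p) := by
        gcongr
        rw [prod_ite, prod_const, prod_const_one, mul_one]
        apply pow_le_pow_right₀ hC
        calc _ ≤ (range B).card := card_le_card fun p hp => by grind
          _ = B := card_range B

lemma two_pow_primeFactors_le_divisors {n : ℕ} (hn : n ≠ 0) :
    2 ^ #n.primeFactors ≤ #n.divisors := by
  rw [Nat.card_divisors hn, ← prod_const]
  refine prod_le_prod' fun p hp => ?_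
  have := (Nat.prime_of_mem_primeFactors hp).factorization_pos_of_dvd hn
    (Nat.dvd_of_mem_primeFactors hp)
  omega

lemma exists_pow_primeFactors_le (hε : 0 < ε) (k : ℕ) :
    ∃ C : ℝ, 1 ≤ C ∧ ∀ n : ℕ, n ≠ 0 → (k : ℝ) ^ #n.primeFactors ≤ C * (n : ℝ) ^ ε := by
  obtain ⟨C, hC, h⟩ := exists_card_divisors_le (ε := ε / (k + 1)) (by positivity)
  refine ⟨C ^ (k + 1), one_le_pow₀ hC, fun n hn => ?_⟩
  have hk : (k : ℝ) ≤ 2 ^ (k + 1) := by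
    have : k < 2 ^ (k + 1) := (Nat.lt_two_pow_self).trans_le (Nat.pow_le_pow_right (by norm_num) (by omega))
    exact_mod_cast this.le
  calc (k : ℝ) ^ #n.primeFactors ≤ (2 ^ (k + 1)) ^ #n.primeFactors := by gcongr
    _ = (2 ^ #n.primeFactors) ^ (k + 1) := by rw [← pow_mul, ← pow_mul, mul_comm]
    _ ≤ (#n.divisors : ℝ) ^ (k + 1) := by
        gcongr
        exact_mod_cast two_pow_primeFactors_le_divisors hn
    _ ≤ (C * (n : ℝ) ^ (ε / (k + 1))) ^ (k + 1) := by gcongr; exact h n hn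
    _ = C ^ (k + 1) * (n : ℝ) ^ ε := by
        rw [mul_pow, ← rpow_natCast ((n : ℝ) ^ _), ← rpow_mul (by positivity)]
        congr 2
        push_cast
        field_simp

/-- A family of asymptotics with a truncation parameter `2 ^ k` yields a single asymptotic with a
power saving. -/
lemma exists_asymp_of_truncated {b δ η : ℝ} (hb : 0 < b) (hδ : 0 < δ) (hη : 0 < η) :
    ∃ δ' c : ℝ, 0 < δ' ∧ 0 < c ∧ ∀ (G : ℝ → ℝ) (C : ℕ → ℝ) (K : ℝ), 0 ≤ K →
      (∀ W : ℝ, 1 ≤ W → ∀ k : ℕ, |G W - C k * W| ≤ K * (((2 : ℝ) ^ k) ^ b * W ^ (1 - δ) +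
          W ^ (1 + η * δ / (4 * b)) * ((2 : ℝ) ^ k) ^ (-η))) →
      ∃ C₀ : ℝ, ∀ W : ℝ, 1 ≤ W → |G W - C₀ * W| ≤ c * K * W ^ (1 - δ') := by
  set β := δ / (2 * b) with hβ
  set ε := η * δ / (4 * b) with hε
  set δ' := min (δ / 2) ε with hδ'
  have hβ0 : 0 < β := by positivity
  have hε0 : 0 < ε := by positivity
  have hδ'0 : 0 < δ' := lt_min (by positivity) hε0
  have hbβ : b * β = δ / 2 := by rw [hβ]; field_simp
  have hηβ : η * β = 2 * ε := by rw [hβ, hε]; field_simp; ring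
  set r := (2 : ℝ) ^ (-(δ' / β)) with hr
  have hr0 : 0 < r := by positivity
  have hr1 : r < 1 := rpow_lt_one_of_one_lt_of_neg (by norm_num) (by
    have : 0 < δ' / β := by positivity
    linarith)
  -- the error at a truncation level close to `W ^ β`
  have herr : ∀ (W : ℝ) (k : ℕ), 1 ≤ W → (2 : ℝ) ^ k ≤ W ^ β → W ^ β ≤ 2 * 2 ^ k →
      ((2 : ℝ) ^ k) ^ b * W ^ (1 - δ) + W ^ (1 + ε) * ((2 : ℝ) ^ k) ^ (-η) ≤
        (1 + 2 ^ η) * W ^ (1 - δ') := fun W k hW h1 h2 => by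
    have hW0 : 0 < W := by linarith
    have e1 : ((2 : ℝ) ^ k) ^ b * W ^ (1 - δ) ≤ W ^ (1 - δ') := by
      calc ((2 : ℝ) ^ k) ^ b * W ^ (1 - δ) ≤ (W ^ β) ^ b * W ^ (1 - δ) := by gcongr
        _ = W ^ (1 - δ / 2) := by
          rw [← rpow_mul hW0.le, ← rpow_add hW0]
          congr 1; linarith
        _ ≤ _ := rpow_le_rpow_of_exponent_le hW (by linarith [min_le_left (δ / 2) ε])
    have e2 : W ^ (1 + ε) * ((2 : ℝ) ^ k) ^ (-η) ≤ 2 ^ η * W ^ (1 - δ') := by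
      calc W ^ (1 + ε) * ((2 : ℝ) ^ k) ^ (-η) ≤ W ^ (1 + ε) * (W ^ β / 2) ^ (-η) := by
            refine mul_le_mul_of_nonneg_left ?_ (by positivity)
            exact rpow_le_rpow_of_nonpos (by positivity) (by linarith) (by linarith)
        _ = 2 ^ η * W ^ (1 - ε) := by
          rw [div_rpow (by positivity) (by norm_num), ← rpow_mul hW0.le,
            rpow_neg (by norm_num : (0 : ℝ) ≤ 2), div_inv_eq_mul, ← mul_assoc,
            ← rpow_add hW0, mul_comm]
          congr 2; linarith
        _ ≤ _ := by
          gcongr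
          exact min_le_right _ _
    linarith
  refine ⟨δ', (1 + 2 ^ η) + 2 * (1 + 2 ^ η) * 4 ^ η * 2 ^ (δ' / β) / (1 - r), hδ'0, by
    have : 0 < 1 - r := by linarith
    positivity, fun G C K hK h => ?_⟩
  have hstep : ∀ k, dist (C k) (C (k + 1)) ≤ (2 * K * (1 + 2 ^ η) * 4 ^ η) * r ^ k := fun k => by
    set W := (2 : ℝ) ^ ((k + 1) / β) with hW
    have hW1 : 1 ≤ W := one_le_rpow (by norm_num) (by positivity)
    have hW0 : 0 < W := by linarith
    have hWβ : W ^ β = 2 ^ (k + 1) := by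
      rw [hW, ← rpow_mul (by norm_num), div_mul_cancel₀ _ hβ0.ne', ← rpow_natCast]
      push_cast; rfl
    have a1 := (h W hW1 k).trans (mul_le_mul_of_nonneg_left (herr W k hW1
      (by rw [hWβ, pow_succ]; linarith [pow_pos (show (0 : ℝ) < 2 by norm_num) k])
      (by rw [hWβ, pow_succ]; linarith)) hK)
    have a2 := (h W hW1 (k + 1)).trans (mul_le_mul_of_nonneg_left (herr W (k + 1) hW1
      (by rw [hWβ]) (by rw [hWβ]; linarith [pow_pos (show (0 : ℝ) < 2 by norm_num) (k + 1)])) hK)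
    have a3 : |C k - C (k + 1)| * W ≤ 2 * K * (1 + 2 ^ η) * W ^ (1 - δ') := by
      rw [← abs_of_pos hW0, ← abs_mul, abs_of_pos hW0]
      have : (C k - C (k + 1)) * W = (G W - C (k + 1) * W) - (G W - C k * W) := by ring
      rw [this]
      refine (abs_sub _ _).trans ?_
      linarith
    have a4 : W ^ (1 - δ') = W * W ^ (-δ') := by rw [sub_eq_add_neg, rpow_add hW0, rpow_one]
    have a5 : W ^ (-δ') ≤ r ^ k := by
      rw [hW, hr, ← rpow_mul (by norm_num), ← rpow_natCast, ← rpow_mul (by norm_num)]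
      apply rpow_le_rpow_of_exponent_le (by norm_num)
      have : 0 < δ' / β := by positivity
      have e : ((k : ℝ) + 1) / β * -δ' = -(δ' / β) * (k + 1) := by ring
      rw [e]; nlinarith
    have a6 : (1 : ℝ) ≤ 4 ^ η := one_le_rpow (by norm_num) hη.le
    rw [dist_eq]
    rw [a4] at a3
    have a7 : |C k - C (k + 1)| ≤ 2 * K * (1 + 2 ^ η) * W ^ (-δ') := by
      refine le_of_mul_le_mul_right ?_ hW0
      linarith
    calc _ ≤ _ := a7
      _ ≤ 2 * K * (1 + 2 ^ η) * r ^ k := by gcongr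
      _ ≤ (2 * K * (1 + 2 ^ η) * 4 ^ η) * r ^ k := by
        refine mul_le_mul_of_nonneg_right ?_ (by positivity)
        exact le_mul_of_one_le_right (by positivity) a6
  obtain ⟨C₀, hC₀⟩ := cauchySeq_tendsto_of_complete (cauchySeq_of_le_geometric r _ hr1 hstep)
  refine ⟨C₀, fun W hW => ?_⟩
  have hW0 : 0 < W := by linarith
  have hWβ1 : 1 ≤ W ^ β := one_le_rpow hW hβ0.le
  obtain ⟨k, hk1, hk2⟩ := exists_nat_pow_near hWβ1 (by norm_num : (1 : ℝ) < 2)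
  have a1 := (h W hW k).trans (mul_le_mul_of_nonneg_left (herr W k hW hk1
    (by rw [pow_succ] at hk2; linarith)) hK)
  have a2 := dist_le_of_le_geometric_of_tendsto r _ hr1 hstep hC₀ k
  have a3 : r ^ k ≤ 2 ^ (δ' / β) * W ^ (-δ') := by
    have e1 : r ^ k = ((2 : ℝ) ^ k) ^ (-(δ' / β)) := by
      rw [hr, ← rpow_natCast, ← rpow_natCast, ← rpow_mul (by norm_num),
        ← rpow_mul (by norm_num), mul_comm]
    rw [e1]
    calc ((2 : ℝ) ^ k) ^ (-(δ' / β)) ≤ (W ^ β / 2) ^ (-(δ' / β)) :=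
          rpow_le_rpow_of_nonpos (by positivity) (by rw [pow_succ] at hk2; linarith)
            (by have : 0 < δ' / β := (by positivity); linarith)
      _ = _ := by
        rw [div_rpow (by positivity) (by norm_num), ← rpow_mul hW0.le,
          rpow_neg (by norm_num : (0 : ℝ) ≤ 2), div_inv_eq_mul, mul_comm]
        congr 2
        field_simp
  have a4 : W ^ (1 - δ') = W * W ^ (-δ') := by rw [sub_eq_add_neg, rpow_add hW0, rpow_one]
  have hr2 : 0 < 1 - r := by linarith
  rw [dist_eq] at a2
  have a5 : |(C k - C₀) * W| ≤
      2 * (1 + 2 ^ η) * 4 ^ η * 2 ^ (δ' / β) / (1 - r) * K * W ^ (1 - δ') := by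
    rw [abs_mul, abs_of_pos hW0, a4]
    calc |C k - C₀| * W ≤ ((2 * K * (1 + 2 ^ η) * 4 ^ η) * r ^ k / (1 - r)) * W := by gcongr
      _ ≤ ((2 * K * (1 + 2 ^ η) * 4 ^ η) * (2 ^ (δ' / β) * W ^ (-δ')) / (1 - r)) * W := by gcongr
      _ = _ := by ring
  have e : G W - C₀ * W = (G W - C k * W) + (C k - C₀) * W := by ring
  rw [e]
  refine (abs_add_le _ _).trans ?_
  refine (add_le_add a1 a5).trans (le_of_eq ?_)
  ring

lemma card_int_mod_le {s : Finset ℤ} {q : ℤ} {L : ℝ} (hq : 0 < q) (hL : 0 ≤ L)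
    (h : ∀ x ∈ s, ∀ y ∈ s, x ≤ y → (y : ℝ) - x ≤ L) (hs : ∀ x ∈ s, ∀ y ∈ s, q ∣ y - x) :
    (#s : ℝ) ≤ L / q + 1 := by
  rcases s.eq_empty_or_nonempty with rfl | hne
  · simp; positivity
  set x₀ := s.min' hne with hx₀
  have hx₀s : x₀ ∈ s := s.min'_mem hne
  have hinj : #s ≤ (Icc (0 : ℤ) ⌊L / q⌋).card := by
    refine card_le_card_of_injOn (fun x => (x - x₀) / q) (fun x hx => ?_) ?_
    · have h1 : x₀ ≤ x := s.min'_le x hx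
      have h2 := h x₀ hx₀s x hx h1
      simp only [coe_Icc, Set.mem_Icc]
      refine ⟨Int.ediv_nonneg (by linarith) hq.le, Int.le_floor.2 ?_⟩
      rw [le_div_iff₀ (mod_cast hq)]
      have h3 := Int.ediv_mul_cancel (hs x₀ hx₀s x hx)
      have h4 : (((x - x₀) / q : ℤ) : ℝ) * q = x - x₀ := mod_cast h3
      linarith
    · intro x hx y hy hxy
      simp only at hxy
      have h3 := Int.ediv_mul_cancel (hs x₀ hx₀s x hx)
      have h4 := Int.ediv_mul_cancel (hs x₀ hx₀s y hy)
      rw [hxy] at h3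
      linarith
  have h0 : (0 : ℝ) ≤ L / q := by positivity
  have h1 : ((Icc (0 : ℤ) ⌊L / q⌋).card : ℝ) = ⌊L / q⌋ + 1 := by
    rw [Int.card_Icc, sub_zero, ← Int.cast_natCast, Int.toNat_of_nonneg (by
      have := Int.floor_nonneg.2 h0; linarith)]
    push_cast; rfl
  calc (#s : ℝ) ≤ ((Icc (0 : ℤ) ⌊L / q⌋).card : ℝ) := mod_cast hinj
    _ = ⌊L / q⌋ + 1 := h1
    _ ≤ _ := by linarith [Int.floor_le (L / (q : ℝ))]

lemma card_int_le {s : Finset ℤ} {L : ℝ} (hL : 0 ≤ L)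
    (h : ∀ x ∈ s, ∀ y ∈ s, x ≤ y → (y : ℝ) - x ≤ L) : (#s : ℝ) ≤ L + 1 := by
  have := card_int_mod_le (q := 1) one_pos hL h (fun _ _ _ _ => one_dvd _)
  simpa using this

lemma card_abs_le {s : Finset ℤ} {L : ℝ} (h : ∀ x ∈ s, |(x : ℝ)| ≤ L) (hL : 0 ≤ L) :
    (#s : ℝ) ≤ 2 * L + 1 := by
  refine card_int_le (by positivity) fun x hx y hy _ => ?_
  have h1 := abs_le.1 (h x hx)
  have h2 := abs_le.1 (h y hy)
  linarith

lemma card_linear_le {s : Finset ℤ} {α β H : ℝ} (hα : α ≠ 0) (hH : 0 ≤ H)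
    (h : ∀ x ∈ s, |α * x + β| ≤ H) : (#s : ℝ) ≤ 2 * H / |α| + 1 := by
  have hα' : 0 < |α| := abs_pos.2 hα
  refine card_int_le (by positivity) fun x hx y hy hxy => ?_
  have hxy' : (0 : ℝ) ≤ y - x := by
    have : (x : ℝ) ≤ y := mod_cast hxy
    linarith
  rw [le_div_iff₀ hα', ← abs_of_nonneg hxy', ← abs_mul]
  have : ((y : ℝ) - x) * α = (α * y + β) - (α * x + β) := by ring
  rw [this]
  refine (abs_sub _ _).trans ?_
  linarith [h x hx, h y hy]

lemma card_quad_le {s : Finset ℤ} {α β γ H : ℝ} (hα : α ≠ 0) (hH : 0 ≤ H)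
    (h : ∀ x ∈ s, |α * x ^ 2 + β * x + γ| ≤ H) :
    (#s : ℝ) ≤ 2 * (√(2 * H / |α|) + 1) := by
  have hα' : 0 < |α| := abs_pos.2 hα
  have key : ∀ x ∈ s, ∀ y ∈ s, x ≤ y → |(y : ℝ) - x| ≤ |(x + y) + β / α| →
      (y : ℝ) - x ≤ √(2 * H / |α|) := fun x hx y hy hxy h1 => by
    have hxy' : (0 : ℝ) ≤ y - x := by
      have : (x : ℝ) ≤ y := mod_cast hxy
      linarith
    rw [abs_of_nonneg hxy'] at h1
    apply le_sqrt_of_sq_le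
    rw [le_div_iff₀ hα']
    have e : |α * y ^ 2 + β * y + γ - (α * x ^ 2 + β * x + γ)| =
        |α| * ((y - x) * |(x + y : ℝ) + β / α|) := by
      rw [← abs_of_nonneg hxy', ← abs_mul, ← abs_mul]
      congr 1; field_simp; ring
    have h2 : |α * y ^ 2 + β * y + γ - (α * x ^ 2 + β * x + γ)| ≤ 2 * H :=
      (abs_sub _ _).trans (by linarith [h x hx, h y hy])
    rw [e] at h2
    have h3 : ((y : ℝ) - x) ^ 2 ≤ (y - x) * |(x + y : ℝ) + β / α| := by
      rw [sq]; exact mul_le_mul_of_nonneg_left h1 hxy'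
    have h4 := mul_le_mul_of_nonneg_left h3 hα'.le
    linarith
  have h1 : ((s.filter fun x : ℤ => -(β / α) ≤ 2 * (x : ℝ)).card : ℝ) ≤ √(2 * H / |α|) + 1 := by
    refine card_int_le (by positivity) fun x hx y hy hxy => ?_
    rw [mem_filter] at hx hy
    have hxy' : (x : ℝ) ≤ y := mod_cast hxy
    refine key x hx.1 y hy.1 hxy ?_
    rw [abs_of_nonneg (by linarith), abs_of_nonneg (by linarith)]
    linarith
  have h2 : ((s.filter fun x : ℤ => ¬ -(β / α) ≤ 2 * (x : ℝ)).card : ℝ) ≤ √(2 * H / |α|) + 1 := by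
    refine card_int_le (by positivity) fun x hx y hy hxy => ?_
    rw [mem_filter] at hx hy
    have hxy' : (x : ℝ) ≤ y := mod_cast hxy
    have hx2 := not_le.1 hx.2
    have hy2 := not_le.1 hy.2
    refine key x hx.1 y hy.1 hxy ?_
    rw [abs_of_nonneg (by linarith), abs_of_nonpos (by linarith)]
    linarith
  have h3 := s.card_filter_add_card_filter_not (fun x : ℤ => -(β / α) ≤ 2 * (x : ℝ))
  have h4 : ((s.filter fun x : ℤ => -(β / α) ≤ 2 * (x : ℝ)).card : ℝ) +
      ((s.filter fun x : ℤ => ¬ -(β / α) ≤ 2 * (x : ℝ)).card : ℝ) = #s := by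
    exact_mod_cast h3
  linarith

/-- The fibre of a finite set of quadruples over the first three coordinates. -/
def dfib (s : Finset Form) (a b c : ℤ) : Finset ℤ :=
  (s.filter fun f => f 0 = a ∧ f 1 = b ∧ f 2 = c).image fun f => f 3

lemma mem_dfib {a b c d : ℤ} : d ∈ dfib s a b c ↔ ![a, b, c, d] ∈ s := by
  simp only [dfib, mem_image, mem_filter]
  constructor
  · rintro ⟨f, ⟨hf, rfl, rfl, rfl⟩, rfl⟩
    convert hf using 1
    ext i; fin_cases i <;> rfl
  · intro h
    exact ⟨_, ⟨h, rfl, rfl, rfl⟩, rfl⟩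

lemma card_le_sum_dfib (s : Finset Form) (t : Finset (ℤ × ℤ × ℤ))
    (h : ∀ f ∈ s, (f 0, f 1, f 2) ∈ t) :
    #s ≤ ∑ x ∈ t, (dfib s x.1 x.2.1 x.2.2).card := by
  rw [card_eq_sum_card_fiberwise h]
  refine sum_le_sum fun x _ => ?_
  rw [dfib, card_image_of_injOn]
  · refine card_le_card fun f hf => ?_
    simp only [mem_filter] at hf ⊢
    exact ⟨hf.1, by rw [← hf.2], by rw [← hf.2], by rw [← hf.2]⟩
  · intro f hf g hg hfg
    simp only [coe_filter, Set.mem_setOf_eq] at hf hg hfg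
    ext i
    fin_cases i
    · exact hf.2.1.trans hg.2.1.symm
    · exact hf.2.2.1.trans hg.2.2.1.symm
    · exact hf.2.2.2.trans hg.2.2.2.symm
    · exact hfg

lemma card_Icc_floor {B : ℝ} (hB : 0 ≤ B) : ((Icc (-⌊B⌋) ⌊B⌋).card : ℝ) ≤ 2 * B + 1 := by
  refine card_abs_le (fun x hx => ?_) hB
  rw [mem_Icc] at hx
  have h1 : (x : ℝ) ≤ ⌊B⌋ := mod_cast hx.2
  have h2 : -(⌊B⌋ : ℝ) ≤ x := mod_cast hx.1
  have := Int.floor_le B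
  exact abs_le.2 ⟨by linarith, by linarith⟩

lemma mem_Icc_floor {B : ℝ} {x : ℤ} (h : |(x : ℝ)| ≤ B) : x ∈ Icc (-⌊B⌋) ⌊B⌋ := by
  have := abs_le.1 h
  rw [mem_Icc]
  exact ⟨by rw [neg_le]; exact Int.le_floor.2 (by push_cast; linarith), Int.le_floor.2 this.2⟩

lemma card_le_of_dfib {B D : ℝ} (hB : 1 ≤ B) (hD : 0 ≤ D)
    (h : ∀ f ∈ s, ∀ i, |(f i : ℝ)| ≤ B) (hd : ∀ a b c, ((dfib s a b c).card : ℝ) ≤ D) :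
    (#s : ℝ) ≤ (3 * B) ^ 3 * D := by
  set I := Icc (-⌊B⌋) ⌊B⌋
  have h1 := card_le_sum_dfib s (I ×ˢ I ×ˢ I) (fun f hf => by
    simp only [mem_product]
    exact ⟨mem_Icc_floor (h f hf 0), mem_Icc_floor (h f hf 1), mem_Icc_floor (h f hf 2)⟩)
  have hI : (#I : ℝ) ≤ 3 * B := (card_Icc_floor (by linarith)).trans (by linarith)
  calc (#s : ℝ) ≤ ((∑ x ∈ I ×ˢ I ×ˢ I, (dfib s x.1 x.2.1 x.2.2).card : ℕ) : ℝ) := by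
        exact_mod_cast h1
    _ ≤ ∑ x ∈ I ×ˢ I ×ˢ I, D := by
        push_cast
        exact sum_le_sum fun x _ => hd _ _ _
    _ = (#I : ℝ) ^ 3 * D := by
        rw [sum_const, card_product, card_product, nsmul_eq_mul]
        push_cast; ring
    _ ≤ _ := by gcongr

lemma card_le_of_coord {B A : ℝ} (hB : 1 ≤ B) (j : Fin 4)
    (h : ∀ f ∈ s, ∀ i, |(f i : ℝ)| ≤ B) (hA : ((s.image fun f => f j).card : ℝ) ≤ A) :
    (#s : ℝ) ≤ A * (3 * B) ^ 3 := by
  set I := Icc (-⌊B⌋) ⌊B⌋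
  have hsub : s ⊆ Fintype.piFinset (fun i => if i = j then s.image (fun f => f j) else I) := by
    intro f hf
    rw [Fintype.mem_piFinset]
    intro i
    split_ifs with hi
    · exact mem_image.2 ⟨f, hf, by rw [hi]⟩
    · exact mem_Icc_floor (h f hf i)
  have hI : (#I : ℝ) ≤ 3 * B := (card_Icc_floor (by linarith)).trans (by linarith)
  have h1 := card_le_card hsub
  rw [Fintype.card_piFinset] at h1
  have h2 : (∏ i, (if i = j then s.image (fun f => f j) else I).card) =
      (s.image (fun f => f j)).card * #I ^ 3 := by
    rw [← mul_prod_erase _ _ (mem_univ j), if_pos rfl]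
    congr 1
    rw [prod_congr rfl (g := fun _ => #I) (fun i hi => by
      rw [if_neg (ne_of_mem_erase hi)]), prod_const, card_erase_of_mem
      (mem_univ j)]
    simp
  rw [h2] at h1
  have hA0 : 0 ≤ A := (Nat.cast_nonneg _).trans hA
  calc (#s : ℝ) ≤ ((s.image (fun f => f j)).card : ℝ) * (#I : ℝ) ^ 3 := by exact_mod_cast h1
    _ ≤ _ := by gcongr

/-- Quadruples in a box where one coordinate is either small or the last coordinate is confined to
few values. -/
lemma card_le_of_dfib_of_large {B D : ℝ} (hB : 1 ≤ B) (hD : 0 ≤ D) (j : Fin 4)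
    (h : ∀ f ∈ s, ∀ i, |(f i : ℝ)| ≤ B)
    (hd : ∀ a b c, ((dfib (s.filter fun f => B ^ (3 / 4 : ℝ) < |(f j : ℝ)|) a b c).card : ℝ) ≤ D) :
    (#s : ℝ) ≤ 27 * B ^ 3 * (3 * B ^ (3 / 4 : ℝ) + D) := by
  have h1 := card_le_of_dfib hB hD (s := s.filter fun f => B ^ (3 / 4 : ℝ) < |(f j : ℝ)|)
    (fun f hf => h f (mem_filter.1 hf).1) hd
  have hB1 : (1 : ℝ) ≤ B ^ (3 / 4 : ℝ) := one_le_rpow hB (by norm_num)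
  have h2 := card_le_of_coord hB (s := s.filter fun f => ¬ B ^ (3 / 4 : ℝ) < |(f j : ℝ)|) j
    (A := 3 * B ^ (3 / 4 : ℝ)) (fun f hf => h f (mem_filter.1 hf).1) (by
      refine (card_abs_le (L := B ^ (3 / 4 : ℝ)) (fun x hx => ?_) (by positivity)).trans
        (by linarith)
      obtain ⟨f, hf, rfl⟩ := mem_image.1 hx
      exact not_lt.1 (mem_filter.1 hf).2)
  have h3 := s.card_filter_add_card_filter_not (fun f => B ^ (3 / 4 : ℝ) < |(f j : ℝ)|)
  have h4 : (#s : ℝ) = ((s.filter fun f => B ^ (3 / 4 : ℝ) < |(f j : ℝ)|).card : ℝ) +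
      ((s.filter fun f => ¬ B ^ (3 / 4 : ℝ) < |(f j : ℝ)|).card : ℝ) := by
    exact_mod_cast h3.symm
  rw [h4]
  linarith

section SmallValues

variable {B M : ℝ}

lemma card_small_of_dfib (hB : 1 ≤ B) (hM : 1 ≤ M) (j : Fin 4) (h : ∀ f ∈ s, ∀ i, |(f i : ℝ)| ≤ B)
    (hd : ∀ a b c d, ![a, b, c, d] ∈ s → B ^ (3 / 4 : ℝ) < |(![a, b, c, d] j : ℝ)| →
      (#(dfib (s.filter fun f => B ^ (3 / 4 : ℝ) < |(f j : ℝ)|) a b c) : ℝ) ≤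
        1001 * M * B ^ (3 / 4 : ℝ)) : (#s : ℝ) ≤ 30000 * M * B ^ (15 / 4 : ℝ) := by
  have hB0 : 0 < B := by linarith
  refine (card_le_of_dfib_of_large hB (D := 1001 * M * B ^ (3 / 4 : ℝ)) (by positivity) j h
    fun a b c => ?_).trans ?_
  · rcases (dfib (s.filter fun f => B ^ (3 / 4 : ℝ) < |(f j : ℝ)|) a b c).eq_empty_or_nonempty
      with he | ⟨d, hd'⟩
    · rw [he]; simp; positivity
    rw [mem_dfib, mem_filter] at hd'
    exact hd _ _ _ _ hd'.1 hd'.2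
  have e : B ^ (15 / 4 : ℝ) = B ^ 3 * B ^ (3 / 4 : ℝ) := by
    rw [← rpow_natCast, ← rpow_add hB0]; norm_num
  rw [e]
  have hB3 : 0 < B ^ 3 * B ^ (3 / 4 : ℝ) := by positivity
  nlinarith

lemma card_linear_small (hB : 1 ≤ B) (hM : 1 ≤ M) (j : Fin 4)
    (h : ∀ f ∈ s, ∀ i, |(f i : ℝ)| ≤ B) (α β : ℤ → ℤ → ℤ → ℝ) {H : ℝ} (hH : 0 ≤ H)
    (hs : ∀ f ∈ s, |α (f 0) (f 1) (f 2) * f 3 + β (f 0) (f 1) (f 2)| ≤ H)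
    (hα : ∀ f ∈ s, B ^ (3 / 4 : ℝ) < |(f j : ℝ)| → α (f 0) (f 1) (f 2) ≠ 0 ∧
      H ≤ 500 * M * B ^ (3 / 4 : ℝ) * |α (f 0) (f 1) (f 2)|) :
    (#s : ℝ) ≤ 30000 * M * B ^ (15 / 4 : ℝ) := by
  have hMB : 1 ≤ M * B ^ (3 / 4 : ℝ) :=
    one_le_mul_of_one_le_of_one_le hM (one_le_rpow hB (by norm_num))
  refine card_small_of_dfib hB hM j h fun a b c d hd hj => ?_
  obtain ⟨a1 : α a b c ≠ 0, a2 : H ≤ 500 * M * B ^ (3 / 4 : ℝ) * |α a b c|⟩ := hα _ hd hj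
  refine (card_linear_le (α := α a b c) (β := β a b c) a1 hH (fun x hx => ?_)).trans ?_
  · rw [mem_dfib, mem_filter] at hx
    exact hs _ hx.1
  · have : 2 * H / |α a b c| ≤ 1000 * M * B ^ (3 / 4 : ℝ) := by
      rw [div_le_iff₀ (abs_pos.2 a1)]
      linarith
    linarith

lemma card_quad_small (hB : 1 ≤ B) (hM : 1 ≤ M) (j : Fin 4)
    (h : ∀ f ∈ s, ∀ i, |(f i : ℝ)| ≤ B) (α β γ : ℤ → ℤ → ℤ → ℝ) {H : ℝ} (hH : 0 ≤ H)
    (hs : ∀ f ∈ s, |α (f 0) (f 1) (f 2) * (f 3) ^ 2 + β (f 0) (f 1) (f 2) * f 3 +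
      γ (f 0) (f 1) (f 2)| ≤ H)
    (hα : ∀ f ∈ s, B ^ (3 / 4 : ℝ) < |(f j : ℝ)| → α (f 0) (f 1) (f 2) ≠ 0 ∧
      H ≤ 500 * M * (B ^ (3 / 4 : ℝ)) ^ 2 * |α (f 0) (f 1) (f 2)|) :
    (#s : ℝ) ≤ 30000 * M * B ^ (15 / 4 : ℝ) := by
  have hMB : 1 ≤ M * B ^ (3 / 4 : ℝ) :=
    one_le_mul_of_one_le_of_one_le hM (one_le_rpow hB (by norm_num))
  refine card_small_of_dfib hB hM j h fun a b c d hd hj => ?_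
  obtain ⟨a1 : α a b c ≠ 0, a2 : H ≤ 500 * M * (B ^ (3 / 4 : ℝ)) ^ 2 * |α a b c|⟩ := hα _ hd hj
  refine (card_quad_le (α := α a b c) (β := β a b c) (γ := γ a b c) a1 hH fun x hx => ?_).trans ?_
  · rw [mem_dfib, mem_filter] at hx
    exact hs _ hx.1
  · have : √(2 * H / |α a b c|) ≤ 34 * M * B ^ (3 / 4 : ℝ) := by
      apply sqrt_le_iff.2 ⟨by positivity, ?_⟩
      rw [div_le_iff₀ (abs_pos.2 a1)]
      have : M ≤ M ^ 2 := by nlinarith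
      have h5 : M * ((B ^ (3 / 4 : ℝ)) ^ 2 * |α a b c|) ≤
        M ^ 2 * ((B ^ (3 / 4 : ℝ)) ^ 2 * |α a b c|) := by gcongr
      have h6 : 0 ≤ M ^ 2 * ((B ^ (3 / 4 : ℝ)) ^ 2 * |α a b c|) := by positivity
      nlinarith
    linarith

lemma le_pow_of_lt_abs {B a : ℝ} (hB : 1 ≤ B) (h : B ^ (3 / 4 : ℝ) < |a|) :
    a ≠ 0 ∧ B ≤ B ^ (3 / 4 : ℝ) * |a| ∧ B ≤ (B ^ (3 / 4 : ℝ)) ^ 2 ∧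
      B ^ 3 ≤ (B ^ (3 / 4 : ℝ)) ^ 2 * a ^ 2 := by
  have hB0 : 0 < B := by linarith
  have e : (B ^ (3 / 4 : ℝ)) ^ 2 = B ^ (3 / 2 : ℝ) := by
    rw [← rpow_natCast, ← rpow_mul hB0.le]; norm_num
  have e3 : B ^ 3 = (B ^ (3 / 4 : ℝ)) ^ 2 * (B ^ (3 / 4 : ℝ)) ^ 2 := by
    rw [e, ← rpow_natCast, ← rpow_add hB0]; norm_num
  have h2 : B ≤ (B ^ (3 / 4 : ℝ)) ^ 2 := by
    rw [e]
    calc B = B ^ (1 : ℝ) := (rpow_one B).symm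
      _ ≤ _ := rpow_le_rpow_of_exponent_le hB (by norm_num)
  have h0 : 0 < B ^ (3 / 4 : ℝ) := by positivity
  refine ⟨fun ha => ?_, ?_, h2, ?_⟩
  · rw [ha, abs_zero] at h; linarith
  · refine h2.trans ?_
    rw [sq]; gcongr
  · rw [e3, ← sq_abs a]; gcongr

/-- Counting integral forms in a box where one of the relevant polynomials is small. -/
lemma card_small_values (hB : 1 ≤ B) (hM : 1 ≤ M) (h : ∀ f ∈ s, ∀ i, |(f i : ℝ)| ≤ B) (w : ℝ)
    (hs : (∀ f ∈ s, |fdisc ⟬f⟭ - w| ≤ 500 * M * B ^ 3) ∨ (∀ f ∈ s, |hesB ⟬f⟭| ≤ 100 * M * B) ∨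
      (∀ f ∈ s, |hesA ⟬f⟭ - hesB ⟬f⟭| ≤ 100 * M * B) ∨
      (∀ f ∈ s, |hesC ⟬f⟭ - hesA ⟬f⟭| ≤ 100 * M * B) ∨
      (∀ f ∈ s, |matA ⟬f⟭| ≤ 100 * M * B) ∨
      (∀ f ∈ s, |matB ⟬f⟭| ≤ 100 * M * B) ∨
      (∀ f ∈ s, |matC ⟬f⟭| ≤ 100 * M * B)) :
    (#s : ℝ) ≤ 30000 * M * B ^ (15 / 4 : ℝ) := by
  have hB0 : 0 < B := by linarith
  have hM0 : 0 < M := by linarith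
  have lin (j : Fin 4) (k : ℝ) (α β : ℤ → ℤ → ℤ → ℝ) (hα : ∀ f : Form, α (f 0) (f 1) (f 2) = k * f j)
      (hk : 1 ≤ |k|) (hs : ∀ f ∈ s, |α (f 0) (f 1) (f 2) * f 3 + β (f 0) (f 1) (f 2)| ≤
        100 * M * B) : (#s : ℝ) ≤ 30000 * M * B ^ (15 / 4 : ℝ) :=
    card_linear_small hB hM j h α β (by positivity) hs fun f _ hlt => by
      obtain ⟨h0, h1, -⟩ := le_pow_of_lt_abs hB hlt
      rw [hα, abs_mul]
      refine ⟨mul_ne_zero (abs_pos.1 (by linarith)) h0, ?_⟩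
      have h4 := mul_le_mul_of_nonneg_left h1 (by positivity : (0 : ℝ) ≤ 100 * M)
      have h5 : 0 ≤ M * (B ^ (3 / 4 : ℝ) * |(f j : ℝ)|) := by positivity
      nlinarith
  rcases hs with hs | hs | hs | hs | hs | hs | hs
  · refine card_quad_small hB hM 0 h (fun a _ _ => -27 * (a : ℝ) ^ 2)
      (fun a b c => -4 * b ^ 3 + 18 * a * b * c) (fun a b c => b ^ 2 * c ^ 2 - 4 * a * c ^ 3 - w)
      (H := 500 * M * B ^ 3) (by positivity) (fun f hf => ?_) (fun f _ hlt => ?_)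
    · convert hs f hf using 2
      simp only [fdisc]; ring
    · obtain ⟨h0, h1, h2, h3⟩ := le_pow_of_lt_abs hB hlt
      refine ⟨by positivity, ?_⟩
      rw [abs_mul, abs_of_nonneg (sq_nonneg (f 0 : ℝ))]
      have : |(-27 : ℝ)| = 27 := by norm_num
      rw [this]
      have h4 := mul_le_mul_of_nonneg_left h3 (by positivity : (0 : ℝ) ≤ 500 * M)
      have h5 : 0 ≤ 500 * M * ((B ^ (3 / 4 : ℝ)) ^ 2 * (f 0 : ℝ) ^ 2) := by positivity
      linarith
  · refine lin 0 (-9) (fun a _ _ => -9 * a) (fun a b c => b * c)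
      (fun _ => rfl) (by norm_num) fun f hf => ?_
    convert hs f hf using 2
    simp only [hesB]; ring
  · refine lin 0 9 (fun a _ _ => 9 * a) (fun a b c => b ^ 2 - 3 * a * c - b * c)
      (fun _ => rfl) (by norm_num) fun f hf => ?_
    convert hs f hf using 2
    simp only [hesB, hesA]; ring
  · refine lin 1 (-3) (fun _ b _ => -3 * b) (fun a b c => c ^ 2 - b ^ 2 + 3 * a * c)
      (fun _ => rfl) (by norm_num) fun f hf => ?_
    convert hs f hf using 2
    simp only [hesC, hesA]; ring
  · refine lin 0 (-1) (fun a _ _ => -1 * a) (fun a b c => b * c)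
      (fun _ => rfl) (by norm_num) fun f hf => ?_
    convert hs f hf using 2
    simp only [matA]; ring
  · refine lin 0 1 (fun a _ _ => 1 * a) (fun a b c => (a - b) ^ 2 + a * c - b * c)
      (fun _ => rfl) (by norm_num) fun f hf => ?_
    convert hs f hf using 2
    simp only [matB]; ring
  · refine card_quad_small hB hM 0 h (fun _ _ _ => 1)
      (fun a b c => -b) (fun a b c => - a ^ 2 + a * c) (H := 100 * M * B) (by positivity)
      (fun f hf => ?_) (fun f _ hlt => ?_)
    · convert hs f hf using 2
      simp only [matC]; ring
    · obtain ⟨h0, h1, h2, h3⟩ := le_pow_of_lt_abs hB hlt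
      refine ⟨one_ne_zero, ?_⟩
      rw [abs_one]
      have h4 := mul_le_mul_of_nonneg_left h2 (by positivity : (0 : ℝ) ≤ 100 * M)
      have h5 : 0 ≤ M * (B ^ (3 / 4 : ℝ)) ^ 2 := by positivity
      linarith

end SmallValues

section Variation

lemma abs_mul_sub_mul_le {x y x' y' B₁ B₂ e₁ e₂ : ℝ} (hx : |x| ≤ B₁) (hy' : |y'| ≤ B₂)
    (h1 : |x - x'| ≤ e₁) (h2 : |y - y'| ≤ e₂) : |x * y - x' * y'| ≤ B₁ * e₂ + e₁ * B₂ := by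
  have e : x * y - x' * y' = x * (y - y') + (x - x') * y' := by ring
  rw [e]
  refine (abs_add_le _ _).trans ?_
  rw [abs_mul, abs_mul]
  have := (abs_nonneg x).trans hx
  have := (abs_nonneg _).trans h1
  gcongr

variable {x y : Fin 4 → ℝ} {B M : ℝ}

lemma abs_mul_le {a b A B : ℝ} (ha : |a| ≤ A) (hb : |b| ≤ B) : |a * b| ≤ A * B := by
  rw [abs_mul]
  exact mul_le_mul ha hb (abs_nonneg _) ((abs_nonneg _).trans ha)

lemma quad_variation (hx : ∀ i, |x i| ≤ B) (hy : ∀ i, |y i| ≤ B) (h : ∀ i, |x i - y i| ≤ M)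
    (i j : Fin 4) : |x i * x j - y i * y j| ≤ 2 * M * B :=
  (abs_mul_sub_mul_le (hx i) (hy j) (h i) (h j)).trans (by linarith)

lemma quart_variation (hx : ∀ i, |x i| ≤ B) (hy : ∀ i, |y i| ≤ B) (h : ∀ i, |x i - y i| ≤ M)
    (i j k l : Fin 4) :
    |x i * x j * (x k * x l) - y i * y j * (y k * y l)| ≤ 4 * M * B ^ 3 :=
  (abs_mul_sub_mul_le (abs_mul_le (hx i) (hx j)) (abs_mul_le (hy k) (hy l))
    (quad_variation hx hy h i j) (quad_variation hx hy h k l)).trans (by linarith)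

lemma fdisc_variation (hx : ∀ i, |x i| ≤ B) (hy : ∀ i, |y i| ≤ B) (h : ∀ i, |x i - y i| ≤ M) :
    |fdisc x - fdisc y| ≤ 500 * M * B ^ 3 := by
  have q := fun i j k l => abs_le.1 (quart_variation hx hy h i j k l)
  obtain ⟨a1, a2⟩ := q 1 1 2 2
  obtain ⟨b1, b2⟩ := q 0 2 2 2
  obtain ⟨c1, c2⟩ := q 1 1 1 3
  obtain ⟨d1, d2⟩ := q 0 0 3 3
  obtain ⟨e1, e2⟩ := q 0 1 2 3
  simp only [fdisc]
  rw [abs_le]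
  constructor <;> linarith

lemma quads_variation (hx : ∀ i, |x i| ≤ B) (hy : ∀ i, |y i| ≤ B) (h : ∀ i, |x i - y i| ≤ M) :
    |hesB x - hesB y| ≤ 100 * M * B ∧ |(hesA x - hesB x) - (hesA y - hesB y)| ≤ 100 * M * B ∧
    |(hesC x - hesA x) - (hesC y - hesA y)| ≤ 100 * M * B ∧ |matA x - matA y| ≤ 100 * M * B ∧
    |matB x - matB y| ≤ 100 * M * B ∧ |matC x - matC y| ≤ 100 * M * B := by
  have q := fun i j => abs_le.1 (quad_variation hx hy h i j)
  obtain ⟨a1, a2⟩ := q 0 0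
  obtain ⟨b1, b2⟩ := q 0 1
  obtain ⟨c1, c2⟩ := q 0 2
  obtain ⟨d1, d2⟩ := q 0 3
  obtain ⟨e1, e2⟩ := q 1 1
  obtain ⟨f1, f2⟩ := q 1 2
  obtain ⟨g1, g2⟩ := q 1 3
  obtain ⟨h1, h2⟩ := q 2 2
  obtain ⟨i1, i2⟩ := q 3 3
  simp only [hesA, hesB, hesC, matA, matB, matC, abs_le]
  refine ⟨⟨?_, ?_⟩, ⟨?_, ?_⟩, ⟨?_, ?_⟩, ⟨?_, ?_⟩, ⟨?_, ?_⟩, ⟨?_, ?_⟩⟩ <;> linarith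

end Variation

section

open MeasureTheory

/-- The half-open cube of side `M` with lower corner `x`. -/
def hcube (M : ℝ) (x : Fin 4 → ℝ) : Set (Fin 4 → ℝ) :=
  Set.pi Set.univ fun i => Set.Ico (x i) (x i + M)

lemma volume_hcube {M : ℝ} (x : Fin 4 → ℝ) : volume (hcube M x) = ENNReal.ofReal M ^ 4 := by
  rw [hcube, volume_pi_Ico]
  simp

lemma measurableSet_hcube (M : ℝ) (x : Fin 4 → ℝ) : MeasurableSet (hcube M x) :=
  MeasurableSet.univ_pi fun _ => measurableSet_Ico

lemma mem_hcube {M : ℝ} {x y : Fin 4 → ℝ} : y ∈ hcube M x ↔ ∀ i, x i ≤ y i ∧ y i < x i + M := by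
  simp [hcube]

lemma hcube_disjoint {M : ℕ} {x y v : Form} (hx : ∀ i, (M : ℤ) ∣ x i - v i)
    (hy : ∀ i, (M : ℤ) ∣ y i - v i) (h : x ≠ y) :
    Disjoint (hcube M ⟬x⟭) (hcube M ⟬y⟭) := by
  rw [Set.disjoint_left]
  intro z hz hz'
  rw [mem_hcube] at hz hz'
  apply h
  ext i
  have h1 := hz i
  have h2 := hz' i
  have h3 : x i < y i + M := by
    have : (x i : ℝ) < y i + M := by linarith
    exact_mod_cast this
  have h4 : y i < x i + M := by
    have : (y i : ℝ) < x i + M := by linarith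
    exact_mod_cast this
  have h5 : (M : ℤ) ∣ x i - y i := by
    have := dvd_sub (hx i) (hy i)
    rwa [sub_sub_sub_cancel_right] at this
  have h6 := Int.eq_zero_of_abs_lt_dvd h5 (abs_lt.2 ⟨by linarith, by linarith⟩)
  linarith

/-- Comparing the volume of a bounded region with the number of points of a translated lattice. -/
lemma abs_card_sub_volume_le {S : Set (Fin 4 → ℝ)} {M : ℕ} (hM : 0 < M) (v : Form)
    (L : Finset Form) (hL : ∀ f ∈ L, ∀ i, (M : ℤ) ∣ f i - v i)
    (hS : ∀ f : Form, (∀ i, (M : ℤ) ∣ f i - v i) →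
      (hcube M ⟬f⟭ ∩ S).Nonempty → f ∈ L) (hfin : volume S ≠ ⊤) :
    |((L.filter fun f => ⟬f⟭ ∈ S).card : ℝ) - (volume S).toReal / M ^ 4| ≤
      ((L.filter fun f => ∃ y ∈ hcube M ⟬f⟭, ¬ (y ∈ S ↔ ⟬f⟭ ∈ S)).card : ℝ) := by
  set N := L.filter fun f => ⟬f⟭ ∈ S
  set D := L.filter fun f => ∃ y ∈ hcube M ⟬f⟭, ¬ (y ∈ S ↔ ⟬f⟭ ∈ S)
  have hM0 : (0 : ℝ) < M := mod_cast hM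
  have hvol : ∀ x : Form, volume (hcube M ⟬x⟭) = (M : ENNReal) ^ 4 := fun x => by
    rw [volume_hcube, ENNReal.ofReal_natCast]
  -- upper bound for the volume
  have hup : S ⊆ ⋃ f ∈ N ∪ D, hcube M ⟬f⟭ := fun y hy => by
    set f : Form := fun i => v i + M * ⌊(y i - v i) / M⌋ with hf
    have hyf : y ∈ hcube M ⟬f⟭ := by
      rw [mem_hcube]
      intro i
      have h1 := Int.floor_le ((y i - v i) / (M : ℝ))
      have h2 := Int.lt_floor_add_one ((y i - v i) / (M : ℝ))
      rw [le_div_iff₀ hM0] at h1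
      rw [div_lt_iff₀ hM0] at h2
      simp only [hf]
      push_cast
      constructor <;> linarith
    have hfL : f ∈ L := hS f (fun i => ⟨_, add_sub_cancel_left _ _⟩) ⟨y, hyf, hy⟩
    simp only [Set.mem_iUnion]
    refine ⟨f, ?_, hyf⟩
    by_cases hfS : ⟬f⟭ ∈ S
    · exact mem_union_left _ (mem_filter.2 ⟨hfL, hfS⟩)
    · exact mem_union_right _ (mem_filter.2 ⟨hfL, y, hyf, fun h => hfS (h.1 hy)⟩)
  have h1 : volume S ≤ ((N ∪ D).card : ENNReal) * (M : ENNReal) ^ 4 := by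
    refine (measure_mono hup).trans ((measure_biUnion_finset_le _ _).trans ?_)
    rw [sum_congr rfl fun f _ => hvol f]
    simp
  have h2 : ((N \ D).card : ENNReal) * (M : ENNReal) ^ 4 ≤ volume S := by
    have hsub : ⋃ f ∈ N \ D, hcube M ⟬f⟭ ⊆ S := fun y hy => by
      simp only [Set.mem_iUnion] at hy
      obtain ⟨f, hf, hyf⟩ := hy
      rw [Finset.mem_sdiff, mem_filter, mem_filter] at hf
      by_contra hyS
      exact hf.2 ⟨hf.1.1, y, hyf, fun h => hyS (h.2 hf.1.2)⟩
    refine le_trans (le_of_eq ?_) (measure_mono hsub)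
    rw [measure_biUnion_finset (fun f hf g hg hfg => hcube_disjoint (v := v)
      (hL f (mem_filter.1 (mem_sdiff.1 hf).1).1)
      (hL g (mem_filter.1 (mem_sdiff.1 hg).1).1) hfg)
      (fun f _ => measurableSet_hcube _ _), sum_congr rfl fun f _ => hvol f,
      sum_const, nsmul_eq_mul]
  have h1' : (volume S).toReal ≤ ((N ∪ D).card : ℝ) * (M : ℝ) ^ 4 := by
    have := ENNReal.toReal_mono (by finiteness) h1
    simpa using this
  have h2' : ((N \ D).card : ℝ) * (M : ℝ) ^ 4 ≤ (volume S).toReal := by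
    have := ENNReal.toReal_mono hfin h2
    simpa using this
  have h3 : ((N ∪ D).card : ℝ) ≤ #N + #D := mod_cast card_union_le N D
  have h4 : (#N : ℝ) ≤ (N \ D).card + #D := by
    have := le_card_sdiff D N
    have h5 : #N ≤ (N \ D).card + #D := by omega
    exact_mod_cast h5
  have hM4 : (0 : ℝ) < (M : ℝ) ^ 4 := by positivity
  rw [← div_le_iff₀ hM4] at h1'
  rw [← le_div_iff₀ hM4] at h2'
  rw [abs_le]
  constructor <;> linarith

section Region

open scoped Pointwise

/-- The region of strictly reduced forms with coefficients bounded by `T` and discriminant bounded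
by `1`, dilated by `l`. -/
def sredRegion (T l : ℝ) : Set (Fin 4 → ℝ) :=
  {f | (∀ i, |f i| ≤ T * l) ∧ SRed f ∧ |fdisc f| ≤ l ^ 4}

lemma fdisc_smul (l : ℝ) (f : Fin 4 → ℝ) : fdisc (l • f) = l ^ 4 * fdisc f := by simp [fdisc]; ring

lemma sred_smul {l : ℝ} (hl : 0 < l) (f : Fin 4 → ℝ) : SRed (l • f) ↔ SRed f := by
  have h2 : 0 < l ^ 2 := by positivity
  have h4 : 0 < l ^ 4 := by positivity
  have eA : hesA (l • f) = l ^ 2 * hesA f := by simp [hesA]; ring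
  have eB : hesB (l • f) = l ^ 2 * hesB f := by simp [hesB]; ring
  have eC : hesC (l • f) = l ^ 2 * hesC f := by simp [hesC]; ring
  have fA : matA (l • f) = l ^ 2 * matA f := by simp [matA]; ring
  have fB : matB (l • f) = l ^ 2 * matB f := by simp [matB]; ring
  have fC : matC (l • f) = l ^ 2 * matC f := by simp [matC]; ring
  have hneg : l ^ 4 * fdisc f < 0 ↔ fdisc f < 0 :=
    ⟨fun h => neg_of_mul_neg_right h h4.le, fun h => mul_neg_of_pos_of_neg h4 h⟩
  unfold SRed
  rw [fdisc_smul, eA, eB, eC, fA, fB, fC, mul_lt_mul_iff_right₀ h2, mul_lt_mul_iff_right₀ h2,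
    mul_pos_iff_of_pos_left h4, mul_pos_iff_of_pos_left h2, mul_pos_iff_of_pos_left h2,
    mul_pos_iff_of_pos_left h2, mul_pos_iff_of_pos_left h2, hneg]

lemma sredRegion_eq {T l : ℝ} (hl : 0 < l) : sredRegion T l = l • sredRegion T 1 := by
  ext f
  rw [Set.mem_smul_set_iff_inv_smul_mem₀ hl.ne']
  have hf : f = l • (l⁻¹ • f) := by rw [smul_inv_smul₀ hl.ne']
  set g := l⁻¹ • f
  rw [hf]
  simp only [sredRegion, Set.mem_setOf_eq]
  rw [sred_smul hl, fdisc_smul]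
  have h4 : 0 < l ^ 4 := by positivity
  refine and_congr (forall_congr' fun i => ?_) (and_congr Iff.rfl ?_)
  · rw [Pi.smul_apply, smul_eq_mul, abs_mul, abs_of_pos hl, mul_one, mul_comm T]
    exact mul_le_mul_iff_right₀ hl
  · rw [abs_mul, abs_of_pos h4, one_pow]
    exact mul_le_iff_le_one_right h4

lemma volume_sredRegion {T l : ℝ} (hl : 0 < l) :
    (volume (sredRegion T l)).toReal = l ^ 4 * (volume (sredRegion T 1)).toReal := by
  rw [sredRegion_eq hl, Measure.addHaar_smul, ENNReal.toReal_mul]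
  simp only [finrank_fintype_fun_eq_card, Fintype.card_fin, abs_pow, abs_of_pos hl]
  rw [ENNReal.toReal_ofReal (by positivity)]

lemma volume_sredRegion_ne_top (T l : ℝ) : volume (sredRegion T l) ≠ ⊤ := by
  have : sredRegion T l ⊆ Metric.closedBall 0 |T * l| := fun f hf => by
    rw [mem_closedBall_zero_iff, pi_norm_le_iff_of_nonneg (abs_nonneg _)]
    intro i
    rw [norm_eq_abs]
    exact (hf.1 i).trans (le_abs_self _)
  exact ((measure_mono this).trans_lt measure_closedBall_lt_top).ne

lemma sred_intCast (f : Form) : SRed ⟬f⟭ ↔ SRed f := by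
  simp only [SRed, fdisc, hesA, hesB, hesC, matA, matB, matC]
  norm_cast

lemma fdisc_intCast (f : Form) : fdisc ⟬f⟭ = (fdisc f : ℤ) := by simp only [fdisc]; push_cast; ring

/-- The strictly reduced integral forms in a residue class, in a box, with bounded discriminant. -/
def sredBox (M : ℕ) (v : Form) (T W : ℝ) : Set Form :=
  {f | (∀ i, (M : ℤ) ∣ f i - v i) ∧ (∀ i, |(f i : ℝ)| ≤ T * W ^ (1 / 4 : ℝ)) ∧ SRed f ∧
    |Δ f| ≤ W}

lemma lt_iff_of_far {p q w H : ℝ} (h : |q - p| ≤ H) (hf : ¬ |p - w| ≤ H) :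
    (w < q ↔ w < p) ∧ (q < w ↔ p < w) ∧ (q ≤ w ↔ p ≤ w) := by
  rw [not_le, lt_abs] at hf
  rw [abs_le] at h
  rcases hf with hf | hf
  · refine ⟨⟨fun _ => ?_, fun _ => ?_⟩, ⟨fun _ => ?_, fun _ => ?_⟩, ⟨fun _ => ?_, fun _ => ?_⟩⟩ <;>
      linarith
  · refine ⟨⟨fun _ => ?_, fun _ => ?_⟩, ⟨fun _ => ?_, fun _ => ?_⟩, ⟨fun _ => ?_, fun _ => ?_⟩⟩ <;>
      linarith

/-- The conditions describing cubes that may meet the boundary of a region of reduced forms. -/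
def nearWall (R w M H₁ H₂ : ℝ) (x : Fin 4 → ℝ) : Fin 4 ⊕ Fin 9 → Prop
  | .inl i => |(|x i|) - R| ≤ M
  | .inr k => (![|fdisc x - 0| ≤ H₁, |fdisc x - w| ≤ H₁, |fdisc x - -w| ≤ H₁, |hesB x| ≤ H₂,
      |hesA x - hesB x| ≤ H₂, |hesC x - hesA x| ≤ H₂, |matA x| ≤ H₂, |matB x| ≤ H₂,
      |matC x| ≤ H₂] : Fin 9 → Prop) k

lemma exists_nearWall {x y : Fin 4 → ℝ} {B M T l : ℝ} (hx : ∀ i, |x i| ≤ B) (hy : ∀ i, |y i| ≤ B)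
    (h : ∀ i, |y i - x i| ≤ M) (hne : ¬ (y ∈ sredRegion T l ↔ x ∈ sredRegion T l)) :
    ∃ k, nearWall (T * l) (l ^ 4) M (500 * M * B ^ 3) (100 * M * B) x k := by
  by_contra! hcon
  apply hne
  have hd := fdisc_variation hy hx h
  obtain ⟨q1, q2, q3, q4, q5, q6⟩ := quads_variation hy hx h
  have c0 : ¬ |fdisc x - 0| ≤ _ := hcon (.inr 0)
  have c1 : ¬ |fdisc x - l ^ 4| ≤ _ := hcon (.inr 1)
  have c2 : ¬ |fdisc x - -l ^ 4| ≤ _ := hcon (.inr 2)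
  have c3 : ¬ |hesB x| ≤ _ := hcon (.inr 3)
  have c4 : ¬ |hesA x - hesB x| ≤ _ := hcon (.inr 4)
  have c5 : ¬ |hesC x - hesA x| ≤ _ := hcon (.inr 5)
  have c6 : ¬ |matA x| ≤ _ := hcon (.inr 6)
  have c7 : ¬ |matB x| ≤ _ := hcon (.inr 7)
  have c8 : ¬ |matC x| ≤ _ := hcon (.inr 8)
  rw [← sub_zero (hesB x)] at c3
  rw [← sub_zero (_ - _)] at c4 c5
  rw [← sub_zero (matA x)] at c6
  rw [← sub_zero (matB x)] at c7
  rw [← sub_zero (matC x)] at c8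
  have r0 := lt_iff_of_far hd c0
  have r1 := lt_iff_of_far hd c1
  have r2 := lt_iff_of_far hd c2
  have r3 := (lt_iff_of_far q1 c3).1
  have r4 := (lt_iff_of_far q2 c4).1
  have r5 := (lt_iff_of_far q3 c5).1
  have r6 := (lt_iff_of_far q4 c6).1
  have r7 := (lt_iff_of_far q5 c7).1
  have r8 := (lt_iff_of_far q6 c8).1
  rw [sub_pos, sub_pos] at r4 r5
  have hbox : ∀ i, |y i| ≤ T * l ↔ |x i| ≤ T * l := fun i =>
    (lt_iff_of_far ((abs_abs_sub_abs_le _ _).trans (h i)) (hcon (.inl i))).2.2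
  simp only [sredRegion, Set.mem_setOf_eq, SRed, hbox, r0.1, r0.2.1, r3, r4, r5, r6, r7, r8]
  refine and_congr_right fun _ => and_congr_right fun _ => ?_
  rw [abs_le, abs_le, ← not_lt, ← not_lt (a := fdisc x), r2.2.1, r1.2.2]

lemma card_nearWall {B M R w : ℝ} (hB : 1 ≤ B) (hM : 1 ≤ M)
    (h : ∀ f ∈ s, ∀ i, |(f i : ℝ)| ≤ B) (k : Fin 4 ⊕ Fin 9)
    (hs : ∀ f ∈ s, nearWall R w M (500 * M * B ^ 3) (100 * M * B) ⟬f⟭ k) :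
    (#s : ℝ) ≤ 30000 * M * B ^ (15 / 4 : ℝ) := by
  rcases k with i | k
  · have h1 := card_le_of_coord (A := 6 * M) hB i h (by
      set t := s.image fun f => f i
      have ht : ∀ x ∈ t, |(|(x : ℝ)|) - R| ≤ M := fun x hx => by
        obtain ⟨f, hf, rfl⟩ := mem_image.1 hx
        exact hs f hf
      have h2 := t.card_filter_add_card_filter_not (fun x => 0 ≤ x)
      have h3 : ((t.filter fun x => 0 ≤ x).card : ℝ) ≤ 2 * M + 1 := by
        refine card_int_le (by positivity) fun x hx y hy _ => ?_
        rw [mem_filter] at hx hy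
        have hx2 := abs_le.1 (ht x hx.1)
        have hy2 := abs_le.1 (ht y hy.1)
        rw [abs_of_nonneg (mod_cast hx.2)] at hx2
        rw [abs_of_nonneg (mod_cast hy.2)] at hy2
        linarith
      have h4 : ((t.filter fun x => ¬ 0 ≤ x).card : ℝ) ≤ 2 * M + 1 := by
        refine card_int_le (by positivity) fun x hx y hy _ => ?_
        rw [mem_filter] at hx hy
        have hx2 := abs_le.1 (ht x hx.1)
        have hy2 := abs_le.1 (ht y hy.1)
        rw [abs_of_neg (mod_cast not_le.1 hx.2)] at hx2
        rw [abs_of_neg (mod_cast not_le.1 hy.2)] at hy2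
        linarith
      have h5 : (#t : ℝ) = ((t.filter fun x => 0 ≤ x).card : ℝ) +
          ((t.filter fun x => ¬ 0 ≤ x).card : ℝ) := mod_cast h2.symm
      rw [h5]; linarith)
    refine h1.trans ?_
    have e : B ^ 3 ≤ B ^ (15 / 4 : ℝ) := by
      rw [← rpow_natCast]
      exact rpow_le_rpow_of_exponent_le hB (by norm_num)
    have : M * B ^ 3 ≤ M * B ^ (15 / 4 : ℝ) := by gcongr
    have h0 : 0 ≤ M * B ^ (15 / 4 : ℝ) := by positivity
    nlinarith
  · fin_cases k
    · exact card_small_values hB hM h 0 (.inl hs)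
    · exact card_small_values hB hM h w (.inl hs)
    · exact card_small_values hB hM h (-w) (.inl hs)
    · exact card_small_values hB hM h 0 (.inr (.inl hs))
    · exact card_small_values hB hM h 0 (.inr (.inr (.inl hs)))
    · exact card_small_values hB hM h 0 (.inr (.inr (.inr (.inl hs))))
    · exact card_small_values hB hM h 0 (.inr (.inr (.inr (.inr (.inl hs)))))
    · exact card_small_values hB hM h 0 (.inr (.inr (.inr (.inr (.inr (.inl hs))))))
    · exact card_small_values hB hM h 0 (.inr (.inr (.inr (.inr (.inr (.inr hs))))))

/-- Counting reduced forms in a residue class and a box. -/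
theorem abs_card_sredBox_sub_le : ∃ c : ℝ, 0 < c ∧ ∀ (M : ℕ) (v : Form) (T W : ℝ), 0 < M →
    1 ≤ T → 1 ≤ W → (sredBox M v T W).Finite ∧
    |((sredBox M v T W).ncard : ℝ) - (volume (sredRegion T 1)).toReal / M ^ 4 * W| ≤
      c * M ^ 5 * T ^ 4 * W ^ (15 / 16 : ℝ) := by
  refine ⟨13 * 30000 * 81, by norm_num, fun M v T W hM hT hW => ?_⟩
  have hW0 : 0 < W := by linarith
  set l := W ^ (1 / 4 : ℝ) with hl
  have hl1 : 1 ≤ l := one_le_rpow hW (by norm_num)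
  have hl0 : 0 < l := by linarith
  have hl4 : l ^ 4 = W := by rw [hl, ← rpow_natCast, ← rpow_mul hW0.le]; norm_num
  have hM1 : (1 : ℝ) ≤ M := mod_cast hM
  set B := T * l + 2 * M with hB
  have hTl : 1 ≤ T * l := one_le_mul_of_one_le_of_one_le hT hl1
  have hB1 : 1 ≤ B := by rw [hB]; linarith
  set L : Finset Form := (Fintype.piFinset fun _ =>
    Icc (-⌊T * l + M⌋) ⌊T * l + M⌋).filter fun f => ∀ i, (M : ℤ) ∣ f i - v i with hLdef
  have hLb : ∀ f ∈ L, ∀ i, |(f i : ℝ)| ≤ T * l + M := fun f hf i => by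
    have h1 := Fintype.mem_piFinset.1 (mem_filter.1 hf).1 i
    rw [mem_Icc] at h1
    have h2 : (f i : ℝ) ≤ ⌊T * l + M⌋ := mod_cast h1.2
    have h3 : -(⌊T * l + M⌋ : ℝ) ≤ f i := mod_cast h1.1
    have := Int.floor_le (T * l + M)
    exact abs_le.2 ⟨by linarith, by linarith⟩
  have key := abs_card_sub_volume_le (S := sredRegion T l) hM v L
    (fun f hf => (mem_filter.1 hf).2) (by
      rintro f hf ⟨y, hy, hyS⟩
      refine mem_filter.2 ⟨Fintype.mem_piFinset.2 fun i => mem_Icc_floor ?_, hf⟩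
      have h1 := mem_hcube.1 hy i
      have h2 := abs_le.1 (hyS.1 i)
      exact abs_le.2 ⟨by linarith, by linarith⟩) (volume_sredRegion_ne_top _ _)
  have hN : sredBox M v T W = ↑(L.filter fun f => ⟬f⟭ ∈ sredRegion T l) := by
    ext f
    simp only [sredBox, sredRegion, coe_filter, Set.mem_setOf_eq, sred_intCast,
      fdisc_intCast, hl4, hLdef, mem_filter, Fintype.mem_piFinset]
    constructor
    · rintro ⟨h1, h2, h3⟩
      exact ⟨⟨fun i => mem_Icc_floor ((h2 i).trans (by linarith)), h1⟩, h2, h3⟩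
    · rintro ⟨⟨_, h1⟩, h2⟩
      exact ⟨h1, h2⟩
  rw [hN, Set.ncard_coe_finset]
  refine ⟨finite_toSet _, ?_⟩
  rw [volume_sredRegion hl0, hl4] at key
  have e : (volume (sredRegion T 1)).toReal / M ^ 4 * W =
    W * (volume (sredRegion T 1)).toReal / M ^ 4 := by ring
  rw [e]
  refine key.trans ?_
  have hsub : (L.filter fun f => ∃ y ∈ hcube M ⟬f⟭, ¬ (y ∈ sredRegion T l ↔ ⟬f⟭ ∈ sredRegion T l)) ⊆
      univ.biUnion fun k => L.filter fun f =>
        nearWall (T * l) (l ^ 4) M (500 * M * B ^ 3) (100 * M * B) ⟬f⟭ k := fun f hf => by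
    obtain ⟨hf1, y, hy, hne⟩ := mem_filter.1 hf
    have h1 := mem_hcube.1 hy
    obtain ⟨k, hk⟩ := exists_nearWall (B := B) (M := M) (x := ⟬f⟭) (y := y)
      (fun i => (hLb f hf1 i).trans (by linarith)) (fun i => by
        have h2 := abs_le.1 (hLb f hf1 i)
        have h3 := h1 i
        exact abs_le.2 ⟨by linarith, by linarith⟩) (fun i => by
        have h3 := h1 i
        exact abs_le.2 ⟨by linarith, by linarith⟩) hne
    exact mem_biUnion.2 ⟨k, mem_univ _, mem_filter.2 ⟨hf1, hk⟩⟩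
  have hB3 : B ≤ 3 * (T * M * l) := by
    have h1 : T * l ≤ T * l * M := le_mul_of_one_le_right (by linarith) hM1
    have h2 : (M : ℝ) ≤ T * l * M := le_mul_of_one_le_left (by linarith) hTl
    rw [hB]; linarith
  have hBp : B ^ (15 / 4 : ℝ) ≤ 81 * (M ^ 4 * T ^ 4 * W ^ (15 / 16 : ℝ)) := by
    calc B ^ (15 / 4 : ℝ) ≤ (3 * (T * M * l)) ^ (15 / 4 : ℝ) := by gcongr
      _ = 3 ^ (15 / 4 : ℝ) * (T ^ (15 / 4 : ℝ) * M ^ (15 / 4 : ℝ) * l ^ (15 / 4 : ℝ)) := by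
        rw [mul_rpow (by norm_num) (by positivity), mul_rpow (by positivity) hl0.le,
          mul_rpow (by positivity) (by positivity)]
      _ = 3 ^ (15 / 4 : ℝ) * (T ^ (15 / 4 : ℝ) * M ^ (15 / 4 : ℝ) * W ^ (15 / 16 : ℝ)) := by
        congr 2
        rw [hl, ← rpow_mul hW0.le]; norm_num
      _ ≤ 3 ^ (4 : ℝ) * (T ^ (4 : ℝ) * M ^ (4 : ℝ) * W ^ (15 / 16 : ℝ)) := by gcongr <;> norm_num
      _ = _ := by
        rw [show (4 : ℝ) = ((4 : ℕ) : ℝ) by norm_num, rpow_natCast, rpow_natCast,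
          rpow_natCast, show (3 : ℝ) ^ 4 = 81 by norm_num]
        ring
  calc _ ≤ ((∑ k, (L.filter fun f => nearWall (T * l) (l ^ 4) M (500 * M * B ^ 3) (100 * M * B)
        ⟬f⟭ k).card : ℕ) : ℝ) := by
        exact_mod_cast (card_le_card hsub).trans card_biUnion_le
    _ ≤ ∑ k : Fin 4 ⊕ Fin 9, 30000 * (M : ℝ) * B ^ (15 / 4 : ℝ) := by
        push_cast
        refine sum_le_sum fun k _ => card_nearWall (R := T * l) (w := l ^ 4) hB1 hM1
          (fun f hf i => ?_) k (fun f hf => (mem_filter.1 hf).2)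
        exact (hLb f (mem_filter.1 hf).1 i).trans (by linarith)
    _ = 13 * 30000 * M * B ^ (15 / 4 : ℝ) := by rw [sum_const, card_univ]; simp; ring
    _ ≤ 13 * 30000 * M * (81 * (M ^ 4 * T ^ 4 * W ^ (15 / 16 : ℝ))) := by gcongr
    _ = _ := by ring

end Region

end

section CubicRings
variable {K : Type*} [Field K] {ω θ : K}

/-- The pair `(ω, θ)` satisfies the Delone–Faddeev multiplication table of the form `f`. -/
structure IdxPair (f : Form) (ω θ : K) : Prop where
  mul : ω * θ = -(f 0 * f 3)
  sq_left : ω ^ 2 = -(f 0 * f 2) + f 1 * ω - f 0 * θ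
  sq_right : θ ^ 2 = -(f 1 * f 3) + f 3 * ω - f 2 * θ

def Indep3 (ω θ : K) : Prop := ∀ i j k : ℤ, (i : K) + j * ω + k * θ = 0 → i = 0 ∧ j = 0 ∧ k = 0

lemma IdxPair.fact_eq {ω θ ω' θ' : K} (hf : IdxPair f ω θ)
    (hi : Indep3 ω θ) (hg : IdxPair g ω' θ') {i₁ i₂ r s t u : ℤ}
    (h1 : ω' = i₁ + r * ω + t * θ) (h2 : θ' = i₂ + s * ω + u * θ) (i : Fin 4) :
    fact r s t u f i = (r * u - s * t) * g i := by
  obtain ⟨fm, fl, fr⟩ := hf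
  obtain ⟨gm, gl, gr⟩ := hg
  rw [h1, h2] at gm gl gr
  have el := hi (i₁ ^ 2 - r ^ 2 * f 0 * f 2 - t ^ 2 * f 1 * f 3 - 2 * r * t * f 0 * f 3
      + g 0 * g 2 - g 1 * i₁ + g 0 * i₂)
    (2 * i₁ * r + r ^ 2 * f 1 + t ^ 2 * f 3 - (g 1 * r - g 0 * s))
    (2 * i₁ * t - r ^ 2 * f 0 - t ^ 2 * f 2 - (g 1 * t - g 0 * u)) (by
      push_cast
      linear_combination gl - (r : K) ^ 2 * fl - (t : K) ^ 2 * fr - 2 * (r : K) * t * fm)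
  have er := hi (i₂ ^ 2 - s ^ 2 * f 0 * f 2 - u ^ 2 * f 1 * f 3 - 2 * s * u * f 0 * f 3
      + g 1 * g 3 - g 3 * i₁ + g 2 * i₂)
    (2 * i₂ * s + s ^ 2 * f 1 + u ^ 2 * f 3 - (g 3 * r - g 2 * s))
    (2 * i₂ * u - s ^ 2 * f 0 - u ^ 2 * f 2 - (g 3 * t - g 2 * u)) (by
      push_cast
      linear_combination gr - (s : K) ^ 2 * fl - (u : K) ^ 2 * fr - 2 * (s : K) * u * fm)
  have em := hi (i₁ * i₂ - r * s * f 0 * f 2 - t * u * f 1 * f 3 - (r * u + s * t) * f 0 * f 3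
      + g 0 * g 3)
    (i₁ * s + i₂ * r + r * s * f 1 + t * u * f 3)
    (i₁ * u + i₂ * t - r * s * f 0 - t * u * f 2) (by
      push_cast
      linear_combination gm - (r : K) * s * fl - (t : K) * u * fr - ((r : K) * u + s * t) * fm)
  obtain ⟨-, l1, l2⟩ := el
  obtain ⟨-, r1, r2⟩ := er
  obtain ⟨-, m1, m2⟩ := em
  fin_cases i <;> simp [fact]
  · linear_combination t * l1 - r * l2
  · linear_combination u * l1 - s * l2 + 2 * (t * m1 - r * m2)
  · linear_combination t * r1 - r * r2 - 2 * (s * m2 - u * m1)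
  · linear_combination u * r1 - s * r2

lemma IdxPair.root_left (hf : IdxPair f ω θ) :
    ω ^ 3 - f 1 * ω ^ 2 + f 0 * f 2 * ω - f 0 ^ 2 * f 3 = 0 := by
  linear_combination ω * hf.sq_left - (f 0 : K) * hf.mul

lemma IdxPair.root_right (hf : IdxPair f ω θ) :
    θ ^ 3 + f 2 * θ ^ 2 + f 1 * f 3 * θ + f 0 * f 3 ^ 2 = 0 := by
  linear_combination θ * hf.sq_right + (f 3 : K) * hf.mul

lemma isIntegral_of_monic_cubic {x : K} (a b c : ℤ) (h : x ^ 3 + a * x ^ 2 + b * x + c = 0) :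
    IsIntegral ℤ x := by
  open Polynomial in
  refine ⟨X ^ 3 + (C a : ℤ[X]) * X ^ 2 + (C b : ℤ[X]) * X + (C c : ℤ[X]), by monicity!, ?_⟩
  simp only [eval₂_add, eval₂_mul, eval₂_pow, eval₂_X, eval₂_C]
  simpa using h

lemma IdxPair.isIntegral (hf : IdxPair f ω θ) : IsIntegral ℤ ω ∧ IsIntegral ℤ θ :=
  ⟨isIntegral_of_monic_cubic (-f 1) (f 0 * f 2) (-(f 0 ^ 2 * f 3)) (by
      push_cast; linear_combination hf.root_left),
    isIntegral_of_monic_cubic (f 2) (f 1 * f 3) (f 0 * f 3 ^ 2) (by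
      push_cast; linear_combination hf.root_right)⟩

/-- `1, ω, θ` is an integral basis of `K`. -/
def IntBasis (ω θ : K) : Prop :=
  Indep3 ω θ ∧ ∀ x : K, IsIntegral ℤ x ↔ ∃ i j k : ℤ, x = i + j * ω + k * θ

lemma IntBasis.isIntegral (h : IntBasis ω θ) : IsIntegral ℤ ω ∧ IsIntegral ℤ θ :=
  ⟨(h.2 _).2 ⟨0, 1, 0, by simp⟩, (h.2 _).2 ⟨0, 0, 1, by simp⟩⟩

/-- Every integral basis can be translated into one with a Delone–Faddeev table. -/
lemma IntBasis.exists_idxPair (h : IntBasis ω θ) :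
    ∃ (n n' : ℤ) (f : Form), IntBasis (ω - n) (θ - n') ∧ IdxPair f (ω - n) (θ - n') := by
  obtain ⟨hω, hθ⟩ := h.isIntegral
  obtain ⟨i, j, k, hm⟩ := (h.2 _).1 (hω.mul hθ)
  have hb : IntBasis (ω - k) (θ - j) := by
    refine ⟨fun a b c hh => ?_, fun x => (h.2 x).trans ⟨?_, ?_⟩⟩
    · have := h.1 (a - b * k - c * j) b c (by push_cast; linear_combination hh)
      obtain ⟨h1, rfl, rfl⟩ := this
      simpa using h1
    · rintro ⟨a, b, c, rfl⟩
      exact ⟨a + b * k + c * j, b, c, by push_cast; ring⟩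
    · rintro ⟨a, b, c, rfl⟩
      exact ⟨a - b * k - c * j, b, c, by push_cast; ring⟩
  have hm' : (ω - k) * (θ - j) = ((i + j * k : ℤ) : K) := by push_cast; linear_combination hm
  generalize i + j * k = n at hm'
  refine ⟨k, j, ?_⟩
  generalize ω - k = ω at *
  generalize θ - j = θ at *
  obtain ⟨hω, hθ⟩ := hb.isIntegral
  obtain ⟨m, b, a, hl⟩ := (hb.2 _).1 (hω.pow 2)
  obtain ⟨l, d, c, hr⟩ := (hb.2 _).1 (hθ.pow 2)
  have e1 := hb.1 (b * n + a * l) (a * d - n) (m + a * c) (by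
    push_cast; linear_combination ω * hm' - θ * hl - (b : K) * hm' - (a : K) * hr)
  have e2 := hb.1 (d * m + c * n) (l + d * b) (d * a - n) (by
    push_cast; linear_combination θ * hm' - ω * hr - (c : K) * hm' - (d : K) * hl)
  refine ⟨![-a, b, -c, d], hb, ?_, ?_, ?_⟩
  · rw [hm']; simp
    have : (n : K) = ((a * d : ℤ) : K) := by congr 1; linarith [e1.2.1]
    rw [this]; push_cast; ring
  · rw [hl]; simp
    have : (m : K) = ((-(a * c) : ℤ) : K) := by congr 1; linarith [e1.2.2]
    rw [this]; push_cast; ring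
  · rw [hr]; simp
    have : (l : K) = ((-(d * b) : ℤ) : K) := by congr 1; linarith [e2.2.1]
    rw [this]; push_cast; ring

/-- `f` is an index form of the cubic field `K`. -/
def IsIdx (f : Form) (K : Type*) [Field K] : Prop := ∃ ω θ : K, IntBasis ω θ ∧ IdxPair f ω θ

lemma IsIdx.exists_fact (hf : IsIdx f K) (hg : IsIdx g K) :
    ∃ r s t u : ℤ, (r * u - s * t) ^ 2 = 1 ∧ ∀ i, fact r s t u f i = (r * u - s * t) * g i := by
  obtain ⟨ω, θ, hb, hp⟩ := hf
  obtain ⟨ω', θ', hb', hp'⟩ := hg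
  obtain ⟨i₁, r, t, h1⟩ := (hb.2 _).1 hb'.isIntegral.1
  obtain ⟨i₂, s, u, h2⟩ := (hb.2 _).1 hb'.isIntegral.2
  obtain ⟨j₁, r', t', h3⟩ := (hb'.2 _).1 hb.isIntegral.1
  obtain ⟨j₂, s', u', h4⟩ := (hb'.2 _).1 hb.isIntegral.2
  refine ⟨r, s, t, u, ?_, hp.fact_eq hb.1 hp' h1 h2⟩
  have e1 := hb.1 (j₁ + r' * i₁ + t' * i₂) (r' * r + t' * s - 1) (r' * t + t' * u) (by
    push_cast; linear_combination -h3 - (r' : K) * h1 - (t' : K) * h2)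
  have e2 := hb.1 (j₂ + s' * i₁ + u' * i₂) (s' * r + u' * s) (s' * t + u' * u - 1) (by
    push_cast; linear_combination -h4 - (s' : K) * h1 - (u' : K) * h2)
  have : IsUnit (r * u - s * t) := by
    refine IsUnit.of_mul_eq_one (r' * u' - s' * t') ?_
    linear_combination (s' * t + u' * u) * e1.2.1 - (s' * r + u' * s) * e1.2.2 + e2.2.2
  rcases Int.isUnit_iff.1 this with h | h <;> rw [h] <;> norm_num

lemma IsIdx.fact_mem (hf : IsIdx f K) {r s t u : ℤ} (hd : (r * u - s * t) ^ 2 = 1) :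
    IsIdx (fun i => (r * u - s * t) * fact r s t u f i) K := by
  obtain ⟨ω, θ, hb, hp⟩ := hf
  have hdK : ((r : K) * u - s * t) ^ 2 = 1 := mod_cast congrArg (Int.cast (R := K)) hd
  have hb' : IntBasis (r * ω + t * θ) (s * ω + u * θ) := by
    refine ⟨fun i j k h => ?_, fun x => (hb.2 x).trans ⟨?_, ?_⟩⟩
    · obtain ⟨h1, h2, h3⟩ := hb.1 i (j * r + k * s) (j * t + k * u) (by
        push_cast; linear_combination h)
      refine ⟨h1, ?_, ?_⟩
      · linear_combination (r * u - s * t) * (u * h2 - s * h3) - j * hd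
      · linear_combination (r * u - s * t) * (r * h3 - t * h2) - k * hd
    · rintro ⟨i, j, k, rfl⟩
      refine ⟨i, (r * u - s * t) * (u * j - s * k), (r * u - s * t) * (r * k - t * j), ?_⟩
      push_cast
      linear_combination -(j * ω + k * θ) * hdK
    · rintro ⟨i, j, k, rfl⟩
      exact ⟨i, j * r + k * s, j * t + k * u, by push_cast; ring⟩
  obtain ⟨n, n', g, hb'', hg⟩ := hb'.exists_idxPair
  have := hp.fact_eq hb.1 hg (i₁ := -n) (i₂ := -n') (r := r) (s := s) (t := t) (u := u)
    (by push_cast; ring) (by push_cast; ring)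
  have e : (fun i => (r * u - s * t) * fact r s t u f i) = g := by
    funext i
    rw [this i]; linear_combination g i * hd
  rw [e]
  exact ⟨_, _, hb'', hg⟩

end CubicRings

section Charpoly
variable {F : Type*} [Field F] [NumberField F]
open Polynomial NumberField

lemma leftMulMatrix_charpoly {n : Type*} [Fintype n] [DecidableEq n] (b : Basis n ℚ F) (y : F) :
    (Algebra.leftMulMatrix b y).charpoly = (LinearMap.mulLeft ℚ y).charpoly := by
  rw [← LinearMap.charpoly_toMatrix (LinearMap.mulLeft ℚ y) b]
  rfl

lemma leftMulMatrix_charpoly_of_isIntegral {n : Type*} [Fintype n] [DecidableEq n] (b : Basis n ℚ F) {y : F}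
    (hy : IsIntegral ℤ y) :
    ∃ P : ℤ[X], (Algebra.leftMulMatrix b y).charpoly = P.map (Int.castRingHom ℚ) := by
  have h2 := Algebra.map_leftMulMatrix_localization (Rₘ := ℚ) (Sₘ := F) (M := nonZeroDivisors ℤ) (R := ℤ) (S := 𝓞 F)
    (b := RingOfIntegers.basis F) (a := (⟨y, hy⟩ : 𝓞 F))
  refine ⟨(Algebra.leftMulMatrix (RingOfIntegers.basis F) (⟨y, hy⟩ : 𝓞 F)).charpoly, ?_⟩
  rw [← Matrix.charpoly_map, leftMulMatrix_charpoly b]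
  have h3 := leftMulMatrix_charpoly (integralBasis F) y
  rw [← h3]
  congr 1
  exact h2.symm

lemma isIntegral_iff_charpoly {n : Type*} [Fintype n] [DecidableEq n] (b : Basis n ℚ F) (y : F) :
    IsIntegral ℤ y ↔ ∀ i, ∃ z : ℤ, (Algebra.leftMulMatrix b y).charpoly.coeff i = z := by
  constructor
  · intro hy i
    obtain ⟨P, hP⟩ := leftMulMatrix_charpoly_of_isIntegral b hy
    exact ⟨P.coeff i, by rw [hP]; simp⟩
  · intro h
    have : (Algebra.leftMulMatrix b y).charpoly ∈ Polynomial.lifts (Int.castRingHom ℚ) := by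
      rw [Polynomial.lifts_iff_coeff_lifts]
      intro i
      obtain ⟨z, hz⟩ := h i
      exact ⟨z, by simp [hz]⟩
    obtain ⟨P, hP, -, hm⟩ := Polynomial.lifts_and_degree_eq_and_monic this (Matrix.charpoly_monic _)
    refine ⟨P, hm, ?_⟩
    have h1 : aeval y (Algebra.leftMulMatrix b y).charpoly = 0 := by
      apply Algebra.leftMulMatrix_injective b
      rw [map_zero, ← aeval_algHom_apply]
      exact Matrix.aeval_self_charpoly _
    rw [← hP, Polynomial.aeval_def, Polynomial.eval₂_map] at h1
    rw [← h1]
    congr 1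
    exact RingHom.ext_int _ _

lemma Matrix.charpoly_smul_coeff {R n : Type*} [CommRing R] [Nontrivial R] [Fintype n] [DecidableEq n] (c : R) (N : Matrix n n R)
    {i : ℕ} (hi : i ≤ Fintype.card n) :
    (c • N).charpoly.coeff i = c ^ (Fintype.card n - i) * N.charpoly.coeff i := by
  have h1 : (c • N).charpolyRev = N.charpolyRev.comp (C c * X) := by
    have := (Polynomial.compRingHom (C c * X)).map_det (1 - (X : R[X]) • N.map C)
    rw [Matrix.charpolyRev, Matrix.charpolyRev]
    refine Eq.trans (congrArg Matrix.det ?_) this.symm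
    ext1 i j
    simp [Matrix.one_apply, apply_ite (fun p : R[X] => p.comp (C c * X))]
    ring
  have h2 : ∀ M : Matrix n n R, M.charpoly.coeff i = M.charpolyRev.coeff (Fintype.card n - i) := by
    intro M
    rw [← Matrix.reverse_charpoly, Polynomial.coeff_reverse, Matrix.charpoly_natDegree_eq_dim,
      Polynomial.revAt_le (Nat.sub_le _ _), Nat.sub_sub_self hi]
  rw [h2, h2, h1, Polynomial.comp_C_mul_X_coeff, mul_comm]

/-- Integrality of `x / d` in terms of the integral multiplication matrix of `x`. -/
lemma isIntegral_div_iff {n : Type*} [Fintype n] [DecidableEq n] (b : Basis n ℚ F) {x : F}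
    {N : Matrix n n ℤ} (hN : Algebra.leftMulMatrix b x = N.map (Int.cast : ℤ → ℚ)) {d : ℤ}
    (hd : d ≠ 0) :
    IsIntegral ℤ (x / d) ↔ ∀ i ≤ Fintype.card n, d ^ (Fintype.card n - i) ∣ N.charpoly.coeff i := by
  have h0 : Algebra.leftMulMatrix b (x / d) = (d⁻¹ : ℚ) • N.map (Int.cast : ℤ → ℚ) := by
    rw [← hN, ← map_smul]
    congr 1
    rw [Algebra.smul_def, div_eq_inv_mul]
    simp
  have h1 : ∀ i, (N.map (Int.cast : ℤ → ℚ)).charpoly.coeff i = N.charpoly.coeff i := fun i => by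
    have := congrArg (fun p => p.coeff i) (Matrix.charpoly_map N (Int.castRingHom ℚ))
    simpa using this
  have hdq : (d : ℚ) ≠ 0 := mod_cast hd
  rw [isIntegral_iff_charpoly b, h0]
  constructor
  · intro h i hi
    obtain ⟨z, hz⟩ := h i
    rw [Matrix.charpoly_smul_coeff _ _ hi, h1] at hz
    refine ⟨z, ?_⟩
    have : (N.charpoly.coeff i : ℚ) = (d : ℚ) ^ (Fintype.card n - i) * z := by
      rw [← hz, ← mul_assoc, ← mul_pow, mul_inv_cancel₀ hdq, one_pow, one_mul]
    exact_mod_cast this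
  · intro h i
    rcases le_or_gt i (Fintype.card n) with hi | hi
    · obtain ⟨z, hz⟩ := h i hi
      refine ⟨z, ?_⟩
      rw [Matrix.charpoly_smul_coeff _ _ hi, h1, hz]
      push_cast
      rw [← mul_assoc, ← mul_pow, inv_mul_cancel₀ hdq, one_pow, one_mul]
    · refine ⟨0, ?_⟩
      rw [Polynomial.coeff_eq_zero_of_natDegree_lt]
      · simp
      · rwa [Matrix.charpoly_natDegree_eq_dim]

end Charpoly

section CubicFields
variable {K : Type*} [Field K] [NumberField K] {ω θ : K}
open NumberField

lemma exists_int_of_smul_eq {n a : ℤ} (hn : n ≠ 0) {x : K} (hx : IsIntegral ℤ x)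
    (h : (n : K) * x = a) : ∃ z : ℤ, x = z := by
  have hx' : x = algebraMap ℚ K (a / n) := by
    have : (n : K) ≠ 0 := mod_cast hn
    simp
    field_simp
    linear_combination h
  rw [hx', isIntegral_algebraMap_iff (algebraMap ℚ K).injective] at hx
  obtain ⟨z, hz⟩ := IsIntegrallyClosed.isIntegral_iff.1 hx
  exact ⟨z, by rw [hx', ← hz]; simp⟩

lemma exists_intBasis (h3 : finrank ℚ K = 3) : ∃ ω θ : K, IntBasis ω θ := by
  let S : Submodule ℤ (𝓞 K) := Submodule.span ℤ {1}
  have hmem : ∀ x : 𝓞 K, x ∈ S ↔ ∃ z : ℤ, (x : K) = z := fun x => by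
    rw [Submodule.mem_span_singleton]
    constructor
    · rintro ⟨z, rfl⟩; exact ⟨z, by simp⟩
    · rintro ⟨z, hz⟩; exact ⟨z, by ext; simp [hz]⟩
  have : IsTorsionFree ℤ (𝓞 K ⧸ S) := by
    rw [isTorsionFree_iff_smul_eq_zero]
    intro n x hx
    obtain ⟨x, rfl⟩ := Submodule.Quotient.mk_surjective _ x
    rw [← Submodule.Quotient.mk_smul, Submodule.Quotient.mk_eq_zero, hmem] at hx
    rw [Submodule.Quotient.mk_eq_zero, hmem]
    by_contra! hc
    obtain ⟨a, ha⟩ := hx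
    refine hc.1 ?_
    by_contra hn
    have ha' : (n : K) * (x : K) = a := by rw [← ha, zsmul_eq_mul]; simp
    obtain ⟨z, hz⟩ := exists_int_of_smul_eq hn x.2 ha'
    exact hc.2 z hz
  have : Module.Free ℤ (𝓞 K ⧸ S) := free_of_finite_type_torsion_free'
  have hS : finrank ℤ S = 1 := by
    let e : ℤ ≃ₗ[ℤ] S := LinearEquiv.toSpanNonzeroSingleton ℤ (𝓞 K) 1 one_ne_zero
    rw [← e.finrank_eq, finrank_self]
  have hQ : finrank ℤ (𝓞 K ⧸ S) = 2 := by
    have h1 := Submodule.finrank_quotient_add_finrank S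
    rw [hS, RingOfIntegers.rank, h3] at h1
    lia
  let b := finBasisOfFinrankEq ℤ (𝓞 K ⧸ S) hQ
  obtain ⟨w, hw⟩ := Submodule.Quotient.mk_surjective S (b 0)
  obtain ⟨t, ht⟩ := Submodule.Quotient.mk_surjective S (b 1)
  refine ⟨w, t, ?_, fun x => ⟨fun hx => ?_, ?_⟩⟩
  · intro i j k h
    have h1 : ((i : 𝓞 K) + j * w + k * t) = 0 := by ext; simpa using h
    have h2 : j • b 0 + k • b 1 = 0 := by
      rw [← hw, ← ht, ← Submodule.Quotient.mk_smul, ← Submodule.Quotient.mk_smul,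
        ← Submodule.Quotient.mk_add, Submodule.Quotient.mk_eq_zero, hmem]
      refine ⟨-i, ?_⟩
      simp only [map_add, zsmul_eq_mul, map_mul, map_intCast]
      push_cast; linear_combination h
    have h3 := Fintype.linearIndependent_iff.1 b.linearIndependent ![j, k]
      (by rw [Fin.sum_univ_two]; exact h2)
    have hj : j = 0 := h3 0
    have hk : k = 0 := h3 1
    subst hj hk
    refine ⟨?_, rfl, rfl⟩
    simpa using h
  · obtain ⟨X, rfl⟩ : ∃ X : 𝓞 K, (X : K) = x := ⟨⟨x, hx⟩, rfl⟩
    have h1 := b.sum_repr (Submodule.Quotient.mk X)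
    rw [Fin.sum_univ_two, ← hw, ← ht, ← Submodule.Quotient.mk_smul, ← Submodule.Quotient.mk_smul,
        ← Submodule.Quotient.mk_add, eq_comm] at h1
    obtain ⟨z, hz⟩ := (hmem _).1 ((Submodule.Quotient.eq S).1 h1)
    refine ⟨z, b.repr (Submodule.Quotient.mk X) 0, b.repr (Submodule.Quotient.mk X) 1, ?_⟩
    generalize b.repr (Submodule.Quotient.mk X) 0 = p at hz ⊢
    generalize b.repr (Submodule.Quotient.mk X) 1 = q at hz ⊢
    rw [← hz]
    simp
    change algebraMap (𝓞 K) K X = algebraMap (𝓞 K) K X - (p * algebraMap (𝓞 K) K w +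
      q * algebraMap (𝓞 K) K t) + p * algebraMap (𝓞 K) K w + q * algebraMap (𝓞 K) K t
    ring
  · rintro ⟨i, j, k, rfl⟩
    exact ((i : 𝓞 K) + j * w + k * t).2

lemma Indep3.linearIndependent (h : Indep3 ω θ) : LinearIndependent ℚ ![1, ω, θ] := by
  rw [← LinearIndependent.iff_fractionRing ℤ ℚ, Fintype.linearIndependent_iff]
  intro g hg
  rw [Fin.sum_univ_three] at hg
  have := h (g 0) (g 1) (g 2) (by simpa using hg)
  intro i
  fin_cases i
  exacts [this.1, this.2.1, this.2.2]

lemma Indep3.exists_basis (h : Indep3 ω θ) (h3 : finrank ℚ K = 3) :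
    ∃ b : Basis (Fin 3) ℚ K, ⇑b = ![1, ω, θ] :=
  ⟨basisOfLinearIndependentOfCardEqFinrank h.linearIndependent (by simp [h3]),
    coe_basisOfLinearIndependentOfCardEqFinrank _ _⟩

/-- The matrix of multiplication by `x₀ + x₁ω + x₂θ` in the cubic ring of `f`. -/
def mulMat (f : Form) (x : Fin 3 → ℤ) : Matrix (Fin 3) (Fin 3) ℤ :=
  !![x 0, -(f 0 * f 2 * x 1) - f 0 * f 3 * x 2, -(f 0 * f 3 * x 1) - f 1 * f 3 * x 2;
    x 1, x 0 + f 1 * x 1, f 3 * x 2;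
    x 2, -(f 0 * x 1), x 0 - f 2 * x 2]

lemma leftMulMatrix_of_sum {n : Type*} [Fintype n] [DecidableEq n] (b : Basis n ℚ K) (y : K)
    (N : Matrix n n ℚ) (h : ∀ j, y * b j = ∑ i, N i j • b i) : Algebra.leftMulMatrix b y = N := by
  ext i j
  rw [Algebra.leftMulMatrix_eq_repr_mul, h, b.repr_sum_self]

lemma IdxPair.leftMulMatrix (hf : IdxPair f ω θ)
    {b : Basis (Fin 3) ℚ K} (hb : ⇑b = ![1, ω, θ]) (x : Fin 3 → ℤ) :
    Algebra.leftMulMatrix b (x 0 + x 1 * ω + x 2 * θ) = (mulMat f x).map (Int.cast : ℤ → ℚ) := by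
  refine leftMulMatrix_of_sum b _ _ fun j => ?_
  rw [Fin.sum_univ_three, hb]
  obtain ⟨m, l, r⟩ := hf
  simp only [Algebra.smul_def, Matrix.map_apply, eq_ratCast, Rat.cast_intCast]
  fin_cases j
  · simp [mulMat]
  · simp [mulMat]; linear_combination (x 1 : K) * l + (x 2 : K) * m
  · simp [mulMat]; linear_combination (x 1 : K) * m + (x 2 : K) * r

lemma IsIdx.discr (hf : IsIdx f K) (h3 : finrank ℚ K = 3) : NumberField.discr K = fdisc f := by
  obtain ⟨ω, θ, hb, hp⟩ := hf
  let v : Fin 3 → 𝓞 K := ![1, ⟨ω, hb.isIntegral.1⟩, ⟨θ, hb.isIntegral.2⟩]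
  have hv : ∀ g : Fin 3 → ℤ, ((∑ i, g i • v i : 𝓞 K) : K) = g 0 + g 1 * ω + g 2 * θ := fun g => by
    rw [Fin.sum_univ_three]
    simp only [map_add, zsmul_eq_mul, map_mul, map_intCast, v]
    simp
    rfl
  have hli : LinearIndependent ℤ v := by
    rw [Fintype.linearIndependent_iff]
    intro g hg
    have := hb.1 (g 0) (g 1) (g 2) (by rw [← hv, hg]; simp)
    intro i
    fin_cases i
    exacts [this.1, this.2.1, this.2.2]
  have hsp : ⊤ ≤ Submodule.span ℤ (Set.range v) := fun x _ => by
    obtain ⟨i, j, k, h⟩ := (hb.2 x).1 x.2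
    rw [Submodule.mem_span_range_iff_exists_fun]
    refine ⟨![i, j, k], ?_⟩
    ext
    rw [hv, h]; simp
  have h1 := NumberField.discr_eq_discr K (Module.Basis.mk hli hsp)
  have h2 := Algebra.discr_localizationLocalization ℤ (nonZeroDivisors ℤ) K
    (Module.Basis.mk hli hsp) (Rₘ := ℚ)
  have e : ⇑((Module.Basis.mk hli hsp).localizationLocalization ℚ (nonZeroDivisors ℤ) K) =
      ![1, ω, θ] := by
    funext i
    rw [Basis.localizationLocalization_apply, Basis.mk_apply]
    fin_cases i <;> simp [v] <;> rfl
  rw [h1, e] at h2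
  have ht : ∀ x : Fin 3 → ℤ, Algebra.trace ℚ K (x 0 + x 1 * ω + x 2 * θ) =
      3 * x 0 + f 1 * x 1 - f 2 * x 2 := fun x => by
    obtain ⟨b, hb'⟩ := hb.1.exists_basis h3
    rw [Algebra.trace_eq_matrix_trace b, hp.leftMulMatrix hb']
    simp [Matrix.trace, Fin.sum_univ_three, mulMat]
    ring
  obtain ⟨m, l, r⟩ := hp
  have e0 : Algebra.trace ℚ K 1 = 3 := by
    have := ht ![1, 0, 0]
    simpa using this
  have t1 : Algebra.trace ℚ K ω = f 1 := by
    have := ht ![0, 1, 0]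
    simpa using this
  have t2 : Algebra.trace ℚ K θ = -f 2 := by
    have := ht ![0, 0, 1]
    simpa using this
  have em : Algebra.trace ℚ K (ω * θ) = -(3 * (f 0 * f 3)) := by
    have e : ω * θ = (![-(f 0 * f 3), 0, 0] : Fin 3 → ℤ) 0
        + (![-(f 0 * f 3), 0, 0] : Fin 3 → ℤ) 1 * ω + (![-(f 0 * f 3), 0, 0] : Fin 3 → ℤ) 2 * θ := by
      rw [m]; simp
    rw [e, ht]; simp
  have el : Algebra.trace ℚ K (ω ^ 2) = -(3 * (f 0 * f 2)) + f 1 * f 1 + f 2 * f 0 := by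
    have e : ω ^ 2 = (![-(f 0 * f 2), f 1, -f 0] : Fin 3 → ℤ) 0
        + (![-(f 0 * f 2), f 1, -f 0] : Fin 3 → ℤ) 1 * ω
        + (![-(f 0 * f 2), f 1, -f 0] : Fin 3 → ℤ) 2 * θ := by
      rw [l]; simp; ring
    rw [e, ht]; simp
  have er : Algebra.trace ℚ K (θ ^ 2) = -(3 * (f 1 * f 3)) + f 1 * f 3 + f 2 * f 2 := by
    have e : θ ^ 2 = (![-(f 1 * f 3), f 3, -f 2] : Fin 3 → ℤ) 0
        + (![-(f 1 * f 3), f 3, -f 2] : Fin 3 → ℤ) 1 * ω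
        + (![-(f 1 * f 3), f 3, -f 2] : Fin 3 → ℤ) 2 * θ := by
      rw [r]; simp; ring
    rw [e, ht]; simp
  have em' : Algebra.trace ℚ K (θ * ω) = -(3 * (f 0 * f 3)) := by rw [mul_comm, em]
  have hd : Algebra.discr ℚ ![1, ω, θ] = fdisc (fun i => (f i : ℚ)) := by
    rw [Algebra.discr_def, Matrix.det_fin_three]
    simp only [Algebra.traceMatrix_apply, Algebra.traceForm_apply, Matrix.cons_val_zero,
      Matrix.cons_val_one, Matrix.cons_val, one_mul, mul_one, ← sq, one_pow]
    rw [e0, t1, t2, el, er, em, em']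
    simp only [fdisc]; ring
  rw [hd, algebraMap_int_eq, eq_intCast] at h2
  have : ((fdisc f : ℤ) : ℚ) = fdisc (fun i => (f i : ℚ)) := by simp [fdisc]
  rw [← this] at h2
  exact_mod_cast h2.symm

end CubicFields

section Isom
variable {K K' : Type*} [Field K] [NumberField K] [Field K'] [NumberField K'] {ω θ : K}

lemma IsIdx.nonempty_algEquiv (hf : IsIdx f K) (hf' : IsIdx f K')
    (h3 : finrank ℚ K = 3) (h3' : finrank ℚ K' = 3) : Nonempty (K ≃ₐ[ℚ] K') := by
  obtain ⟨ω, θ, hb, m, l, r⟩ := hf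
  obtain ⟨ω', θ', hb', m', l', r'⟩ := hf'
  obtain ⟨b, hbb⟩ := hb.1.exists_basis h3
  obtain ⟨b', hbb'⟩ := hb'.1.exists_basis h3'
  let e := b.equiv b' (Equiv.refl _)
  have he : ∀ i, e (b i) = b' i := fun i => by simp [e]
  have e1 : e 1 = 1 := by have := he 0; simpa [hbb, hbb'] using this
  have e2 : e ω = ω' := by have := he 1; simpa [hbb, hbb'] using this
  have e3 : e θ = θ' := by have := he 2; simpa [hbb, hbb'] using this
  have hx : ∀ x : K, ∃ i j k : ℚ, x = i + j * ω + k * θ := fun x => by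
    refine ⟨b.repr x 0, b.repr x 1, b.repr x 2, ?_⟩
    have := b.sum_repr x
    rw [Fin.sum_univ_three, hbb] at this
    generalize b.repr x 0 = i, b.repr x 1 = j, b.repr x 2 = k at this ⊢
    rw [← this]
    simp [Algebra.smul_def]
  have hex : ∀ i j k : ℚ, e (i + j * ω + k * θ) = i + j * ω' + k * θ' := fun i j k => by
    have : (i : K) + j * ω + k * θ = i • (1 : K) + j • ω + k • θ := by simp [Algebra.smul_def]
    rw [this, map_add, map_add, map_smul, map_smul, map_smul, e1, e2, e3]
    simp [Algebra.smul_def]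
  refine ⟨AlgEquiv.ofLinearEquiv e e1 fun x y => ?_⟩
  obtain ⟨i, j, k, rfl⟩ := hx x
  obtain ⟨p, q, s, rfl⟩ := hx y
  have h : ((i : K) + j * ω + k * θ) * (p + q * ω + s * θ) =
      ((i * p - j * q * (f 0 * f 2) - (j * s + k * q) * (f 0 * f 3) - k * s * (f 1 * f 3) : ℚ) : K)
      + ((i * q + j * p + j * q * f 1 + k * s * f 3 : ℚ) : K) * ω
      + ((i * s + k * p - j * q * f 0 - k * s * f 2 : ℚ) : K) * θ := by
    push_cast
    linear_combination ((j : K) * s + k * q) * m + (j : K) * q * l + (k : K) * s * r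
  rw [h, hex, hex, hex]
  push_cast
  linear_combination -((j : K') * s + k * q) * m' - (j : K') * q * l' - (k : K') * s * r'

lemma IsIdx.of_algEquiv (hf : IsIdx f K) (e : K ≃ₐ[ℚ] K') : IsIdx f K' := by
  obtain ⟨ω, θ, hb, m, l, r⟩ := hf
  have hi : ∀ x, IsIntegral ℤ x ↔ IsIntegral ℤ (e x) := fun x =>
    (isIntegral_algEquiv (e.restrictScalars ℤ)).symm
  refine ⟨e ω, e θ, ⟨fun i j k h => hb.1 i j k (e.injective ?_), fun x => ?_⟩, ?_, ?_, ?_⟩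
  · simpa using h
  · obtain ⟨y, rfl⟩ := e.surjective x
    rw [← hi, hb.2]
    refine exists_congr fun i => exists_congr fun j => exists_congr fun k => ?_
    rw [← e.injective.eq_iff]; simp
  · have := congrArg e m; simpa using this
  · have := congrArg e l; simpa using this
  · have := congrArg e r; simpa using this

/-- `f` has no nontrivial integral zero. -/
def IrrF (f : Form) : Prop := ∀ x y : ℤ,
  f 0 * x ^ 3 + f 1 * x ^ 2 * y + f 2 * x * y ^ 2 + f 3 * y ^ 3 = 0 → x = 0 ∧ y = 0

lemma IdxPair.irrF (hf : IdxPair f ω θ) (hi : Indep3 ω θ) : IrrF f := by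
  intro x y h
  have hω : ω ≠ 0 := fun h => by have := hi 0 1 0 (by simp [h]); simp at this
  have hθ : θ ≠ 0 := fun h => by have := hi 0 0 1 (by simp [h]); simp at this
  have hK : (f 0 : K) * x ^ 3 + f 1 * x ^ 2 * y + f 2 * x * y ^ 2 + f 3 * y ^ 3 = 0 := by
    exact_mod_cast congrArg (Int.cast (R := K)) h
  have h03 : f 0 * f 3 ≠ 0 := fun h => by
    have : (f 0 : K) * f 3 = 0 := mod_cast congrArg (Int.cast (R := K)) h
    have := hf.mul
    rw [‹(f 0 : K) * f 3 = 0›, neg_zero, mul_eq_zero] at this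
    tauto
  have h0 := left_ne_zero_of_mul h03
  by_cases hy : y = 0
  · subst hy
    refine ⟨?_, rfl⟩
    simpa [h0] using h
  exfalso
  have hp : (y * ω + f 0 * x) * ((y : K) ^ 2 * ω ^ 2 - (f 1 * y ^ 2 + f 0 * x * y) * ω
      + f 0 * (f 2 * y ^ 2 + f 1 * x * y + f 0 * x ^ 2)) = 0 := by
    linear_combination (y : K) ^ 3 * hf.root_left + (f 0 : K) ^ 2 * hK
  rcases mul_eq_zero.1 hp with h' | h'
  · have := hi (f 0 * x) y 0 (by push_cast; linear_combination h')
    exact hy this.2.1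
  · have := hi (-(f 0 * f 2) * y ^ 2 + f 0 * (f 2 * y ^ 2 + f 1 * x * y + f 0 * x ^ 2))
      (f 1 * y ^ 2 - (f 1 * y ^ 2 + f 0 * x * y)) (- (f 0 * y ^ 2)) (by
        push_cast; linear_combination h' - (y : K) ^ 2 * hf.sq_left)
    simp [h0, hy] at this

/-- The cubic ring of `f` is not maximal at `p`. -/
def NM (p : ℕ) (f : Form) : Prop := ∃ x : Fin 3 → ℤ, (¬ ∀ i, (p : ℤ) ∣ x i) ∧
    ∀ i ≤ 3, (p : ℤ) ^ (3 - i) ∣ (mulMat f x).charpoly.coeff i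

lemma IdxPair.isIntegral_div_iff (hf : IdxPair f ω θ) (h : Indep3 ω θ)
    (h3 : finrank ℚ K = 3) (x : Fin 3 → ℤ) {d : ℤ} (hd : d ≠ 0) :
    IsIntegral ℤ ((x 0 + x 1 * ω + x 2 * θ) / d) ↔
      ∀ i ≤ 3, d ^ (3 - i) ∣ (mulMat f x).charpoly.coeff i := by
  obtain ⟨b, hb⟩ := h.exists_basis h3
  have := _root_.isIntegral_div_iff b (hf.leftMulMatrix hb x) hd
  rw [Fintype.card_fin] at this
  exact this

lemma IdxPair.nm_iff {ω θ ω' θ' : K} (hf : IdxPair f ω θ)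
    (h : Indep3 ω θ) (h3 : finrank ℚ K = 3) (hb : IntBasis ω' θ') {i₁ i₂ r s t u : ℤ}
    (h1 : ω = i₁ + r * ω' + t * θ') (h2 : θ = i₂ + s * ω' + u * θ') (hp : p.Prime) :
    NM p f ↔ (p : ℤ) ∣ r * u - s * t := by
  have hp0 : (p : ℤ) ≠ 0 := mod_cast hp.ne_zero
  have hpK : ((p : ℤ) : K) ≠ 0 := mod_cast hp.ne_zero
  have hpp : Prime (p : ℤ) := Nat.prime_iff_prime_int.1 hp
  constructor
  · rintro ⟨x, hx, hc⟩
    rw [← hf.isIntegral_div_iff h h3 x hp0, hb.2] at hc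
    obtain ⟨i, j, k, e⟩ := hc
    rw [div_eq_iff hpK] at e
    by_contra hn
    obtain ⟨e0, e1, e2⟩ := hb.1 (x 0 + x 1 * i₁ + x 2 * i₂ - p * i) (x 1 * r + x 2 * s - p * j)
      (x 1 * t + x 2 * u - p * k) (by
        push_cast
        push_cast at e
        linear_combination e - (x 1 : K) * h1 - (x 2 : K) * h2)
    have d1 : (p : ℤ) ∣ (r * u - s * t) * x 1 := ⟨u * j - s * k, by
      linear_combination u * e1 - s * e2⟩
    have d2 : (p : ℤ) ∣ (r * u - s * t) * x 2 := ⟨r * k - t * j, by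
      linear_combination r * e2 - t * e1⟩
    have d1 := (hpp.dvd_or_dvd d1).resolve_left hn
    have d2 := (hpp.dvd_or_dvd d2).resolve_left hn
    apply hx
    intro i'
    fin_cases i'
    · obtain ⟨v, hv⟩ := d1
      obtain ⟨w, hw⟩ := d2
      exact ⟨i - v * i₁ - w * i₂, by simp; linear_combination e0 - i₁ * hv - i₂ * hw⟩
    exacts [d1, d2]
  · intro hd
    obtain ⟨n, hn⟩ := hd
    have key : ∀ j k v w : ℤ, j * r + k * s = p * v → j * t + k * u = p * w →
        ¬ ((p : ℤ) ∣ j ∧ (p : ℤ) ∣ k) → NM p f := fun j k v w hv hw hjk => by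
      refine ⟨![-(j * i₁ + k * i₂), j, k], fun hh => hjk ⟨hh 1, hh 2⟩, ?_⟩
      rw [← hf.isIntegral_div_iff h h3 _ hp0, hb.2]
      refine ⟨0, v, w, ?_⟩
      rw [div_eq_iff hpK]
      have hvK := congrArg (Int.cast (R := K)) hv
      have hwK := congrArg (Int.cast (R := K)) hw
      push_cast at hvK hwK
      simp
      linear_combination (j : K) * h1 + (k : K) * h2 + ω' * hvK + θ' * hwK
    by_cases c1 : (p : ℤ) ∣ s ∧ (p : ℤ) ∣ r
    · by_cases c2 : (p : ℤ) ∣ u ∧ (p : ℤ) ∣ t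
      · obtain ⟨⟨a, ha⟩, b, hb⟩ := c1
        obtain ⟨⟨c, hc⟩, d, hd⟩ := c2
        refine key 1 0 b d (by rw [hb]; ring) (by rw [hd]; ring) ?_
        rintro ⟨h, -⟩
        exact hpp.not_dvd_one h
      · refine key u (-t) n 0 (by linear_combination hn) (by ring) ?_
        rwa [dvd_neg]
    · refine key s (-r) 0 (-n) (by ring) (by linear_combination -hn) ?_
      rwa [dvd_neg]

lemma IsIdx.irrF (hf : IsIdx f K) : IrrF f := by
  obtain ⟨ω, θ, hb, hp⟩ := hf
  exact hp.irrF hb.1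

lemma IsIdx.not_nm (hf : IsIdx f K) (h3 : finrank ℚ K = 3) (hp : p.Prime) : ¬ NM p f := by
  obtain ⟨ω, θ, hb, h⟩ := hf
  rw [h.nm_iff hb.1 h3 hb (i₁ := 0) (i₂ := 0) (r := 1) (s := 0) (t := 0) (u := 1)
    (by simp) (by simp) hp]
  simpa using (Nat.prime_iff_prime_int.1 hp).not_dvd_one

lemma fact_cast (r s t u : ℤ) (f : Form) :
    (fun i => ((fact r s t u f i : ℤ) : ℝ)) = fact (r : ℝ) s t u ⟬f⟭ := by
  funext i
  fin_cases i <;> simp [fact]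

lemma unit_mul_inv {e : ℝ} (he : e ^ 2 = 1) (f : Fin 4 → ℝ) :
    fdisc (fun i => e * f i) = fdisc f ∧ hesA (fun i => e * f i) = hesA f ∧
    hesB (fun i => e * f i) = hesB f ∧ hesC (fun i => e * f i) = hesC f ∧
    matA (fun i => e * f i) = matA f ∧ matB (fun i => e * f i) = matB f ∧
    matC (fun i => e * f i) = matC f := by
  simp only [fdisc, hesA, hesB, hesC, matA, matB, matC]
  refine ⟨?_, ?_, ?_, ?_, ?_, ?_, ?_⟩
  · linear_combination fdisc f * (e ^ 2 + 1) * he + (e ^ 4 - 1) * (by simp only [fdisc] :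
      f 1 ^ 2 * f 2 ^ 2 - 4 * f 0 * f 2 ^ 3 - 4 * f 1 ^ 3 * f 3 - 27 * f 0 ^ 2 * f 3 ^ 2
    + 18 * f 0 * f 1 * f 2 * f 3 = fdisc f)
  · linear_combination (f 1 ^ 2 - 3 * f 0 * f 2) * he
  · linear_combination (f 1 * f 2 - 9 * f 0 * f 3) * he
  · linear_combination (f 2 ^ 2 - 3 * f 1 * f 3) * he
  · linear_combination (f 1 * f 2 - f 0 * f 3) * he
  · linear_combination ((f 0 - f 1) ^ 2 + f 0 * f 2 + f 0 * f 3 - f 1 * f 2) * he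
  · linear_combination (f 3 ^ 2 - f 0 ^ 2 + f 0 * f 2 - f 1 * f 3) * he

lemma cred_unit_mul {e : ℝ} (he : e ^ 2 = 1) {f : Fin 4 → ℝ} :
    CRed (fun i => e * f i) ↔ CRed f := by
  obtain ⟨h1, h2, h3, h4, h5, h6, h7⟩ := unit_mul_inv he f
  simp only [CRed, h1, h2, h3, h4, h5, h6, h7]

lemma sred_unit_mul {e : ℝ} (he : e ^ 2 = 1) {f : Fin 4 → ℝ} :
    SRed (fun i => e * f i) ↔ SRed f := by
  obtain ⟨h1, h2, h3, h4, h5, h6, h7⟩ := unit_mul_inv he f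
  simp only [SRed, h1, h2, h3, h4, h5, h6, h7]

lemma exists_idx_cred (h3 : finrank ℚ K = 3) : ∃ f : Form, IsIdx f K ∧ CRed ⟬f⟭ := by
  obtain ⟨ω, θ, hb⟩ := exists_intBasis h3
  obtain ⟨n, n', f, hb', hf⟩ := hb.exists_idxPair
  have hf : IsIdx f K := ⟨_, _, hb', hf⟩
  have hd : fdisc f ≠ 0 := by rw [← hf.discr h3]; exact NumberField.discr_ne_zero K
  have hdR : fdisc ⟬f⟭ = fdisc f := by simp [fdisc]
  obtain ⟨r, s, t, w, hdet, hc⟩ := exists_cred (f := ⟬f⟭) (by rw [hdR]; exact_mod_cast hd)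
  refine ⟨_, hf.fact_mem hdet, ?_⟩
  have hdetR : ((r : ℝ) * w - s * t) ^ 2 = 1 := mod_cast hdet
  rw [← cred_unit_mul hdetR, ← fact_cast] at hc
  convert hc using 2
  push_cast
  ring

lemma IsIdx.neg (hf : IsIdx f K) : IsIdx (fun i => -f i) K := by
  have := hf.fact_mem (r := -1) (s := 0) (t := 0) (u := -1) (by norm_num)
  convert this using 2 with i
  fin_cases i <;> simp [fact]

lemma IsIdx.eq_or_eq_neg (hf : IsIdx f K) (hg : IsIdx g K) (hf' : SRed ⟬f⟭) (hg' : SRed ⟬g⟭) :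
    g = f ∨ g = fun i => -f i := by
  obtain ⟨r, s, t, u, hdet, h⟩ := hf.exists_fact hg
  have hdetR : ((r : ℝ) * u - s * t) ^ 2 = 1 := mod_cast hdet
  have h' : SRed (fact (r : ℝ) s t u ⟬f⟭) := by
    rw [← fact_cast, ← sred_unit_mul hdetR]
    convert hg' using 2 with i
    rw [h]
    push_cast
    linear_combination (g i : ℝ) * hdetR
  rcases hf'.unique hdet h' with ⟨rfl, rfl, rfl, rfl⟩ | ⟨rfl, rfl, rfl, rfl⟩
  · left; funext i; rw [show g i = (1 * 1 - 0 * 0) * g i by ring, ← h]; fin_cases i <;> simp [fact]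
  · right; funext i
    rw [show g i = (-1 * -1 - 0 * 0) * g i by ring, ← h]; fin_cases i <;> simp [fact]

/-- A field with a nontrivial automorphism has no strictly reduced index form. -/
lemma IsIdx.not_sred_of_aut (hf : IsIdx f K) (h3 : finrank ℚ K = 3)
    (σ : K ≃ₐ[ℚ] K) (hσ : σ ≠ 1) : ¬ SRed ⟬f⟭ := fun hs => by
  have hd : fdisc f ≠ 0 := by rw [← hf.discr h3]; exact NumberField.discr_ne_zero K
  obtain ⟨ω, θ, hb, hp⟩ := hf
  have hp' : IdxPair f (σ ω) (σ θ) := by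
    obtain ⟨m, l, r⟩ := hp
    refine ⟨?_, ?_, ?_⟩
    · have := congrArg σ m; simpa using this
    · have := congrArg σ l; simpa using this
    · have := congrArg σ r; simpa using this
  have hint : ∀ x, IsIntegral ℤ x → IsIntegral ℤ (σ x) := fun x hx => hx.map (σ.restrictScalars ℤ)
  have hint' : ∀ x, IsIntegral ℤ x → IsIntegral ℤ (σ.symm x) := fun x hx =>
    hx.map (σ.symm.restrictScalars ℤ)
  obtain ⟨i₁, r, t, h1⟩ := (hb.2 _).1 (hint _ hb.isIntegral.1)
  obtain ⟨i₂, s, u, h2⟩ := (hb.2 _).1 (hint _ hb.isIntegral.2)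
  have hb' : IntBasis (σ ω) (σ θ) := by
    refine ⟨fun i j k h => hb.1 i j k (σ.injective (by simpa using h)), fun x => ?_⟩
    constructor
    · intro hx
      obtain ⟨i, j, k, e⟩ := (hb.2 _).1 (hint' x hx)
      refine ⟨i, j, k, ?_⟩
      have := congrArg σ e
      simpa using this
    · rintro ⟨i, j, k, rfl⟩
      have := hint _ ((hb.2 _).2 ⟨i, j, k, rfl⟩)
      simpa using this
  have hfe := hp.fact_eq hb.1 hp' h1 h2
  have hdet : (r * u - s * t) ^ 2 = 1 := by
    obtain ⟨j₁, r', t', h3⟩ := (hb'.2 _).1 hb.isIntegral.1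
    obtain ⟨j₂, s', u', h4⟩ := (hb'.2 _).1 hb.isIntegral.2
    obtain ⟨-, e1, e2⟩ := hb.1 (j₁ + r' * i₁ + t' * i₂) (r' * r + t' * s - 1) (r' * t + t' * u) (by
      push_cast; linear_combination -h3 - (r' : K) * h1 - (t' : K) * h2)
    obtain ⟨-, e3, e4⟩ := hb.1 (j₂ + s' * i₁ + u' * i₂) (s' * r + u' * s) (s' * t + u' * u - 1) (by
      push_cast; linear_combination -h4 - (s' : K) * h1 - (u' : K) * h2)
    have : IsUnit (r * u - s * t) := IsUnit.of_mul_eq_one (r' * u' - s' * t') (by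
      linear_combination e1 * (s' * t + u' * u) + e4 - e2 * (s' * r + u' * s))
    rcases Int.isUnit_iff.1 this with h | h <;> rw [h] <;> norm_num
  have hdetR : ((r : ℝ) * u - s * t) ^ 2 = 1 := mod_cast hdet
  have h' : SRed (fact (r : ℝ) s t u ⟬f⟭) := by
    rw [← fact_cast, ← sred_unit_mul hdetR]
    convert hs using 2 with i
    rw [hfe]
    push_cast
    linear_combination (f i : ℝ) * hdetR
  rcases hs.unique hdet h' with ⟨rfl, rfl, rfl, rfl⟩ | ⟨rfl, rfl, rfl, rfl⟩
  · have key : ∀ (x : K) (i : ℤ), σ x = x + i → σ x = x := fun x i hx => by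
      have h5 : ∀ n : ℕ, (σ ^ n) x = x + n * i := fun n => by
        induction n with
        | zero => simp
        | succ n ih =>
          rw [pow_succ, AlgEquiv.mul_apply, hx, map_add, ih]
          simp; ring
      have h6 := h5 (Fintype.card (K ≃ₐ[ℚ] K))
      rw [pow_card_eq_one] at h6
      have h7 : (i : K) = 0 := by simpa using h6
      rw [hx, h7, add_zero]
    have k1 := key ω i₁ (by rw [h1]; push_cast; ring)
    have k2 := key θ i₂ (by rw [h2]; push_cast; ring)
    apply hσ
    obtain ⟨b, hbb⟩ := hb.1.exists_basis h3
    have : σ.toLinearMap = LinearMap.id := b.ext fun i => by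
      rw [hbb]
      fin_cases i
      exacts [map_one σ, k1, k2]
    ext x
    exact LinearMap.congr_fun this x
  · apply hd
    have : ∀ i, f i = 0 := fun i => by
      have := hfe i
      fin_cases i <;> simp [fact] at this ⊢ <;> omega
    simp [fdisc, this]

end Isom

instance isAlgebraic_qbar : Algebra.IsAlgebraic ℚ Qbar := by exact AlgebraicClosure.isAlgebraic ℚ

section FieldOfForm
open Polynomial IntermediateField

/-- The polynomial `f(X, 1)`. -/
def formPoly (f : Form) : ℚ[X] :=
  C (f 0 : ℚ) * X ^ 3 + C (f 1 : ℚ) * X ^ 2 + C (f 2 : ℚ) * X + C (f 3 : ℚ)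

lemma IrrF.ne_zero (hf : IrrF f) : f 0 ≠ 0 := fun h => by have := hf 1 0 (by simp [h]); simp at this

lemma IrrF.natDegree (hf : IrrF f) : (formPoly f).natDegree = 3 :=
  natDegree_cubic (mod_cast hf.ne_zero)

lemma IrrF.irreducible (hf : IrrF f) : Irreducible (formPoly f) := by
  refine irreducible_of_degree_le_three_of_not_isRoot ?_ fun x hx => ?_
  · rw [hf.natDegree]; decide
  · have h := hf x.num x.den ?_
    · exact x.den_ne_zero (mod_cast h.2)
    · have hd : (x.den : ℚ) ≠ 0 := mod_cast x.den_ne_zero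
      have hx' : (f 0 : ℚ) * x ^ 3 + f 1 * x ^ 2 + f 2 * x + f 3 = 0 := by simpa [formPoly] using hx
      have hxn : (x.num : ℚ) = x * x.den := (Rat.mul_den_eq_num x).symm
      have : (f 0 : ℚ) * x.num ^ 3 + f 1 * x.num ^ 2 * x.den + f 2 * x.num * x.den ^ 2
          + f 3 * x.den ^ 3 = 0 := by
        rw [hxn]; linear_combination (x.den : ℚ) ^ 3 * hx'
      exact_mod_cast this

/-- The cubic ring of an irreducible form, embedded in the cubic field it defines. -/
lemma IrrF.exists_field (hf : IrrF f) : ∃ K : Fld, finrank ℚ K = 3 ∧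
      ∃ ω θ : K, IdxPair f ω θ ∧ Indep3 ω θ := by
  obtain ⟨α, hα⟩ := IsAlgClosed.exists_aeval_eq_zero Qbar (formPoly f) (by
    rw [degree_eq_natDegree hf.irreducible.ne_zero, hf.natDegree]; decide)
  have hint : IsIntegral ℚ α := (Algebra.IsAlgebraic.isAlgebraic α).isIntegral
  have hdeg : (minpoly ℚ α).natDegree = 3 := by
    rw [← minpoly.eq_of_irreducible hf.irreducible hα, natDegree_mul_C, hf.natDegree]
    exact inv_ne_zero (leadingCoeff_ne_zero.2 hf.irreducible.ne_zero)
  have hαe : (f 0 : Qbar) * α ^ 3 + f 1 * α ^ 2 + f 2 * α + f 3 = 0 := by simpa [formPoly] using hα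
  let β : ℚ⟮α⟯ := AdjoinSimple.gen ℚ α
  have hβ : (f 0 : ℚ⟮α⟯) * β ^ 3 + f 1 * β ^ 2 + f 2 * β + f 3 = 0 := by
    apply Subtype.ext
    push_cast
    simpa [β] using hαe
  refine ⟨ℚ⟮α⟯, (adjoin.finrank hint).trans hdeg, -(f 0 * β), -(f 0 * β ^ 2 + f 1 * β + f 2),
    ⟨?_, ?_, ?_⟩, fun i j k h => ?_⟩
  · linear_combination (f 0 : ℚ⟮α⟯) * hβ
  · ring
  · linear_combination (f 0 * β + f 1 : ℚ⟮α⟯) * hβ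
  · have h' : (i : Qbar) - j * (f 0 * α) - k * (f 0 * α ^ 2 + f 1 * α + f 2) = 0 := by
      have := congrArg (Subtype.val) h
      push_cast at this
      simp only [β, AdjoinSimple.coe_gen] at this
      linear_combination this
    have hq := minpoly.degree_le_of_ne_zero ℚ α
      (p := C (-(k * f 0) : ℚ) * X ^ 2 + C (-(j * f 0) - k * f 1 : ℚ) * X + C (i - k * f 2 : ℚ))
    by_contra hc
    have h0 : C (-(k * f 0) : ℚ) * X ^ 2 + C (-(j * f 0) - k * f 1 : ℚ) * X + C (i - k * f 2 : ℚ)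
        ≠ 0 := fun hz => by
      have c0 := congrArg (eval 0) hz
      have c1 := congrArg (eval 1) hz
      have c2 := congrArg (eval (-1)) hz
      simp at c0 c1 c2
      have hk : (k : ℚ) * f 0 = 0 := by linear_combination (2 * c0 - c1 - c2) / 2
      have hj : (j : ℚ) * f 0 + k * f 1 = 0 := by linear_combination (c2 - c1) / 2
      have hk : k = 0 := by
        have : k * f 0 = 0 := mod_cast hk
        simpa [hf.ne_zero] using this
      subst hk
      have hj : j = 0 := by
        have : j * f 0 = 0 := by simpa using hj
        simpa [hf.ne_zero] using this
      subst hj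
      exact hc ⟨by simpa using c0, rfl, rfl⟩
    have := hq h0 (by simp; linear_combination h')
    rw [degree_eq_natDegree (minpoly.ne_zero hint), hdeg] at this
    have h2 := this.trans degree_quadratic_le
    exact absurd h2 (by decide)

/-- Every irreducible form is obtained from the index form of its cubic field by an integral
substitution of determinant `n`, and `n` detects the primes at which it is not maximal. -/
lemma IrrF.exists_idx (hf : IrrF f) : ∃ K : Fld, finrank ℚ K = 3 ∧
      ∃ (g : Form) (r s t u : ℤ), IsIdx g K ∧ r * u - s * t ≠ 0 ∧
        (∀ i, fact r s t u g i = (r * u - s * t) * f i) ∧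
        (∀ p : ℕ, p.Prime → (NM p f ↔ (p : ℤ) ∣ r * u - s * t)) ∧
        ((r * u - s * t) ^ 2 = 1 → IsIdx f K) := by
  obtain ⟨K, h3, ω, θ, hp, hi⟩ := hf.exists_field
  have : FiniteDimensional ℚ K := finite_of_finrank_pos (by omega)
  have : NumberField K := ⟨⟩
  obtain ⟨ω₀, θ₀, hb₀⟩ := exists_intBasis h3
  obtain ⟨n, n', g, hb, hg⟩ := hb₀.exists_idxPair
  generalize ω₀ - n = ω' at hb hg
  generalize θ₀ - n' = θ' at hb hg
  obtain ⟨i₁, r, t, h1⟩ := (hb.2 _).1 hp.isIntegral.1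
  obtain ⟨i₂, s, u, h2⟩ := (hb.2 _).1 hp.isIntegral.2
  have hfe := hg.fact_eq hb.1 hp h1 h2
  have hg' : IsIdx g K := ⟨ω', θ', hb, hg⟩
  refine ⟨K, h3, g, r, s, t, u, hg', fun h0 => ?_, hfe,
    fun p hpp => hp.nm_iff hi h3 hb h1 h2 hpp, fun h => ?_⟩
  · have hz : ∀ x y : ℤ, r * x + s * y = 0 → t * x + u * y = 0 → x = 0 ∧ y = 0 := by
      intro x y e1 e2
      have := hi (-(x * i₁ + y * i₂)) x y (by
        have e1' := congrArg (Int.cast (R := K)) e1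
        have e2' := congrArg (Int.cast (R := K)) e2
        push_cast at e1' e2' ⊢
        linear_combination (x : K) * h1 + (y : K) * h2 + ω' * e1' + θ' * e2')
      exact this.2
    have c1 := hz u (-t) (by linear_combination h0) (by ring)
    have c2 := hz s (-r) (by ring) (by linear_combination -h0)
    have := hz 1 0 (by linarith [c2.2]) (by linarith [c1.2])
    simp at this
  · have := hg'.fact_mem h
    convert this using 2 with i
    rw [hfe]
    linear_combination -f i * h

lemma exists_field_of_maximal (hf : IrrF f) (hm : ∀ p : ℕ, p.Prime → ¬ NM p f) :
    ∃ K : Fld, finrank ℚ K = 3 ∧ IsIdx f K := by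
  obtain ⟨K, h3, g, r, s, t, u, -, h0, -, hn, h1⟩ := hf.exists_idx
  refine ⟨K, h3, h1 ?_⟩
  have : (r * u - s * t).natAbs = 1 := by
    by_contra hc
    obtain ⟨p, hp, hd⟩ := Nat.exists_prime_and_dvd hc
    exact hm p hp ((hn p hp).2 (Int.natCast_dvd.2 hd))
  rw [← Int.natAbs_sq, this]
  norm_num

end FieldOfForm

section TotallyRamified
open NumberField
variable {K : Type*} [Field K] [NumberField K]

/-- Some prime of `K` above `p` has ramification index at least `3`. -/
def TotRam (p : ℕ) (K : Type*) [Field K] : Prop :=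
  ∃ P : Ideal (𝓞 K), P.IsPrime ∧ P ^ 3 ∣ Ideal.span {(p : 𝓞 K)}

lemma exists_int_sub_mem (hp : p.Prime) {P : Ideal (𝓞 K)} (hP : Ideal.absNorm P = p)
    (x : 𝓞 K) : ∃ u : ℤ, x - u ∈ P := by
  have : Fact p.Prime := ⟨hp⟩
  have hpP : (p : 𝓞 K) ∈ P := by
    have := Ideal.absNorm_mem P
    rwa [hP] at this
  have hc : Nat.card (𝓞 K ⧸ P) = p := by rw [← hP]; rfl
  have : Finite (𝓞 K ⧸ P) := Nat.finite_of_card_ne_zero (by rw [hc]; exact hp.ne_zero)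
  have : Nontrivial (𝓞 K ⧸ P) := by
    have : 1 < Nat.card (𝓞 K ⧸ P) := by rw [hc]; exact hp.one_lt
    exact Finite.one_lt_card_iff_nontrivial.1 this
  have hchar : CharP (𝓞 K ⧸ P) p := by
    refine (CharP.charP_iff_prime_eq_zero hp).2 ?_
    rw [← map_natCast (Ideal.Quotient.mk P)]
    exact Ideal.Quotient.eq_zero_iff_mem.2 hpP
  let φ := ZMod.castHom (dvd_refl p) (𝓞 K ⧸ P)
  have hbij : Function.Bijective φ := by
    have := Fintype.ofFinite (𝓞 K ⧸ P)
    rw [Fintype.bijective_iff_injective_and_card]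
    exact ⟨φ.injective, by rw [ZMod.card, ← Nat.card_eq_fintype_card, hc]⟩
  obtain ⟨y, hy⟩ := hbij.2 (Ideal.Quotient.mk P x)
  obtain ⟨u, rfl⟩ := ZMod.intCast_surjective y
  refine ⟨u, Ideal.Quotient.eq_zero_iff_mem.1 ?_⟩
  rw [map_sub, ← hy]
  simp

lemma TotRam.dvd_hes (hp : p.Prime) (h : TotRam p K) (h3 : finrank ℚ K = 3)
    (hf : IsIdx f K) : (p : ℤ) ∣ hesA f ∧ (p : ℤ) ∣ hesB f := by
  obtain ⟨P, hP, hPd⟩ := h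
  have hnp : Ideal.absNorm (Ideal.span {(p : 𝓞 K)}) = p ^ 3 := by
    rw [Ideal.absNorm_span_singleton, ← h3, ← RingOfIntegers.rank K]
    have := Algebra.norm_algebraMap (S := 𝓞 K) (p : ℤ)
    simp only [map_natCast] at this
    rw [this]; simp [Int.natAbs_pow]
  have hd := Ideal.absNorm_dvd_absNorm_of_le (Ideal.le_of_dvd hPd)
  rw [hnp, map_pow] at hd
  have hd' : Ideal.absNorm P ∣ p := (Nat.pow_dvd_pow_iff (by norm_num)).1 hd
  have hN : Ideal.absNorm P = p := ((Nat.dvd_prime hp).1 hd').resolve_left fun h1 =>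
    hP.ne_top (Ideal.absNorm_eq_one_iff.1 h1)
  obtain ⟨J, hJ⟩ := hPd
  have hJ1 : J = ⊤ := by
    rw [← Ideal.absNorm_eq_one_iff]
    have := congrArg Ideal.absNorm hJ
    rw [hnp, map_mul, map_pow, hN] at this
    have h0 : 0 < p ^ 3 := pow_pos hp.pos 3
    nlinarith
  rw [hJ1, Ideal.mul_top] at hJ
  obtain ⟨ω, θ, hb, hi⟩ := hf
  obtain ⟨ω', rfl⟩ : ∃ w : 𝓞 K, (w : K) = ω := ⟨⟨ω, hb.isIntegral.1⟩, rfl⟩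
  obtain ⟨u, hu⟩ := exists_int_sub_mem hp hN ω'
  have h4 : (ω' - u) ^ 3 ∈ Ideal.span {(p : 𝓞 K)} := by rw [hJ]; exact Ideal.pow_mem_pow hu 3
  obtain ⟨z, hz⟩ := Ideal.mem_span_singleton.1 h4
  obtain ⟨i, j, k, hz'⟩ := (hb.2 z).1 z.2
  have hzK : ((ω' : K) - u) ^ 3 = p * (z : K) := by
    have := congrArg (algebraMap (𝓞 K) K) hz
    simpa using this
  rw [hz'] at hzK
  obtain ⟨e0, e1, e2⟩ := hb.1 (-(f 0 * f 2) * (f 1 - 3 * u) + f 0 ^ 2 * f 3 - u ^ 3 - p * i)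
    (f 1 * (f 1 - 3 * u) + 3 * u ^ 2 - f 0 * f 2 - p * j)
    (-(f 0 * (f 1 - 3 * u)) - p * k) (by
      push_cast
      linear_combination hzK - hi.root_left - ((f 1 : K) - 3 * u) * hi.sq_left)
  have hpp : Prime (p : ℤ) := Nat.prime_iff_prime_int.1 hp
  have d0 : (p : ℤ) ∣ -(f 0 * f 2) * (f 1 - 3 * u) + f 0 ^ 2 * f 3 - u ^ 3 :=
    ⟨i, by linear_combination e0⟩
  have d1 : (p : ℤ) ∣ f 1 * (f 1 - 3 * u) + 3 * u ^ 2 - f 0 * f 2 := ⟨j, by linear_combination e1⟩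
  have d2 : (p : ℤ) ∣ f 0 * (f 1 - 3 * u) := ⟨-k, by linear_combination -e2⟩
  simp only [hesA, hesB]
  rcases hpp.dvd_or_dvd d2 with ha | hbu
  · obtain ⟨a', ha⟩ := ha
    have hu3 : (p : ℤ) ∣ u := by
      refine hpp.dvd_of_dvd_pow (n := 3) ?_
      obtain ⟨x, hx⟩ := d0
      exact ⟨-(a' * f 2) * (f 1 - 3 * u) + a' * f 0 * f 3 - x, by
        linear_combination -hx + (-f 2 * (f 1 - 3 * u) + f 0 * f 3) * ha⟩
    obtain ⟨u', hu'⟩ := hu3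
    have hb' : (p : ℤ) ∣ f 1 := by
      refine hpp.dvd_of_dvd_pow (n := 2) ?_
      obtain ⟨x, hx⟩ := d1
      exact ⟨x + 3 * f 1 * u' - 3 * u * u' + f 2 * a', by
        linear_combination hx + (3 * f 1 - 3 * u) * hu' + f 2 * ha⟩
    obtain ⟨b', hb'⟩ := hb'
    rw [ha, hb']
    exact ⟨⟨b' * (p * b') - 3 * a' * f 2, by ring⟩, ⟨b' * f 2 - 9 * a' * f 3, by ring⟩⟩
  · by_cases ha : (p : ℤ) ∣ f 0
    · obtain ⟨a', ha⟩ := ha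
      obtain ⟨w, hw⟩ := hbu
      have hu3 : (p : ℤ) ∣ u := by
        refine hpp.dvd_of_dvd_pow (n := 3) ?_
        obtain ⟨x, hx⟩ := d0
        exact ⟨-(a' * f 2) * (f 1 - 3 * u) + a' * f 0 * f 3 - x, by
          linear_combination -hx + (-f 2 * (f 1 - 3 * u) + f 0 * f 3) * ha⟩
      obtain ⟨u', hu'⟩ := hu3
      have hb' : f 1 = p * (w + 3 * u') := by linear_combination hw + 3 * hu'
      rw [ha, hb']
      exact ⟨⟨(w + 3 * u') * (p * (w + 3 * u')) - 3 * a' * f 2, by ring⟩,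
        ⟨(w + 3 * u') * f 2 - 9 * a' * f 3, by ring⟩⟩
    · obtain ⟨w, hw⟩ := hbu
      obtain ⟨x, hx⟩ := d1
      obtain ⟨y, hy⟩ := d0
      refine ⟨⟨w * (f 1 + 3 * u) + 3 * (x - f 1 * w), ?_⟩, ?_⟩
      · linear_combination (f 1 + 3 * u) * hw + 3 * hx - 3 * f 1 * hw
      · refine (hpp.dvd_or_dvd (b := f 1 * f 2 - 9 * f 0 * f 3) (a := f 0) ?_).resolve_left ha
        have : (p : ℤ) ∣ f 0 * (f 1 * f 2 - 9 * f 0 * f 3) := by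
          refine ⟨f 0 * f 2 * w - 3 * u * (x - f 1 * w) - 9 * y - 9 * f 0 * f 2 * w, ?_⟩
          linear_combination f 0 * f 2 * hw - 3 * u * hx + 3 * u * f 1 * hw - 9 * hy
            - 9 * f 0 * f 2 * hw
        exact this

end TotallyRamified

/-- The bounds satisfied by reduced integral forms with nonzero leading coefficient and
discriminant at most `W`. -/
def EnvB (W P : ℝ) (f : Form) : Prop :=
  f 0 ≠ 0 ∧ 0 < P ∧ P ^ 2 ≤ 8 * W ∧ (f 0 : ℝ) ^ 2 ≤ 8 * P ∧ (f 1 : ℝ) ^ 2 ≤ 8 * P ∧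
    (f 2 : ℝ) ^ 2 * P ≤ 8 * W ∧ (f 3 : ℝ) ^ 2 * P ^ 3 ≤ 8 * W ^ 2 ∧
    (|9 * (f 0 : ℝ) * f 3 - f 1 * f 2| ≤ 8 * P ∨ |1 * (f 0 : ℝ) * f 3 - f 1 * f 2| ≤ 8 * P)

/-- A dyadic version of the bounds. -/
def EnvAt (W p : ℝ) (f : Form) : Prop := f 0 ≠ 0 ∧ (f 0 : ℝ) ^ 2 ≤ 16 * p ∧ (f 1 : ℝ) ^ 2 ≤ 16 * p ∧
    (f 2 : ℝ) ^ 2 * p ≤ 8 * W ∧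
    (|9 * (f 0 : ℝ) * f 3 - f 1 * f 2| ≤ 16 * p ∨ |1 * (f 0 : ℝ) * f 3 - f 1 * f 2| ≤ 16 * p)

lemma EnvB.exists_dyadic (h : EnvB W P f) :
    ∃ k : ℕ, EnvAt W (2 ^ k / 16) f ∧ (2 : ℝ) ^ k / 16 ≤ P := by
  obtain ⟨h0, hP, h1, h2, h3, h4, h5, h6⟩ := h
  have ha : (1 : ℝ) ≤ (f 0 : ℝ) ^ 2 := by
    have : 1 ≤ (f 0) ^ 2 := by
      have := sq_nonneg (f 0)
      have : f 0 ^ 2 ≠ 0 := pow_ne_zero 2 h0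
      omega
    exact_mod_cast this
  obtain ⟨k, hk1, hk2⟩ := exists_nat_pow_near (show (1 : ℝ) ≤ 16 * P by linarith)
    (by norm_num : (1 : ℝ) < 2)
  rw [pow_succ] at hk2
  refine ⟨k, ⟨h0, by linarith, by linarith, ?_, ?_⟩, by linarith⟩
  · refine le_trans ?_ h4
    have : (2 : ℝ) ^ k / 16 ≤ P := by linarith
    gcongr
  · rcases h6 with h6 | h6
    · exact .inl (by linarith)
    · exact .inr (by linarith)

/-- Summation over dyadic blocks. -/
lemma card_le_of_dyadic {Z K K₂ : ℝ} (hZ : 1 ≤ Z) (hK : 0 ≤ K)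
    (hK₂ : 0 ≤ K₂) (cond : ℕ → Form → Prop)
    (h : ∀ f ∈ s, ∃ k, cond k f ∧ (2 : ℝ) ^ k / 16 ≤ Z)
    (hb : ∀ k, (2 : ℝ) ^ k / 16 ≤ Z → ∀ t : Finset Form, (∀ f ∈ t, f ∈ s ∧ cond k f) →
      (#t : ℝ) ≤ K * (2 ^ k / 16) + K₂) :
    (#s : ℝ) ≤ 2 * K * Z + K₂ * (6 * (1 + log Z)) := by
  replace hb : ∀ k, (2 : ℝ) ^ k / 16 ≤ Z → ((s.filter (cond k)).card : ℝ) ≤ K * (2 ^ k / 16) + K₂ :=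
    fun k hk => hb k hk _ fun f hf => mem_filter.1 hf
  set N := Nat.log 2 ⌊16 * Z⌋₊ with hN
  have h16 : ⌊16 * Z⌋₊ ≠ 0 := by rw [Nat.ne_zero_iff_zero_lt, Nat.floor_pos]; linarith
  have hNpow : (2 : ℝ) ^ N ≤ 16 * Z := by
    have h1 := Nat.pow_log_le_self 2 h16
    have h2 : ((2 ^ N : ℕ) : ℝ) ≤ (⌊16 * Z⌋₊ : ℝ) := mod_cast h1
    push_cast at h2
    exact h2.trans (Nat.floor_le (by linarith))
  have hle : ∀ k : ℕ, (2 : ℝ) ^ k / 16 ≤ Z ↔ k ≤ N := fun k => by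
    constructor
    · intro hk
      rw [hN, Nat.le_log_iff_pow_le one_lt_two h16]
      refine Nat.le_floor ?_
      push_cast; linarith
    · intro hk
      have : (2 : ℝ) ^ k ≤ 2 ^ N := pow_le_pow_right₀ (by norm_num) hk
      linarith
  have hsub : s ⊆ (range (N + 1)).biUnion fun k => s.filter (cond k) := fun f hf => by
    obtain ⟨k, hk, hk2⟩ := h f hf
    have := (hle k).1 hk2
    exact mem_biUnion.2 ⟨k, mem_range.2 (by omega), mem_filter.2 ⟨hf, hk⟩⟩
  have h1 : (#s : ℝ) ≤ ∑ k ∈ range (N + 1), (K * (2 ^ k / 16) + K₂) := by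
    calc (#s : ℝ) ≤ ((∑ k ∈ range (N + 1), (s.filter (cond k)).card : ℕ) : ℝ) := by
          exact_mod_cast (card_le_card hsub).trans card_biUnion_le
      _ ≤ _ := by
        push_cast
        refine sum_le_sum fun k hk => hb k ((hle k).2 ?_)
        have := mem_range.1 hk
        omega
  rw [sum_add_distrib, ← mul_sum, ← sum_div, geom_sum_eq (by norm_num)] at h1
  simp only [sum_const, card_range, nsmul_eq_mul] at h1
  have hlog : ((N + 1 : ℕ) : ℝ) ≤ 6 * (1 + log Z) := by
    have h2 := log_le_log (by positivity) hNpow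
    rw [log_pow, log_mul (by norm_num) (by linarith),
      show (16 : ℝ) = 2 ^ 4 by norm_num, log_pow] at h2
    have h3 := log_two_gt_d9
    have h4 := log_nonneg hZ
    push_cast at h2 ⊢
    have h5 : (N : ℝ) * log 2 ≤ (4 + 2 * log Z) * log 2 := by nlinarith
    have h6 := le_of_mul_le_mul_right h5 (by linarith)
    linarith
  have h2 : K * (((2 : ℝ) ^ (N + 1) - 1) / (2 - 1) / 16) ≤ 2 * K * Z := by
    have : ((2 : ℝ) ^ (N + 1) - 1) / (2 - 1) / 16 ≤ 2 * Z := by rw [pow_succ]; linarith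
    calc _ ≤ K * (2 * Z) := by gcongr
      _ = _ := by ring
  have h3 : ((N + 1 : ℕ) : ℝ) * K₂ ≤ K₂ * (6 * (1 + log Z)) := by rw [mul_comm]; gcongr
  linarith

/-- The nonzero integers of absolute value at most `X`. -/
def nzInt (X : ℝ) : Finset ℤ := (Icc (-⌊X⌋) ⌊X⌋).erase 0

lemma mem_nzInt {X : ℝ} {x : ℤ} (h0 : x ≠ 0) (h : |(x : ℝ)| ≤ X) : x ∈ nzInt X :=
  mem_erase.2 ⟨h0, mem_Icc_floor h⟩

lemma abs_le_of_mem_nzInt {X : ℝ} {x : ℤ} (h : x ∈ nzInt X) : x ≠ 0 ∧ |(x : ℝ)| ≤ X := by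
  obtain ⟨h0, h⟩ := mem_erase.1 h
  refine ⟨h0, ?_⟩
  rw [mem_Icc] at h
  have h2 : (x : ℝ) ≤ ⌊X⌋ := mod_cast h.2
  have h3 : -(⌊X⌋ : ℝ) ≤ x := mod_cast h.1
  have := Int.floor_le X
  exact abs_le.2 ⟨by linarith, by linarith⟩

lemma sum_inv_nzInt_le {X : ℝ} (hX : 1 ≤ X) : ∑ a ∈ nzInt X, 1 / |(a : ℝ)| ≤ 2 * (1 + log X) := by
  set n := ⌊X⌋₊ with hn
  have hn1 : 1 ≤ n := Nat.le_floor (by simpa using hX)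
  have h1 : ∑ a ∈ nzInt X, 1 / |(a : ℝ)| ≤ ∑ b ∈ Icc 1 n ×ˢ ({1, -1} : Finset ℤ),
      1 / (b.1 : ℝ) := by
    rw [← sum_fiberwise_of_maps_to (s := nzInt X) (t := Icc 1 n ×ˢ ({1, -1} : Finset ℤ))
      (g := fun a => (a.natAbs, a.sign))]
    · refine sum_le_sum fun b hb => ?_
      have hb1 := mem_Icc.1 (mem_product.1 hb).1
      have hsub : ((nzInt X).filter fun a => (a.natAbs, a.sign) = b) ⊆ {b.2 * b.1} := fun a ha => by
        rw [mem_filter] at ha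
        rw [mem_singleton, ← ha.2]
        exact (Int.sign_mul_natAbs a).symm
      have hbp : (0 : ℝ) < b.1 := by
        have := hb1.1
        exact_mod_cast this
      rw [sum_congr rfl (g := fun _ => 1 / (b.1 : ℝ)) (fun a ha => by
        have h2 := congrArg Prod.fst (mem_filter.1 ha).2
        simp only at h2
        rw [← h2, Nat.cast_natAbs, Int.cast_abs])]
      rw [sum_const, nsmul_eq_mul]
      have h3 := card_le_card hsub
      rw [card_singleton] at h3
      have h4 : (((nzInt X).filter fun a => (a.natAbs, a.sign) = b).card : ℝ) ≤ 1 := by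
        exact_mod_cast h3
      have : 0 < 1 / (b.1 : ℝ) := by positivity
      nlinarith
    · intro a ha
      obtain ⟨h0, h⟩ := abs_le_of_mem_nzInt ha
      rw [mem_product, mem_Icc]
      refine ⟨⟨Int.natAbs_pos.2 h0, Nat.le_floor ?_⟩, ?_⟩
      · rwa [Nat.cast_natAbs, Int.cast_abs]
      · rcases lt_or_gt_of_ne h0 with h | h
        · simp [Int.sign_eq_neg_one_of_neg h]
        · simp [Int.sign_eq_one_of_pos h]
  refine h1.trans ?_
  rw [sum_product]
  simp only [sum_const, nsmul_eq_mul]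
  rw [← mul_sum]
  have h2 : ((({1, -1} : Finset ℤ).card : ℕ) : ℝ) = 2 := by norm_num
  rw [h2]
  have h3 := harmonic_le_one_add_log n
  rw [harmonic_eq_sum_Icc] at h3
  push_cast at h3
  simp only [one_div]
  have h4 : log n ≤ log X := log_le_log (by positivity) (Nat.floor_le (by linarith))
  linarith

/-- Counting forms in a dyadic block, given bounds for the number of last coefficients. -/
lemma card_envAt_le {p : ℝ} (hW : 1 ≤ W) (hp : 1 / 16 ≤ p)
    (hpW : p ^ 2 ≤ 8 * W) (h : ∀ f ∈ s, EnvAt W p f) (D : ℤ → ℤ → ℝ) (hD : ∀ a b, 0 ≤ D a b)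
    (hd : ∀ a b c, ((dfib s a b c).card : ℝ) ≤ D a b) :
    (#s : ℝ) ≤ 10 * √(W / p) * ∑ a ∈ nzInt (4 * √p), ∑ b ∈ Icc (-⌊4 * √p⌋) ⌊4 * √p⌋, D a b := by
  have hp0 : 0 < p := by linarith
  have hWp : 1 / 4 ≤ √(W / p) := by
    apply le_sqrt_of_sq_le
    rw [le_div_iff₀ hp0]
    nlinarith
  set I := Icc (-⌊4 * √p⌋) ⌊4 * √p⌋
  set J := Icc (-⌊3 * √(W / p)⌋) ⌊3 * √(W / p)⌋
  have hsq : ∀ x : ℝ, x ^ 2 ≤ 16 * p → |x| ≤ 4 * √p := fun x hx => by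
    apply abs_le_of_sq_le_sq (b := 4 * √p) _ (by positivity)
    rw [mul_pow, sq_sqrt hp0.le]; linarith
  have h1 := card_le_sum_dfib s (nzInt (4 * √p) ×ˢ I ×ˢ J) (fun f hf => by
    obtain ⟨h0, h1, h2, h3, -⟩ := h f hf
    simp only [mem_product]
    refine ⟨mem_nzInt h0 (hsq _ h1), mem_Icc_floor (hsq _ h2), mem_Icc_floor ?_⟩
    apply abs_le_of_sq_le_sq _ (by positivity)
    rw [mul_pow, sq_sqrt (by positivity)]
    rw [← le_div_iff₀ hp0] at h3
    have : 8 * W / p = 8 * (W / p) := by ring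
    have : 0 ≤ W / p := by positivity
    linarith)
  have hJ : (#J : ℝ) ≤ 10 * √(W / p) := (card_Icc_floor (by positivity)).trans (by linarith)
  calc (#s : ℝ) ≤ ((∑ x ∈ nzInt (4 * √p) ×ˢ I ×ˢ J,
        (dfib s x.1 x.2.1 x.2.2).card : ℕ) : ℝ) := mod_cast h1
    _ ≤ ∑ x ∈ nzInt (4 * √p) ×ˢ I ×ˢ J, D x.1 x.2.1 := by
      push_cast
      exact sum_le_sum fun x _ => hd _ _ _
    _ = #J * ∑ a ∈ nzInt (4 * √p), ∑ b ∈ I, D a b := by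
      rw [sum_product, mul_sum]
      refine sum_congr rfl fun a _ => ?_
      rw [sum_product, mul_sum]
      refine sum_congr rfl fun b _ => ?_
      simp
    _ ≤ _ := by
      refine mul_le_mul_of_nonneg_right hJ ?_
      exact sum_nonneg fun a _ => sum_nonneg fun b _ => hD a b

lemma card_or_le {s t u : Finset ℤ} (h : ∀ x ∈ s, x ∈ t ∨ x ∈ u) {A B : ℝ}
    (ht : (#t : ℝ) ≤ A) (hu : (#u : ℝ) ≤ B) : (#s : ℝ) ≤ A + B := by
  have h1 : s ⊆ t ∪ u := fun x hx => mem_union.2 (h x hx)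
  have h2 : (#s : ℝ) ≤ #t + #u := by exact_mod_cast (card_le_card h1).trans (card_union_le _ _)
  linarith

/-- The last coefficients in a dyadic block lie in two short intervals, and may moreover be
restricted to a residue class. -/
lemma card_dfib_envAt_le {p : ℝ} (hp : 0 ≤ p)
    (h : ∀ f ∈ s, EnvAt W p f) (a b c : ℤ) {q : ℤ} (hq : 0 < q)
    (hs : ∀ d ∈ dfib s a b c, ∀ d' ∈ dfib s a b c, q ∣ d' - d) :
    ((dfib s a b c).card : ℝ) ≤ 64 * p / (|(a : ℝ)| * q) + 2 := by
  rcases (dfib s a b c).eq_empty_or_nonempty with he | ⟨d₀, hd₀⟩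
  · rw [he]; simp; positivity
  have ha : a ≠ 0 := (h _ (mem_dfib.1 hd₀)).1
  have ha' : (0 : ℝ) < |(a : ℝ)| := abs_pos.2 (mod_cast ha)
  have hq' : (0 : ℝ) < q := mod_cast hq
  have key : ∀ k : ℝ, 1 ≤ k →
      (((dfib s a b c).filter fun d : ℤ => |k * (a : ℝ) * d - b * c| ≤ 16 * p).card : ℝ) ≤
        32 * p / |(a : ℝ)| / q + 1 := fun k hk => by
    refine card_int_mod_le hq (by positivity) (fun x hx y hy hxy => ?_) (fun x hx y hy =>
      hs x (mem_filter.1 hx).1 y (mem_filter.1 hy).1)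
    have h1 := (mem_filter.1 hx).2
    have h2 := (mem_filter.1 hy).2
    have hxy' : (0 : ℝ) ≤ y - x := by
      have : (x : ℝ) ≤ y := mod_cast hxy
      linarith
    rw [le_div_iff₀ ha', ← abs_of_nonneg hxy', ← abs_mul]
    have e : k * (((y : ℝ) - x) * a) = (k * (a : ℝ) * y - b * c) - (k * (a : ℝ) * x - b * c) := by
      ring
    have h3 : |k * (((y : ℝ) - x) * a)| ≤ 32 * p := by
      rw [e]; exact (abs_sub _ _).trans (by linarith)
    rw [abs_mul, abs_of_nonneg (by linarith : (0 : ℝ) ≤ k)] at h3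
    nlinarith [abs_nonneg (((y : ℝ) - x) * a)]
  have h1 := card_or_le (s := dfib s a b c) (fun d hd => ?_) (key 9 (by norm_num)) (key 1 le_rfl)
  · refine h1.trans (le_of_eq ?_)
    field_simp
    ring
  · rw [mem_filter, mem_filter]
    rcases (h _ (mem_dfib.1 hd)).2.2.2.2 with h5 | h5
    · exact .inl ⟨hd, h5⟩
    · exact .inr ⟨hd, h5⟩

lemma exists_log_le (hε : 0 < ε) : ∃ c : ℝ, 1 ≤ c ∧ ∀ W X : ℝ, 1 ≤ W → 1 ≤ X → X ≤ 100 * W →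
    1 + log X ≤ c * W ^ ε := by
  refine ⟨1 + 100 ^ ε / ε, by
    have : 0 < (100 : ℝ) ^ ε / ε := by positivity
    linarith, fun W X hW hX hXW => ?_⟩
  have h1 := log_le_rpow_div (by linarith : (0 : ℝ) ≤ X) hε
  have h2 : X ^ ε ≤ 100 ^ ε * W ^ ε := by
    rw [← mul_rpow (by norm_num) (by linarith)]
    gcongr
  have h3 : 1 ≤ W ^ ε := one_le_rpow hW hε.le
  calc 1 + log X ≤ 1 + (100 ^ ε * W ^ ε) / ε := by
        have : X ^ ε / ε ≤ (100 ^ ε * W ^ ε) / ε := by gcongr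
        linarith
    _ ≤ W ^ ε + (100 ^ ε * W ^ ε) / ε := by gcongr
    _ = _ := by ring

lemma sqrt_block {p : ℝ} (hW : 1 ≤ W) (hp : 1 / 16 ≤ p) (hpW : p ^ 2 ≤ 8 * W) :
    1 / 4 ≤ √p ∧ √p ≤ 4 * p ∧ p ≤ 3 * W ∧ 1 ≤ 4 * √p ∧ 4 * √p ≤ 100 * W ∧ √(W / p) * √p = √W ∧
    √p ≤ 2 * W ^ (1 / 4 : ℝ) := by
  have hp0 : 0 < p := by linarith
  have h1 : 1 / 4 ≤ √p := le_sqrt_of_sq_le (by norm_num; linarith)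
  have h2 : √p * √p = p := mul_self_sqrt hp0.le
  have h3 : p ≤ 3 * W := by nlinarith
  refine ⟨h1, by nlinarith, h3, by linarith, by nlinarith, ?_, ?_⟩
  · rw [← sqrt_mul (by positivity), div_mul_cancel₀ _ hp0.ne']
  · have e : (W ^ (1 / 4 : ℝ)) ^ 4 = W := by rw [← rpow_natCast, ← rpow_mul (by linarith)]; norm_num
    refine le_of_pow_le_pow_left₀ (n := 4) (by norm_num) (by positivity) ?_
    rw [mul_pow, e]
    have : √p ^ 4 = p ^ 2 := by rw [show √p ^ 4 = (√p * √p) ^ 2 by ring, h2]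
    rw [this]; linarith

lemma card_I_le {p : ℝ} (h : 1 / 4 ≤ √p) : ((Icc (-⌊4 * √p⌋) ⌊4 * √p⌋).card : ℝ) ≤ 12 * √p :=
  (card_Icc_floor (by positivity)).trans (by linarith)

lemma card_nzInt_le {p : ℝ} (h : 1 / 4 ≤ √p) : ((nzInt (4 * √p)).card : ℝ) ≤ 12 * √p := by
  refine le_trans ?_ (card_I_le h)
  exact_mod_cast card_le_card (erase_subset _ _)

lemma exists_card_env_le (hε : 0 < ε) : ∃ c : ℝ, 0 < c ∧ ∀ (W Z : ℝ)
    (s : Finset Form), 1 ≤ W → 1 ≤ Z → (∀ f ∈ s, ∃ P, EnvB W P f ∧ P ≤ Z) →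
    (#s : ℝ) ≤ c * W ^ (1 / 2 + ε) * Z := by
  obtain ⟨c, hc, hlog⟩ := exists_log_le hε
  refine ⟨2 * (30000 * c), by positivity, fun W Z s hW hZ hs => ?_⟩
  have hW0 : 0 < W := by linarith
  have h := card_le_of_dyadic (s := s) (Z := Z) (K := 30000 * c * W ^ (1 / 2 + ε)) (K₂ := 0) hZ
    (by positivity) le_rfl (fun k f => EnvAt W (2 ^ k / 16) f ∧ ((2 : ℝ) ^ k / 16) ^ 2 ≤ 8 * W)
    (fun f hf => by
      obtain ⟨P, hP, hPZ⟩ := hs f hf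
      obtain ⟨k, hk, hkP⟩ := hP.exists_dyadic
      refine ⟨k, ⟨hk, ?_⟩, hkP.trans hPZ⟩
      refine le_trans ?_ hP.2.2.1
      gcongr) (fun k _ S hS => ?_)
  · refine h.trans (le_of_eq ?_); ring
  rw [add_zero]
  set p := (2 : ℝ) ^ k / 16 with hpdef
  have hp : 1 / 16 ≤ p := by
    have : (1 : ℝ) ≤ 2 ^ k := one_le_pow₀ (by norm_num)
    rw [hpdef]; linarith
  replace hS : ∀ f ∈ S, EnvAt W p f ∧ p ^ 2 ≤ 8 * W := fun f hf => (hS f hf).2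
  by_cases hpW : p ^ 2 ≤ 8 * W
  swap
  · have : S = ∅ := eq_empty_of_forall_notMem fun f hf => hpW (hS f hf).2
    rw [this]; simp; positivity
  obtain ⟨s1, s2, s3, s4, s5, s6, -⟩ := sqrt_block hW hp hpW
  have hp0 : 0 < p := by linarith
  have henv : ∀ f ∈ S, EnvAt W p f := fun f hf => (hS f hf).1
  have h1 := card_envAt_le hW hp hpW henv (fun a _ => 64 * p / |(a : ℝ)| + 2)
    (fun a b => by positivity) (fun a b c => by
      have := card_dfib_envAt_le hp0.le henv a b c one_pos (fun _ _ _ _ => one_dvd _)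
      simpa using this)
  refine h1.trans ?_
  have h2 : ∑ a ∈ nzInt (4 * √p), ∑ b ∈ Icc (-⌊4 * √p⌋) ⌊4 * √p⌋,
      (64 * p / |(a : ℝ)| + 2) ≤ 12 * √p * (64 * p * (2 * (c * W ^ ε)) + 24 * √p) := by
    simp only [sum_const, nsmul_eq_mul]
    rw [← mul_sum]
    have e : ∑ a ∈ nzInt (4 * √p), (64 * p / |(a : ℝ)| + 2) =
        64 * p * ∑ a ∈ nzInt (4 * √p), 1 / |(a : ℝ)| + 2 * (nzInt (4 * √p)).card := by
      rw [sum_add_distrib, mul_sum]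
      congr 1
      · exact sum_congr rfl fun a _ => by ring
      · simp [mul_comm]
    rw [e]
    have h3 := (sum_inv_nzInt_le s4).trans (mul_le_mul_of_nonneg_left (hlog W _ hW s4 s5)
      (by norm_num))
    have h4 := card_nzInt_le s1
    have h5 := card_I_le s1
    have h6 : 0 ≤ ∑ a ∈ nzInt (4 * √p), 1 / |(a : ℝ)| := sum_nonneg fun a _ => by positivity
    refine mul_le_mul h5 (add_le_add ?_ (by linarith)) (by positivity) (by positivity)
    gcongr
  calc _ ≤ 10 * √(W / p) * (12 * √p * (64 * p * (2 * (c * W ^ ε)) + 24 * √p)) := by gcongr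
    _ = 120 * √W * (128 * p * (c * W ^ ε) + 24 * √p) := by rw [← s6]; ring
    _ ≤ 120 * √W * (128 * p * (c * W ^ ε) + 96 * p * (c * W ^ ε)) := by
      have h3 : 1 ≤ c * W ^ ε := one_le_mul_of_one_le_of_one_le hc (one_le_rpow hW hε.le)
      have : 24 * √p ≤ 96 * p * (c * W ^ ε) := by nlinarith
      gcongr
    _ = 26880 * c * (√W * W ^ ε) * p := by ring
    _ = 26880 * c * W ^ (1 / 2 + ε) * p := by rw [rpow_add hW0, sqrt_eq_rpow]
    _ ≤ _ := by gcongr; norm_num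

lemma EnvB.le_sqrt (hW : 1 ≤ W) (h : EnvB W P f) : P ≤ 3 * √W := by
  refine abs_le_of_sq_le_sq' ?_ (by positivity) |>.2
  rw [mul_pow, sq_sqrt (by linarith)]
  have := h.2.2.1
  linarith

lemma exists_card_env_total (hε : 0 < ε) : ∃ c : ℝ, 0 < c ∧ ∀ (W : ℝ)
    (s : Finset Form), 1 ≤ W → (∀ f ∈ s, ∃ P, EnvB W P f) →
    (#s : ℝ) ≤ c * W ^ (1 + ε) := by
  obtain ⟨c, hc, h⟩ := exists_card_env_le hε
  refine ⟨3 * c, by positivity, fun W s hW hs => ?_⟩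
  have h1 : 1 ≤ √W := one_le_sqrt.2 hW
  refine (h W (3 * √W) s hW (by linarith) fun f hf => ?_).trans (le_of_eq ?_)
  · obtain ⟨P, hP⟩ := hs f hf
    exact ⟨P, hP, hP.le_sqrt hW⟩
  · rw [sqrt_eq_rpow, show (1 : ℝ) + ε = (1 / 2 + ε) + 1 / 2 by ring,
      rpow_add (by linarith : 0 < W) (1 / 2 + ε)]
    ring

/-- The number of reduced forms far out in the cusp. -/
lemma exists_card_env_tail (hε : 0 < ε) : ∃ c : ℝ, 0 < c ∧ ∀ (W T : ℝ)
    (s : Finset Form), 1 ≤ W → 1 ≤ T →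
    (∀ f ∈ s, (∃ P, EnvB W P f) ∧ ∃ i, T * W ^ (1 / 4 : ℝ) < |(f i : ℝ)|) →
    (#s : ℝ) ≤ c * W ^ (1 + ε) * T ^ (-(2 / 3) : ℝ) := by
  obtain ⟨c, hc, h⟩ := exists_card_env_le hε
  refine ⟨72 * c, by positivity, fun W T s hW hT hs => ?_⟩
  have hW0 : 0 < W := by linarith
  have hT0 : 0 < T := by linarith
  rcases s.eq_empty_or_nonempty with rfl | ⟨f₀, hf₀⟩
  · simp; positivity
  set u := √W with hu
  have hu2 : u ^ 2 = W := sq_sqrt hW0.le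
  have hu1 : 1 ≤ u := one_le_sqrt.2 hW
  have hl2 : (W ^ (1 / 4 : ℝ)) ^ 2 = u := by
    rw [hu, sqrt_eq_rpow, ← rpow_natCast, ← rpow_mul hW0.le]; norm_num
  have hτ : (T ^ (2 / 3 : ℝ)) ^ 3 = T ^ 2 := by
    rw [← rpow_natCast, ← rpow_mul hT0.le, ← rpow_natCast]; norm_num
  have hbound : ∀ f ∈ s, ∀ P, EnvB W P f → P ≤ 9 * u * T ^ (-(2 / 3) : ℝ) := fun f hf P hP => by
    have hPu := hP.le_sqrt hW
    obtain ⟨i, hi⟩ := (hs f hf).2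
    obtain ⟨h0, hP0, h1, h2, h3, h4, h5, -⟩ := hP
    rw [rpow_neg hT0.le, ← div_eq_mul_inv, le_div_iff₀ (by positivity)]
    refine le_of_pow_le_pow_left₀ (n := 3) (by norm_num) (by positivity) ?_
    rw [mul_pow, hτ]
    have hi2 : T ^ 2 * u < (f i : ℝ) ^ 2 := by
      rw [← hl2, ← mul_pow, ← sq_abs (f i : ℝ)]
      gcongr
    have hu3 : 0 < u ^ 3 := by positivity
    have hP3 : P ^ 3 ≤ (3 * u) ^ 3 := by gcongr
    have hP2 : P ^ 2 ≤ (3 * u) ^ 2 := by gcongr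
    have small : (f i : ℝ) ^ 2 ≤ 8 * P → P ^ 3 * T ^ 2 ≤ (9 * u) ^ 3 := fun h6 => by
      have h7 : T ^ 2 ≤ 24 := by
        have : T ^ 2 * u ≤ 24 * u := by linarith
        exact le_of_mul_le_mul_right this (by linarith)
      calc P ^ 3 * T ^ 2 ≤ (3 * u) ^ 3 * 24 := by gcongr
        _ ≤ _ := by rw [mul_pow, mul_pow]; linarith
    fin_cases i
    · exact small h2
    · exact small h3
    · have h6 : T ^ 2 * u * P ≤ 8 * u ^ 2 := by
        rw [hu2]; refine le_trans ?_ h4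
        exact mul_le_mul_of_nonneg_right hi2.le hP0.le
      have h7 : T ^ 2 * P ≤ 8 * u := by
        have : (T ^ 2 * P) * u ≤ 8 * u * u := by linarith
        exact le_of_mul_le_mul_right this (by linarith)
      calc P ^ 3 * T ^ 2 = P ^ 2 * (T ^ 2 * P) := by ring
        _ ≤ (3 * u) ^ 2 * (8 * u) := by gcongr
        _ ≤ _ := by nlinarith
    · have h6 : T ^ 2 * u * P ^ 3 ≤ 8 * u ^ 4 := by
        rw [show u ^ 4 = (u ^ 2) ^ 2 by ring, hu2]; refine le_trans ?_ h5
        exact mul_le_mul_of_nonneg_right hi2.le (by positivity)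
      have h7 : (P ^ 3 * T ^ 2) * u ≤ (8 * u ^ 3) * u := by linarith
      refine (le_of_mul_le_mul_right h7 (by linarith)).trans ?_
      rw [mul_pow]; linarith
  have hZ1 : 1 ≤ 8 * (9 * u * T ^ (-(2 / 3) : ℝ)) := by
    obtain ⟨P, hP⟩ := (hs f₀ hf₀).1
    have h1 := hbound f₀ hf₀ P hP
    have h2 := hP.2.2.2.1
    have h3 : (1 : ℝ) ≤ (f₀ 0 : ℝ) ^ 2 := by
      have := sq_nonneg (f₀ 0)
      have : f₀ 0 ^ 2 ≠ 0 := pow_ne_zero 2 hP.1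
      exact_mod_cast (by omega : 1 ≤ f₀ 0 ^ 2)
    linarith
  refine (h W _ s hW hZ1 fun f hf => ?_).trans (le_of_eq ?_)
  · obtain ⟨P, hP⟩ := (hs f hf).1
    refine ⟨P, hP, (hbound f hf P hP).trans ?_⟩
    have : 0 < 9 * u * T ^ (-(2 / 3) : ℝ) := by positivity
    linarith
  · rw [hu, sqrt_eq_rpow, show (1 : ℝ) + ε = (1 / 2 + ε) + 1 / 2 by ring,
      rpow_add (by linarith : 0 < W) (1 / 2 + ε)]
    ring

lemma sum_gcd_le {X : ℝ} (hX : 1 ≤ X) {a : ℤ} (ha : a ≠ 0) (haX : |(a : ℝ)| ≤ X) :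
    ∑ b ∈ Icc (-⌊X⌋) ⌊X⌋, (Int.gcd a b : ℝ) ≤ 4 * X * (#a.natAbs.divisors : ℝ) := by
  have h1 : ∀ b ∈ Icc (-⌊X⌋) ⌊X⌋, (Int.gcd a b : ℝ) ≤
      ∑ g ∈ a.natAbs.divisors, if (g : ℤ) ∣ b then (g : ℝ) else 0 := fun b _ => by
    have hm : Int.gcd a b ∈ a.natAbs.divisors :=
      Nat.mem_divisors.2 ⟨Int.natCast_dvd.1 (Int.gcd_dvd_left a b), by simpa using ha⟩
    refine le_trans (le_of_eq ?_) (single_le_sum (fun g _ => by positivity) hm)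
    rw [if_pos (Int.gcd_dvd_right a b)]
  refine (sum_le_sum h1).trans ?_
  rw [sum_comm, mul_comm, ← nsmul_eq_mul]
  refine sum_le_card_nsmul _ _ _ fun g hg => ?_
  obtain ⟨hga, -⟩ := Nat.mem_divisors.1 hg
  have hg0 : 0 < g := Nat.pos_of_mem_divisors hg
  have hgX : (g : ℝ) ≤ X := by
    refine le_trans ?_ haX
    rw [← Int.cast_abs, Int.abs_eq_natAbs]
    exact_mod_cast Nat.le_of_dvd (by omega) hga
  rw [← sum_filter, sum_const, nsmul_eq_mul]
  have hg0' : (0 : ℝ) < g := mod_cast hg0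
  have h2 := card_int_mod_le (s := (Icc (-⌊X⌋) ⌊X⌋).filter fun b => (g : ℤ) ∣ b)
    (q := g) (L := 2 * X) (mod_cast hg0) (by linarith) (fun x hx y hy _ => by
      have h3 := (mem_Icc.1 (mem_filter.1 hx).1).1
      have h4 := (mem_Icc.1 (mem_filter.1 hy).1).2
      have h5 : (y : ℝ) ≤ ⌊X⌋ := mod_cast h4
      have h6 : (-⌊X⌋ : ℝ) ≤ x := mod_cast h3
      have h7 := Int.floor_le X
      linarith) (fun x hx y hy =>
      dvd_sub (mem_filter.1 hy).2 (mem_filter.1 hx).2)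
  calc _ ≤ (2 * X / ((g : ℤ) : ℝ) + 1) * g := by gcongr
    _ = 2 * X + g := by push_cast; field_simp
    _ ≤ 4 * X := by linarith

lemma card_envAt_graph_le {p : ℝ} (hp : 0 < p)
    (h : ∀ f ∈ s, EnvAt W p f) (cc : ℤ → ℤ → ℤ) (hc : ∀ f ∈ s, f 2 = cc (f 0) (f 1))
    (D : ℤ → ℤ → ℝ) (hd : ∀ a b c, ((dfib s a b c).card : ℝ) ≤ D a b) :
    (#s : ℝ) ≤ ∑ a ∈ nzInt (4 * √p), ∑ b ∈ Icc (-⌊4 * √p⌋) ⌊4 * √p⌋, D a b := by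
  set I := Icc (-⌊4 * √p⌋) ⌊4 * √p⌋
  have hsq : ∀ x : ℝ, x ^ 2 ≤ 16 * p → |x| ≤ 4 * √p := fun x hx => by
    apply abs_le_of_sq_le_sq (b := 4 * √p) _ (by positivity)
    rw [mul_pow, sq_sqrt hp.le]; linarith
  have h1 := card_le_sum_dfib s ((nzInt (4 * √p) ×ˢ I).image fun x => (x.1, x.2, cc x.1 x.2))
    (fun f hf => by
      obtain ⟨h0, h1, h2, -⟩ := h f hf
      refine mem_image.2 ⟨(f 0, f 1), ?_, by simp [hc f hf]⟩
      exact mem_product.2 ⟨mem_nzInt h0 (hsq _ h1), mem_Icc_floor (hsq _ h2)⟩)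
  rw [sum_image fun x _ y _ hxy => by
    simp only [Prod.mk.injEq] at hxy
    exact Prod.ext hxy.1 hxy.2.1, sum_product] at h1
  calc (#s : ℝ) ≤ ((∑ a ∈ nzInt (4 * √p), ∑ b ∈ I, (dfib s a b (cc a b)).card : ℕ) : ℝ) :=
        Nat.cast_le.2 h1
    _ ≤ _ := by
      push_cast
      exact sum_le_sum fun a _ => sum_le_sum fun b _ => hd _ _ _

lemma sum_sum_inv_le {p L : ℝ} (hp : 0 ≤ p) (h1 : 1 / 4 ≤ √p)
    (hL : ∑ a ∈ nzInt (4 * √p), 1 / |(a : ℝ)| ≤ 2 * L) :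
    ∑ a ∈ nzInt (4 * √p), ∑ _b ∈ Icc (-⌊4 * √p⌋) ⌊4 * √p⌋, (64 * p / |(a : ℝ)| + 2) ≤
      12 * √p * (64 * p * (2 * L) + 24 * √p) := by
  simp only [sum_const, nsmul_eq_mul]
  rw [← mul_sum]
  have e : ∑ a ∈ nzInt (4 * √p), (64 * p / |(a : ℝ)| + 2) =
      64 * p * ∑ a ∈ nzInt (4 * √p), 1 / |(a : ℝ)| + 2 * (nzInt (4 * √p)).card := by
    rw [sum_add_distrib, mul_sum]
    congr 1
    · exact sum_congr rfl fun a _ => by ring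
    · simp [mul_comm]
  rw [e]
  have h4 := card_nzInt_le h1
  have h6 : 0 ≤ ∑ a ∈ nzInt (4 * √p), 1 / |(a : ℝ)| := sum_nonneg fun a _ => by positivity
  refine mul_le_mul (card_I_le h1) (add_le_add ?_ (by linarith)) (by positivity) (by positivity)
  gcongr

/-- A residue class restriction imposed by a squarefree divisor of the Hessian. -/
lemma hes_residue {a b c d d' : ℤ} {q : ℕ} (hq : Squarefree q) (ha : a ≠ 0)
    (hA : (q : ℤ) ∣ b ^ 2 - 3 * a * c) (h1 : (q : ℤ) ∣ b * c - 9 * a * d)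
    (h2 : (q : ℤ) ∣ b * c - 9 * a * d') :
    ((q / Nat.gcd (9 * a.natAbs) q : ℕ) : ℤ) ∣ d' - d ∧
      Nat.gcd (9 * a.natAbs) q ≤ 9 * Int.gcd a b := by
  have hq0 : 0 < q := Nat.pos_of_ne_zero hq.ne_zero
  have hg0 : 0 < Nat.gcd (9 * a.natAbs) q := Nat.gcd_pos_of_pos_right _ hq0
  constructor
  · have h3 : (q : ℤ) ∣ 9 * a * (d' - d) := by
      have : 9 * a * (d' - d) = (b * c - 9 * a * d) - (b * c - 9 * a * d') := by ring
      rw [this]; exact dvd_sub h1 h2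
    have h4 : q ∣ 9 * a.natAbs * (d' - d).natAbs := by
      have := Int.natAbs_dvd_natAbs.2 h3
      simpa [Int.natAbs_mul] using this
    rw [Int.natCast_dvd]
    refine Nat.Coprime.dvd_of_dvd_mul_left (m := 9 * a.natAbs / Nat.gcd (9 * a.natAbs) q)
      (Nat.coprime_div_gcd_div_gcd hg0).symm ?_
    rw [← Nat.mul_dvd_mul_iff_left hg0, ← mul_assoc, Nat.mul_div_cancel' (Nat.gcd_dvd_left _ _),
      Nat.mul_div_cancel' (Nat.gcd_dvd_right _ _)]
    exact h4
  · have h3 : Nat.gcd (9 * a.natAbs) q ∣ 9 * Nat.gcd a.natAbs q :=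
      (Nat.gcd_mul_left_dvd_mul_gcd _ _ _).trans (mul_dvd_mul_right (Nat.gcd_dvd_left _ _) _)
    have h4 : Nat.gcd a.natAbs q ∣ Int.gcd a b := by
      refine Nat.dvd_gcd (Nat.gcd_dvd_left _ _) ?_
      have hsq : Squarefree (Nat.gcd a.natAbs q) := hq.squarefree_of_dvd (Nat.gcd_dvd_right _ _)
      refine (hsq.dvd_pow_iff_dvd two_ne_zero).1 ?_
      have h5 : ((Nat.gcd a.natAbs q : ℕ) : ℤ) ∣ b ^ 2 := by
        have e : b ^ 2 = (b ^ 2 - 3 * a * c) + a * (3 * c) := by ring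
        rw [e]
        refine dvd_add (dvd_trans (mod_cast Nat.gcd_dvd_right _ _) hA)
          (Dvd.dvd.mul_right (Int.natCast_dvd.2 (Nat.gcd_dvd_left _ _)) _)
      rw [← Int.natAbs_pow]
      exact Int.natCast_dvd.1 h5
    refine (Nat.le_of_dvd ?_ h3).trans ?_
    · have : 0 < Nat.gcd a.natAbs q := Nat.gcd_pos_of_pos_right _ hq0
      omega
    · have : Nat.gcd a.natAbs q ≤ Int.gcd a b := Nat.le_of_dvd (Int.gcd_pos_of_ne_zero_left _ ha) h4
      omega

lemma hesA_block {p : ℝ} (hW : 1 ≤ W) (hp : 1 / 16 ≤ p) (hpW : p ^ 2 ≤ 8 * W)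
    (hf : EnvAt W p f) : ((hesA f).natAbs : ℝ) ≤ 100 * W := by
  have hp0 : 0 < p := by linarith
  obtain ⟨-, h0, h1, h2, -⟩ := hf
  have h3 := (sqrt_block hW hp hpW).2.2.1
  have h4 : |(f 0 : ℝ) * f 2| ≤ 12 * W := by
    refine abs_le_of_sq_le_sq ?_ (by linarith)
    have : ((f 0 : ℝ) * f 2) ^ 2 * p ≤ 16 * p * (8 * W) := by
      calc ((f 0 : ℝ) * f 2) ^ 2 * p = (f 0 : ℝ) ^ 2 * ((f 2 : ℝ) ^ 2 * p) := by ring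
        _ ≤ _ := by gcongr
    have h5 : ((f 0 : ℝ) * f 2) ^ 2 ≤ 128 * W := le_of_mul_le_mul_right (by linarith) hp0
    nlinarith
  rw [← Int.cast_natCast, Int.natCast_natAbs, Int.cast_abs]
  simp only [hesA]
  push_cast
  rw [abs_le] at h4 ⊢
  constructor <;> nlinarith [sq_nonneg (f 1 : ℝ)]

/-- Forms in a dyadic block whose Hessian has a large squarefree divisor. -/
lemma exists_card_ram_block (hε : 0 < ε) : ∃ c : ℝ, 0 < c ∧ ∀ (W Q p : ℝ)
    (s : Finset Form), 1 ≤ W → 1 ≤ Q → 1 / 16 ≤ p → p ^ 2 ≤ 8 * W →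
    (∀ f ∈ s, EnvAt W p f ∧ hesA f ≠ 0 ∧
      ∃ q : ℕ, Squarefree q ∧ Q ≤ q ∧ (q : ℤ) ∣ hesA f ∧ (q : ℤ) ∣ hesB f) →
    (#s : ℝ) ≤ c * (W ^ ε) ^ 3 * (√W * p / Q + W ^ (3 / 4 : ℝ)) := by
  obtain ⟨c, hc, hlog⟩ := exists_log_le hε
  obtain ⟨C, hC, hdiv⟩ := exists_card_divisors_le hε
  refine ⟨10 * ((100 ^ ε * C) ^ 2 * c * 20000), by positivity, fun W Q p s hW hQ hp hpW hs => ?_⟩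
  have hW0 : 0 < W := by linarith
  have hp0 : 0 < p := by linarith
  have hQ0 : 0 < Q := by linarith
  obtain ⟨s1, s2, s3, s4, s5, s6, s7⟩ := sqrt_block hW hp hpW
  set w := W ^ ε with hw
  have hw1 : 1 ≤ w := one_le_rpow hW hε.le
  set C' := 100 ^ ε * C * w with hC'
  have h100 : (1 : ℝ) ≤ 100 ^ ε := one_le_rpow (by norm_num) hε.le
  have hC'1 : 1 ≤ C' := one_le_mul_of_one_le_of_one_le (one_le_mul_of_one_le_of_one_le h100 hC) hw1
  have hdivW : ∀ n : ℕ, n ≠ 0 → (n : ℝ) ≤ 100 * W → (#n.divisors : ℝ) ≤ C' := fun n hn hnW => by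
    refine (hdiv n hn).trans ?_
    calc C * (n : ℝ) ^ ε ≤ C * (100 * W) ^ ε := by gcongr
      _ = C' := by rw [mul_rpow (by norm_num) hW0.le]; ring
  have henv : ∀ f ∈ s, EnvAt W p f := fun f hf => (hs f hf).1
  have key := card_envAt_le hW hp hpW henv
    (fun a b => C' * (576 * p * (Int.gcd a b : ℝ) / (|(a : ℝ)| * Q) + 2))
    (fun a b => by positivity) (fun a b c => by
      rcases (dfib s a b c).eq_empty_or_nonempty with he | ⟨d₀, hd₀⟩
      · rw [he]; simp; positivity
      have h0 := mem_dfib.1 hd₀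
      have ha : a ≠ 0 := (henv _ h0).1
      have ha' : (0 : ℝ) < |(a : ℝ)| := abs_pos.2 (mod_cast ha)
      have hA := (hs _ h0).2.1
      have hAW := hesA_block hW hp hpW (henv _ h0)
      set n := (hesA ![a, b, c, d₀]).natAbs with hn
      have hn0 : n ≠ 0 := by simpa [hn] using hA
      have hAeq : ∀ d, hesA ![a, b, c, d] = b ^ 2 - 3 * a * c := fun d => rfl
      have hBeq : ∀ d, hesB ![a, b, c, d] = b * c - 9 * a * d := fun d => rfl
      set t : ℕ → Finset ℤ := fun q => (dfib s a b c).filter fun d =>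
        Squarefree q ∧ Q ≤ q ∧ (q : ℤ) ∣ b ^ 2 - 3 * a * c ∧ (q : ℤ) ∣ b * c - 9 * a * d with ht
      have hcov : dfib s a b c ⊆ n.divisors.biUnion t := fun d hd => by
        obtain ⟨q, hq1, hq2, hq3, hq4⟩ := (hs _ (mem_dfib.1 hd)).2.2
        rw [hAeq] at hq3
        rw [hBeq] at hq4
        refine mem_biUnion.2 ⟨q, ?_, mem_filter.2 ⟨hd, hq1, hq2, hq3, hq4⟩⟩
        exact Nat.mem_divisors.2 ⟨Int.natCast_dvd.1 (by rw [hAeq]; exact hq3), hn0⟩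
      have hbd : ∀ q ∈ n.divisors, ((t q).card : ℝ) ≤
          576 * p * (Int.gcd a b : ℝ) / (|(a : ℝ)| * Q) + 2 := fun q hq => by
        rcases (t q).eq_empty_or_nonempty with he | ⟨d₁, hd₁⟩
        · rw [he]; simp; positivity
        obtain ⟨-, hq1, hq2, hq3, hq4⟩ := mem_filter.1 hd₁
        have hq0 : 0 < q := Nat.pos_of_ne_zero hq1.ne_zero
        set g := Nat.gcd (9 * a.natAbs) q with hg
        have hg0 : 0 < g := Nat.gcd_pos_of_pos_right _ hq0
        have hgq : g ∣ q := Nat.gcd_dvd_right _ _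
        have hqg : 0 < q / g := Nat.div_pos (Nat.le_of_dvd hq0 hgq) hg0
        have hsub : dfib (s.filter fun f => f 3 ∈ t q) a b c = t q := by
          ext d
          rw [mem_dfib, mem_filter]
          constructor
          · rintro ⟨-, h⟩; exact h
          · intro h; exact ⟨mem_dfib.1 (mem_filter.1 h).1, h⟩
        have h1 := card_dfib_envAt_le (s := s.filter fun f => f 3 ∈ t q) hp0.le
          (fun f hf => henv f (mem_filter.1 hf).1) a b c (q := ((q / g : ℕ) : ℤ))
          (mod_cast hqg) (fun d hd d' hd' => by
            rw [hsub] at hd hd'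
            exact (hes_residue hq1 ha hq3 (mem_filter.1 hd).2.2.2.2 (mem_filter.1 hd').2.2.2.2).1)
        rw [hsub] at h1
        refine h1.trans ?_
        have h2 : (g : ℝ) ≤ 9 * (Int.gcd a b : ℝ) := by
          exact_mod_cast (hes_residue hq1 ha hq3 hq4 hq4).2
        have h3 : (((q / g : ℕ) : ℤ) : ℝ) * g = q := by exact_mod_cast Nat.div_mul_cancel hgq
        have hqg' : (0 : ℝ) < (((q / g : ℕ) : ℤ) : ℝ) := mod_cast hqg
        refine add_le_add ?_ le_rfl
        rw [div_le_div_iff₀ (by positivity) (by positivity)]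
        have h4 : Q ≤ (((q / g : ℕ) : ℤ) : ℝ) * (9 * (Int.gcd a b : ℝ)) := by
          refine hq2.trans ?_
          rw [← h3]; gcongr
        calc 64 * p * (|(a : ℝ)| * Q) ≤
            64 * p * (|(a : ℝ)| * ((((q / g : ℕ) : ℤ) : ℝ) * (9 * (Int.gcd a b : ℝ)))) := by gcongr
          _ = _ := by ring
      calc ((dfib s a b c).card : ℝ) ≤ ∑ q ∈ n.divisors, ((t q).card : ℝ) := by
            exact_mod_cast (card_le_card hcov).trans card_biUnion_le
        _ ≤ #n.divisors * (576 * p * (Int.gcd a b : ℝ) / (|(a : ℝ)| * Q) + 2) := by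
            rw [← nsmul_eq_mul]; exact sum_le_card_nsmul _ _ _ hbd
        _ ≤ _ := by
          gcongr
          exact hdivW n hn0 hAW)
  refine key.trans ?_
  have h2 : ∑ a ∈ nzInt (4 * √p), ∑ b ∈ Icc (-⌊4 * √p⌋) ⌊4 * √p⌋,
      C' * (576 * p * (Int.gcd a b : ℝ) / (|(a : ℝ)| * Q) + 2) ≤
      C' * (576 * p / Q * (4 * (4 * √p) * C' * (2 * (c * w))) + 2 * (12 * √p) * (12 * √p)) := by
    calc _ ≤ ∑ a ∈ nzInt (4 * √p), C' * (576 * p / Q * (4 * (4 * √p) * C') * (1 / |(a : ℝ)|)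
          + 2 * (12 * √p)) := by
          refine sum_le_sum fun a ha => ?_
          obtain ⟨ha0, haX⟩ := abs_le_of_mem_nzInt ha
          have hg := sum_gcd_le s4 ha0 haX
          have hd := hdivW a.natAbs (by simpa using ha0) (by
            refine le_trans (le_of_eq ?_) (haX.trans s5)
            rw [← Int.cast_abs, Int.abs_eq_natAbs, Int.cast_natCast])
          rw [← mul_sum, sum_add_distrib]
          refine mul_le_mul_of_nonneg_left (add_le_add ?_ ?_) (by linarith)
          · calc ∑ b ∈ Icc (-⌊4 * √p⌋) ⌊4 * √p⌋, 576 * p * (Int.gcd a b : ℝ) / (|(a : ℝ)| * Q)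
                = 576 * p / Q * (∑ b ∈ Icc (-⌊4 * √p⌋) ⌊4 * √p⌋, (Int.gcd a b : ℝ)) *
                    (1 / |(a : ℝ)|) := by
                  rw [mul_sum, sum_mul]
                  refine sum_congr rfl fun b _ => ?_
                  rw [div_mul_eq_mul_div, div_mul_div_comm, mul_one, mul_comm Q]
              _ ≤ _ := by
                  have := hg.trans (mul_le_mul_of_nonneg_left hd (by positivity))
                  gcongr
          · rw [sum_const, nsmul_eq_mul, mul_comm]
            have := card_I_le s1
            linarith
      _ = C' * (576 * p / Q * (4 * (4 * √p) * C') * (∑ a ∈ nzInt (4 * √p), 1 / |(a : ℝ)|)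
          + (nzInt (4 * √p)).card * (2 * (12 * √p))) := by
          rw [← mul_sum, sum_add_distrib, ← mul_sum, sum_const, nsmul_eq_mul]
      _ ≤ C' * (576 * p / Q * (4 * (4 * √p) * C') * (2 * (c * w))
          + (12 * √p) * (2 * (12 * √p))) := by
          have h3 := (sum_inv_nzInt_le s4).trans (mul_le_mul_of_nonneg_left (hlog W _ hW s4 s5)
            (by norm_num))
          have h4 := card_nzInt_le s1
          gcongr
      _ = _ := by ring
  calc _ ≤ 10 * √(W / p) * (C' * (576 * p / Q * (4 * (4 * √p) * C' * (2 * (c * w))) +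
        2 * (12 * √p) * (12 * √p))) := by gcongr
    _ = 10 * (√(W / p) * √p) * (C' * (18432 * p / Q * (C' * (c * w)) + 288 * √p)) := by ring
    _ = 10 * (18432 * (C' * C' * (c * w)) * (√W * p / Q) + 288 * C' * (√W * √p)) := by rw [s6]; ring
    _ ≤ 10 * (20000 * (C' * C' * (c * w)) * (√W * p / Q) +
        20000 * (C' * C' * (c * w)) * W ^ (3 / 4 : ℝ)) := by
        have hcw : 1 ≤ c * w := one_le_mul_of_one_le_of_one_le hc hw1
        have h5 : √W * √p ≤ 2 * W ^ (3 / 4 : ℝ) := by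
          have e : W ^ (3 / 4 : ℝ) = √W * W ^ (1 / 4 : ℝ) := by
            rw [sqrt_eq_rpow, ← rpow_add hW0]; norm_num
          rw [e]
          calc √W * √p ≤ √W * (2 * W ^ (1 / 4 : ℝ)) := by gcongr
            _ = _ := by ring
        have h6 : C' ≤ C' * C' * (c * w) := by
          rw [mul_assoc]
          exact le_mul_of_one_le_right (by linarith) (one_le_mul_of_one_le_of_one_le hC'1 hcw)
        gcongr 10 * (?_ + ?_)
        · gcongr; norm_num
        · calc 288 * C' * (√W * √p) ≤ 288 * (C' * C' * (c * w)) * (2 * W ^ (3 / 4 : ℝ)) := by gcongr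
            _ ≤ _ := by
                have : 0 ≤ (C' * C' * (c * w)) * W ^ (3 / 4 : ℝ) := by positivity
                linarith
    _ = _ := by rw [hC']; ring

lemma exists_card_hesA_zero_block (hε : 0 < ε) : ∃ c : ℝ, 0 < c ∧ ∀ (W p : ℝ)
    (s : Finset Form), 1 ≤ W → 1 / 16 ≤ p → p ^ 2 ≤ 8 * W →
    (∀ f ∈ s, EnvAt W p f ∧ hesA f = 0) → (#s : ℝ) ≤ c * W ^ ε * W ^ (3 / 4 : ℝ) := by
  obtain ⟨c, hc, hlog⟩ := exists_log_le hε
  refine ⟨30000 * c, by positivity, fun W p s hW hp hpW hs => ?_⟩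
  have hW0 : 0 < W := by linarith
  have hp0 : 0 < p := by linarith
  obtain ⟨s1, s2, s3, s4, s5, s6, s7⟩ := sqrt_block hW hp hpW
  have henv : ∀ f ∈ s, EnvAt W p f := fun f hf => (hs f hf).1
  have h1 := card_envAt_graph_le hp0 henv (fun a b => b ^ 2 / (3 * a)) (fun f hf => by
      have h0 := (henv f hf).1
      have h1 := (hs f hf).2
      rw [hesA, sub_eq_zero] at h1
      exact (Int.ediv_eq_of_eq_mul_right (mul_ne_zero (by norm_num) h0) h1).symm)
    (fun a _ => 64 * p / |(a : ℝ)| + 2) (fun a b c => by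
      have := card_dfib_envAt_le hp0.le henv a b c one_pos (fun _ _ _ _ => one_dvd _)
      simpa using this)
  refine h1.trans ((sum_sum_inv_le hp0.le s1 ((sum_inv_nzInt_le s4).trans
    (mul_le_mul_of_nonneg_left (hlog W _ hW s4 s5) (by norm_num)))).trans ?_)
  have h3 : 1 ≤ c * W ^ ε := one_le_mul_of_one_le_of_one_le hc (one_le_rpow hW hε.le)
  have h4 : √p * p ≤ 8 * W ^ (3 / 4 : ℝ) := by
    have e : W ^ (3 / 4 : ℝ) = (W ^ (1 / 4 : ℝ)) ^ 3 := by
      rw [← rpow_natCast, ← rpow_mul hW0.le]; norm_num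
    have e2 : √p * p = √p ^ 3 := by rw [pow_succ, sq_sqrt hp0.le, mul_comm]
    rw [e, e2, show (8 : ℝ) = 2 ^ 3 by norm_num, ← mul_pow]
    gcongr
  calc 12 * √p * (64 * p * (2 * (c * W ^ ε)) + 24 * √p)
      ≤ 12 * √p * (64 * p * (2 * (c * W ^ ε)) + 24 * (4 * p * (c * W ^ ε))) := by
        have : √p ≤ 4 * p * (c * W ^ ε) := by
          refine s2.trans (le_mul_of_one_le_right (by linarith) h3)
        gcongr
    _ = 2688 * (c * W ^ ε) * (√p * p) := by ring
    _ ≤ 2688 * (c * W ^ ε) * (8 * W ^ (3 / 4 : ℝ)) := by gcongr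
    _ ≤ _ := by
      have : 0 ≤ c * W ^ ε * W ^ (3 / 4 : ℝ) := by positivity
      linarith

/-- The number of reduced forms whose Hessian has a large squarefree divisor. -/
lemma exists_card_ram_tail (hε : 0 < ε) : ∃ c : ℝ, 0 < c ∧ ∀ (W Q : ℝ)
    (s : Finset Form), 1 ≤ W → 1 ≤ Q →
    (∀ f ∈ s, (∃ P, EnvB W P f) ∧
      ∃ q : ℕ, Squarefree q ∧ Q ≤ q ∧ (q : ℤ) ∣ hesA f ∧ (q : ℤ) ∣ hesB f) →
    (#s : ℝ) ≤ c * (W ^ (1 + ε) / Q + W ^ (3 / 4 + ε)) := by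
  have hε4 : 0 < ε / 4 := by positivity
  obtain ⟨c₁, hc₁, H₁⟩ := exists_card_ram_block hε4
  obtain ⟨c₂, hc₂, H₂⟩ := exists_card_hesA_zero_block hε4
  obtain ⟨c₃, hc₃, hlog⟩ := exists_log_le hε4
  refine ⟨6 * c₁ + (c₁ + c₂) * (6 * c₃), by positivity, fun W Q s hW hQ hs => ?_⟩
  have hW0 : 0 < W := by linarith
  have hQ0 : 0 < Q := by linarith
  have hsW : 1 ≤ √W := one_le_sqrt.2 hW
  set w := W ^ (ε / 4) with hw
  have hw1 : 1 ≤ w := one_le_rpow hW hε4.le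
  have h := card_le_of_dyadic (s := s) (Z := 3 * √W) (K := c₁ * w ^ 3 * (√W / Q))
    (K₂ := (c₁ + c₂) * w ^ 3 * W ^ (3 / 4 : ℝ)) (by linarith)
    (by positivity) (by positivity)
    (fun k f => EnvAt W (2 ^ k / 16) f ∧ ((2 : ℝ) ^ k / 16) ^ 2 ≤ 8 * W)
    (fun f hf => by
      obtain ⟨P, hP⟩ := (hs f hf).1
      obtain ⟨k, hk, hkP⟩ := hP.exists_dyadic
      refine ⟨k, ⟨hk, ?_⟩, hkP.trans (hP.le_sqrt hW)⟩
      refine le_trans ?_ hP.2.2.1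
      gcongr) (fun k _ S hS => ?_)
  · refine h.trans ?_
    have hl := hlog W (3 * √W) hW (by linarith) (by
      have : √W ≤ W := sqrt_le_iff.2 ⟨hW0.le, by nlinarith⟩
      linarith)
    have e1 : W ^ (1 + ε) = w ^ 4 * (√W * √W) := by
      rw [mul_self_sqrt hW0.le, rpow_add hW0, rpow_one, hw, ← rpow_natCast,
        ← rpow_mul hW0.le, mul_comm]
      norm_num
    have e2 : W ^ (3 / 4 + ε) = w ^ 4 * W ^ (3 / 4 : ℝ) := by
      rw [rpow_add hW0, hw, ← rpow_natCast, ← rpow_mul hW0.le, mul_comm]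
      norm_num
    have hw34 : w ^ 3 ≤ w ^ 4 := pow_le_pow_right₀ hw1 (by norm_num)
    rw [e1, e2]
    calc _ ≤ 2 * (c₁ * w ^ 4 * (√W / Q)) * (3 * √W) +
          (c₁ + c₂) * w ^ 3 * W ^ (3 / 4 : ℝ) * (6 * (c₃ * w)) := by gcongr
      _ = 6 * c₁ * (w ^ 4 * (√W * √W) / Q) +
          (c₁ + c₂) * (6 * c₃) * (w ^ 4 * W ^ (3 / 4 : ℝ)) := by ring
      _ ≤ (6 * c₁ + (c₁ + c₂) * (6 * c₃)) * (w ^ 4 * (√W * √W) / Q) +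
          (6 * c₁ + (c₁ + c₂) * (6 * c₃)) * (w ^ 4 * W ^ (3 / 4 : ℝ)) := by
          refine add_le_add (mul_le_mul_of_nonneg_right ?_ (by positivity))
            (mul_le_mul_of_nonneg_right ?_ (by positivity))
          · have : 0 ≤ (c₁ + c₂) * (6 * c₃) := by positivity
            linarith
          · linarith
      _ = _ := by ring
  set p := (2 : ℝ) ^ k / 16 with hpdef
  have hp : 1 / 16 ≤ p := by
    have : (1 : ℝ) ≤ 2 ^ k := one_le_pow₀ (by norm_num)
    rw [hpdef]; linarith
  have hp0 : 0 < p := by linarith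
  rcases S.eq_empty_or_nonempty with rfl | ⟨f₀, hf₀⟩
  · simp; positivity
  have hpW : p ^ 2 ≤ 8 * W := (hS f₀ hf₀).2.2
  have h1 := H₁ W Q p (S.filter fun f => hesA f ≠ 0) hW hQ hp hpW fun f hf => by
    obtain ⟨h1, h2⟩ := mem_filter.1 hf
    exact ⟨(hS f h1).2.1, h2, (hs f (hS f h1).1).2⟩
  have h2 := H₂ W p (S.filter fun f => ¬ hesA f ≠ 0) hW hp hpW fun f hf => by
    obtain ⟨h1, h2⟩ := mem_filter.1 hf
    exact ⟨(hS f h1).2.1, not_not.1 h2⟩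
  have h3 : (#S : ℝ) = (S.filter fun f => hesA f ≠ 0).card +
      (S.filter fun f => ¬ hesA f ≠ 0).card := by
    exact_mod_cast (card_filter_add_card_filter_not (s := S) fun f => hesA f ≠ 0).symm
  rw [h3]
  have hw3 : w ≤ w ^ 3 := le_self_pow₀ hw1 (by norm_num)
  calc _ ≤ c₁ * w ^ 3 * (√W * p / Q + W ^ (3 / 4 : ℝ)) + c₂ * w ^ 3 * W ^ (3 / 4 : ℝ) := by
        refine add_le_add h1 (h2.trans ?_)
        gcongr
    _ = _ := by ring

lemma card_signed_divisors (n : ℕ) :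
    ((n.divisors.image fun k : ℕ => (k : ℤ)) ∪ n.divisors.image fun k : ℕ => -(k : ℤ)).card ≤
      2 * #n.divisors := by
  refine (card_union_le _ _).trans ?_
  have h1 := card_image_le (s := n.divisors) (f := fun k : ℕ => (k : ℤ))
  have h2 := card_image_le (s := n.divisors) (f := fun k : ℕ => -(k : ℤ))
  omega

lemma mem_signed_divisors {n : ℕ} (hn : n ≠ 0) {x : ℤ} (h : x.natAbs ∣ n) :
    x ∈ ((n.divisors.image fun k : ℕ => (k : ℤ)) ∪ n.divisors.image fun k : ℕ => -(k : ℤ)) := by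
  rw [mem_union, mem_image, mem_image]
  rcases Int.natAbs_eq x with hx | hx
  · exact .inl ⟨_, Nat.mem_divisors.2 ⟨h, hn⟩, hx.symm⟩
  · exact .inr ⟨_, Nat.mem_divisors.2 ⟨h, hn⟩, hx.symm⟩

lemma exists_coprime_root (h : ¬ IrrF f) : ∃ x y : ℤ, IsCoprime x y ∧
    f 0 * x ^ 3 + f 1 * x ^ 2 * y + f 2 * x * y ^ 2 + f 3 * y ^ 3 = 0 := by
  simp only [IrrF, not_forall] at h
  obtain ⟨x, y, h, hxy⟩ := h
  have hg : 0 < Int.gcd x y := by rw [Int.gcd_pos_iff]; tauto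
  obtain ⟨x', y', hco, hx, hy⟩ := Int.exists_gcd_one hg
  refine ⟨x', y', Int.isCoprime_iff_gcd_eq_one.2 hco, ?_⟩
  have hg' : ((Int.gcd x y : ℕ) : ℤ) ^ 3 ≠ 0 := by positivity
  set g := ((Int.gcd x y : ℕ) : ℤ)
  refine (mul_eq_zero.1 (?_ : g ^ 3 * _ = 0)).resolve_left hg'
  rw [← h, hx, hy]; ring

lemma exists_card_reducible (hε : 0 < ε) : ∃ c : ℝ, 0 < c ∧ ∀ (B : ℝ)
    (s : Finset Form), 1 ≤ B → (∀ f ∈ s, (∀ i, |(f i : ℝ)| ≤ B) ∧ ¬ IrrF f) →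
    (#s : ℝ) ≤ c * B ^ (3 + ε) := by
  obtain ⟨C, hC, hdiv⟩ := exists_card_divisors_le (half_pos hε)
  refine ⟨54 + 4 * C ^ 2 * 27, by positivity, fun B s hB hs => ?_⟩
  have hB0 : 0 < B := by linarith
  have hB3 : B ^ 3 ≤ B ^ (3 + ε) := by
    rw [← rpow_natCast]; exact rpow_le_rpow_of_exponent_le hB (by norm_num; linarith)
  have hzero : ∀ j : Fin 4, ((s.filter fun f => f j = 0).card : ℝ) ≤ 27 * B ^ (3 + ε) := fun j => by
    have := card_le_of_coord hB (s := s.filter fun f => f j = 0) j (A := 1)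
      (fun f hf => (hs f (mem_filter.1 hf).1).1) (by
        have : (s.filter fun f => f j = 0).image (fun f => f j) ⊆ {0} := fun x hx => by
          obtain ⟨f, hf, rfl⟩ := mem_image.1 hx
          simpa using (mem_filter.1 hf).2
        exact_mod_cast card_le_card this)
    refine this.trans ?_
    rw [one_mul, mul_pow]
    linarith
  set s' := s.filter fun f => f 0 ≠ 0 ∧ f 3 ≠ 0 with hs'
  have hcov : s ⊆ ((s.filter fun f => f 0 = 0) ∪ (s.filter fun f => f 3 = 0)) ∪ s' := fun f hf => by
    simp only [mem_union, mem_filter, hs', hf, true_and]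
    tauto
  set I := Icc (-⌊B⌋) ⌊B⌋
  have hI : (#I : ℝ) ≤ 3 * B := (card_Icc_floor hB0.le).trans (by linarith)
  have hfib : ∀ x ∈ s'.image (fun f => (f 0, f 1, f 3)),
      ((s'.filter fun f => (f 0, f 1, f 3) = x).card : ℝ) ≤ 4 * (C * B ^ (ε / 2)) ^ 2 := by
    rintro ⟨a, b, d⟩ hx
    obtain ⟨f₀, hf₀, he⟩ := mem_image.1 hx
    simp only [Prod.mk.injEq] at he
    obtain ⟨hf₀s, hf00, hf03⟩ := mem_filter.1 hf₀
    rw [he.1] at hf00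
    rw [he.2.2] at hf03
    have hbd : ∀ z : ℤ, z ≠ 0 → |(z : ℝ)| ≤ B → (#z.natAbs.divisors : ℝ) ≤ C * B ^ (ε / 2) := by
      intro z hz hzB
      refine (hdiv _ (by simpa using hz)).trans ?_
      have : (z.natAbs : ℝ) ≤ B := by
        refine le_trans (le_of_eq ?_) hzB
        rw [← Int.cast_abs, Int.abs_eq_natAbs, Int.cast_natCast]
      gcongr
    have ha := hbd a hf00 (by rw [← he.1]; exact (hs _ hf₀s).1 0)
    have hd := hbd d hf03 (by rw [← he.2.2]; exact (hs _ hf₀s).1 3)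
    set Dv : ℕ → Finset ℤ := fun n => ((n.divisors.image fun k : ℕ => (k : ℤ)) ∪
      n.divisors.image fun k : ℕ => -(k : ℤ)) with hDv
    have hsub : (s'.filter fun f => (f 0, f 1, f 3) = (a, b, d)) ⊆
        (Dv d.natAbs ×ˢ Dv a.natAbs).image fun z : ℤ × ℤ =>
          ![a, b, -(a * z.1 ^ 3 + b * z.1 ^ 2 * z.2 + d * z.2 ^ 3) / (z.1 * z.2 ^ 2), d] := by
      intro f hf
      obtain ⟨hf', hfe⟩ := mem_filter.1 hf
      simp only [Prod.mk.injEq] at hfe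
      obtain ⟨h0, h1, h3⟩ := hfe
      obtain ⟨x, y, hxy, hr⟩ := exists_coprime_root (hs f (mem_filter.1 hf').1).2
      rw [h0, h1, h3] at hr
      have hxd : x ∣ d := by
        refine (hxy.pow_right (n := 3)).dvd_of_dvd_mul_right ?_
        exact ⟨-(a * x ^ 2 + b * x * y + f 2 * y ^ 2), by linarith⟩
      have hya : y ∣ a := by
        refine (hxy.symm.pow_right (n := 3)).dvd_of_dvd_mul_right ?_
        exact ⟨-(b * x ^ 2 + f 2 * x * y + d * y ^ 2), by linarith⟩
      have hx0 : x ≠ 0 := fun h => hf03 (by simpa [h] using hxd)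
      have hy0 : y ≠ 0 := fun h => hf00 (by simpa [h] using hya)
      refine mem_image.2 ⟨(x, y), mem_product.2
        ⟨mem_signed_divisors (by simpa using hf03) (Int.natAbs_dvd_natAbs.2 hxd),
        mem_signed_divisors (by simpa using hf00) (Int.natAbs_dvd_natAbs.2 hya)⟩, ?_⟩
      have hc : -(a * x ^ 3 + b * x ^ 2 * y + d * y ^ 3) / (x * y ^ 2) = f 2 :=
        Int.ediv_eq_of_eq_mul_right (mul_ne_zero hx0 (pow_ne_zero 2 hy0)) (by linarith)
      ext i
      fin_cases i
      · exact h0.symm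
      · exact h1.symm
      · exact hc
      · exact h3.symm
    have h1 := (card_le_card hsub).trans card_image_le
    rw [card_product] at h1
    have h2 : ((s'.filter fun f => (f 0, f 1, f 3) = (a, b, d)).card : ℝ) ≤
        (2 * #d.natAbs.divisors) * (2 * #a.natAbs.divisors) := by
      exact_mod_cast h1.trans (Nat.mul_le_mul (card_signed_divisors _) (card_signed_divisors _))
    calc _ ≤ _ := h2
      _ ≤ (2 * (C * B ^ (ε / 2))) * (2 * (C * B ^ (ε / 2))) := by gcongr
      _ = _ := by ring
  have himg : ((s'.image fun f => (f 0, f 1, f 3)).card : ℝ) ≤ (3 * B) ^ 3 := by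
    have : (s'.image fun f => (f 0, f 1, f 3)) ⊆ I ×ˢ I ×ˢ I := fun x hx => by
      obtain ⟨f, hf, rfl⟩ := mem_image.1 hx
      have := (hs f (mem_filter.1 hf).1).1
      simp only [mem_product]
      exact ⟨mem_Icc_floor (this 0), mem_Icc_floor (this 1), mem_Icc_floor (this 3)⟩
    have h := card_le_card this
    rw [card_product, card_product] at h
    calc _ ≤ ((#I * (#I * #I) : ℕ) : ℝ) := mod_cast h
      _ = (#I : ℝ) ^ 3 := by push_cast; ring
      _ ≤ _ := by gcongr
  have hs'card : (#s' : ℝ) ≤ (3 * B) ^ 3 * (4 * (C * B ^ (ε / 2)) ^ 2) := by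
    rw [card_eq_sum_card_image (fun f : Form => (f 0, f 1, f 3)) s']
    push_cast
    refine (sum_le_card_nsmul _ _ _ hfib).trans ?_
    rw [nsmul_eq_mul]
    gcongr
  have hpow : B ^ 3 * (B ^ (ε / 2)) ^ 2 = B ^ (3 + ε) := by
    rw [← rpow_natCast, ← rpow_natCast (B ^ (ε / 2)), ← rpow_mul hB0.le, ← rpow_add hB0]
    norm_num
  have h1 : (#s : ℝ) ≤ (s.filter fun f => f 0 = 0).card + (s.filter fun f => f 3 = 0).card
      + #s' := by
    exact_mod_cast (card_le_card hcov).trans ((card_union_le _ _).trans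
      (Nat.add_le_add_right (card_union_le _ _) _))
  have e : (3 * B) ^ 3 * (4 * (C * B ^ (ε / 2)) ^ 2) = 4 * C ^ 2 * 27 * B ^ (3 + ε) := by
    rw [← hpow]; ring
  rw [e] at hs'card
  linarith [hzero 0, hzero 3]

lemma SRed.cRed {R : Type*} [CommRing R] [LinearOrder R] {f : Fin 4 → R} (h : SRed f) : CRed f := by
  rcases h with ⟨h1, h2, h3, h4⟩ | ⟨h1, h2, h3, h4⟩
  · exact .inl ⟨h1, h2.le, h3.le, h4.le⟩
  · exact .inr ⟨h1, h2.le, h3.le, h4.le⟩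

lemma exists_envB (hr : CRed ⟬f⟭) (hi : IrrF f) (hW : |Δ f| ≤ W) : ∃ P, EnvB W P f := by
  rw [← fdisc_intCast] at hW
  obtain ⟨P, h⟩ := hr.bounds hW
  exact ⟨P, hi.ne_zero, h⟩

lemma SRed.exists_envB (hr : SRed f) (hi : IrrF f) (hW : |Δ f| ≤ W) : ∃ P, EnvB W P f :=
  _root_.exists_envB ((sred_intCast f).2 hr).cRed hi hW

lemma Set.finite_of_forall_card_le {α : Type*} {S : Set α} {N : ℝ}
    (h : ∀ s : Finset α, (∀ x ∈ s, x ∈ S) → (#s : ℝ) ≤ N) :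
    S.Finite ∧ (S.ncard : ℝ) ≤ N := by
  have hfin : S.Finite := by
    by_contra hS
    obtain ⟨n, hn⟩ := exists_nat_gt N
    obtain ⟨t, ht, hc⟩ := Set.Infinite.exists_subset_card_eq (s := S) hS n
    have := h t fun x hx => ht hx
    rw [hc] at this
    linarith
  refine ⟨hfin, ?_⟩
  rw [Set.ncard_eq_toFinset_card S hfin]
  exact h _ fun x hx => by simpa using hx

/-- Irreducible strictly reduced forms in a residue class, of bounded discriminant. -/
def irrSet (M : ℕ) (v : Form) (W : ℝ) : Set Form :=
  {f | (∀ i, (M : ℤ) ∣ f i - v i) ∧ SRed f ∧ IrrF f ∧ |Δ f| ≤ W}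

lemma irrSet_finite (M : ℕ) (v : Form) (W : ℝ) : (irrSet M v W).Finite := by
  obtain ⟨c, -, h⟩ := exists_card_env_total one_pos
  refine (Set.finite_of_forall_card_le (N := c * (max W 1) ^ (1 + 1 : ℝ)) fun s hs => ?_).1
  refine h (max W 1) s (le_max_right _ _) fun f hf => ?_
  obtain ⟨-, h1, h2, h3⟩ := hs f hf
  exact h1.exists_envB h2 (h3.trans (le_max_left _ _))

/-- Counting irreducible strictly reduced forms in a residue class. -/
theorem exists_irrSet_asymp : ∃ K δ : ℝ, 0 < K ∧ 0 < δ ∧ ∀ (M : ℕ) (v : Form), 0 < M →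
    ∃ C : ℝ, ∀ W : ℝ, 1 ≤ W →
      |((irrSet M v W).ncard : ℝ) - C * W| ≤ K * M ^ 5 * W ^ (1 - δ) := by
  obtain ⟨δ, c, hδ, hc, hlim⟩ := exists_asymp_of_truncated (b := 4) (δ := 1 / 16) (η := 2 / 3)
    (by norm_num) (by norm_num) (by norm_num)
  obtain ⟨c₁, hc₁, H₁⟩ := abs_card_sredBox_sub_le
  obtain ⟨c₂, hc₂, H₂⟩ := exists_card_reducible (ε := 1 / 4) (by norm_num)
  obtain ⟨c₃, hc₃, H₃⟩ := exists_card_env_tail (ε := 2 / 3 * (1 / 16) / (4 * 4)) (by norm_num)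
  refine ⟨c * (c₁ + c₂ + c₃), δ, by positivity, hδ, fun M v hM => ?_⟩
  have hM1 : (1 : ℝ) ≤ (M : ℝ) ^ 5 := one_le_pow₀ (mod_cast hM)
  refine Exists.imp (fun C hC W hW => (hC W hW).trans (le_of_eq (by ring)))
    (hlim (fun W => (irrSet M v W).ncard)
    (fun k => (MeasureTheory.volume (sredRegion (2 ^ k) 1)).toReal / M ^ 4) ((c₁ + c₂ + c₃) * M ^ 5)
    (by positivity) (fun W hW k => ?_))
  have hW0 : 0 < W := by linarith
  set T : ℝ := 2 ^ k with hT
  have hT1 : 1 ≤ T := one_le_pow₀ (by norm_num)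
  have hT0 : 0 < T := by linarith
  obtain ⟨hfin, hbox⟩ := H₁ M v T W hM hT1 hW
  have hl1 : 1 ≤ W ^ (1 / 4 : ℝ) := one_le_rpow hW (by norm_num)
  set S := irrSet M v W with hS
  have hSfin : S.Finite := irrSet_finite M v W
  set Bx := sredBox M v T W with hBx
  have h1 := Set.finite_of_forall_card_le (S := Bx \ S) fun s hs =>
    H₂ (T * W ^ (1 / 4 : ℝ)) s (one_le_mul_of_one_le_of_one_le hT1 hl1) fun f hf => by
      obtain ⟨⟨h1, h2, h3, h4⟩, h5⟩ := hs f hf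
      exact ⟨h2, fun h6 => h5 ⟨h1, h3, h6, h4⟩⟩
  have h2 := Set.finite_of_forall_card_le (S := S \ Bx) fun s hs => H₃ W T s hW hT1 fun f hf => by
      obtain ⟨⟨h1, h2, h3, h4⟩, h5⟩ := hs f hf
      refine ⟨h2.exists_envB h3 h4, ?_⟩
      by_contra h6
      push Not at h6
      exact h5 ⟨h1, h6, h2, h4⟩
  have e1 : ((Bx \ S).ncard : ℝ) + (Bx ∩ S).ncard = Bx.ncard := by
    rw [add_comm]; exact_mod_cast Set.ncard_inter_add_ncard_diff_eq_ncard Bx S hfin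
  have e2 : ((S \ Bx).ncard : ℝ) + (Bx ∩ S).ncard = S.ncard := by
    rw [add_comm, Set.inter_comm]
    exact_mod_cast Set.ncard_inter_add_ncard_diff_eq_ncard S Bx hSfin
  have hT4 : T ^ (4 : ℝ) = T ^ 4 := mod_cast rpow_natCast T 4
  have h3 : (T * W ^ (1 / 4 : ℝ)) ^ (3 + 1 / 4 : ℝ) ≤ T ^ (4 : ℝ) * W ^ (1 - 1 / 16 : ℝ) := by
    rw [mul_rpow hT0.le (by positivity), ← rpow_mul hW0.le]
    gcongr ?_ * ?_
    · exact rpow_le_rpow_of_exponent_le hT1 (by norm_num)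
    · exact rpow_le_rpow_of_exponent_le hW (by norm_num)
  have h4 : (15 / 16 : ℝ) = 1 - 1 / 16 := by norm_num
  rw [← hT4, h4] at hbox
  set u := T ^ (4 : ℝ) * W ^ (1 - 1 / 16 : ℝ) with hu
  set w := W ^ (1 + 2 / 3 * (1 / 16) / (4 * 4) : ℝ) * T ^ (-(2 / 3) : ℝ) with hw
  have hu0 : 0 ≤ u := by positivity
  have hw0 : 0 ≤ w := by positivity
  have h5 : ((Bx \ S).ncard : ℝ) ≤ c₂ * u := h1.2.trans (by gcongr)
  have h6 : ((S \ Bx).ncard : ℝ) ≤ c₃ * w := h2.2.trans (le_of_eq (by rw [hw]; ring))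
  have h7 : |(Bx.ncard : ℝ) - (MeasureTheory.volume (sredRegion T 1)).toReal / M ^ 4 * W| ≤
      c₁ * M ^ 5 * u := hbox.trans (le_of_eq (by rw [hu]; ring))
  have h8 : (S.ncard : ℝ) - (MeasureTheory.volume (sredRegion T 1)).toReal / M ^ 4 * W =
      ((Bx.ncard : ℝ) - (MeasureTheory.volume (sredRegion T 1)).toReal / M ^ 4 * W)
      - (Bx \ S).ncard + (S \ Bx).ncard := by linarith
  have h9 : 0 ≤ ((Bx \ S).ncard : ℝ) := by positivity
  have h10 : 0 ≤ ((S \ Bx).ncard : ℝ) := by positivity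
  have h11 : c₂ * u ≤ c₂ * M ^ 5 * u := by
    rw [mul_assoc]
    exact mul_le_mul_of_nonneg_left (le_mul_of_one_le_left hu0 hM1) hc₂.le
  have h12 : c₃ * w ≤ c₃ * M ^ 5 * w := by
    rw [mul_assoc]
    exact mul_le_mul_of_nonneg_left (le_mul_of_one_le_left hw0 hM1) hc₃.le
  have h13 : 0 ≤ c₁ * M ^ 5 * w := by positivity
  have h14 : 0 ≤ c₂ * M ^ 5 * w := by positivity
  have h15 : 0 ≤ c₃ * M ^ 5 * u := by positivity
  rw [h8]
  rw [abs_le] at h7 ⊢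
  have e3 : (c₁ + c₂ + c₃) * (M : ℝ) ^ 5 * (u + w) = c₁ * M ^ 5 * u + c₂ * M ^ 5 * u +
      c₃ * M ^ 5 * u + c₁ * M ^ 5 * w + c₂ * M ^ 5 * w + c₃ * M ^ 5 * w := by ring
  rw [e3]
  constructor <;> linarith

/-- Reduced forms lying on the walls are negligible. -/
theorem exists_card_wall : ∃ K δ : ℝ, 0 < K ∧ 0 < δ ∧ ∀ (W : ℝ) (s : Finset Form), 1 ≤ W →
    (∀ f ∈ s, CRed ⟬f⟭ ∧ ¬ SRed f ∧ IrrF f ∧ |Δ f| ≤ W) →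
    (#s : ℝ) ≤ K * W ^ (1 - δ) := by
  obtain ⟨c, hc, H⟩ := exists_card_env_tail (ε := 1 / 300) (by norm_num)
  refine ⟨13 * 30000 + c, 1 / 300, by positivity, by norm_num, fun W s hW hs => ?_⟩
  have hW0 : 0 < W := by linarith
  set T := W ^ (1 / 100 : ℝ) with hT
  have hT1 : 1 ≤ T := one_le_rpow hW (by norm_num)
  have hl1 : 1 ≤ W ^ (1 / 4 : ℝ) := one_le_rpow hW (by norm_num)
  set B := T * W ^ (1 / 4 : ℝ) with hB
  have hB1 : 1 ≤ B := one_le_mul_of_one_le_of_one_le hT1 hl1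
  set s₁ := s.filter fun f => ∃ i, T * W ^ (1 / 4 : ℝ) < |(f i : ℝ)| with hs₁
  have h1 := H W T s₁ hW hT1 fun f hf => by
    obtain ⟨hf, h⟩ := mem_filter.1 hf
    exact ⟨exists_envB (hs f hf).1 (hs f hf).2.2.1 (hs f hf).2.2.2, h⟩
  set t : Fin 4 ⊕ Fin 9 → Finset Form := fun k => s.filter fun f => (∀ i, |(f i : ℝ)| ≤ B) ∧
      nearWall 0 0 1 (500 * 1 * B ^ 3) (100 * 1 * B) ⟬f⟭ k with ht
  have h2 : ∀ k, ((t k).card : ℝ) ≤ 30000 * 1 * B ^ (15 / 4 : ℝ) := fun k =>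
    card_nearWall (R := 0) (w := 0) hB1 le_rfl (fun f hf => (mem_filter.1 hf).2.1) k
      fun f hf => (mem_filter.1 hf).2.2
  have hcov : s ⊆ s₁ ∪ univ.biUnion t := fun f hf => by
    rw [mem_union]
    by_cases hbig : ∃ i, T * W ^ (1 / 4 : ℝ) < |(f i : ℝ)|
    · exact .inl (mem_filter.2 ⟨hf, hbig⟩)
    right
    push Not at hbig
    obtain ⟨hC, hnS, -⟩ := hs f hf
    have hH : (0 : ℝ) ≤ 100 * 1 * B := by linarith
    suffices ∃ k, nearWall 0 0 1 (500 * 1 * B ^ 3) (100 * 1 * B) ⟬f⟭ k by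
      obtain ⟨k, hk⟩ := this
      exact mem_biUnion.2 ⟨k, mem_univ _, mem_filter.2 ⟨hf, hbig, hk⟩⟩
    rw [← sred_intCast] at hnS
    set g : Fin 4 → ℝ := ⟬f⟭
    have hz : ∀ x : ℝ, x = 0 → |x| ≤ 100 * 1 * B := fun x hx => by rw [hx, abs_zero]; exact hH
    rcases hC with ⟨hd, h1, h2, h3⟩ | ⟨hd, h1, h2, h3⟩
    · by_cases e1 : hesB g = 0
      · exact ⟨.inr 3, hz _ e1⟩
      by_cases e2 : hesA g - hesB g = 0
      · exact ⟨.inr 4, hz _ e2⟩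
      by_cases e3 : hesC g - hesA g = 0
      · exact ⟨.inr 5, hz _ e3⟩
      exact absurd (.inl ⟨hd, lt_of_le_of_ne h1 (Ne.symm e1),
        lt_of_le_of_ne h2 fun h => e2 (by linarith),
        lt_of_le_of_ne h3 fun h => e3 (by linarith)⟩) hnS
    · by_cases e1 : matA g = 0
      · exact ⟨.inr 6, hz _ e1⟩
      by_cases e2 : matB g = 0
      · exact ⟨.inr 7, hz _ e2⟩
      by_cases e3 : matC g = 0
      · exact ⟨.inr 8, hz _ e3⟩
      exact absurd (.inr ⟨hd, lt_of_le_of_ne h1 (Ne.symm e1), lt_of_le_of_ne h2 (Ne.symm e2),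
        lt_of_le_of_ne h3 (Ne.symm e3)⟩) hnS
  have h3 : (#s : ℝ) ≤ #s₁ + ∑ k, ((t k).card : ℝ) := by
    exact_mod_cast (card_le_card hcov).trans ((card_union_le _ _).trans
      (Nat.add_le_add_left card_biUnion_le _))
  have h4 : ∑ k, ((t k).card : ℝ) ≤ 13 * (30000 * 1 * B ^ (15 / 4 : ℝ)) := by
    refine (sum_le_card_nsmul _ _ _ fun k _ => h2 k).trans (le_of_eq ?_)
    rw [card_univ, nsmul_eq_mul]
    simp
  have h5 : B ^ (15 / 4 : ℝ) ≤ W ^ (1 - 1 / 300 : ℝ) := by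
    rw [hB, hT, ← rpow_add hW0, ← rpow_mul hW0.le]
    exact rpow_le_rpow_of_exponent_le hW (by norm_num)
  have h6 : c * W ^ (1 + 1 / 300 : ℝ) * T ^ (-(2 / 3) : ℝ) = c * W ^ (1 - 1 / 300 : ℝ) := by
    rw [mul_assoc, hT, ← rpow_mul hW0.le, ← rpow_add hW0]
    norm_num
  rw [h6] at h1
  linarith

lemma fact_mul_fact {R : Type*} [CommRing R] (r s t u r' s' t' u' : R) (f : Fin 4 → R) :
    fact r' s' t' u' (fact r s t u f) =
      fact (r * r' + s * t') (r * s' + s * u') (t * r' + u * t') (t * s' + u * u') f := by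
  funext i
  fin_cases i <;> simp [fact] <;> ring

lemma fact_smul {R : Type*} [CommRing R] (r s t u c : R) (f : Fin 4 → R) (i : Fin 4) :
    fact r s t u (fun i => c * f i) i = c * fact r s t u f i := by
  fin_cases i <;> simp [fact] <;> ring

lemma fact_inv {R : Type*} [CommRing R] {r s t u : R} (h : (r * u - s * t) ^ 2 = 1)
    (f : Fin 4 → R) (i : Fin 4) :
    fact u (-s) (-t) r (fact r s t u f) i = (r * u - s * t) * f i := by
  have : (r * u - s * t) * f i = (r * u - s * t) ^ 3 * f i := by
    linear_combination (-(r * u - s * t) * f i) * h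
  rw [this, fact_mul_fact]
  fin_cases i <;> simp [fact] <;> ring

lemma exists_hnf (r s t u : ℤ) (h : r * u - s * t ≠ 0) : ∃ (a k d : ℕ) (r' s' t' u' : ℤ),
    k < a ∧ 0 < d ∧ a * d = (r * u - s * t).natAbs ∧ (r' * u' - s' * t') ^ 2 = 1 ∧
    r = a * r' + k * t' ∧ s = a * s' + k * u' ∧ t = d * t' ∧ u = d * u' := by
  have hg : 0 < Int.gcd t u := by
    rw [Nat.pos_iff_ne_zero]
    intro h0
    rw [Int.gcd_eq_zero_iff] at h0
    exact h (by rw [h0.1, h0.2]; ring)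
  obtain ⟨t', ht⟩ := Int.gcd_dvd_left t u
  obtain ⟨u', hu⟩ := Int.gcd_dvd_right t u
  set g := Int.gcd t u with hgd
  have hgz : (g : ℤ) ≠ 0 := mod_cast hg.ne'
  obtain ⟨x, y, hxy⟩ : ∃ x y : ℤ, x * t' + y * u' = 1 := by
    refine ⟨Int.gcdA t u, Int.gcdB t u, mul_left_cancel₀ hgz ?_⟩
    have := Int.gcd_eq_gcd_ab t u
    rw [← hgd] at this
    linear_combination -this + (Int.gcdA t u) * (-ht) - (Int.gcdB t u) * hu
  set D := r * u' - s * t' with hD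
  have hDg : r * u - s * t = g * D := by rw [hu, ht]; ring
  have hD0 : D ≠ 0 := by rintro h0; exact h (by rw [hDg, h0, mul_zero])
  have hDa : (D.natAbs : ℤ) * D.sign = D := by rw [mul_comm, Int.sign_mul_natAbs]
  have hsg : D.sign ^ 2 = 1 := by
    rcases lt_or_gt_of_ne hD0 with h' | h'
    · rw [Int.sign_eq_neg_one_of_neg h']; norm_num
    · rw [Int.sign_eq_one_of_pos h']; norm_num
  set e := D.sign
  set a := D.natAbs with ha
  have ha0 : (0 : ℤ) < a := by simpa [ha] using hD0
  have hmod := Int.emod_add_mul_ediv (r * x + s * y) a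
  set q := (r * x + s * y) / a
  obtain ⟨k, hk⟩ := Int.eq_ofNat_of_zero_le (Int.emod_nonneg (r * x + s * y) ha0.ne')
  have hlt := Int.emod_lt_of_pos (r * x + s * y) ha0
  rw [hk] at hmod hlt
  refine ⟨a, k, g, e * y + q * t', -e * x + q * u', t', u', mod_cast hlt, hg, ?_, ?_,
    ?_, ?_, ht, hu⟩
  · rw [hDg, Int.natAbs_mul, Int.natAbs_natCast, mul_comm]
  · rw [show (e * y + q * t') * u' - (-e * x + q * u') * t' = e * (x * t' + y * u') by ring, hxy,
      mul_one, hsg]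
  · linear_combination (-t') * hmod - y * hDa - r * hxy - y * hD
  · linear_combination (-u') * hmod + x * hDa - s * hxy + x * hD

lemma NM.of_dvd (hp : p.Prime) (h : ∀ i, (p : ℤ) ∣ f i) : NM p f := by
  refine ⟨![0, 1, 0], fun h' => ?_, fun i hi => ?_⟩
  · have := h' 1
    simp only [Matrix.cons_val_one, Matrix.cons_val_zero] at this
    exact hp.one_lt.ne' (mod_cast Int.eq_one_of_dvd_one (by positivity) this)
  · obtain ⟨a, ha⟩ := h 0
    obtain ⟨b, hb⟩ := h 1
    obtain ⟨c, hc⟩ := h 2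
    obtain ⟨d, hd⟩ := h 3
    have hcp : (mulMat f ![0, 1, 0]).charpoly = Polynomial.X ^ 3 - Polynomial.C (f 1) *
        Polynomial.X ^ 2 + Polynomial.C (f 0 * f 2) * Polynomial.X -
        Polynomial.C (f 0 ^ 2 * f 3) := by
      rw [Matrix.charpoly, Matrix.det_fin_three]
      simp [mulMat]
      ring
    have h1 : (p : ℤ) ∣ f 1 := h 1
    have h2 : (p : ℤ) ^ 2 ∣ f 0 * f 2 := ⟨a * c, by rw [ha, hc]; ring⟩
    have h3 : (p : ℤ) ^ 3 ∣ f 0 ^ 2 * f 3 := ⟨a ^ 2 * d, by rw [ha, hd]; ring⟩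
    rw [hcp]
    generalize f 1 = x at h1
    generalize f 0 * f 2 = y at h2
    generalize f 0 ^ 2 * f 3 = z at h3
    interval_cases i <;> simp [-eq_intCast, Polynomial.coeff_X, Polynomial.coeff_C,
      Polynomial.coeff_X_pow, h1, h2, h3]

lemma IrrF.exists_hnf (hf : IrrF f) : ∃ (F : Form) (a k d : ℕ),
    CRed ⟬F⟭ ∧ IrrF F ∧ (∀ p : ℕ, p.Prime → ¬ NM p F) ∧ k < a ∧ 0 < d ∧
    fdisc f = ((a * d : ℕ) : ℤ) ^ 2 * fdisc F ∧ (∀ p : ℕ, p.Prime → NM p f → p ∣ a * d) ∧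
    ∃ r s t u e : ℤ, (r * u - s * t) ^ 2 = 1 ∧ e ^ 2 = 1 ∧
      ∀ i, fact r s t u (fact (a : ℤ) k 0 d F) i = e * (a * d : ℕ) * f i := by
  obtain ⟨K, h3, g, r, s, t, u, hg, hdet, hfact, hnm, -⟩ := hf.exists_idx
  have : FiniteDimensional ℚ K := finite_of_finrank_eq_succ h3
  have : NumberField K := ⟨⟩
  obtain ⟨F, hF, hFc⟩ := exists_idx_cred h3
  obtain ⟨r₁, s₁, t₁, u₁, hd₁, h₁⟩ := hF.exists_fact hg
  set D := r * u - s * t with hD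
  set E := r₁ * u₁ - s₁ * t₁ with hE
  have hmul : (r₁ * r + s₁ * t) * (t₁ * s + u₁ * u) - (r₁ * s + s₁ * u) * (t₁ * r + u₁ * t) =
      E * D := by rw [hE, hD]; ring
  have hE0 : E ≠ 0 := by rintro h0; rw [h0] at hd₁; norm_num at hd₁
  obtain ⟨a, k, d, r', s', t', u', hka, hd, had, hdet', e1, e2, e3, e4⟩ :=
    _root_.exists_hnf _ _ _ _ (hmul ▸ mul_ne_zero hE0 hdet)
  rw [hmul] at had
  have hEa : E.natAbs = 1 := by
    rcases mul_self_eq_one_iff.1 ((sq _).symm.trans hd₁) with h | h <;> simp [h]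
  have hED : (E * D).natAbs = D.natAbs := by rw [Int.natAbs_mul, hEa, one_mul]
  rw [hED] at had
  have hDs : (D.natAbs : ℤ) * D.sign = D := by rw [mul_comm, Int.sign_mul_natAbs]
  have hsg : D.sign ^ 2 = 1 := by
    rcases lt_or_gt_of_ne hdet with h' | h'
    · rw [Int.sign_eq_neg_one_of_neg h']; norm_num
    · rw [Int.sign_eq_one_of_pos h']; norm_num
  have hmain : ∀ i, fact r' s' t' u' (fact (a : ℤ) k 0 d F) i =
      (E * D.sign) * (a * d : ℕ) * f i := fun i => by
    rw [fact_mul_fact, zero_mul, zero_mul, zero_add, zero_add, ← e1, ← e2, ← e3, ← e4,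
      ← fact_mul_fact, funext h₁, fact_smul, hfact, had]
    linear_combination (-E * f i) * hDs
  refine ⟨F, a, k, d, hFc, hF.irrF, fun p hp => hF.not_nm h3 hp, hka, hd, ?_, fun p hp h => ?_,
    r', s', t', u', E * D.sign, hdet', by rw [mul_pow, hd₁, hsg, one_mul], hmain⟩
  · have h5 : fdisc (fact r s t u g) = D ^ 4 * fdisc f := by rw [funext hfact]; simp only [fdisc]; ring
    rw [fdisc_fact] at h5
    have h6 : fdisc g = fdisc F := by rw [← hg.discr h3, ← hF.discr h3]
    have h7 : D ^ 4 * fdisc f = D ^ 4 * (D ^ 2 * fdisc F) := by rw [← h5, h6]; ring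
    rw [mul_left_cancel₀ (pow_ne_zero 4 hdet) h7, had, Int.natAbs_sq]
  · rw [had, ← Int.natCast_dvd]
    exact (hnm p hp).1 h

lemma hnf_fiber {f f' F : Form} {n : ℤ} (hn : n ≠ 0) (hf : SRed f) (hf' : SRed f')
    {r s t u e r' s' t' u' e' : ℤ} (hd : (r * u - s * t) ^ 2 = 1) (he : e ^ 2 = 1)
    (h : ∀ i, fact r s t u F i = e * n * f i) (hd' : (r' * u' - s' * t') ^ 2 = 1)
    (he' : e' ^ 2 = 1) (h' : ∀ i, fact r' s' t' u' F i = e' * n * f' i) :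
    f' = f ∨ f' = fun i => -f i := by
  set D := r * u - s * t with hD
  have h1 : ∀ i, fact u (-s) (-t) r (fun i => f i) i * (e * n) = D * F i := fun i => by
    rw [← fact_inv hd, funext h, fact_smul]
    ring
  have h2 : ∀ i, (e * D * e') * fact r' s' t' u' (fact u (-s) (-t) r f) i = f' i := fun i => by
    have h3 : fact r' s' t' u' (fun i => (e * n) * fact u (-s) (-t) r f i) i =
        D * (e' * n * f' i) := by
      rw [← h', ← fact_smul]
      congr 1
      funext i
      rw [← h1, mul_comm]
    rw [fact_smul] at h3
    refine mul_left_cancel₀ hn ?_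
    linear_combination (D * e') * h3 + n * f' i * (D ^ 2 * he' + hd)
  rw [fact_mul_fact] at h2
  have hdet : ((u * r' + -s * t') * (-t * s' + r * u') - (u * s' + -s * u') * (-t * r' + r * t')) ^ 2
      = 1 := by
    rw [← hd, ← mul_one ((r * u - s * t) ^ 2), ← hd']; ring
  have hε : (e * D * e') ^ 2 = 1 := by rw [mul_pow, mul_pow, he, hd, he']; norm_num
  have hεR : ((e * D * e' : ℤ) : ℝ) ^ 2 = 1 := mod_cast hε
  have hsr : SRed (fact ((u * r' + -s * t' : ℤ) : ℝ) (u * s' + -s * u' : ℤ) (-t * r' + r * t' : ℤ)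
      (-t * s' + r * u' : ℤ) ⟬f⟭) := by
    rw [← fact_cast, ← sred_unit_mul hεR]
    convert (sred_intCast f').2 hf' using 2 with i
    rw [← h2 i]
    push_cast
    ring
  have key := ((sred_intCast f).2 hf).unique hdet hsr
  have hsgn := mul_self_eq_one_iff.1 ((sq _).symm.trans hε)
  rcases key with ⟨k1, k2, k3, k4⟩ | ⟨k1, k2, k3, k4⟩ <;> rcases hsgn with h5 | h5 <;>
    rw [k1, k2, k3, k4, h5] at h2
  · left; funext i; rw [← h2 i]; fin_cases i <;> simp [fact]
  · right; funext i; rw [← h2 i]; fin_cases i <;> simp [fact]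
  · right; funext i; rw [← h2 i]; fin_cases i <;> simp [fact]
  · left; funext i; rw [← h2 i]; fin_cases i <;> simp [fact]

lemma card_residues_le {S : Finset ℕ} (hS : ∀ p ∈ S, p.Prime) {N r : ℕ}
    (hd : ∀ p ∈ S, p ∣ N) (R : ℕ → Finset ℕ) (hR : ∀ p ∈ S, (R p).card ≤ r) {s : Finset ℕ}
    (hs : ∀ k ∈ s, k < N ∧ ∀ p ∈ S, k % p ∈ R p) :
    #s ≤ N / (∏ p ∈ S, p) * r ^ #S := by
  have hP : (∏ p ∈ S, p) ∣ N := prod_primes_dvd N (fun p hp => (hS p hp).prime) hd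
  have hP0 : 0 < ∏ p ∈ S, p := prod_pos fun p hp => (hS p hp).pos
  have h1 : #s ≤ (range (N / ∏ p ∈ S, p) ×ˢ S.pi R).card := by
    refine card_le_card_of_injOn (fun k => (k / ∏ p ∈ S, p, fun p _ => k % p)) ?_ ?_
    · intro k hk
      obtain ⟨hk1, hk2⟩ := hs k hk
      simp only [coe_product, Set.mem_prod, mem_coe, mem_range, Finset.mem_pi]
      exact ⟨Nat.div_lt_div_of_lt_of_dvd hP hk1, hk2⟩
    · intro k hk l hl hkl
      simp only [Prod.mk.injEq] at hkl
      have h2 : k % (∏ p ∈ S, p) = l % (∏ p ∈ S, p) := by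
        rw [← Nat.ModEq, Nat.modEq_iff_dvd, Int.natCast_dvd]
        refine prod_primes_dvd _ (fun p hp => (hS p hp).prime) fun p hp => ?_
        rw [← Int.natCast_dvd, ← Nat.modEq_iff_dvd]
        exact congrFun (congrFun hkl.2 p) hp
      rw [← Nat.div_add_mod k (∏ p ∈ S, p), ← Nat.div_add_mod l (∏ p ∈ S, p), h2, hkl.1]
  refine h1.trans ?_
  rw [card_product, card_range, card_pi]
  exact Nat.mul_le_mul_left _ (prod_le_pow_card _ _ _ hR)

lemma card_roots_mod_le (hp : p.Prime) {F : Form} (hF : ¬ ∀ i, (p : ℤ) ∣ F i)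
    {d : ℕ} (hd : ¬ p ∣ d) :
    ((range p).filter fun k : ℕ => (p : ℤ) ∣
      F 0 * k ^ 3 + F 1 * k ^ 2 * d + F 2 * k * d ^ 2 + F 3 * d ^ 3).card ≤ 3 := by
  have : Fact p.Prime := ⟨hp⟩
  have hd0 : (d : ZMod p) ≠ 0 := by rwa [Ne, ZMod.natCast_eq_zero_iff]
  let P : Polynomial (ZMod p) := Polynomial.C (F 0 : ZMod p) * Polynomial.X ^ 3 +
    Polynomial.C (F 1 * d : ZMod p) * Polynomial.X ^ 2 +
    Polynomial.C (F 2 * d ^ 2 : ZMod p) * Polynomial.X + Polynomial.C (F 3 * d ^ 3 : ZMod p)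
  have hP : P ≠ 0 := fun h0 => by
    apply hF
    have h := fun i => congrArg (fun Q => Polynomial.coeff Q i) h0
    have h3 := h 3
    have h2 := h 2
    have h1 := h 1
    have h0 := h 0
    simp [P, -map_mul, -map_pow, -map_natCast, -map_intCast, -eq_intCast, Polynomial.coeff_X,
      Polynomial.coeff_C, Polynomial.coeff_X_pow, hd0] at h0 h1 h2 h3
    intro i
    rw [← ZMod.intCast_zmod_eq_zero_iff_dvd]
    fin_cases i <;> simp [*]
  have hdeg : P.natDegree ≤ 3 := Polynomial.natDegree_cubic_le
  refine le_trans (card_le_card_of_injOn (fun k : ℕ => (k : ZMod p))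
    (t := P.roots.toFinset) ?_ ?_) ((Multiset.toFinset_card_le _).trans
      ((Polynomial.card_roots' P).trans hdeg))
  · intro k hk
    simp only [coe_filter, mem_range, Set.mem_setOf_eq] at hk
    simp only [mem_coe, Multiset.mem_toFinset, Polynomial.mem_roots hP, Polynomial.IsRoot.def]
    have := (ZMod.intCast_zmod_eq_zero_iff_dvd _ p).2 hk.2
    push_cast at this
    simp only [P, Polynomial.eval_add, Polynomial.eval_mul, Polynomial.eval_C, Polynomial.eval_pow,
      Polynomial.eval_X]
    linear_combination this
  · intro k hk l hl hkl
    simp only [coe_filter, mem_range, Set.mem_setOf_eq] at hk hl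
    have := (ZMod.natCast_eq_natCast_iff' _ _ _).1 hkl
    rwa [Nat.mod_eq_of_lt hk.1, Nat.mod_eq_of_lt hl.1] at this

lemma card_hnf_le {F : Form} (hF : ∀ p : ℕ, p.Prime → ¬ NM p F) {n d : ℕ} (hn : 0 < n)
    (hd : d ∣ n) {s : Finset ℕ} (hs : ∀ k ∈ s, k < n / d ∧ (n : ℤ) ∣
      F 0 * k ^ 3 + F 1 * k ^ 2 * d + F 2 * k * d ^ 2 + F 3 * d ^ 3) :
    (#s : ℝ) ≤ n / ((∏ p ∈ n.primeFactors, p : ℕ) : ℝ) * 3 ^ #n.primeFactors := by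
  set S := n.primeFactors.filter fun p => ¬ p ∣ d with hS
  have hprime : ∀ p ∈ n.primeFactors, p.Prime := fun p => Nat.prime_of_mem_primeFactors
  have hd0 : 0 < d := Nat.pos_of_dvd_of_pos hd hn
  have hSn : S ⊆ n.primeFactors := filter_subset _ _
  have hSd : ∀ p ∈ S, p ∣ n / d := fun p hp => by
    have h1 := (mem_filter.1 hp)
    have h2 : p ∣ d * (n / d) := by
      rw [Nat.mul_div_cancel' hd]
      exact Nat.dvd_of_mem_primeFactors h1.1
    exact ((hprime p h1.1).dvd_mul.1 h2).resolve_left h1.2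
  have h1 := card_residues_le (fun p hp => hprime p (hSn hp)) hSd
    (fun p => (range p).filter fun k : ℕ => (p : ℤ) ∣
      F 0 * k ^ 3 + F 1 * k ^ 2 * d + F 2 * k * d ^ 2 + F 3 * d ^ 3) (r := 3)
    (fun p hp => card_roots_mod_le (hprime p (hSn hp))
      (fun h => hF p (hprime p (hSn hp)) (NM.of_dvd (hprime p (hSn hp)) h))
      (mem_filter.1 hp).2) (s := s) (fun k hk => by
    refine ⟨(hs k hk).1, fun p hp => ?_⟩
    rw [mem_filter, mem_range]
    refine ⟨Nat.mod_lt _ (hprime p (hSn hp)).pos, ?_⟩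
    have h2 := (Int.natCast_dvd_natCast.2 (Nat.dvd_of_mem_primeFactors (hSn hp))).trans (hs k hk).2
    have h3 : ((k % p : ℕ) : ℤ) ≡ k [ZMOD p] := by rw [Int.natCast_mod]; exact Int.mod_modEq _ _
    refine Int.modEq_zero_iff_dvd.1 (Int.ModEq.trans ?_ (Int.modEq_zero_iff_dvd.2 h2))
    gcongr)
  have hprod : ∏ p ∈ n.primeFactors, p ≤ (∏ p ∈ S, p) * d := by
    rw [← prod_filter_mul_prod_filter_not n.primeFactors (fun p => ¬ p ∣ d)]
    refine Nat.mul_le_mul_left _ (Nat.le_of_dvd hd0 ?_)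
    refine prod_primes_dvd _ (fun p hp => (hprime p (filter_subset _ _ hp)).prime) ?_
    intro p hp
    simpa using (mem_filter.1 hp).2
  have hpos : 0 < ∏ p ∈ n.primeFactors, p := prod_pos fun p hp => (hprime p hp).pos
  have hposS : 0 < ∏ p ∈ S, p := prod_pos fun p hp => (hprime p (hSn hp)).pos
  have h4 : ((n / d / ∏ p ∈ S, p : ℕ) : ℝ) ≤ n / ((∏ p ∈ n.primeFactors, p : ℕ) : ℝ) := by
    rw [Nat.div_div_eq_div_mul]
    refine Nat.cast_div_le.trans ?_
    gcongr
    rw [mul_comm]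
    exact_mod_cast hprod
  have h5 : (#s : ℝ) ≤ ((n / d / ∏ p ∈ S, p : ℕ) : ℝ) * 3 ^ #S := mod_cast h1
  refine h5.trans ?_
  gcongr
  norm_num

lemma card_hnf_total_le {A : ℝ → ℝ} {n : ℕ} (hn : 0 < n)
    (hA : ∀ t : Finset Form, (∀ F ∈ t, CRed ⟬F⟭ ∧ IrrF F ∧
      |Δ F| ≤ W / n ^ 2) → (#t : ℝ) ≤ A n)
    {I : Finset (Form × ℕ × ℕ × ℕ)} (hI : ∀ x ∈ I, CRed (fun i => (x.1 i : ℝ)) ∧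
      IrrF x.1 ∧ |((fdisc x.1 : ℤ) : ℝ)| ≤ W / n ^ 2 ∧ (∀ p : ℕ, p.Prime → ¬ NM p x.1) ∧
      x.2.2.1 < x.2.1 ∧ 0 < x.2.2.2 ∧ x.2.1 * x.2.2.2 = n ∧ (n : ℤ) ∣
      x.1 0 * x.2.2.1 ^ 3 + x.1 1 * x.2.2.1 ^ 2 * x.2.2.2 + x.1 2 * x.2.2.1 * x.2.2.2 ^ 2 +
        x.1 3 * x.2.2.2 ^ 3) :
    (#I : ℝ) ≤ #n.divisors * (n / ((∏ p ∈ n.primeFactors, p : ℕ) : ℝ) *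
      3 ^ #n.primeFactors) * A n := by
  set B : ℝ := n / ((∏ p ∈ n.primeFactors, p : ℕ) : ℝ) * 3 ^ #n.primeFactors
  have hB : 0 ≤ B := by positivity
  have h1 : ∀ F : Form, ∀ d : ℕ,
      (((I.filter fun x => x.1 = F).filter fun x => x.2.2.2 = d).card : ℝ) ≤ B := fun F d => by
    rcases (((I.filter fun x => x.1 = F).filter fun x => x.2.2.2 = d)).eq_empty_or_nonempty with
      h | ⟨x, hx⟩
    · rw [h]; simpa using hB
    simp only [mem_filter] at hx
    obtain ⟨⟨hx, rfl⟩, rfl⟩ := hx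
    have hx' := hI x hx
    rw [← card_image_of_injOn (f := fun y => y.2.2.1)]
    · refine card_hnf_le hx'.2.2.2.1 hn (Dvd.intro_left _ hx'.2.2.2.2.2.2.1) fun k hk => ?_
      simp only [mem_image, mem_filter] at hk
      obtain ⟨y, ⟨⟨hy, e1⟩, e2⟩, rfl⟩ := hk
      have hy' := hI y hy
      rw [e1, e2] at hy'
      refine ⟨?_, hy'.2.2.2.2.2.2.2⟩
      rw [← hy'.2.2.2.2.2.2.1, Nat.mul_div_cancel _ hx'.2.2.2.2.2.1]
      exact hy'.2.2.2.2.1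
    · intro y hy z hz hyz
      simp only [coe_filter, Set.mem_setOf_eq, mem_filter] at hy hz
      have hy' := hI y hy.1.1
      have hz' := hI z hz.1.1
      refine Prod.ext (hy.1.2.trans hz.1.2.symm) (Prod.ext ?_ (Prod.ext hyz (hy.2.trans hz.2.symm)))
      refine Nat.eq_of_mul_eq_mul_right hy'.2.2.2.2.2.1 ?_
      rw [hy'.2.2.2.2.2.2.1, hy.2, ← hz.2, hz'.2.2.2.2.2.2.1]
  have h2 : ∀ F : Form, ((I.filter fun x => x.1 = F).card : ℝ) ≤ #n.divisors * B := fun F => by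
    rw [card_eq_sum_card_fiberwise (f := fun x => x.2.2.2) (t := n.divisors)]
    · push_cast
      refine (sum_le_sum fun d _ => h1 F d).trans (le_of_eq ?_)
      rw [sum_const, nsmul_eq_mul]
    · intro x hx
      rw [mem_coe, mem_filter] at hx
      exact Nat.mem_divisors.2 ⟨Dvd.intro_left _ (hI x hx.1).2.2.2.2.2.2.1, hn.ne'⟩
  rw [card_eq_sum_card_image Prod.fst I]
  push_cast
  refine (sum_le_sum fun F _ => h2 F).trans ?_
  rw [sum_const, nsmul_eq_mul, mul_comm]
  gcongr
  refine hA _ fun F hF => ?_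
  obtain ⟨x, hx, rfl⟩ := mem_image.1 hF
  exact ⟨(hI x hx).1, (hI x hx).2.1, (hI x hx).2.2.1⟩

theorem exists_card_index_tail (hε : 0 < ε) : ∃ c : ℝ, 0 < c ∧ ∀ (W Y : ℝ)
    (s : Finset Form), 1 ≤ W → 1 ≤ Y →
    (∀ f ∈ s, SRed f ∧ IrrF f ∧ |Δ f| ≤ W ∧
      ∃ q : ℕ, Squarefree q ∧ Y ≤ q ∧ ∀ p : ℕ, p.Prime → p ∣ q → NM p f) →
    (#s : ℝ) ≤ c * (W ^ (1 + ε) / Y) := by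
  obtain ⟨c₁, hc₁, h₁⟩ := exists_card_env_total (half_pos hε)
  obtain ⟨c₂, hc₂, h₂⟩ := exists_card_divisors_le (half_pos hε)
  obtain ⟨c₃, hc₃, h₃⟩ := exists_pow_primeFactors_le (half_pos hε) 3
  obtain ⟨c₄, hc₄, h₄⟩ := exists_log_le (half_pos hε)
  refine ⟨2 * (c₂ * c₃ * c₁ * c₄), by positivity, fun W Y s hW hY hs => ?_⟩
  choose! F a k d hFc hFi hFm hka hd hdisc hnm r t u w e hdet he hfact using
    fun f (hf : IrrF f) => hf.exists_hnf
  have hndvd : ∀ f, IrrF f → ((a f * d f : ℕ) : ℤ) ∣ F f 0 * k f ^ 3 + F f 1 * k f ^ 2 * d f +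
      F f 2 * k f * d f ^ 2 + F f 3 * d f ^ 3 := fun f hf => by
    have h5 := fact_inv (hdet f hf) (fact (a f : ℤ) (k f) 0 (d f) (F f)) 3
    rw [funext (hfact f hf), fact_smul] at h5
    have h6 : fact (a f : ℤ) (k f) 0 (d f) (F f) 3 = F f 0 * k f ^ 3 + F f 1 * k f ^ 2 * d f +
      F f 2 * k f * d f ^ 2 + F f 3 * d f ^ 3 := by simp [fact]
    rw [h6] at h5
    have h7 : F f 0 * k f ^ 3 + F f 1 * k f ^ 2 * d f + F f 2 * k f * d f ^ 2 + F f 3 * d f ^ 3 =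
        (r f * w f - t f * u f) ^ 2 * (F f 0 * k f ^ 3 + F f 1 * k f ^ 2 * d f +
        F f 2 * k f * d f ^ 2 + F f 3 * d f ^ 3) := by rw [hdet f hf, one_mul]
    rw [h7, sq, mul_assoc, ← h5]
    exact ⟨(r f * w f - t f * u f) * (e f * fact (w f) (-t f) (-u f) (r f) f 3), by ring⟩
  set g : Form → Form × ℕ × ℕ × ℕ := fun f => (F f, a f, k f, d f) with hg
  have hfib : #s ≤ 2 * (s.image g).card := by
    refine card_le_mul_card_image s 2 fun b hb => ?_
    obtain ⟨f, hf, rfl⟩ := mem_image.1 hb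
    refine (card_le_card (t := {f, fun i => -f i}) fun f' hf' => ?_).trans card_le_two
    obtain ⟨hf's, hgf⟩ := mem_filter.1 hf'
    simp only [hg, Prod.mk.injEq] at hgf
    obtain ⟨e1, e2, e3, e4⟩ := hgf
    have hi := (hs f hf).2.1
    have hi' := (hs f' hf's).2.1
    have hn0 : ((a f * d f : ℕ) : ℤ) ≠ 0 := by
      have := hka f hi
      have := hd f hi
      exact_mod_cast Nat.mul_ne_zero (by omega) (by omega)
    have h5 := hfact f' hi'
    rw [e1, e2, e3, e4] at h5
    have := hnf_fiber hn0 (hs f hf).1 (hs f' hf's).1 (hdet f hi) (he f hi) (hfact f hi)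
      (hdet f' hi') (he f' hi') h5
    simpa using this
  set N := ⌊√W⌋₊ with hN
  set T := (Icc 1 N).filter fun n => Y ≤ ((∏ p ∈ n.primeFactors, p : ℕ) : ℝ) with hT
  have hfacts : ∀ x ∈ s.image g, ∃ f ∈ s, g f = x := fun x hx => by simpa using hx
  have hmem : ∀ f ∈ s, 0 < a f * d f ∧ |((fdisc (F f) : ℤ) : ℝ)| ≤ W / ((a f * d f : ℕ) : ℝ) ^ 2 ∧
      a f * d f ∈ T := fun f hf => by
    obtain ⟨hsr, hi, hfW, q, hq, hqY, hqp⟩ := hs f hf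
    have hn0 : 0 < a f * d f := Nat.mul_pos (by have := hka f hi; omega) (hd f hi)
    have hn0' : (0 : ℝ) < ((a f * d f : ℕ) : ℝ) := mod_cast hn0
    have h5 : |Δ f| = ((a f * d f : ℕ) : ℝ) ^ 2 * |((fdisc (F f) : ℤ) : ℝ)| := by
      rw [hdisc f hi]; push_cast; rw [abs_mul, abs_of_nonneg (by positivity)]
    have h6 : |((fdisc (F f) : ℤ) : ℝ)| ≤ W / ((a f * d f : ℕ) : ℝ) ^ 2 := by
      rw [le_div_iff₀ (by positivity), mul_comm, ← h5]; exact hfW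
    have h7 : fdisc (F f) ≠ 0 := fun h0 => by
      have := hdisc f hi
      rw [h0, mul_zero] at this
      rcases hsr with h | h
      · exact h.1.ne' this
      · exact h.1.ne this
    have h8 : (1 : ℝ) ≤ |((fdisc (F f) : ℤ) : ℝ)| := mod_cast Int.one_le_abs h7
    have h9 : ((a f * d f : ℕ) : ℝ) ^ 2 ≤ W := by rw [h5] at hfW; nlinarith
    refine ⟨hn0, h6, ?_⟩
    rw [hT, mem_filter, mem_Icc]
    refine ⟨⟨hn0, Nat.le_floor (le_sqrt_of_sq_le h9)⟩, hqY.trans ?_⟩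
    have hq0 : q ≠ 0 := hq.ne_zero
    have h10 : q ∣ ∏ p ∈ (a f * d f).primeFactors, p := by
      rw [← Nat.prod_primeFactors_of_squarefree hq]
      refine prod_dvd_prod_of_subset _ _ _ fun p hp => ?_
      have hp' := Nat.prime_of_mem_primeFactors hp
      exact Nat.mem_primeFactors.2 ⟨hp', hnm f hi p hp' (hqp p hp' (Nat.dvd_of_mem_primeFactors hp)),
        hn0.ne'⟩
    exact_mod_cast Nat.le_of_dvd (prod_pos fun p hp => (Nat.prime_of_mem_primeFactors hp).pos) h10
  have hblock : ∀ n ∈ T, (((s.image g).filter fun x => x.2.1 * x.2.2.2 = n).card : ℝ) ≤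
      c₂ * c₃ * c₁ * (W ^ (1 + ε / 2) / Y) * (n : ℝ)⁻¹ := fun n hn => by
    obtain ⟨hn1, hnY⟩ := mem_filter.1 hn
    obtain ⟨hn1, hnN⟩ := mem_Icc.1 hn1
    have hn0 : (0 : ℝ) < n := mod_cast hn1
    have hnW : 1 ≤ W / (n : ℝ) ^ 2 := by
      rw [le_div_iff₀ (by positivity), one_mul]
      have := (Nat.le_floor_iff (sqrt_nonneg W)).1 hnN
      exact (le_sqrt' hn0).1 this
    have h5 := card_hnf_total_le (W := W) (A := fun n => c₁ * (W / n ^ 2) ^ (1 + ε / 2)) hn1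
      (fun t ht => h₁ _ t hnW fun F hF => exists_envB (ht F hF).1 (ht F hF).2.1 (ht F hF).2.2)
      (I := (s.image g).filter fun x => x.2.1 * x.2.2.2 = n) (fun x hx => by
        obtain ⟨hx', rfl⟩ := mem_filter.1 hx
        obtain ⟨f, hf, rfl⟩ := hfacts x hx'
        have hi := (hs f hf).2.1
        exact ⟨hFc f hi, hFi f hi, (hmem f hf).2.1, hFm f hi, hka f hi, hd f hi, rfl, hndvd f hi⟩)
    refine h5.trans ?_
    have h6 := h₂ n (by omega)
    have h7 := h₃ n (by omega)
    push_cast at h7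
    have h8 : (W / (n : ℝ) ^ 2) ^ (1 + ε / 2) =
        W ^ (1 + ε / 2) * ((n : ℝ) ^ 2)⁻¹ * ((n : ℝ) ^ (ε / 2))⁻¹ * ((n : ℝ) ^ (ε / 2))⁻¹ := by
      rw [div_eq_mul_inv, mul_rpow (by linarith) (by positivity), inv_rpow (by positivity),
        rpow_add (by positivity : (0 : ℝ) < (n : ℝ) ^ 2), rpow_one,
        sq, mul_rpow hn0.le hn0.le]
      simp only [mul_inv]
      ring
    have hpe : (0 : ℝ) < (n : ℝ) ^ (ε / 2) := by positivity
    calc _ ≤ (c₂ * (n : ℝ) ^ (ε / 2)) * (n / Y * (c₃ * (n : ℝ) ^ (ε / 2))) *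
          (c₁ * (W / (n : ℝ) ^ 2) ^ (1 + ε / 2)) := by gcongr
      _ = _ := by
        rw [h8]
        field_simp
  have hsum : (((s.image g).card : ℕ) : ℝ) ≤
      ∑ n ∈ T, c₂ * c₃ * c₁ * (W ^ (1 + ε / 2) / Y) * (n : ℝ)⁻¹ := by
    rw [card_eq_sum_card_fiberwise (f := fun x => x.2.1 * x.2.2.2) (t := T)]
    · push_cast
      exact sum_le_sum hblock
    · intro x hx
      obtain ⟨f, hf, rfl⟩ := hfacts x hx
      exact (hmem f hf).2.2
  have hharm : ∑ n ∈ T, (n : ℝ)⁻¹ ≤ c₄ * W ^ (ε / 2) := by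
    have h5 : ∑ n ∈ T, (n : ℝ)⁻¹ ≤ ∑ n ∈ Icc 1 N, (n : ℝ)⁻¹ :=
      sum_le_sum_of_subset_of_nonneg (filter_subset _ _) fun _ _ _ => by positivity
    have h6 := harmonic_le_one_add_log N
    rw [harmonic_eq_sum_Icc] at h6
    push_cast at h6
    have hsq : 1 ≤ √W := one_le_sqrt.2 hW
    have hN1 : 1 ≤ N := Nat.le_floor (by simpa using hsq)
    have hNW : (N : ℝ) ≤ 100 * W := by
      have := Nat.floor_le (sqrt_nonneg W)
      have h7 : √W ≤ W := by
        nth_rw 2 [← mul_self_sqrt (by linarith : (0 : ℝ) ≤ W)]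
        nlinarith
      linarith
    exact h5.trans (h6.trans (h₄ W N hW (mod_cast hN1) hNW))
  have hfibR : (#s : ℝ) ≤ 2 * (s.image g).card := mod_cast hfib
  rw [← mul_sum] at hsum
  calc (#s : ℝ) ≤ 2 * (c₂ * c₃ * c₁ * (W ^ (1 + ε / 2) / Y) * (c₄ * W ^ (ε / 2))) := by
        refine hfibR.trans ?_
        gcongr
        refine hsum.trans ?_
        gcongr
    _ = _ := by
        have : W ^ (1 + ε) = W ^ (1 + ε / 2) * W ^ (ε / 2) := by
          rw [← rpow_add (by linarith)]; congr 1; ring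
        rw [this]; ring

section Maximal

open ArithmeticFunction.Moebius

lemma charpoly_coeff_congr {n : Type*} [Fintype n] [DecidableEq n] {A B : Matrix n n ℤ}
    (h : ∀ i j, (N : ℤ) ∣ A i j - B i j) (i : ℕ) :
    (N : ℤ) ∣ A.charpoly.coeff i - B.charpoly.coeff i := by
  have h1 : A.map (Int.castRingHom (ZMod N)) = B.map (Int.castRingHom (ZMod N)) := by
    ext i j
    simp only [Matrix.map_apply, eq_intCast]
    rw [eq_comm, ZMod.intCast_eq_intCast_iff_dvd_sub]
    exact h i j
  have h2 := congrArg (fun M => M.charpoly.coeff i) h1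
  simp only [Matrix.charpoly_map, Polynomial.coeff_map, eq_intCast] at h2
  rwa [eq_comm, ZMod.intCast_eq_intCast_iff_dvd_sub] at h2

lemma mulMat_congr (h : ∀ i, (N : ℤ) ∣ f i - g i) (x : Fin 3 → ℤ)
    (i j : Fin 3) : (N : ℤ) ∣ mulMat f x i j - mulMat g x i j := by
  have h' : ∀ i, ((g i : ℤ) : ZMod N) = f i := fun i =>
    (ZMod.intCast_eq_intCast_iff_dvd_sub _ _ _).2 (h i)
  rw [← ZMod.intCast_eq_intCast_iff_dvd_sub]
  fin_cases i <;> fin_cases j <;> simp [mulMat, h']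

lemma NM.congr (h : ∀ i, ((p ^ 3 : ℕ) : ℤ) ∣ f i - g i) (hf : NM p f) : NM p g := by
  obtain ⟨x, hx, hc⟩ := hf
  refine ⟨x, hx, fun i hi => ?_⟩
  have h1 := charpoly_coeff_congr (mulMat_congr h x) i
  have h2 : (p : ℤ) ^ (3 - i) ∣ ((p ^ 3 : ℕ) : ℤ) := by
    push_cast; exact pow_dvd_pow _ (Nat.sub_le _ _)
  exact (dvd_sub_right (hc i hi)).1 (h2.trans h1)

/-- The product of the primes at which a form is not maximal. -/
def nmRad (f : Form) : ℕ := ∏ p ∈ (fdisc f).natAbs.primeFactors.filter (NM · f), p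

lemma SRed.fdisc_ne_zero (h : SRed f) : fdisc f ≠ 0 := by
  rcases h with h | h
  · exact h.1.ne'
  · exact h.1.ne

lemma nmRad_pos (f : Form) : 0 < nmRad f :=
  prod_pos fun _ hp => (Nat.prime_of_mem_primeFactors (filter_subset _ _ hp)).pos

lemma dvd_nmRad_iff (hf : IrrF f) (h0 : fdisc f ≠ 0) {q : ℕ} (hq : Squarefree q) :
    q ∣ nmRad f ↔ ∀ p : ℕ, p.Prime → p ∣ q → NM p f := by
  have key : ∀ p : ℕ, p.Prime → (p ∣ nmRad f ↔ NM p f) := fun p hp => by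
    constructor
    · intro h
      obtain ⟨p', hp', h⟩ := (Prime.dvd_finset_prod_iff hp.prime _).1 h
      have := (Nat.prime_dvd_prime_iff_eq hp
        (Nat.prime_of_mem_primeFactors (filter_subset _ _ hp'))).1 h
      rw [this]
      exact (mem_filter.1 hp').2
    · intro h
      obtain ⟨F, a, k, d, -, -, -, -, -, hd, hn, -⟩ := hf.exists_hnf
      refine dvd_prod_of_mem _ (mem_filter.2 ⟨Nat.mem_primeFactors.2 ⟨hp, ?_, by
        simpa using h0⟩, h⟩)
      rw [← Int.natCast_dvd, hd, sq, mul_assoc]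
      exact (Int.natCast_dvd_natCast.2 (hn p hp h)).trans (dvd_mul_right _ _)
  constructor
  · exact fun h p hp hpq => (key p hp).1 (hpq.trans h)
  · intro h
    rw [← Nat.prod_primeFactors_of_squarefree hq]
    refine prod_primes_dvd _ (fun p hp => (Nat.prime_of_mem_primeFactors hp).prime) fun p hp => ?_
    have hp' := Nat.prime_of_mem_primeFactors hp
    exact (key p hp').2 (h p hp' (Nat.dvd_of_mem_primeFactors hp))

lemma squarefree_nmRad (f : Form) : Squarefree (nmRad f) := by
  refine squarefree_prod_of_pairwise_isCoprime ?_ fun p hp =>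
    (Nat.prime_of_mem_primeFactors (filter_subset _ _ hp)).squarefree
  intro p hp q hq hpq
  have hp' := Nat.prime_of_mem_primeFactors (filter_subset _ _ hp)
  have hq' := Nat.prime_of_mem_primeFactors (filter_subset _ _ hq)
  exact Nat.coprime_iff_isRelPrime.1 ((Nat.coprime_primes hp' hq').2 hpq)

lemma nmRad_le (hf : IrrF f) (h0 : fdisc f ≠ 0) : (nmRad f : ℝ) ≤ |Δ f| := by
  have hd : nmRad f ∣ (fdisc f).natAbs := prod_primes_dvd _
    (fun p hp => (Nat.prime_of_mem_primeFactors (filter_subset _ _ hp)).prime)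
    fun p hp => Nat.dvd_of_mem_primeFactors (filter_subset _ _ hp)
  have := Nat.le_of_dvd (by simpa [Nat.pos_iff_ne_zero] using h0) hd
  rw [← Int.cast_abs, Int.abs_eq_natAbs]
  exact_mod_cast this

/-- Representatives of the residue classes of binary cubic forms. -/
def resBox (N : ℕ) : Finset Form := Fintype.piFinset fun _ => Ico 0 (N : ℤ)

lemma card_resBox (N : ℕ) : (resBox N).card = N ^ 4 := by simp [resBox]

lemma ncard_eq_sum_resBox {S : Set Form} (hS : S.Finite) (hN : 0 < N) :
    S.ncard = ∑ w ∈ resBox N, {f | f ∈ S ∧ ∀ i, (N : ℤ) ∣ f i - w i}.ncard := by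
  have hN' : (0 : ℤ) < N := mod_cast hN
  rw [Set.ncard_eq_toFinset_card S hS, card_eq_sum_card_fiberwise
    (f := fun (f : Form) (i : Fin 4) => f i % (N : ℤ)) (t := resBox N)]
  · refine sum_congr rfl fun w hw => ?_
    rw [← Set.ncard_coe_finset]
    congr 1
    ext f
    simp only [coe_filter, Set.Finite.mem_toFinset, Set.mem_setOf_eq, and_congr_right_iff]
    intro _
    rw [resBox, Fintype.mem_piFinset] at hw
    rw [funext_iff]
    refine forall_congr' fun i => ?_
    have h1 := mem_Ico.1 (hw i)
    rw [Int.dvd_iff_emod_eq_zero, ← Int.emod_eq_emod_iff_emod_sub_eq_zero,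
      Int.emod_eq_of_lt h1.1 h1.2]
  · intro f _
    simp only [resBox, mem_coe, Fintype.mem_piFinset, mem_Ico]
    exact fun i => ⟨Int.emod_nonneg _ hN'.ne', Int.emod_lt_of_pos _ hN'⟩

lemma exists_dvd_nmRad_asymp : ∃ K δ : ℝ, 0 < K ∧ 0 < δ ∧ ∀ (M q : ℕ) (v : Form), 0 < M →
    Squarefree q → ∃ C : ℝ, ∀ W : ℝ, 1 ≤ W →
      |({f | f ∈ irrSet M v W ∧ q ∣ nmRad f}.ncard : ℝ) - C * W| ≤
        K * (M * q ^ 3) ^ 9 * W ^ (1 - δ) := by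
  obtain ⟨K, δ, hK, hδ, H⟩ := exists_irrSet_asymp
  refine ⟨K, δ, hK, hδ, fun M q v hM hq => ?_⟩
  have hN : 0 < M * q ^ 3 := Nat.mul_pos hM (pow_pos hq.ne_zero.bot_lt 3)
  choose C hC using fun w => H (M * q ^ 3) w hN
  set good : Form → Prop := fun w => (∀ i, (M : ℤ) ∣ w i - v i) ∧
    ∀ p : ℕ, p.Prime → p ∣ q → NM p w with hgood
  refine ⟨∑ w ∈ resBox (M * q ^ 3), if good w then C w else 0, fun W hW => ?_⟩
  have hclass : ∀ w, {f | f ∈ {f | f ∈ irrSet M v W ∧ q ∣ nmRad f} ∧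
      ∀ i, ((M * q ^ 3 : ℕ) : ℤ) ∣ f i - w i} = if good w then irrSet (M * q ^ 3) w W else ∅ := by
    intro w
    have hM' : ∀ f : Form, (∀ i, ((M * q ^ 3 : ℕ) : ℤ) ∣ f i - w i) →
        ∀ i, (M : ℤ) ∣ f i - w i := fun f hf i =>
      (by push_cast; exact dvd_mul_right _ _ : (M : ℤ) ∣ ((M * q ^ 3 : ℕ) : ℤ)).trans (hf i)
    have hp' : ∀ f : Form, (∀ i, ((M * q ^ 3 : ℕ) : ℤ) ∣ f i - w i) → ∀ p, p ∣ q →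
        ∀ i, ((p ^ 3 : ℕ) : ℤ) ∣ f i - w i := fun f hf p hp i =>
      (Int.natCast_dvd_natCast.2 ((pow_dvd_pow_of_dvd hp 3).trans (dvd_mul_left _ _))).trans (hf i)
    split_ifs with hw
    · ext f
      simp only [irrSet, Set.mem_setOf_eq]
      constructor
      · rintro ⟨⟨⟨-, h2, h3, h4⟩, -⟩, h5⟩
        exact ⟨h5, h2, h3, h4⟩
      · rintro ⟨h5, h2, h3, h4⟩
        refine ⟨⟨⟨fun i => ?_, h2, h3, h4⟩, (dvd_nmRad_iff h3 h2.fdisc_ne_zero hq).2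
          fun p hp hpq => (hw.2 p hp hpq).congr fun i => ?_⟩, h5⟩
        · rw [← sub_add_sub_cancel (f i) (w i)]
          exact dvd_add (hM' f h5 i) (hw.1 i)
        · rw [← neg_sub]; exact (hp' f h5 p hpq i).neg_right
    · rw [Set.eq_empty_iff_forall_notMem]
      rintro f ⟨⟨⟨h1, h2, h3, h4⟩, h6⟩, h5⟩
      refine hw ⟨fun i => ?_, fun p hp hpq => ((dvd_nmRad_iff h3 h2.fdisc_ne_zero hq).1 h6 p hp
        hpq).congr (hp' f h5 p hpq)⟩
      rw [← sub_sub_sub_cancel_left _ _ (f i)]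
      exact dvd_sub (h1 i) (hM' f h5 i)
  rw [ncard_eq_sum_resBox ((irrSet_finite M v W).subset fun f hf => hf.1) hN, sum_mul]
  push_cast
  rw [← sum_sub_distrib]
  refine (abs_sum_le_sum_abs _ _).trans ((sum_le_card_nsmul _ _
    (K * ((M * q ^ 3 : ℕ) : ℝ) ^ 5 * W ^ (1 - δ)) fun w _ => ?_).trans (le_of_eq ?_))
  · have h1 := hclass w
    push_cast at h1
    rw [h1]
    split_ifs with hw
    · exact hC w W hW
    · have : 0 < W := by linarith
      simp only [Set.ncard_empty, Nat.cast_zero, zero_mul, sub_zero, abs_zero]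
      positivity
  · rw [card_resBox, nsmul_eq_mul]
    push_cast
    ring

/-- Strictly reduced, irreducible, maximal binary cubic forms of bounded discriminant in a
residue class. -/
def maxSet (M : ℕ) (v : Form) (W : ℝ) : Set Form :=
  {f | f ∈ irrSet M v W ∧ ∀ p : ℕ, p.Prime → ¬ NM p f}

lemma nmRad_eq_one_iff (hf : IrrF f) (h0 : fdisc f ≠ 0) :
    nmRad f = 1 ↔ ∀ p : ℕ, p.Prime → ¬ NM p f := by
  rw [Nat.eq_one_iff_not_exists_prime_dvd]
  refine forall_congr' fun p => forall_congr' fun hp => not_congr ?_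
  rw [dvd_nmRad_iff hf h0 hp.squarefree]
  exact ⟨fun h => h p hp dvd_rfl, fun h p' hp' hd =>
    ((Nat.prime_dvd_prime_iff_eq hp' hp).1 hd).symm ▸ h⟩

lemma abs_moebius_truncated_le {n : ℕ} (hn : n ≠ 0) (Y : ℕ) :
    |(if n = 1 then 1 else 0 : ℝ) - ∑ q ∈ Icc 1 Y, (μ q : ℝ) * (if q ∣ n then 1 else 0)| ≤
      if Y < n then (#n.divisors : ℝ) else 0 := by
  have h1 : (if n = 1 then 1 else 0 : ℝ) = ∑ q ∈ n.divisors, (μ q : ℝ) := by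
    have := congrArg (fun g => ((g n : ℤ) : ℝ)) ArithmeticFunction.coe_zeta_mul_moebius
    simp only [ArithmeticFunction.coe_zeta_mul_apply, ArithmeticFunction.one_apply] at this
    push_cast at this
    exact this.symm
  have h2 : ∑ q ∈ Icc 1 Y, (μ q : ℝ) * (if q ∣ n then 1 else 0) =
      ∑ q ∈ n.divisors.filter (· ≤ Y), (μ q : ℝ) := by
    simp only [mul_ite, mul_one, mul_zero]
    rw [← sum_filter]
    refine sum_congr ?_ fun _ _ => rfl
    ext q
    simp only [mem_filter, mem_Icc, Nat.mem_divisors]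
    exact ⟨fun h => ⟨⟨h.2, hn⟩, h.1.2⟩, fun h => ⟨⟨Nat.pos_of_dvd_of_pos h.1.1 hn.bot_lt, h.2⟩,
      h.1.1⟩⟩
  rw [h1, h2, ← sum_filter_add_sum_filter_not n.divisors (· ≤ Y), add_sub_cancel_left]
  split_ifs with h
  · refine (abs_sum_le_sum_abs _ _).trans ((sum_le_card_nsmul _ _ 1 fun q _ => ?_).trans ?_)
    · exact_mod_cast ArithmeticFunction.abs_moebius_le_one
    · rw [nsmul_one]
      exact_mod_cast card_filter_le _ _
  · rw [sum_eq_zero, abs_zero]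
    intro q hq
    obtain ⟨hq, hq'⟩ := mem_filter.1 hq
    exact absurd ((Nat.le_of_dvd hn.bot_lt (Nat.dvd_of_mem_divisors hq)).trans (not_lt.1 h)) hq'

lemma exists_maxSet_asymp_of_one_le : ∃ K δ : ℝ, 0 < K ∧ 0 < δ ∧ ∀ (M : ℕ) (v : Form), 0 < M →
    ∃ C : ℝ, ∀ W : ℝ, 1 ≤ W → |((maxSet M v W).ncard : ℝ) - C * W| ≤ K * M ^ 9 * W ^ (1 - δ) := by
  obtain ⟨K, δ, hK, hδ, H⟩ := exists_dvd_nmRad_asymp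
  obtain ⟨δ', c, hδ', hc, hlim⟩ := exists_asymp_of_truncated (b := 28) (by norm_num) hδ one_pos
  set ε := δ / (8 * 28) with hε
  have hε0 : 0 < ε := by positivity
  obtain ⟨c₁, hc₁, ht⟩ := exists_card_index_tail hε0
  obtain ⟨c₂, hc₂, hd⟩ := exists_card_divisors_le hε0
  refine ⟨c * (K + c₁ * c₂), δ', by positivity, hδ', fun M v hM => ?_⟩
  choose! C hC using fun q (hq : Squarefree q) => H M q v hM hq
  have hM1 : (1 : ℝ) ≤ (M : ℝ) ^ 9 := one_le_pow₀ (mod_cast hM)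
  rw [mul_assoc]
  refine hlim (fun W => ((maxSet M v W).ncard : ℝ)) (fun k => ∑ q ∈ Icc 1 (2 ^ k), (μ q : ℝ) * C q)
    ((K + c₁ * c₂) * M ^ 9) (by positivity) fun W hW k => ?_
  have hW0 : 0 < W := by linarith
  set S := (irrSet_finite M v W).toFinset with hS
  have hmem : ∀ f, f ∈ S ↔ f ∈ irrSet M v W := fun f => Set.Finite.mem_toFinset _
  have hG : ((maxSet M v W).ncard : ℝ) = ∑ f ∈ S, if nmRad f = 1 then 1 else 0 := by
    rw [sum_boole, ← Set.ncard_coe_finset]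
    congr 2
    ext f
    simp only [coe_filter, hmem, maxSet, Set.mem_setOf_eq, and_congr_right_iff]
    exact fun hf => (nmRad_eq_one_iff hf.2.2.1 hf.2.1.fdisc_ne_zero).symm
  have hH : ∀ q : ℕ, ({f | f ∈ irrSet M v W ∧ q ∣ nmRad f}.ncard : ℝ) =
      ∑ f ∈ S, if q ∣ nmRad f then 1 else 0 := fun q => by
    rw [sum_boole, ← Set.ncard_coe_finset]
    congr 2
    ext f
    simp [hmem]
  have hA : |((maxSet M v W).ncard : ℝ) - ∑ q ∈ Icc 1 (2 ^ k),
      (μ q : ℝ) * ({f | f ∈ irrSet M v W ∧ q ∣ nmRad f}.ncard : ℝ)| ≤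
      c₁ * c₂ * (W ^ (1 + 2 * ε) / 2 ^ k) := by
    have hT := ht W (2 ^ k) (S.filter fun f => 2 ^ k < nmRad f) hW (one_le_pow₀ one_le_two)
      fun f hf => by
        obtain ⟨hf, hf'⟩ := mem_filter.1 hf
        rw [hmem] at hf
        exact ⟨hf.2.1, hf.2.2.1, hf.2.2.2, nmRad f, squarefree_nmRad f, mod_cast hf'.le,
          (dvd_nmRad_iff hf.2.2.1 hf.2.1.fdisc_ne_zero (squarefree_nmRad f)).1 dvd_rfl⟩
    have hsw : ∑ q ∈ Icc 1 (2 ^ k), (μ q : ℝ) * ({f | f ∈ irrSet M v W ∧ q ∣ nmRad f}.ncard : ℝ) =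
        ∑ f ∈ S, ∑ q ∈ Icc 1 (2 ^ k), (μ q : ℝ) * (if q ∣ nmRad f then 1 else 0) := by
      rw [sum_comm]
      refine sum_congr rfl fun q _ => ?_
      rw [hH, mul_sum]
    rw [hsw, hG, ← sum_sub_distrib]
    calc _ ≤ ∑ f ∈ S, if 2 ^ k < nmRad f then ((nmRad f).divisors.card : ℝ) else 0 :=
          (abs_sum_le_sum_abs _ _).trans (sum_le_sum fun f _ =>
            abs_moebius_truncated_le (nmRad_pos f).ne' _)
      _ = ∑ f ∈ S.filter fun f => 2 ^ k < nmRad f, ((nmRad f).divisors.card : ℝ) :=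
          (sum_filter _ _).symm
      _ ≤ (S.filter fun f => 2 ^ k < nmRad f).card • (c₂ * W ^ ε) := by
          refine sum_le_card_nsmul _ _ _ fun f hf => ?_
          have hf := (hmem f).1 (mem_filter.1 hf).1
          refine (hd _ (nmRad_pos f).ne').trans ?_
          gcongr
          exact (nmRad_le hf.2.2.1 hf.2.1.fdisc_ne_zero).trans hf.2.2.2
      _ ≤ c₁ * (W ^ (1 + ε) / 2 ^ k) * (c₂ * W ^ ε) := by rw [nsmul_eq_mul]; gcongr
      _ = c₁ * c₂ * (W ^ (1 + 2 * ε) / 2 ^ k) := by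
          rw [show 1 + 2 * ε = (1 + ε) + ε by ring, rpow_add hW0 (1 + ε) ε]; ring
  have hB : |∑ q ∈ Icc 1 (2 ^ k), (μ q : ℝ) * ({f | f ∈ irrSet M v W ∧ q ∣ nmRad f}.ncard : ℝ) -
      (∑ q ∈ Icc 1 (2 ^ k), (μ q : ℝ) * C q) * W| ≤
      K * M ^ 9 * ((2 ^ k) ^ 28 * W ^ (1 - δ)) := by
    rw [sum_mul, ← sum_sub_distrib]
    refine (abs_sum_le_sum_abs _ _).trans ((sum_le_card_nsmul _ _
      (K * (M * (2 ^ k) ^ 3) ^ 9 * W ^ (1 - δ)) fun q hq => ?_).trans (le_of_eq ?_))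
    · by_cases hsq : Squarefree q
      · rw [mul_assoc, ← mul_sub, abs_mul]
        have h1 : |((μ q : ℤ) : ℝ)| ≤ 1 := by exact_mod_cast ArithmeticFunction.abs_moebius_le_one
        have h2 : (q : ℝ) ≤ 2 ^ k := mod_cast (mem_Icc.1 hq).2
        refine (mul_le_of_le_one_left (abs_nonneg _) h1).trans ((hC q hsq W hW).trans ?_)
        gcongr
      · rw [ArithmeticFunction.moebius_eq_zero_of_not_squarefree hsq]
        simp only [Int.cast_zero, zero_mul, sub_zero, abs_zero]
        positivity
    · rw [Nat.card_Icc, nsmul_eq_mul]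
      push_cast [Nat.add_sub_cancel]
      ring
  have hexp : (1 : ℝ) + 1 * δ / (4 * 28) = 1 + 2 * ε := by rw [hε]; ring
  rw [hexp, rpow_neg_one, show ((2 : ℝ) ^ k) ^ (28 : ℝ) = ((2 : ℝ) ^ k) ^ 28 by norm_cast]
  refine (abs_sub_le _ _ _).trans ((add_le_add hA hB).trans ?_)
  have hx : 0 ≤ W ^ (1 + 2 * ε) / 2 ^ k := by positivity
  have hy : 0 ≤ ((2 : ℝ) ^ k) ^ 28 * W ^ (1 - δ) := by positivity
  have hcc : 0 < c₁ * c₂ := by positivity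
  rw [div_eq_mul_inv] at hx ⊢
  nlinarith [mul_nonneg (mul_nonneg hcc.le hx) (sub_nonneg.2 hM1), mul_nonneg hcc.le
    (mul_nonneg (zero_le_one.trans hM1) hy), mul_nonneg hK.le (mul_nonneg (zero_le_one.trans hM1) hx)]

/-- The number of strictly reduced maximal irreducible forms in a residue class, with a power
saving error term that is polynomial in the modulus. -/
theorem exists_maxSet_asymp : ∃ K δ : ℝ, 0 < K ∧ 0 < δ ∧ δ ≤ 1 ∧ ∀ (M : ℕ) (v : Form), 0 < M →
    ∃ C : ℝ, ∀ W : ℝ, 0 < W → |((maxSet M v W).ncard : ℝ) - C * W| ≤ K * M ^ 9 * W ^ (1 - δ) := by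
  obtain ⟨K, δ, hK, hδ, H⟩ := exists_maxSet_asymp_of_one_le
  set N := (irrSet 1 0 1).ncard with hN
  refine ⟨K + N, min δ 1, by positivity, lt_min hδ one_pos, min_le_right _ _, fun M v hM => ?_⟩
  obtain ⟨C, hC⟩ := H M v hM
  have hM1 : (1 : ℝ) ≤ (M : ℝ) ^ 9 := one_le_pow₀ (mod_cast hM)
  refine ⟨C, fun W hW => ?_⟩
  rcases le_or_gt 1 W with hW1 | hW1
  · refine (hC W hW1).trans ?_
    gcongr
    · linarith [(Nat.cast_nonneg N : (0 : ℝ) ≤ N)]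
    · exact min_le_left _ _
  · have h0 : maxSet M v W = ∅ := by
      rw [Set.eq_empty_iff_forall_notMem]
      rintro f ⟨⟨-, h1, -, h2⟩, -⟩
      have : (1 : ℝ) ≤ |Δ f| := by exact_mod_cast Int.one_le_abs h1.fdisc_ne_zero
      linarith
    have h1 : |C| ≤ (K + N) * M ^ 9 := by
      have h2 := hC 1 le_rfl
      have h3 : ((maxSet M v 1).ncard : ℝ) ≤ N := by
        have : maxSet M v 1 ⊆ irrSet 1 0 1 := fun f hf => ⟨by simp, hf.1.2⟩
        exact_mod_cast Set.ncard_le_ncard this (irrSet_finite _ _ _)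
      have h4 : (N : ℝ) ≤ N * M ^ 9 := le_mul_of_one_le_right (Nat.cast_nonneg N) hM1
      have h5 : (0 : ℝ) ≤ (maxSet M v 1).ncard := Nat.cast_nonneg _
      rw [one_rpow, mul_one, mul_one, abs_le] at h2
      rw [abs_le, add_mul]
      constructor <;> nlinarith [mul_nonneg hK.le (zero_le_one.trans hM1)]
    rw [h0, Set.ncard_empty, Nat.cast_zero, zero_sub, abs_neg, abs_mul, abs_of_pos hW]
    gcongr
    conv_lhs => rw [← rpow_one W]
    exact rpow_le_rpow_of_exponent_ge hW hW1.le (by linarith [lt_min hδ one_pos])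

end Maximal

section Compositum

open Matrix

variable {ι : Type*} [Fintype ι]

/-- The matrix of multiplication by `∑ x (i, j) eᵢ lⱼ`, where `e` is the normalised basis of the cubic
ring of `f` and `Λ j` is the matrix of multiplication by `l j`. -/
def compMat (f : Form) (Λ : ι → Matrix ι ι ℤ) (x : Fin 3 × ι → ℤ) :
    Matrix (Fin 3 × ι) (Fin 3 × ι) ℤ :=
  ∑ p, x p • kroneckerMap (· * ·) (mulMat f (Pi.single p.1 1)) (Λ p.2)

lemma compMat_congr (h : ∀ i, (N : ℤ) ∣ f i - g i)
    (Λ : ι → Matrix ι ι ℤ) (x : Fin 3 × ι → ℤ) (p q : Fin 3 × ι) :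
    (N : ℤ) ∣ compMat f Λ x p q - compMat g Λ x p q := by
  simp only [compMat, Matrix.sum_apply, Matrix.smul_apply, kroneckerMap_apply]
  rw [← sum_sub_distrib]
  refine dvd_sum fun r _ => ?_
  rw [smul_eq_mul, smul_eq_mul, ← mul_sub, ← sub_mul]
  exact dvd_mul_of_dvd_right (dvd_mul_of_dvd_left (mulMat_congr h _ _ _) _) _

/-- The trace form attached to multiplication matrices. -/
def trMat {κ : Type*} [Fintype κ] (Λ : κ → Matrix κ κ ℤ) : Matrix κ κ ℤ :=
  Matrix.of fun j k => (Λ j * Λ k).trace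

lemma det_trMat_mulMat (f : Form) : (trMat fun i => mulMat f (Pi.single i 1)).det = fdisc f := by
  rw [det_fin_three]
  simp [trMat, mulMat, Matrix.trace_fin_three, fdisc]
  ring

lemma det_sq_eq_of_lattice_eq {κ : Type*} [Fintype κ] [DecidableEq κ] {X Y : Matrix κ κ ℤ}
    (h : ∀ x : κ → ℤ, (∃ u, x = u ᵥ* X) ↔ ∃ u, x = u ᵥ* Y) : X.det ^ 2 = Y.det ^ 2 := by
  have key : ∀ {X Y : Matrix κ κ ℤ}, (∀ x : κ → ℤ, (∃ u, x = u ᵥ* X) → ∃ u, x = u ᵥ* Y) →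
      Y.det ∣ X.det := by
    intro X Y h
    choose U hU using fun i => h (X i) ⟨Pi.single i 1, by simp [Matrix.row]⟩
    have : X = Matrix.of U * Y := by
      ext i j
      rw [hU]
      rfl
    rw [this, det_mul]
    exact dvd_mul_left _ _
  exact (sq_eq_sq_iff_abs_eq_abs _ _).2 (by
    rw [Int.abs_eq_natAbs, Int.abs_eq_natAbs, Int.natAbs_eq_of_dvd_dvd (key fun x => (h x).2)
      (key fun x => (h x).1)])

variable [DecidableEq ι] {K E : Type*} [Field K] [NumberField K] [Field E] [NumberField E] [Algebra K E]

lemma exists_smul_eq_of_isIntegral {ω θ : K} (hb : IntBasis ω θ)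
    (l : Basis ι K E) {Λ : ι → Matrix ι ι ℤ}
    (hΛ : ∀ j k, l j * l k = ∑ i, Λ j i k • l i) (hl : ∀ j, IsIntegral ℤ (l j))
    {y : E} (hy : IsIntegral ℤ y) :
    ∃ x : Fin 3 × ι → ℤ, ((trMat Λ).det : E) * y =
      ∑ j, ((x (0, j) + x (1, j) * ω + x (2, j) * θ : K)) • l j := by
  have hlm : ∀ j, Algebra.leftMulMatrix l (l j) = (Λ j).map (Int.castRingHom K) := fun j => by
    ext i k
    rw [Algebra.leftMulMatrix_eq_repr_mul, hΛ]
    simp only [← Int.cast_smul_eq_zsmul K]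
    rw [l.repr_sum_self, Matrix.map_apply, eq_intCast]
  have htr : ∀ j k, Algebra.trace K E (l j * l k) = ((trMat Λ j k : ℤ) : K) := fun j k => by
    rw [Algebra.trace_eq_matrix_trace l, map_mul, hlm, hlm, trMat, of_apply, ← Matrix.map_mul]
    simp [Matrix.trace]
  have hv : ∀ k, IsIntegral ℤ (Algebra.trace K E (y * l k)) := fun k =>
    Algebra.isIntegral_trace (hy.mul (hl k))
  have hvy : ∀ k, Algebra.trace K E (y * l k) = ∑ j, l.repr y j * ((trMat Λ j k : ℤ) : K) := by
    intro k
    conv_lhs => rw [← l.sum_repr y, sum_mul, map_sum]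
    refine sum_congr rfl fun j _ => ?_
    rw [smul_mul_assoc, map_smul, htr, smul_eq_mul]
  have hint : ∀ j, IsIntegral ℤ (((trMat Λ).det : K) * l.repr y j) := fun j => by
    have h1 : (fun k => Algebra.trace K E (y * l k)) =
        (fun j => l.repr y j) ᵥ* ((trMat Λ).map (Int.castRingHom K)) := by
      funext k; rw [hvy]; rfl
    have h2 := congrArg (fun v => (v ᵥ* ((trMat Λ).map (Int.castRingHom K)).adjugate) j) h1
    simp only [vecMul_vecMul, mul_adjugate, vecMul_smul, vecMul_one, Pi.smul_apply,
      smul_eq_mul] at h2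
    rw [← RingHom.mapMatrix_apply, ← RingHom.map_det, ← RingHom.map_adjugate] at h2
    rw [← eq_intCast (Int.castRingHom K), ← h2]
    refine IsIntegral.sum _ fun k _ => (hv k).mul ?_
    exact isIntegral_algebraMap (x := (trMat Λ).adjugate k j)
  choose i j k h using fun j => (hb.2 _).1 (hint j)
  refine ⟨fun p => ![i p.2, j p.2, k p.2] p.1, ?_⟩
  conv_lhs => rw [← l.sum_repr y, mul_sum]
  refine sum_congr rfl fun a _ => ?_
  have : (((trMat Λ).det : ℤ) : E) = algebraMap K E ((trMat Λ).det : ℤ) := by simp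
  rw [this, ← Algebra.smul_def, smul_smul, h]
  rfl

/-- The integral elements of the compositum of a cubic field `K` with index form `f` and a field with
multiplication matrices `Λ`: they form a lattice depending on `f` only through congruence
conditions, and the covolume of this lattice determines the discriminant. -/
lemma exists_compMat_lattice {ω θ : K} (hb : IntBasis ω θ) (hf : IdxPair f ω θ)
    (h3 : finrank ℚ K = 3) (l : Basis ι K E) {Λ : ι → Matrix ι ι ℤ}
    (hΛ : ∀ j k, l j * l k = ∑ i, Λ j i k • l i) (hl : ∀ j, IsIntegral ℤ (l j))
    (hD : (trMat Λ).det ≠ 0) :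
    ∃ X : Matrix (Fin 3 × ι) (Fin 3 × ι) ℤ,
      (∀ x, (∀ i ≤ 3 * Fintype.card ι, (trMat Λ).det ^ (3 * Fintype.card ι - i) ∣
        (compMat f Λ x).charpoly.coeff i) ↔ ∃ u, x = u ᵥ* X) ∧
      NumberField.discr E * (trMat Λ).det ^ (2 * (3 * Fintype.card ι)) =
        X.det ^ 2 * (fdisc f ^ Fintype.card ι * (trMat Λ).det ^ 3) := by
  obtain ⟨e, he⟩ := hb.1.exists_basis h3
  set b : Basis (Fin 3 × ι) ℚ E := e.smulTower l with hbdef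
  have hbp : ∀ p, b p = e p.1 • l p.2 := fun p => Basis.smulTower_apply _ _ _
  have hcard : Fintype.card (Fin 3 × ι) = 3 * Fintype.card ι := by simp
  set D := (trMat Λ).det with hDdef
  have hDE : (D : E) ≠ 0 := mod_cast hD
  have hee : ∀ i j, e i * e j = ∑ k, mulMat f (Pi.single i 1) k j • e k := fun i j => by
    have h1 := Algebra.leftMulMatrix_mulVec_repr e (e i) (e j)
    have h2 : e i = ((Pi.single i 1 : Fin 3 → ℤ) 0 : K) + ((Pi.single i 1 : Fin 3 → ℤ) 1 : K) * ω +
        ((Pi.single i 1 : Fin 3 → ℤ) 2 : K) * θ := by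
      rw [he]; fin_cases i <;> simp
    rw [← e.sum_repr (e i * e j), ← h1]
    refine sum_congr rfl fun k _ => ?_
    rw [← Int.cast_smul_eq_zsmul ℚ, e.repr_self, Finsupp.single_eq_pi_single, mulVec_single_one]
    conv_lhs => rw [h2, hf.leftMulMatrix he]
    rfl
  have hlm : ∀ p, Algebra.leftMulMatrix b (b p) =
      (kroneckerMap (· * ·) (mulMat f (Pi.single p.1 1)) (Λ p.2)).map (Int.castRingHom ℚ) := by
    intro p
    refine leftMulMatrix_of_sum b _ _ fun q => ?_
    rw [hbp, hbp, smul_mul_smul_comm, hee, hΛ, sum_smul_sum, ← sum_product']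
    refine sum_congr rfl fun r _ => ?_
    rw [hbp, Matrix.map_apply, kroneckerMap_apply, eq_intCast, Int.cast_smul_eq_zsmul]
    module
  have hlmx : ∀ x : Fin 3 × ι → ℤ, Algebra.leftMulMatrix b (∑ p, x p • b p) =
      (compMat f Λ x).map (Int.cast : ℤ → ℚ) := fun x => by
    rw [map_sum]
    simp only [map_zsmul, hlm]
    ext q r
    simp only [compMat, Matrix.sum_apply, Matrix.smul_apply, Matrix.map_apply]
    simp
  have hint : ∀ x : Fin 3 × ι → ℤ, IsIntegral ℤ ((∑ p, x p • b p) / D) ↔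
      ∀ i ≤ 3 * Fintype.card ι, D ^ (3 * Fintype.card ι - i) ∣
        (compMat f Λ x).charpoly.coeff i := fun x => by
    rw [isIntegral_div_iff b (hlmx x) hD, hcard]
  have hmem : ∀ y : E, IsIntegral ℤ y → ∃ x : Fin 3 × ι → ℤ, (D : E) * y = ∑ p, x p • b p := by
    intro y hy
    obtain ⟨x, hx⟩ := exists_smul_eq_of_isIntegral hb l hΛ hl hy
    refine ⟨x, hx.trans ?_⟩
    rw [Fintype.sum_prod_type_right]
    refine sum_congr rfl fun j _ => ?_
    rw [Fin.sum_univ_three]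
    simp only [hbp, he]
    simp only [← Int.cast_smul_eq_zsmul K, smul_smul, ← add_smul]
    simp
  let B : Basis (Fin 3 × ι) ℤ (NumberField.RingOfIntegers E) :=
    (NumberField.RingOfIntegers.basis E).reindex (Fintype.equivOfCardEq (by
      rw [← finrank_eq_card_chooseBasisIndex, NumberField.RingOfIntegers.rank,
        ← finrank_eq_card_basis b]))
  have hdisc : (NumberField.discr E : ℚ) = Algebra.discr ℚ fun p => (B p : E) := by
    rw [← NumberField.discr_eq_discr E B, ← eq_intCast (algebraMap ℤ ℚ),
      ← Algebra.discr_localizationLocalization ℤ (nonZeroDivisors ℤ) E B (Rₘ := ℚ)]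
    congr 1
    funext p
    rw [Basis.localizationLocalization_apply]
  choose X hX using fun p => hmem (B p) (B p).2
  have hdb : Algebra.discr ℚ b = ((fdisc f ^ Fintype.card ι * D ^ 3 : ℤ) : ℚ) := by
    have : Algebra.traceMatrix ℚ b = (kroneckerMap (· * ·) (trMat fun i =>
        mulMat f (Pi.single i 1)) (trMat Λ)).map (Int.castRingHom ℚ) := by
      ext p q
      rw [Algebra.traceMatrix_apply, Algebra.traceForm_apply, Algebra.trace_eq_matrix_trace b,
        map_mul, hlm, hlm, ← Matrix.map_mul, ← mul_kronecker_mul, Matrix.map_apply,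
        kroneckerMap_apply, trMat, trMat, of_apply, of_apply, ← trace_kronecker]
      simp [Matrix.trace]
    rw [Algebra.discr_def, this, ← RingHom.mapMatrix_apply, ← RingHom.map_det, det_kronecker,
      det_trMat_mulMat, eq_intCast, Fintype.card_fin]
  have hX1 : (fun p => (D : E) * (B p : E)) =
      ((Matrix.of X).map (Int.castRingHom ℚ)).map (algebraMap ℚ E) *ᵥ b := by
    funext p
    rw [hX]
    simp [mulVec, dotProduct]
  have hX2 : (fun p => (D : E) * (B p : E)) =
      ((D : ℚ) • (1 : Matrix (Fin 3 × ι) (Fin 3 × ι) ℚ)).map (algebraMap ℚ E) *ᵥ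
        fun p => (B p : E) := by
    rw [Matrix.map_smul' _ _ _ (map_mul _), Matrix.map_one _ (map_zero _) (map_one _), smul_mulVec,
      one_mulVec]
    funext p
    simp
  have key : NumberField.discr E * D ^ (2 * (3 * Fintype.card ι)) =
      (Matrix.of X).det ^ 2 * (fdisc f ^ Fintype.card ι * D ^ 3) := by
    have h1 := congrArg (Algebra.discr ℚ) hX1
    have h2 := congrArg (Algebra.discr ℚ) hX2
    rw [Algebra.discr_of_matrix_mulVec, ← RingHom.mapMatrix_apply, ← RingHom.map_det, hdb,
      eq_intCast] at h1
    rw [Algebra.discr_of_matrix_mulVec, det_smul, det_one, mul_one, hcard, ← hdisc, h1] at h2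
    rw [pow_mul', mul_comm]
    exact_mod_cast h2.symm
  refine ⟨Matrix.of X, fun x => ?_, key⟩
  have hsum : ∀ u : Fin 3 × ι → ℤ, (D : E) * ∑ p, u p • (B p : E) =
      ∑ q, (u ᵥ* Matrix.of X) q • b q := fun u => by
    simp only [mul_sum, mul_smul_comm, hX, smul_sum, vecMul, dotProduct, of_apply,
      sum_smul, smul_smul]
    exact sum_comm
  have hinj : ∀ x y : Fin 3 × ι → ℤ, ∑ p, x p • b p = ∑ p, y p • b p → x = y := fun x y h => by
    simp only [← Int.cast_smul_eq_zsmul ℚ] at h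
    funext q
    have h1 : b.repr _ q = b.repr _ q := congrArg (fun z => b.repr z q) h
    rw [b.repr_sum_self, b.repr_sum_self] at h1
    exact_mod_cast h1
  rw [← hint]
  constructor
  · intro h
    refine ⟨fun p => B.repr ⟨_, h⟩ p, hinj _ _ ?_⟩
    rw [← hsum]
    have h1 := congrArg (fun z : NumberField.RingOfIntegers E => (z : E)) (B.sum_repr ⟨_, h⟩)
    simp only [map_sum, map_zsmul] at h1
    rw [h1]
    exact (mul_div_cancel₀ _ hDE).symm
  · rintro ⟨u, rfl⟩
    rw [← hsum, mul_div_cancel_left₀ _ hDE]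
    exact IsIntegral.sum _ fun p _ => (B p).2.smul _

end Compositum

section LocalFactor

open Matrix NumberField

variable {K L : Fld}

lemma absDisc_eq (K : Fld) [NumberField K] : absDisc K = (discr K).natAbs :=
  dif_pos (inferInstance : FiniteDimensional ℚ K)

lemma absDisc_pos (K : Fld) [FiniteDimensional ℚ K] : 0 < absDisc K := by
  have : NumberField K := ⟨⟩
  rw [absDisc_eq]
  exact Int.natAbs_pos.2 (discr_ne_zero K)

/-- Multiplication matrices, on an integral basis, of the ring of integers of `L`. -/
def basisMat (L : Fld) [NumberField L] : Module.Free.ChooseBasisIndex ℤ (𝓞 L) →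
      Matrix (Module.Free.ChooseBasisIndex ℤ (𝓞 L)) (Module.Free.ChooseBasisIndex ℤ (𝓞 L)) ℤ :=
  fun j => Algebra.leftMulMatrix (RingOfIntegers.basis L) (RingOfIntegers.basis L j)

lemma det_trMat_basisMat [NumberField L] : (trMat (basisMat L)).det = discr L := by
  refine congr_arg Matrix.det ?_
  ext j k
  rw [Algebra.traceMatrix_apply, Algebra.traceForm_apply,
    Algebra.trace_eq_matrix_trace (RingOfIntegers.basis L), map_mul]
  rfl

lemma card_basisIndex [NumberField L] :
    Fintype.card (Module.Free.ChooseBasisIndex ℤ (𝓞 L)) = finrank ℚ L := by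
  rw [← RingOfIntegers.rank L, finrank_eq_card_chooseBasisIndex]

lemma exists_sup_lattice [NumberField K] [NumberField L]
    (h3 : finrank ℚ K = 3) (hm : finrank ℚ ↥(K ⊔ L) = 3 * finrank ℚ L)
    (hf : IsIdx f K) :
    ∃ X : Matrix (Fin 3 × Module.Free.ChooseBasisIndex ℤ (𝓞 L))
        (Fin 3 × Module.Free.ChooseBasisIndex ℤ (𝓞 L)) ℤ,
      (∀ x, (∀ i ≤ 3 * finrank ℚ L, discr L ^ (3 * finrank ℚ L - i) ∣
        (compMat f (basisMat L) x).charpoly.coeff i) ↔ ∃ u, x = u ᵥ* X) ∧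
      (absDisc (K ⊔ L) : ℤ) * absDisc L ^ (2 * (3 * finrank ℚ L)) =
        X.det ^ 2 * (absDisc K ^ finrank ℚ L * absDisc L ^ 3) := by
  have hd : K.LinearDisjoint L := IntermediateField.LinearDisjoint.of_finrank_sup (by rw [hm, h3])
  have : NumberField ↥(K ⊔ L) := ⟨⟩
  let _ : Algebra K ↥(K ⊔ L) := (IntermediateField.inclusion le_sup_left).toAlgebra
  have : IsScalarTower ℚ K ↥(K ⊔ L) := IsScalarTower.of_algebraMap_eq fun x => by simp
  have hfr : finrank K ↥(K ⊔ L) = finrank ℚ L := by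
    have := finrank_mul_finrank ℚ K ↥(K ⊔ L)
    rw [hm, h3] at this
    omega
  obtain ⟨i, hi⟩ : ∃ i : L →ₐ[ℚ] ↥(K ⊔ L), ∀ x, (i x : Qbar) = x :=
    ⟨IntermediateField.inclusion le_sup_right, fun _ => rfl⟩
  have hKi : ∀ x : K, (algebraMap K ↥(K ⊔ L) x : Qbar) = x := fun _ => rfl
  have hli : LinearIndependent K (fun j => i (integralBasis L j)) := by
    have h1 := hd.linearIndependent_right' (integralBasis L).linearIndependent
    rw [Fintype.linearIndependent_iff] at h1 ⊢
    intro g hg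
    refine h1 g ?_
    have := congr_arg (fun z : ↥(K ⊔ L) => (z : Qbar)) hg
    simpa [Algebra.smul_def, hi, hKi] using this
  have : Nonempty (Module.Free.ChooseBasisIndex ℤ (𝓞 L)) := by
    rw [← Fintype.card_pos_iff, card_basisIndex]
    exact finrank_pos
  set l := basisOfLinearIndependentOfCardEqFinrank hli (by rw [card_basisIndex, hfr]) with hl
  have hlj : ∀ j, l j = i (integralBasis L j) := fun j => by simp [hl]
  obtain ⟨ω, θ, hb, hfi⟩ := hf
  have hdK := IsIdx.discr ⟨ω, θ, hb, hfi⟩ h3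
  have hmul : ∀ j k, l j * l k = ∑ r, basisMat L j r k • l r := fun j k => by
    have h1 : RingOfIntegers.basis L j * RingOfIntegers.basis L k =
        ∑ r, basisMat L j r k • RingOfIntegers.basis L r := by
      conv_lhs => rw [← (RingOfIntegers.basis L).sum_repr (RingOfIntegers.basis L j * _)]
      refine sum_congr rfl fun r _ => ?_
      rw [basisMat, Algebra.leftMulMatrix_eq_repr_mul]
    have h2 := congr_arg (i.toRingHom.comp (algebraMap (𝓞 L) L)) h1
    simp only [map_mul, map_sum, map_zsmul] at h2
    simp only [hlj, integralBasis_apply]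
    exact h2
  have hint : ∀ j, IsIntegral ℤ (l j) := fun j => by
    rw [hlj, integralBasis_apply]
    exact (RingOfIntegers.isIntegral_coe _).map (i.restrictScalars ℤ)
  have hdet := det_trMat_basisMat (L := L)
  obtain ⟨X, hX, hX2⟩ := exists_compMat_lattice hb hfi h3 l hmul hint
    (by rw [hdet]; exact discr_ne_zero L)
  rw [hdet, card_basisIndex] at hX2
  simp only [hdet, card_basisIndex] at hX
  refine ⟨X, hX, ?_⟩
  have h4 := congr_arg Int.natAbs hX2
  rw [absDisc_eq, absDisc_eq, absDisc_eq, hdK]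
  simp only [Int.natAbs_mul, Int.natAbs_pow] at h4
  have h5 : ((X.det.natAbs : ℤ)) ^ 2 = X.det ^ 2 := by simp
  rw [← h5]
  exact_mod_cast h4

lemma absDisc_sup_congr {K' : Fld} [NumberField K] [NumberField K'] [NumberField L]
    (h3 : finrank ℚ K = 3) (hm : finrank ℚ ↥(K ⊔ L) = 3 * finrank ℚ L)
    (hf : IsIdx f K) (h3' : finrank ℚ K' = 3)
    (hm' : finrank ℚ ↥(K' ⊔ L) = 3 * finrank ℚ L) (hg : IsIdx g K')
    (hfg : ∀ i, ((absDisc L ^ (3 * finrank ℚ L) : ℕ) : ℤ) ∣ f i - g i) :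
    (absDisc (K ⊔ L) : ℝ) / absDisc K ^ finrank ℚ L =
      absDisc (K' ⊔ L) / absDisc K' ^ finrank ℚ L := by
  obtain ⟨X, hX, hX2⟩ := exists_sup_lattice h3 hm hf
  obtain ⟨Y, hY, hY2⟩ := exists_sup_lattice h3' hm' hg
  have key : X.det ^ 2 = Y.det ^ 2 := by
    refine det_sq_eq_of_lattice_eq fun x => ?_
    rw [← hX, ← hY]
    refine forall₂_congr fun i hi => ?_
    have h1 := charpoly_coeff_congr (compMat_congr hfg (basisMat L) x) i
    refine dvd_iff_dvd_of_dvd_sub (dvd_trans ?_ h1)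
    rw [absDisc_eq, Nat.cast_pow]
    refine (pow_dvd_pow _ (Nat.sub_le _ _)).trans (pow_dvd_pow_of_dvd ?_ _)
    exact Int.dvd_natAbs.2 dvd_rfl
  rw [key] at hX2
  have hK := absDisc_pos K
  have hK' := absDisc_pos K'
  have hL := absDisc_pos L
  rw [div_eq_div_iff (by positivity) (by positivity)]
  have hX2 : (absDisc (K ⊔ L) : ℝ) * absDisc L ^ (2 * (3 * finrank ℚ L)) =
    Y.det ^ 2 * (absDisc K ^ finrank ℚ L * absDisc L ^ 3) := mod_cast hX2
  have hY2 : (absDisc (K' ⊔ L) : ℝ) * absDisc L ^ (2 * (3 * finrank ℚ L)) =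
    Y.det ^ 2 * (absDisc K' ^ finrank ℚ L * absDisc L ^ 3) := mod_cast hY2
  have : (0 : ℝ) < absDisc L ^ (2 * (3 * finrank ℚ L)) := by positivity
  apply mul_right_cancel₀ this.ne'
  linear_combination (absDisc K' : ℝ) ^ finrank ℚ L * hX2 - (absDisc K : ℝ) ^ finrank ℚ L * hY2

lemma exists_tower {F E : Fld} [NumberField F] [NumberField E] (h : F ≤ E) :
    ∃ d, absDisc E = d * absDisc F ^ (finrank ℚ E / finrank ℚ F) := by
  let _ : Algebra F E := (IntermediateField.inclusion h).toAlgebra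
  have : IsScalarTower ℚ F E := IsScalarTower.of_algebraMap_eq fun x => by simp
  rw [absDisc_eq, absDisc_eq, ← finrank_mul_finrank ℚ F E, Nat.mul_div_cancel_left _ finrank_pos]
  exact ⟨_, natAbs_discr_eq_absNorm_differentIdeal_mul_natAbs_discr_pow F (𝓞 F) E (𝓞 E)⟩

lemma exists_localFactor (L : Fld) [FiniteDimensional ℚ L] : ∃ c : Form → ℝ, (∀ f, 1 ≤ c f) ∧
      (∀ f g, (∀ i, ((absDisc L ^ (3 * finrank ℚ L) : ℕ) : ℤ) ∣ f i - g i) → c f = c g) ∧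
      ∀ (K : Fld) (f : Form), finrank ℚ K = 3 → finrank ℚ ↥(K ⊔ L) = 3 * finrank ℚ L → IsIdx f K →
        (absDisc (K ⊔ L) : ℝ) = |Δ f| ^ finrank ℚ L * c f := by
  have : NumberField L := ⟨⟩
  set M := absDisc L ^ (3 * finrank ℚ L)
  let P : Form → ℝ → Prop := fun f r => ∃ (K : Fld) (g : Form),
    finrank ℚ K = 3 ∧ finrank ℚ ↥(K ⊔ L) = 3 * finrank ℚ L ∧ IsIdx g K ∧
    (∀ i, (M : ℤ) ∣ f i - g i) ∧ r = absDisc (K ⊔ L) / absDisc K ^ finrank ℚ L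
  have hfin : ∀ K : Fld, finrank ℚ K = 3 → NumberField K := fun K h =>
    have : FiniteDimensional ℚ K := FiniteDimensional.of_finrank_pos (by omega)
    ⟨⟩
  have huniq : ∀ f r r', P f r → P f r' → r = r' := by
    rintro f r r' ⟨K, g, h3, hm, hg, hfg, rfl⟩ ⟨K', g', h3', hm', hg', hfg', rfl⟩
    have := hfin K h3
    have := hfin K' h3'
    refine absDisc_sup_congr h3 hm hg h3' hm' hg' fun i => ?_
    have := dvd_sub (hfg' i) (hfg i)
    rwa [sub_sub_sub_cancel_left] at this
  refine ⟨fun f => if h : ∃ r, P f r then h.choose else 1, fun f => ?_, fun f g hfg => ?_, ?_⟩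
  · dsimp only
    split_ifs with h
    · obtain ⟨K, g, h3, hm, hg, hfg, hr⟩ := h.choose_spec
      rw [hr]
      have := hfin K h3
      have : FiniteDimensional ℚ ↥(K ⊔ L) := inferInstance
      have : NumberField ↥(K ⊔ L) := ⟨⟩
      obtain ⟨d, hd⟩ := exists_tower (le_sup_left : K ≤ K ⊔ L)
      rw [hm, h3, Nat.mul_div_cancel_left _ (by norm_num)] at hd
      have hp := absDisc_pos (K ⊔ L)
      have hK := absDisc_pos K
      have : 0 < d := Nat.pos_of_ne_zero fun h => by simp [h, hd] at hp
      rw [le_div_iff₀ (by positivity), one_mul, hd]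
      exact_mod_cast Nat.le_mul_of_pos_left _ this
    · exact le_rfl
  · have : P f = P g := by
      ext r
      refine exists₂_congr fun K k => and_congr_right fun _ => and_congr_right fun _ =>
        and_congr_right fun _ => and_congr_left fun _ => forall_congr' fun i => ?_
      refine dvd_iff_dvd_of_dvd_sub ?_
      rw [sub_sub_sub_cancel_right]
      exact hfg i
    dsimp only
    rw [this]
  · intro K f h3 hm hf
    have hP : P f (absDisc (K ⊔ L) / absDisc K ^ finrank ℚ L) := ⟨K, f, h3, hm, hf, by simp, rfl⟩
    have hex : ∃ r, P f r := ⟨_, hP⟩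
    simp only [dif_pos hex]
    rw [huniq f _ _ hex.choose_spec hP]
    have := hfin K h3
    have hK := absDisc_pos K
    have h1 : |Δ f| = absDisc K := by rw [absDisc_eq, hf.discr h3, Nat.cast_natAbs, Int.cast_abs]
    rw [h1]
    field_simp

end LocalFactor

section Ramification

open NumberField UniqueFactorizationMonoid Ideal

variable {F E : Type*} [Field F] [NumberField F] [Field E] [NumberField E]

lemma span_ne_bot (hp : p.Prime) : span {(p : ℤ)} ≠ ⊥ := by simp [hp.ne_zero]

lemma isMaximal_span (hp : p.Prime) : (span {(p : ℤ)}).IsMaximal :=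
  ((span_singleton_prime (mod_cast hp.ne_zero)).2
    (Nat.prime_iff_prime_int.1 hp)).isMaximal (span_ne_bot hp)

lemma ramificationIdx_of_dvd_discr [IsGalois ℚ F] (hp : p.Prime) (hd : (p : ℤ) ∣ discr F)
    (P : Ideal (𝓞 F)) [P.IsPrime] [P.LiesOver (span {(p : ℤ)})] :
    P.ramificationIdx ℤ ≠ 1 ∧ P.ramificationIdx ℤ ∣ finrank ℚ F := by
  have := isMaximal_span hp
  constructor
  · intro h1
    refine (not_dvd_discr_iff_forall_liesOver F (𝓞 F) (Nat.prime_iff_prime_int.1 hp)).2 ?_ hd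
    intro Q hQ hQp
    have : (Q.under ℤ).IsMaximal := by rw [← over_def Q (span {(p : ℤ)})]; infer_instance
    have : Finite (ℤ ⧸ Q.under ℤ) := by
      rw [← over_def Q (span {(p : ℤ)})]
      exact Ring.HasFiniteQuotients.finiteQuotient (span_ne_bot hp)
    have : Finite (Q.under ℤ).ResidueField :=
      Finite.of_surjective _ (Ideal.bijective_algebraMap_quotient_residueField _).surjective
    rw [← ramificationIdx_eq_one_iff, ← h1]
    exact ramificationIdx_eq_of_isGaloisGroup (span {(p : ℤ)}) Q P Gal(F/ℚ)
  · rw [← IsGalois.card_aut_eq_finrank, ← ncard_primesOver_mul_ramificationIdxIn_mul_inertiaDegIn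
      (span {(p : ℤ)}) (𝓞 F) Gal(F/ℚ), ramificationIdxIn_eq_ramificationIdx (span {(p : ℤ)}) P
      Gal(F/ℚ)]
    exact (dvd_mul_right _ _).mul_left _

lemma isCoprime_of_prime_ne {P Q : Ideal (𝓞 F)} (hP : Prime P) (hQ : Prime Q) (h : P ≠ Q) :
    IsCoprime P Q :=
  have := (isPrime_of_prime hP).isMaximal hP.ne_zero
  have := (isPrime_of_prime hQ).isMaximal hQ.ne_zero
  isCoprime_of_isMaximal h

lemma sq_map_dvd_cube [Algebra F E] {P : Ideal (𝓞 F)} (hP : Prime P)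
    (h : ∀ Q : Ideal (𝓞 E), Q.IsPrime → Q.LiesOver P → 3 ≤ Q.ramificationIdx (𝓞 F)) :
    (P.map (algebraMap (𝓞 F) (𝓞 E))) ^ 2 ∣ differentIdeal (𝓞 F) (𝓞 E) ^ 3 := by
  have := (isPrime_of_prime hP).isMaximal hP.ne_zero
  set I := P.map (algebraMap (𝓞 F) (𝓞 E)) with hI
  have hI0 : I ≠ ⊥ := map_ne_bot_of_ne_bot hP.ne_zero
  have hprime : ∀ Q ∈ (normalizedFactors I).toFinset, Prime Q := fun Q hQ =>
    prime_of_normalized_factor Q (Multiset.mem_toFinset.1 hQ)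
  have key : I = ∏ Q ∈ (normalizedFactors I).toFinset, Q ^ (normalizedFactors I).count Q := by
    rw [← prod_multiset_count, Ideal.prod_normalizedFactors_eq_self hI0]
  rw [key, ← prod_pow]
  refine prod_dvd_of_coprime (fun Q hQ R hR hne =>
    ((isCoprime_of_prime_ne (hprime Q hQ) (hprime R hR) hne).pow).pow) fun Q hQ => ?_
  have hQI : Q ∣ I := dvd_of_mem_normalizedFactors (Multiset.mem_toFinset.1 hQ)
  have hQp := isPrime_of_prime (hprime Q hQ)
  have hlo : Q.LiesOver P := (liesOver_iff_dvd_map hQp.ne_top).2 hQI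
  have h3 := h Q hQp hlo
  rw [IsDedekindDomain.ramificationIdx_eq_normalizedFactors_count P Q hI0, ← hI] at h3
  have h4 := pow_sub_one_dvd_differentIdeal (𝓞 F) Q ((normalizedFactors I).count Q) hP.ne_zero (by
    conv_rhs => rw [← hI, key]
    exact dvd_prod_of_mem (fun Q => Q ^ (normalizedFactors I).count Q) hQ)
  refine dvd_trans ?_ (pow_dvd_pow_of_dvd h4 3)
  rw [← pow_mul, ← pow_mul]
  exact pow_dvd_pow _ (by omega)

lemma exists_radical_ideal {r : ℕ} (hr : Squarefree r) (h3 : finrank ℚ F = 3)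
    (hT : ∀ p : ℕ, p.Prime → p ∣ r → ¬ TotRam p F) :
    ∃ T : Finset (Ideal (𝓞 F)), (∀ P ∈ T, Prime P ∧ ∃ p : ℕ, p.Prime ∧ p ∣ r ∧
      P.LiesOver (span {(p : ℤ)}) ∧ P.ramificationIdx ℤ ≤ 2) ∧ r ^ 2 ∣ absNorm (∏ P ∈ T, P) := by
  set I : Ideal (𝓞 F) := span {(r : 𝓞 F)} with hI
  have hI0 : I ≠ ⊥ := by simpa [hI] using hr.ne_zero
  have hprime : ∀ Q ∈ (normalizedFactors I).toFinset, Prime Q := fun Q hQ =>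
    prime_of_normalized_factor Q (Multiset.mem_toFinset.1 hQ)
  have key : I = ∏ Q ∈ (normalizedFactors I).toFinset, Q ^ (normalizedFactors I).count Q := by
    rw [← prod_multiset_count, Ideal.prod_normalizedFactors_eq_self hI0]
  have hover : ∀ P ∈ (normalizedFactors I).toFinset, ∃ p : ℕ, p.Prime ∧ p ∣ r ∧ (p : 𝓞 F) ∈ P ∧
      P.LiesOver (span {(p : ℤ)}) := fun P hP => by
    have hPp := isPrime_of_prime (hprime P hP)
    have hrP : (r : 𝓞 F) ∈ P := by
      have := dvd_of_mem_normalizedFactors (Multiset.mem_toFinset.1 hP)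
      rwa [hI, dvd_span_singleton] at this
    rw [← Nat.prod_primeFactors_of_squarefree hr, Nat.cast_prod, hPp.prod_mem_iff] at hrP
    obtain ⟨p, hp, hpP⟩ := hrP
    have hpp := Nat.prime_of_mem_primeFactors hp
    have := isMaximal_span hpp
    refine ⟨p, hpp, Nat.dvd_of_mem_primeFactors hp, hpP, ?_⟩
    refine (liesOver_iff_dvd_map hPp.ne_top).2 ?_
    rw [map_span, Set.image_singleton, dvd_span_singleton]
    simpa using hpP
  have hcop : ∀ P ∈ (normalizedFactors I).toFinset, ∀ p : ℕ, p.Prime → p ∣ r → (p : 𝓞 F) ∈ P →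
      ¬ P ^ 3 ∣ span {(p : 𝓞 F)} := fun P hP p hp hpr hpP hd =>
    hT p hp hpr ⟨P, isPrime_of_prime (hprime P hP), hd⟩
  refine ⟨(normalizedFactors I).toFinset, fun P hP => ⟨hprime P hP, ?_⟩, ?_⟩
  · obtain ⟨p, hp, hpr, hpP, hlo⟩ := hover P hP
    refine ⟨p, hp, hpr, hlo, ?_⟩
    have hm0 : (span {(p : ℤ)}).map (algebraMap ℤ (𝓞 F)) ≠ ⊥ := map_ne_bot_of_ne_bot (span_ne_bot hp)
    rw [IsDedekindDomain.ramificationIdx_eq_normalizedFactors_count (span {(p : ℤ)}) P hm0]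
    by_contra! hc
    refine hcop P hP p hp hpr hpP ?_
    rw [map_span, Set.image_singleton, eq_intCast, Int.cast_natCast] at hc hm0
    refine (pow_dvd_pow P hc).trans ?_
    conv_rhs => rw [← Ideal.prod_normalizedFactors_eq_self hm0]
    rw [← Multiset.prod_replicate]
    exact Multiset.prod_dvd_prod_of_le (Multiset.le_count_iff_replicate_le.1 le_rfl)
  · have hle : ∀ P ∈ (normalizedFactors I).toFinset, (normalizedFactors I).count P ≤ 2 := by
      intro P hP
      obtain ⟨p, hp, hpr, hpP, hlo⟩ := hover P hP
      by_contra! hc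
      refine hcop P hP p hp hpr hpP ?_
      obtain ⟨s, rfl⟩ := hpr
      have h1 : P ^ 3 ∣ span {(p : 𝓞 F)} * span {(s : 𝓞 F)} := by
        rw [span_singleton_mul_span_singleton, ← Nat.cast_mul, ← hI]
        exact (pow_dvd_pow P hc).trans (by
          conv_rhs => rw [key]
          exact dvd_prod_of_mem (fun Q => Q ^ (normalizedFactors I).count Q) hP)
      refine (hprime P hP).pow_dvd_of_dvd_mul_right 3 (fun h => ?_) h1
      rw [dvd_span_singleton] at h
      have hcp : IsCoprime (p : 𝓞 F) (s : 𝓞 F) := (Nat.coprime_of_squarefree_mul hr).cast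
      obtain ⟨a, b, hab⟩ := hcp
      have := P.add_mem (P.mul_mem_left a hpP) (P.mul_mem_left b h)
      rw [hab] at this
      exact (isPrime_of_prime (hprime P hP)).ne_top ((eq_top_iff_one P).2 this)
    have hd : I ∣ (∏ P ∈ (normalizedFactors I).toFinset, P) ^ 2 := by
      conv_lhs => rw [key]
      rw [← prod_pow]
      exact prod_dvd_prod_of_dvd _ _ fun P hP => pow_dvd_pow _ (hle P hP)
    have h1 := map_dvd (absNorm (S := 𝓞 F)) hd
    have h0 : absNorm I = r ^ 3 := by
      rw [hI, absNorm_span_singleton, ← map_natCast (algebraMap ℤ (𝓞 F)), Algebra.norm_algebraMap,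
        RingOfIntegers.rank, h3, Int.natAbs_pow, Int.natAbs_natCast]
    rw [h0, map_pow] at h1
    conv_lhs => rw [← Nat.prod_primeFactors_of_squarefree hr, ← prod_pow]
    refine prod_dvd_of_isRelPrime (fun p hp q hq hne => ?_) fun p hp => ?_
    · exact Nat.coprime_iff_isRelPrime.1 (((Nat.coprime_primes (Nat.prime_of_mem_primeFactors hp)
        (Nat.prime_of_mem_primeFactors hq)).2 hne).pow _ _)
    · have hpp := Nat.prime_of_mem_primeFactors hp
      have h2 := (pow_dvd_pow_of_dvd (Nat.dvd_of_mem_primeFactors hp) 3).trans h1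
      obtain ⟨M, hM⟩ := hpp.dvd_of_dvd_pow ((dvd_pow_self p (by norm_num)).trans h2)
      rw [hM] at h2 ⊢
      have h3 : p ∣ M ^ 2 := by
        have h4 : p ^ 2 * p ∣ p ^ 2 * M ^ 2 := by convert! h2 using 1 <;> ring
        exact Nat.dvd_of_mul_dvd_mul_left (pow_pos hpp.pos 2) h4
      rw [pow_two]
      exact mul_dvd_mul_left _ (hpp.dvd_of_dvd_pow h3)

lemma discr_pow_mul_radical_pow_le {L : Type*} [Field L] [NumberField L] [Algebra F E]
    [Algebra L E] [IsGalois ℚ L] (h3 : finrank ℚ F = 3) (hm : Odd (finrank ℚ L))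
    (hE : finrank ℚ E = 3 * finrank ℚ L) {r : ℕ} (hr : Squarefree r)
    (hp : ∀ p : ℕ, p.Prime → p ∣ r → (p : ℤ) ∣ discr L ∧ ¬ TotRam p F) :
    (discr F).natAbs ^ (3 * finrank ℚ L) * r ^ (4 * finrank ℚ L) ≤ (discr E).natAbs ^ 3 := by
  obtain ⟨T, hT, hN⟩ := exists_radical_ideal hr h3 fun p h1 h2 => (hp p h1 h2).2
  have hFE : finrank F E = finrank ℚ L := by
    have := finrank_mul_finrank ℚ F E
    rw [h3, hE] at this
    omega
  have h1 : ((∏ P ∈ T, P).map (algebraMap (𝓞 F) (𝓞 E))) ^ 2 ∣ differentIdeal (𝓞 F) (𝓞 E) ^ 3 := by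
    rw [← mapHom_apply, map_prod, ← prod_pow]
    refine prod_dvd_of_coprime (fun P hP Q hQ hne => ?_) fun P hP => ?_
    · exact ((isCoprime_of_prime_ne (hT P hP).1 (hT Q hQ).1 hne).map (mapHom _)).pow
    · obtain ⟨hP, p, hpp, hpr, hlo, he⟩ := hT P hP
      refine sq_map_dvd_cube hP fun Q hQ hQP => ?_
      have := isPrime_of_prime hP
      have : Q.LiesOver (span {(p : ℤ)}) := LiesOver.trans Q P _
      have hQL : (Q.under (𝓞 L)).LiesOver (span {(p : ℤ)}) :=
        LiesOver.tower_bot Q (Q.under (𝓞 L)) (span {(p : ℤ)})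
      obtain ⟨e1, e2⟩ := ramificationIdx_of_dvd_discr hpp (hp p hpp hpr).1 (Q.under (𝓞 L))
      have t1 := ramificationIdx_tower (R := ℤ) P Q
      have t2 := ramificationIdx_tower (R := ℤ) (Q.under (𝓞 L)) Q
      have pos1 := ramificationIdx_pos P ℤ
      have pos2 := ramificationIdx_pos Q (𝓞 F)
      have hodd := hm.of_dvd_nat e2
      set e := (Q.under (𝓞 L)).ramificationIdx ℤ
      have hd : e ∣ P.ramificationIdx ℤ * Q.ramificationIdx (𝓞 F) := ⟨_, t1.symm.trans t2⟩
      have hcop : Nat.Coprime e (P.ramificationIdx ℤ) := by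
        interval_cases P.ramificationIdx ℤ
        · simp
        · exact hodd.coprime_two_right
      have := Nat.le_of_dvd pos2 (hcop.dvd_of_dvd_mul_left hd)
      obtain ⟨a, ha⟩ := hodd
      omega
  have h2 := map_dvd (absNorm (S := 𝓞 E)) h1
  rw [map_pow, map_pow, absNorm_algebraMap (𝓞 F),
    ← IsFractionRing.finrank_eq (𝓞 F) F (𝓞 E) E, hFE] at h2
  have h0 := natAbs_discr_eq_absNorm_differentIdeal_mul_natAbs_discr_pow F (𝓞 F) E (𝓞 E)
  have hD : absNorm (differentIdeal (𝓞 F) (𝓞 E)) ≠ 0 := fun h => by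
    rw [h, zero_mul, Int.natAbs_eq_zero] at h0
    exact discr_ne_zero E h0
  have h4 := Nat.le_of_dvd (by positivity) ((pow_dvd_pow_of_dvd (pow_dvd_pow_of_dvd hN _) 2).trans h2)
  rw [h0, mul_pow, hFE, mul_comm]
  refine Nat.mul_le_mul ?_ (by rw [← pow_mul, mul_comm])
  refine le_trans (le_of_eq ?_) h4
  ring

lemma mem_differentIdeal_iff {x : 𝓞 F} : x ∈ differentIdeal ℤ (𝓞 F) ↔
    ∀ y : F, (∀ z : 𝓞 F, ∃ n : ℤ, Algebra.trace ℚ F (y * z) = n) → ∃ w : 𝓞 F, (w : F) = x * y := by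
  have h0 : FractionalIdeal.dual ℤ ℚ (1 : FractionalIdeal (nonZeroDivisors (𝓞 F)) F) ≠ 0 :=
    FractionalIdeal.dual_ne_zero _ _ one_ne_zero
  have h1 : x ∈ differentIdeal ℤ (𝓞 F) ↔ (x : F) ∈
      ((differentIdeal ℤ (𝓞 F) : Ideal (𝓞 F)) : FractionalIdeal (nonZeroDivisors (𝓞 F)) F) := by
    simp [FractionalIdeal.mem_coeIdeal]
  rw [h1, coeIdeal_differentIdeal ℤ ℚ, FractionalIdeal.mem_inv_iff h0]
  have h2 : ∀ y, y ∈ FractionalIdeal.dual ℤ ℚ (1 : FractionalIdeal (nonZeroDivisors (𝓞 F)) F) ↔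
      ∀ z : 𝓞 F, ∃ n : ℤ, Algebra.trace ℚ F (y * z) = n := fun y => by
    rw [FractionalIdeal.mem_dual (I := (1 : FractionalIdeal (nonZeroDivisors (𝓞 F)) F)) one_ne_zero]
    simp [eq_comm, FractionalIdeal.mem_one_iff]
  simp [h2, FractionalIdeal.mem_one_iff]

lemma smul_mem_differentIdeal {x y : 𝓞 F} (σ : F ≃ₐ[ℚ] F) (hx : x ∈ differentIdeal ℤ (𝓞 F))
    (hy : (y : F) = σ x) : y ∈ differentIdeal ℤ (𝓞 F) := by
  rw [mem_differentIdeal_iff] at hx ⊢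
  intro v hv
  obtain ⟨w, hw⟩ := hx (σ.symm v) fun z => by
    obtain ⟨n, hn⟩ := hv (RingOfIntegers.mapRingEquiv σ z)
    refine ⟨n, ?_⟩
    rw [← hn, ← Algebra.trace_eq_of_algEquiv σ]
    simp
  refine ⟨RingOfIntegers.mapRingEquiv σ w, ?_⟩
  have := congr_arg σ hw
  simpa [hy] using this

lemma span_discr_dvd [IsGalois ℚ F] :
    span {((discr F).natAbs : 𝓞 F)} = differentIdeal ℤ (𝓞 F) ^ finrank ℚ F := by
  set D := differentIdeal ℤ (𝓞 F)
  have hD : D ≠ ⊥ := differentIdeal_ne_bot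
  have hle : span {((discr F).natAbs : 𝓞 F)} ≤ D ^ finrank ℚ F := by
    have h1 := congr_arg (Ideal.map (algebraMap ℤ (𝓞 F))) (relNorm_int (𝓞 F) D)
    rw [map_span, Set.image_singleton, absNorm_differentIdeal F, map_relNorm, eq_intCast,
      Int.cast_natCast] at h1
    rw [← h1, span_le]
    rintro _ ⟨x, hx, rfl⟩
    have h2 : algebraMap ℤ (𝓞 F) (Algebra.intNorm ℤ (𝓞 F) x) =
        ∏ σ : F ≃ₐ[ℚ] F, RingOfIntegers.mapRingEquiv σ x := by
      apply RingOfIntegers.ext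
      have h3 := Algebra.norm_eq_prod_automorphisms ℚ (x : F)
      rw [Algebra.intNorm_eq_norm, RingOfIntegers.coe_eq_algebraMap, RingOfIntegers.coe_eq_algebraMap,
        map_prod]
      rw [← Algebra.coe_norm_int] at h3
      simpa using h3
    simp only [SetLike.mem_coe, Function.comp_apply]
    rw [h2, ← IsGalois.card_aut_eq_finrank, Nat.card_eq_fintype_card, ← card_univ, ← prod_const]
    exact prod_mem_prod fun σ _ => smul_mem_differentIdeal σ hx rfl
  obtain ⟨J, hJ⟩ := dvd_iff_le.2 hle
  have h1 := congr_arg absNorm hJ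
  have h2 : absNorm (span {((discr F).natAbs : 𝓞 F)}) = (discr F).natAbs ^ finrank ℚ F := by
    rw [absNorm_span_singleton, ← map_natCast (algebraMap ℤ (𝓞 F)), Algebra.norm_algebraMap,
      RingOfIntegers.rank, Int.natAbs_pow, Int.natAbs_natCast]
  rw [h2, map_mul, map_pow, absNorm_differentIdeal F] at h1
  have h3 : absNorm J = 1 := by
    have : 0 < (discr F).natAbs := Int.natAbs_pos.2 (discr_ne_zero F)
    exact (Nat.eq_of_mul_eq_mul_left (pow_pos this _) (by rw [mul_one]; exact h1)).symm
  rw [hJ, absNorm_eq_one_iff.1 h3, mul_top]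

lemma dvd_finrank_of_dvd_differentIdeal (hN : N ≠ 0)
    (h : span {(N : 𝓞 F)} ∣ differentIdeal ℤ (𝓞 F)) : N ∣ finrank ℚ F := by
  have h1 := (differentialIdeal_le_iff (K := ℚ) (L := F) (by simpa)).1 (le_of_dvd h)
  obtain ⟨n, hn⟩ := Submodule.mem_one.1 (h1 (Submodule.mem_map_of_mem (r := (N : F)⁻¹) (by
    refine (FractionalIdeal.mem_inv_iff (by simpa [FractionalIdeal.spanSingleton_eq_zero_iff])).2 fun y hy => ?_
    obtain ⟨z, hz, rfl⟩ := (FractionalIdeal.mem_coeIdeal _).1 hy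
    obtain ⟨w, rfl⟩ := mem_span_singleton.1 hz
    exact (FractionalIdeal.mem_one_iff _).2 ⟨w, by field_simp; simp [mul_comm]⟩)))
  have h2 : Algebra.trace ℚ F (N : F)⁻¹ = finrank ℚ F / N := by
    rw [← map_natCast (algebraMap ℚ F), ← map_inv₀, Algebra.trace_algebraMap, nsmul_eq_mul]
    rfl
  rw [LinearMap.restrictScalars_apply, h2, eq_div_iff (mod_cast hN), eq_intCast] at hn
  exact Int.natCast_dvd_natCast.1 ⟨n, by rw [mul_comm]; exact_mod_cast hn.symm⟩

lemma discr_dvd [IsGalois ℚ F] : (discr F).natAbs ∣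
    (finrank ℚ F * ∏ p ∈ (discr F).natAbs.primeFactors, p) ^ finrank ℚ F := by
  set d := (discr F).natAbs with hd
  set m := finrank ℚ F with hm
  have hm0 : m ≠ 0 := finrank_pos.ne'
  have hd0 : d ≠ 0 := Int.natAbs_ne_zero.2 (discr_ne_zero F)
  have hprod : ∏ p ∈ d.primeFactors, p ≠ 0 :=
    prod_ne_zero_iff.2 fun p hp => (Nat.prime_of_mem_primeFactors hp).ne_zero
  rw [← Nat.factorization_prime_le_iff_dvd hd0 (by positivity)]
  intro p hp
  by_cases hpd : p ∣ d
  swap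
  · rw [Nat.factorization_eq_zero_of_not_dvd hpd]
    exact Nat.zero_le _
  have h1 : 1 ≤ (∏ p ∈ d.primeFactors, p).factorization p :=
    (hp.dvd_iff_one_le_factorization hprod).1
      (dvd_prod_of_mem _ (Nat.mem_primeFactors.2 ⟨hp, hpd, hd0⟩))
  rw [Nat.factorization_pow, Nat.factorization_mul hm0 hprod]
  simp only [Finsupp.smul_apply, Finsupp.add_apply, smul_eq_mul]
  refine le_trans ?_ (Nat.mul_le_mul_left m (Nat.add_le_add_left h1 _))
  by_contra! hc
  have h2 : (p ^ (m.factorization p + 1)) ^ m ∣ d := by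
    rw [← pow_mul, hp.pow_dvd_iff_le_factorization hd0, mul_comm]
    exact hc.le
  have h3 : span {((p ^ (m.factorization p + 1) : ℕ) : 𝓞 F)} ^ m ∣ differentIdeal ℤ (𝓞 F) ^ m := by
    rw [← span_discr_dvd, span_singleton_pow, ← Nat.cast_pow, dvd_span_singleton,
      mem_span_singleton]
    exact Nat.cast_dvd_cast h2
  have h4 := dvd_finrank_of_dvd_differentIdeal (by positivity [hp.pos])
    ((pow_dvd_pow_iff_dvd hm0).1 h3)
  exact Nat.pow_succ_factorization_not_dvd hm0 hp h4

end Ramification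

section Inertia

open NumberField Ideal

lemma isCyclic_inertia {R G : Type*} [CommRing R] [IsDedekindDomain R] [Group G] [Finite G]
    [MulSemiringAction G R] [FaithfulSMul G R] (P : Ideal R) [P.IsPrime] (hP : P ≠ ⊥) {m : ℕ}
    (hm : (m : R) ∉ P) (h : ∀ g : G, g ^ m = 1) : IsCyclic (P.inertia G) := by
  obtain ⟨ϖ, hϖ, hϖ'⟩ := P.exists_mem_pow_notMem_pow_succ hP IsPrime.ne_top' 1
  have hsm : ∀ σ ∈ P.inertia G, ∀ j, ∀ x ∈ P ^ j, σ • x ∈ P ^ j := fun σ hσ j x hx => by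
    have h1 : P.map (MulSemiringAction.toRingHom G R σ) ≤ P := map_le_iff_le_comap.2 fun y hy => by
        have := P.add_mem (hσ y) hy
        rwa [sub_add_cancel] at this
    have h2 := mem_map_of_mem (MulSemiringAction.toRingHom G R σ) hx
    rw [Ideal.map_pow] at h2
    exact pow_right_mono h1 j h2
  have hex : ∀ σ : P.inertia G, ∃ d, ∃ e ∈ P ^ (1 + 1), ϖ * d + e = (σ : G) • ϖ := fun σ =>
    exists_mul_add_mem_pow_succ hP _ _ hϖ hϖ' (hsm σ σ.2 1 ϖ hϖ)
  choose d e he hde using hex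
  have huniq : ∀ σ : P.inertia G, ∀ a, (σ : G) • ϖ - ϖ * a ∈ P ^ (1 + 1) → d σ - a ∈ P := by
    intro σ a ha
    refine mul_add_mem_pow_succ_unique hP ϖ _ _ (e σ) 0 hϖ' (he σ) (zero_mem _) ?_
    rwa [hde, add_zero]
  let f : P.inertia G →* R ⧸ P :=
    { toFun := fun σ => Ideal.Quotient.mk P (d σ)
      map_one' := by
        rw [← map_one (Ideal.Quotient.mk P), Ideal.Quotient.eq]
        exact huniq 1 1 (by simp)
      map_mul' := fun σ τ => by
        rw [← map_mul, Ideal.Quotient.eq]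
        have h1 : d (σ * τ) - d σ * ((σ : G) • d τ) ∈ P := by
          refine huniq _ _ ?_
          have : ((σ * τ : P.inertia G) : G) • ϖ - ϖ * (d σ * ((σ : G) • d τ)) =
              e σ * ((σ : G) • d τ) + (σ : G) • e τ := by
            rw [Subgroup.coe_mul, mul_smul, ← hde τ, smul_add, smul_mul', ← hde σ]
            ring
          rw [this]
          exact add_mem (mul_mem_right _ _ (he σ)) (hsm σ σ.2 _ _ (he τ))
        have h2 := P.mul_mem_left (d σ) (σ.2 (d τ))
        convert! add_mem h1 h2 using 1
        ring }
  refine isCyclic_of_subgroup_isDomain f ((injective_iff_map_eq_one f).2 fun σ hσ => ?_)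
  have h1 : d σ - 1 ∈ P := by
    rw [← Ideal.Quotient.eq, map_one]
    exact hσ
  have h2 : ∀ j, ∀ x ∈ P ^ j, (σ : G) • x - x ∈ P ^ (j + 1) := fun j => by
    induction j with
    | zero => exact fun x _ => by simpa using σ.2 x
    | succ j ih =>
      intro x hx
      rw [pow_succ] at hx
      refine Submodule.mul_induction_on hx (fun a ha b hb => ?_) fun a b ha hb => ?_
      · have hb' : (σ : G) • b - b ∈ P ^ 2 := by
          obtain ⟨c, u, hu, rfl⟩ := exists_mul_add_mem_pow_succ hP ϖ b hϖ hϖ' (by simpa using hb)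
          have h3 : (σ : G) • (ϖ * c + u) - (ϖ * c + u) = ϖ * (((σ : G) • c) * (d σ - 1)) +
              ϖ * ((σ : G) • c - c) + (e σ * ((σ : G) • c) + (σ : G) • u - u) := by
            rw [smul_add, smul_mul', ← hde σ]
            ring
          rw [h3]
          rw [pow_one] at hϖ
          refine add_mem (add_mem ?_ ?_) (sub_mem (add_mem ?_ ?_) hu)
          · rw [pow_two]
            exact mul_mem_mul hϖ (P.mul_mem_left _ h1)
          · rw [pow_two]
            exact mul_mem_mul hϖ (σ.2 c)
          · exact mul_mem_right _ _ (he σ)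
          · exact hsm σ σ.2 _ _ hu
        have h4 : (σ : G) • (a * b) - a * b = ((σ : G) • a - a) * ((σ : G) • b) +
            a * ((σ : G) • b - b) := by
          rw [smul_mul']
          ring
        rw [h4]
        refine add_mem ?_ ?_
        · rw [pow_succ]
          exact mul_mem_mul (ih a ha) (by simpa using hsm σ σ.2 1 b (by simpa using hb))
        · rw [add_assoc, pow_add]
          exact mul_mem_mul ha hb'
      · have : (σ : G) • (a + b) - (a + b) = ((σ : G) • a - a) + ((σ : G) • b - b) := by
          rw [smul_add]
          ring
        rw [this]
        exact add_mem ha hb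
  have h3 : ∀ k, ∀ x : R, (σ : G) • x - x ∈ P ^ k := fun k => by
    induction k with
    | zero => simp
    | succ k ih =>
      intro x
      set δ := (σ : G) • x - x with hδ
      have h4 : ∀ i : ℕ, (σ : G) ^ i • x - (x + i * δ) ∈ P ^ (k + 1) := fun i => by
        induction i with
        | zero => simp
        | succ i ihi =>
          have h5 : (σ : G) ^ (i + 1) • x - (x + (i + 1 : ℕ) * δ) =
              (σ : G) • ((σ : G) ^ i • x - (x + i * δ)) + i * ((σ : G) • δ - δ) := by
            rw [pow_succ', mul_smul, smul_sub, smul_add, smul_mul']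
            have : (σ : G) • (i : R) = i := map_natCast (MulSemiringAction.toRingHom G R σ) i
            rw [this, show (σ : G) • x = x + δ by rw [hδ]; ring]
            push_cast
            ring
          rw [h5]
          exact add_mem (hsm σ σ.2 _ _ ihi) (mul_mem_left _ _ (h2 k δ (ih x)))
      have h6 := h4 m
      rw [h, one_smul, sub_add_cancel_left, neg_mem_iff] at h6
      exact (IsPrime.mul_mem_pow P h6).resolve_left hm
  refine Subtype.ext (eq_of_smul_eq_smul fun x : R => ?_)
  have h4 : (σ : G) • x - x ∈ (⨅ k, P ^ k : Ideal R) := (Submodule.mem_iInf _).2 fun k => h3 k x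
  rw [iInf_pow_eq_bot_of_isDomain P IsPrime.ne_top', Ideal.mem_bot, sub_eq_zero] at h4
  simpa using h4

lemma not_dvd_discr_iff_inertia {F E : Type*} [Field F] [NumberField F] [Field E] [NumberField E]
    [Algebra F E] [IsGalois ℚ E] [IsGalois ℚ F] (hp : p.Prime) (P : Ideal (𝓞 E))
    [P.IsPrime] [P.LiesOver (span {(p : ℤ)})] :
    ¬ (p : ℤ) ∣ discr F ↔
      ∀ σ ∈ P.inertia Gal(E/ℚ), ∀ x : F, σ (algebraMap F E x) = algebraMap F E x := by
  have := isMaximal_span hp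
  have : IsGalois F E := IsGalois.tower_top_of_isGalois ℚ F E
  have hQ : (P.under (𝓞 F)).LiesOver (span {(p : ℤ)}) :=
    LiesOver.tower_bot P (P.under (𝓞 F)) (span {(p : ℤ)})
  have : IsMaximal (P.under (𝓞 F)) := IsMaximal.of_liesOver_isMaximal _ (span {(p : ℤ)})
  have e1 : Nat.card (P.inertia Gal(E/ℚ)) = P.ramificationIdx ℤ := by
    rw [card_inertia_eq_ramificationIdxIn (span {(p : ℤ)}) P,
      ramificationIdxIn_eq_ramificationIdx _ P Gal(E/ℚ)]
  have e2 : Nat.card (P.inertia Gal(E/F)) = P.ramificationIdx (𝓞 F) := by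
    rw [card_inertia_eq_ramificationIdxIn (P.under (𝓞 F)) P,
      ramificationIdxIn_eq_ramificationIdx _ P Gal(E/F)]
  have e3 := ramificationIdx_tower (R := ℤ) (P.under (𝓞 F)) P
  have pos := ramificationIdx_pos P (𝓞 F)
  let φ : P.inertia Gal(E/F) → P.inertia Gal(E/ℚ) := fun σ => ⟨σ.1.restrictScalars ℚ, σ.2⟩
  have hφ : Function.Injective φ := fun σ τ h =>
    Subtype.ext (AlgEquiv.restrictScalars_injective ℚ (Subtype.ext_iff.1 h))
  constructor
  · intro hd σ hσ x
    have hun := (not_dvd_discr_iff_forall_liesOver F (𝓞 F) (Nat.prime_iff_prime_int.1 hp)).1 hd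
      (P.under (𝓞 F)) inferInstance hQ
    have : PerfectField ((P.under (𝓞 F)).under ℤ).ResidueField := by
      have : ((P.under (𝓞 F)).under ℤ).IsMaximal := by
        rw [← over_def (P.under (𝓞 F)) (span {(p : ℤ)})]; infer_instance
      infer_instance
    have e4 : (P.under (𝓞 F)).ramificationIdx ℤ = 1 := ramificationIdx_eq_one_iff.2 hun
    rw [e4, one_mul] at e3
    obtain ⟨τ, hτ⟩ := ((Nat.bijective_iff_injective_and_card φ).2
      ⟨hφ, by rw [e1, e2, e3]⟩).2 ⟨σ, hσ⟩
    rw [show σ = τ.1.restrictScalars ℚ from (Subtype.ext_iff.1 hτ).symm]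
    exact τ.1.commutes x
  · intro h hd
    refine (ramificationIdx_of_dvd_discr hp hd (P.under (𝓞 F))).1 ?_
    have hs : Function.Surjective φ := fun σ =>
      ⟨⟨AlgEquiv.ofRingEquiv (f := σ.1.toRingEquiv) (h σ.1 σ.2), σ.2⟩, rfl⟩
    have := Nat.card_congr (Equiv.ofBijective φ ⟨hφ, hs⟩)
    rw [e1, e2, e3] at this
    exact Nat.eq_of_mul_eq_mul_right pos (by rw [one_mul, ← this])

instance normal_qbar : Normal ℚ Qbar := have : IsAlgClosure ℚ Qbar := ⟨inferInstance, inferInstance⟩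
  IsAlgClosure.normal ℚ Qbar

lemma exists_inertia_generator (M : Fld) [FiniteDimensional ℚ M]
    [IsGalois ℚ M] {m : ℕ} (h : ∀ g : Gal(M/ℚ), g ^ m = 1) (hp : p.Prime) (hpm : ¬ p ∣ m) :
    ∃ g : Gal(Qbar/ℚ), ∀ L ≤ M, IsGalois ℚ L → (¬ p ∣ absDisc L ↔ g ∈ L.fixingSubgroup) := by
  have : NumberField M := ⟨⟩
  have := isMaximal_span hp
  obtain ⟨P, hP, hlo⟩ := exists_maximal_ideal_liesOver_of_isIntegral (S := 𝓞 M) (span {(p : ℤ)})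
  have hP0 : P ≠ ⊥ := ne_bot_of_liesOver_of_ne_bot (span_ne_bot hp) P
  have : FaithfulSMul Gal(M/ℚ) (𝓞 M) := IsGaloisGroup.faithful ℤ
  have hm : (m : 𝓞 M) ∉ P := fun hm => by
    have h1 : (m : ℤ) ∈ span {(p : ℤ)} := by
      rw [hlo.over, Ideal.mem_comap]
      simpa using hm
    exact hpm (Int.natCast_dvd_natCast.1 (mem_span_singleton.1 h1))
  obtain ⟨⟨τ, hτ⟩, hgen⟩ := (isCyclic_inertia P hP0 hm h).exists_generator
  obtain ⟨g, hg⟩ := AlgEquiv.restrictNormalHom_surjective (K₁ := M) Qbar τ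
  refine ⟨g, fun L hL hgal => ?_⟩
  let _ : Algebra L M := (IntermediateField.inclusion hL).toAlgebra
  have : IsScalarTower ℚ L M := IsScalarTower.of_algebraMap_eq fun x => by simp
  have : FiniteDimensional ℚ L := FiniteDimensional.left ℚ L M
  have : NumberField L := ⟨⟩
  have hgx : ∀ x : L, ((τ (algebraMap L M x) : M) : Qbar) = g x := fun x => by
    rw [← hg]
    exact AlgEquiv.restrictNormal_commutes g M _
  rw [absDisc_eq, ← Int.natCast_dvd, not_dvd_discr_iff_inertia (E := M) hp P,
    IntermediateField.mem_fixingSubgroup_iff]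
  constructor
  · intro H x hx
    rw [← hgx ⟨x, hx⟩, H τ hτ]
    rfl
  · intro H σ hσ x
    obtain ⟨k, hk⟩ := hgen ⟨σ, hσ⟩
    have h1 : τ ∈ MulAction.stabilizer Gal(M/ℚ) (algebraMap L M x) :=
      Subtype.ext ((hgx x).trans (H x x.2))
    have h2 := Subgroup.zpow_mem _ h1 k
    rwa [show τ ^ k = σ from Subtype.ext_iff.1 hk] at h2

end Inertia

section CountGalois

open IntermediateField

instance isGalois_qbar : IsGalois ℚ Qbar := ⟨⟩

instance normal_algebra' (L : Fld) [h : Normal ℚ L] : @Normal ℚ L _ _ L.algebra' := h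

lemma finite_absDisc_le (B : ℕ) : {L : Fld | FiniteDimensional ℚ L ∧ absDisc L ≤ B}.Finite := by
  refine ((NumberField.finite_of_discr_bdd Qbar B).image Subtype.val).subset ?_
  rintro L ⟨hf, hL⟩
  have : NumberField L := ⟨⟩
  rw [absDisc_eq] at hL
  refine ⟨⟨L, hf⟩, ?_, rfl⟩
  change |NumberField.discr L| ≤ B
  rw [Int.abs_eq_natAbs]
  exact_mod_cast hL

lemma finite_hom_of_absDisc_le (A : Type*) [CommGroup A] [Finite A] (B : ℕ) :
    {Ψ : Gal(Qbar/ℚ) →* A | ∃ L : Fld,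
      (FiniteDimensional ℚ L ∧ absDisc L ≤ B) ∧ L.fixingSubgroup ≤ Ψ.ker}.Finite := by
  have : {Ψ : Gal(Qbar/ℚ) →* A | ∃ L : Fld,
      (FiniteDimensional ℚ L ∧ absDisc L ≤ B) ∧ L.fixingSubgroup ≤ Ψ.ker} ⊆
      ⋃ L ∈ {L : Fld | FiniteDimensional ℚ L ∧ absDisc L ≤ B},
        {Ψ : Gal(Qbar/ℚ) →* A | L.fixingSubgroup ≤ Ψ.ker} := by
    rintro Ψ ⟨L, h1, h2⟩
    exact Set.mem_biUnion (x := L) h1 h2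
  refine ((finite_absDisc_le B).biUnion fun L hL => ?_).subset this
  have := hL.1
  have hi : L.fixingSubgroup.index ≠ 0 := by
    rw [← finrank_eq_fixingSubgroup_index]
    exact finrank_pos.ne'
  have : Finite (Gal(Qbar/ℚ) ⧸ L.fixingSubgroup) := have : L.fixingSubgroup.FiniteIndex := ⟨hi⟩
    inferInstance
  refine Set.Finite.of_finite_image
    (f := fun Ψ (q : Gal(Qbar/ℚ) ⧸ L.fixingSubgroup) => Ψ q.out) (Set.toFinite _) ?_
  intro Ψ hΨ Φ hΦ h
  have key : ∀ Ψ : Gal(Qbar/ℚ) →* A, L.fixingSubgroup ≤ Ψ.ker → ∀ g,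
      Ψ g = Ψ (g : Gal(Qbar/ℚ) ⧸ L.fixingSubgroup).out := fun Ψ hΨ g => by
    have := hΨ (QuotientGroup.eq.1 (QuotientGroup.out_eq' (g : Gal(Qbar/ℚ) ⧸ L.fixingSubgroup)))
    rw [MonoidHom.mem_ker, map_mul, map_inv, inv_mul_eq_one] at this
    exact this.symm
  ext g
  rw [key Ψ hΨ, key Φ hΦ]
  exact congrFun h _

lemma ker_restrictNormalHom (L : Fld) [IsGalois ℚ L] :
    (AlgEquiv.restrictNormalHom L : Gal(Qbar/ℚ) →* Gal(L/ℚ)).ker = L.fixingSubgroup :=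
  restrictNormalHom_ker L

lemma exists_hom_ker_eq {A : Type*} [CommGroup A] (L : Fld) [IsGalois ℚ L]
    (h : Nonempty (Gal(L/ℚ) ≃* A)) :
    ∃ X : Gal(Qbar/ℚ) →* A, X.ker = L.fixingSubgroup ∧ Function.Surjective X := by
  obtain ⟨e⟩ := h
  refine ⟨e.toMonoidHom.comp (AlgEquiv.restrictNormalHom L), ?_,
    e.surjective.comp (AlgEquiv.restrictNormalHom_surjective Qbar)⟩
  rw [← ker_restrictNormalHom]
  ext g
  exact map_eq_one_iff e e.injective

lemma absDisc_le_of_primeFactors (L : Fld) [FiniteDimensional ℚ L]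
    [IsGalois ℚ L] {n d : ℕ} (hn : n ≠ 0) (hd : finrank ℚ L ≤ d)
    (h : ∀ p, p.Prime → p ∣ absDisc L → p ∣ n) : absDisc L ≤ (d * n) ^ d := by
  have : NumberField L := ⟨⟩
  have h0 : 0 < d := finrank_pos.trans_le hd
  have h1 := discr_dvd (F := L)
  rw [← absDisc_eq] at h1
  have h2 : ∏ p ∈ (absDisc L).primeFactors, p ≤ n :=
    (prod_le_prod_of_subset_of_one_le' (fun p hp => Nat.mem_primeFactors.2
      ⟨Nat.prime_of_mem_primeFactors hp, h p (Nat.prime_of_mem_primeFactors hp)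
        (Nat.dvd_of_mem_primeFactors hp), hn⟩)
      fun p hp _ => (Nat.prime_of_mem_primeFactors hp).one_le).trans
      (Nat.le_of_dvd (Nat.pos_of_ne_zero hn) (Nat.prod_primeFactors_dvd n))
  have h3 : 0 < ∏ p ∈ (absDisc L).primeFactors, p :=
    prod_pos fun p hp => Nat.pos_of_mem_primeFactors hp
  refine (Nat.le_of_dvd (pow_pos (Nat.mul_pos finrank_pos h3) _) h1).trans ?_
  refine (Nat.pow_le_pow_left (Nat.mul_le_mul hd h2) _).trans
    (Nat.pow_le_pow_right (Nat.mul_pos h0 (Nat.pos_of_ne_zero hn)) hd)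

/-- The number of Galois extensions of `ℚ` with group `A`, unramified outside `n`. -/
lemma exists_card_galois_le (A : Type*) [CommGroup A] [Finite A] : ∃ C : ℕ, ∀ n : ℕ, n ≠ 0 →
    ∀ s : Finset Fld, (∀ L ∈ s, FiniteDimensional ℚ L ∧ IsGalois ℚ L ∧
      Nonempty (Gal(L/ℚ) ≃* A) ∧ ∀ p, p.Prime → p ∣ absDisc L → p ∣ n) →
    #s ≤ C * Nat.card A ^ #n.primeFactors := by
  set m := Nat.card A with hm
  have hm0 : m ≠ 0 := Nat.card_pos.ne'
  set B := (m * m * m) ^ (m * m)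
  set 𝓕 := finite_hom_of_absDisc_le A B
  refine ⟨#𝓕.toFinset, fun n hn s hs => ?_⟩
  have hX : ∀ L : s, ∃ X : Gal(Qbar/ℚ) →* A, X.ker = (L : Fld).fixingSubgroup := fun L =>
    have := (hs L L.2).2.1
    (exists_hom_ker_eq L.1 (hs L L.2).2.2.1).imp fun _ h => h.1
  choose X hXk using hX
  have hfd : ∀ L : s, FiniteDimensional ℚ L.1 := fun L => (hs L L.2).1
  have hgal : ∀ L : s, IsGalois ℚ L.1 := fun L => (hs L L.2).2.1
  have hdeg : ∀ L : s, finrank ℚ L.1 = m := fun L => by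
    obtain ⟨e⟩ := (hs L L.2).2.2.1
    rw [← IsGalois.card_aut_eq_finrank, Nat.card_congr e.toEquiv]
  have hnor : ∀ L : s, @Normal ℚ L.1 _ _ L.1.algebra' := fun L => (hgal L).to_normal
  set M : Fld := ⨆ L : s, L.1 with hM
  have : FiniteDimensional ℚ M := finiteDimensional_iSup_of_finite
  have : Normal ℚ M := normal_iSup ℚ Qbar _
  have : IsGalois ℚ M := ⟨⟩
  have hLM : ∀ L : s, L.1 ≤ M := fun L => le_iSup (fun L : s => L.1) L
  have hpow : ∀ σ : Gal(M/ℚ), σ ^ m = 1 := fun σ => by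
    obtain ⟨g, rfl⟩ := AlgEquiv.restrictNormalHom_surjective (K₁ := M) Qbar σ
    rw [← map_pow, ← MonoidHom.mem_ker, ker_restrictNormalHom, ← Subgroup.zpowers_le, ← le_iff_le]
    refine iSup_le fun L => ?_
    rw [le_iff_le, Subgroup.zpowers_le, ← hXk, MonoidHom.mem_ker, map_pow, hm, pow_card_eq_one']
  have hgen := fun (p : ℕ) (hp : p.Prime) (hpm : ¬ p ∣ m) => exists_inertia_generator M hpow hp hpm
  let γ : ℕ → Gal(Qbar/ℚ) := fun p => if h : p.Prime ∧ ¬ p ∣ m then (hgen p h.1 h.2).choose else 1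
  have hγ : ∀ p, p.Prime → ¬ p ∣ m → ∀ L ≤ M, IsGalois ℚ L →
      (¬ p ∣ absDisc L ↔ γ p ∈ L.fixingSubgroup) := fun p hp hpm => by
    have := (hgen p hp hpm).choose_spec
    simpa only [γ, dif_pos (And.intro hp hpm)] using this
  have key : ∀ L L' : s, (∀ p ∈ n.primeFactors, X L (γ p) = X L' (γ p)) →
      X L / X L' ∈ 𝓕.toFinset := fun L L' h => by
    set Ψ := X L / X L'
    have hle : (L.1 ⊔ L'.1).fixingSubgroup ≤ Ψ.ker := by
      rw [fixingSubgroup_sup, ← hXk, ← hXk]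
      rintro g ⟨h1, h2⟩
      replace h1 := MonoidHom.mem_ker.1 h1
      replace h2 := MonoidHom.mem_ker.1 h2
      rw [MonoidHom.mem_ker, MonoidHom.div_apply, h1, h2, div_one]
    have hfd' : FiniteDimensional ℚ ↥(L.1 ⊔ L'.1) := inferInstance
    have hcl : IsClosed (Ψ.ker : Set Gal(Qbar/ℚ)) :=
      Subgroup.isClosed_of_isOpen _ (Subgroup.isOpen_mono hle (fixingSubgroup_isOpen _))
    set N := fixedField Ψ.ker
    have hN : N.fixingSubgroup = Ψ.ker := InfiniteGalois.fixingSubgroup_fixedField ⟨Ψ.ker, hcl⟩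
    have hNL : N ≤ L.1 ⊔ L'.1 := by
      rw [← InfiniteGalois.fixedField_fixingSubgroup (L.1 ⊔ L'.1)]
      exact fixedField_antitone hle
    have : FiniteDimensional ℚ N := Submodule.finiteDimensional_of_le (S₂ := (L.1 ⊔ L'.1).toSubmodule)
      (S₁ := N.toSubmodule) hNL
    have hNg : IsGalois ℚ N := (InfiniteGalois.normal_iff_isGalois N).1 (by
      rw [hN]
      infer_instance)
    have hNd : finrank ℚ N ≤ m * m := by
      refine (Submodule.finrank_mono (s := N.toSubmodule) (t := (L.1 ⊔ L'.1).toSubmodule)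
        hNL).trans ((finrank_sup_le L.1 L'.1).trans_eq ?_)
      rw [hdeg, hdeg]
    refine 𝓕.mem_toFinset.2 ⟨N, ⟨this, absDisc_le_of_primeFactors N hm0 hNd fun p hp hpN => ?_⟩,
      hN.le⟩
    by_contra hpm
    refine (hγ p hp hpm N (hNL.trans (sup_le (hLM L) (hLM L'))) hNg).2 ?_ hpN
    rw [hN, MonoidHom.mem_ker, MonoidHom.div_apply, div_eq_one]
    by_cases hpn : p ∣ n
    · exact h p (Nat.mem_primeFactors.2 ⟨hp, hpn, hn⟩)
    · have h1 : ∀ L : s, X L (γ p) = 1 := fun L => by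
        rw [← MonoidHom.mem_ker, hXk]
        exact (hγ p hp hpm L (hLM L) (hgal L)).1 fun hd => hpn ((hs L L.2).2.2.2 p hp hd)
      rw [h1, h1]
  have hinj : Function.Injective X := fun L L' h => by
    have := hXk L
    rw [h, hXk L'] at this
    refine Subtype.ext ?_
    rw [← InfiniteGalois.fixedField_fixingSubgroup L.1, ← this,
      InfiniteGalois.fixedField_fixingSubgroup]
  have : Fintype A := Fintype.ofFinite A
  have hcard := card_le_mul_card_image_of_maps_to (s := s.attach)
    (f := fun L (p : n.primeFactors) => X L (γ p)) (t := univ) (fun _ _ => mem_univ _)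
    #𝓕.toFinset fun b _ => ?_
  · rw [card_attach, card_univ, Fintype.card_fun, Fintype.card_coe] at hcard
    rwa [hm, Nat.card_eq_fintype_card]
  · rcases eq_empty_or_nonempty {L ∈ s.attach | (fun p : n.primeFactors => X L (γ p)) = b}
      with h | ⟨L₀, h₀⟩
    · rw [h, card_empty]
      exact Nat.zero_le _
    · refine card_le_card_of_injOn (fun L => X L / X L₀) (fun L hL => ?_) fun L _ L' _ h =>
        hinj (div_left_injective h)
      have h1 := (mem_filter.1 hL).2.trans (mem_filter.1 h₀).2.symm
      exact key L L₀ fun p hp => congrFun h1 ⟨p, hp⟩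

end CountGalois

section Galois

open IntermediateField

variable {Γ A : Type*} [Group Γ] [CommGroup A]

set_option maxRecDepth 100000 in
lemma exists_conj_mul_conj : ∀ (i : Fin 3) (g : Equiv.Perm (Fin 3)),
    ∃ a b c d : Equiv.Perm (Fin 3), a i = i ∧ b i = i ∧ g = c * a * c⁻¹ * (d * b * d⁻¹) := by
  decide

lemma exists_involutions : ∀ g : Equiv.Perm (Fin 3), ∃ a b, a * a = 1 ∧ b * b = 1 ∧ g = a * b := by
  decide

lemma exists_swap_fixing : ∀ i : Fin 3, ∃ g : Equiv.Perm (Fin 3), g i = i ∧ ∀ j, g j = j → j = i := by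
  decide

lemma eq_one_or_eq_of_fixing : ∀ (i : Fin 3) (g y : Equiv.Perm (Fin 3)), g i = i → g ≠ 1 → y i = i →
    y = 1 ∨ y = g := by
  decide

lemma normalClosure_eq_ker {ψ : Γ →* Equiv.Perm (Fin 3) × A} (hψ : Function.Surjective ψ) {i : Fin 3}
    {H : Subgroup Γ} (hH : ∀ σ, σ ∈ H ↔ (ψ σ).1 i = i ∧ (ψ σ).2 = 1) (σ : Γ) :
    σ ∈ Subgroup.normalClosure (H : Set Γ) ↔ (ψ σ).2 = 1 := by
  constructor
  · intro h
    exact Subgroup.normalClosure_le_normal (N := ((MonoidHom.snd _ A).comp ψ).ker)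
      (fun σ hσ => ((hH σ).1 hσ).2) h
  · intro h
    obtain ⟨a, b, c, d, ha, hb, hg⟩ := exists_conj_mul_conj i (ψ σ).1
    obtain ⟨s, hs⟩ := hψ (a, 1)
    obtain ⟨s', hs'⟩ := hψ (b, 1)
    obtain ⟨t, ht⟩ := hψ (c, 1)
    obtain ⟨u, hu⟩ := hψ (d, 1)
    have hsH : s ∈ Subgroup.normalClosure (H : Set Γ) :=
      Subgroup.subset_normalClosure ((hH s).2 (by rw [hs]; exact ⟨ha, rfl⟩))
    have hsH' : s' ∈ Subgroup.normalClosure (H : Set Γ) :=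
      Subgroup.subset_normalClosure ((hH s').2 (by rw [hs']; exact ⟨hb, rfl⟩))
    have hn := Subgroup.normalClosure_normal (s := (H : Set Γ))
    have h1 := mul_mem (hn.conj_mem s hsH t) (hn.conj_mem s' hsH' u)
    have h2 : (t * s * t⁻¹ * (u * s' * u⁻¹))⁻¹ * σ ∈ H := by
      have : ψ ((t * s * t⁻¹ * (u * s' * u⁻¹))⁻¹ * σ) = 1 := by
        rw [map_mul, map_inv, inv_mul_eq_one, map_mul, map_mul, map_mul, map_mul, map_mul, map_inv,
          map_inv, hs, hs', ht, hu]
        exact Prod.ext hg.symm (by simp [h])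
      rw [hH, this]
      exact ⟨rfl, rfl⟩
    have h3 := mul_mem h1 (Subgroup.subset_normalClosure h2)
    rwa [mul_inv_cancel_left] at h3

lemma mem_normalizer_iff_fixes {ψ : Γ →* Equiv.Perm (Fin 3) × A} (hψ : Function.Surjective ψ)
    {i : Fin 3} {H : Subgroup Γ} (hH : ∀ σ, σ ∈ H ↔ (ψ σ).1 i = i ∧ (ψ σ).2 = 1) (σ : Γ) :
    (∀ τ, τ ∈ H ↔ σ⁻¹ * τ * σ ∈ H) ↔ (ψ σ).1 i = i := by
  constructor
  · intro h
    obtain ⟨g, hg, hj⟩ := exists_swap_fixing i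
    obtain ⟨s, hs⟩ := hψ (g, 1)
    have h1 := (hH _).1 ((h s).1 ((hH s).2 (by rw [hs]; exact ⟨hg, rfl⟩)))
    simp only [map_mul, map_inv, hs, Prod.fst_mul, Prod.fst_inv, Equiv.Perm.mul_apply,
      Equiv.Perm.inv_eq_iff_eq] at h1
    exact hj _ h1.1
  · intro h τ
    rw [hH, hH]
    simp only [map_mul, map_inv, Prod.fst_mul, Prod.fst_inv, Equiv.Perm.mul_apply,
      Equiv.Perm.inv_eq_iff_eq, h, Prod.snd_mul, Prod.snd_inv]
    simp [mul_comm]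

lemma exists_extend {F : Fld} (f : F →ₐ[ℚ] Qbar) : ∃ σ : Gal(Qbar/ℚ), ∀ x : F, σ x = f x := by
  have : Algebra.IsAlgebraic F Qbar := Algebra.IsAlgebraic.tower_top (K := ℚ) F
  obtain ⟨φ, hφ⟩ := IsAlgClosed.surjective_domRestrict_of_isAlgebraic (E := Qbar) f
  refine ⟨AlgEquiv.ofBijective φ (Algebra.IsAlgebraic.algHom_bijective φ), fun x => ?_⟩
  rw [← hφ]
  rfl

lemma nonempty_algEquiv_iff {F F' : Fld} : Nonempty (F ≃ₐ[ℚ] F') ↔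
    ∃ σ : Gal(Qbar/ℚ), ∀ τ, τ ∈ F'.fixingSubgroup ↔ σ⁻¹ * τ * σ ∈ F.fixingSubgroup := by
  have key : ∀ σ : Gal(Qbar/ℚ), ∀ τ, τ ∈ (F.map σ.toAlgHom).fixingSubgroup ↔
      σ⁻¹ * τ * σ ∈ F.fixingSubgroup := fun σ τ => by
    simp only [IntermediateField.mem_fixingSubgroup_iff, AlgEquiv.mul_apply]
    constructor
    · intro h x hx
      rw [h (σ x) ⟨x, hx, rfl⟩]
      exact σ.symm_apply_apply x
    · rintro h _ ⟨x, hx, rfl⟩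
      exact (σ.symm_apply_eq).1 (h x hx)
  constructor
  · rintro ⟨e⟩
    obtain ⟨σ, hσ⟩ := exists_extend (F'.val.comp e.toAlgHom)
    have : F.map σ.toAlgHom = F' := by
      ext y
      constructor
      · rintro ⟨x, hx, rfl⟩
        change σ x ∈ F'
        rw [hσ ⟨x, hx⟩]
        exact (e ⟨x, hx⟩).2
      · intro hy
        refine ⟨e.symm ⟨y, hy⟩, (e.symm ⟨y, hy⟩).2, ?_⟩
        refine (hσ _).trans (congrArg F'.val (e.apply_symm_apply _))
    exact ⟨σ, this ▸ key σ⟩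
  · rintro ⟨σ, hσ⟩
    have : F.map σ.toAlgHom = F' := by
      rw [← InfiniteGalois.fixedField_fixingSubgroup F',
        ← InfiniteGalois.fixedField_fixingSubgroup (F.map σ.toAlgHom)]
      congr 1
      ext τ
      rw [key, hσ]
    rw [← this]
    exact ⟨intermediateFieldMap σ F⟩

lemma fixingSubgroup_fixedField_of_le (F : Fld) [FiniteDimensional ℚ F]
    {H : Subgroup Gal(Qbar/ℚ)} (h : F.fixingSubgroup ≤ H) : (fixedField H).fixingSubgroup = H :=
  InfiniteGalois.fixingSubgroup_fixedField ⟨H, Subgroup.isClosed_of_isOpen _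
    (Subgroup.isOpen_mono h (fixingSubgroup_isOpen _))⟩

/-- The Galois action on `K` and `L` is given by the coordinates of a surjection to `S₃ × A`. -/
def GalPair (ψ : Gal(Qbar/ℚ) →* Equiv.Perm (Fin 3) × A) (i : Fin 3) (K L : Fld) : Prop :=
  Function.Surjective ψ ∧ (∀ σ, σ ∈ K.fixingSubgroup ↔ (ψ σ).1 i = i) ∧
    ∀ σ, σ ∈ L.fixingSubgroup ↔ (ψ σ).2 = 1

variable {K L K' L' : Fld} {ψ ψ' : Gal(Qbar/ℚ) →* Equiv.Perm (Fin 3) × A}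
  {i i' : Fin 3}

lemma GalPair.mem_sup (h : GalPair ψ i K L) (σ : Gal(Qbar/ℚ)) :
    σ ∈ (K ⊔ L).fixingSubgroup ↔ (ψ σ).1 i = i ∧ (ψ σ).2 = 1 := by
  rw [fixingSubgroup_sup, Subgroup.mem_inf, h.2.1, h.2.2]

lemma GalPair.nonempty_algEquiv_iff (h : GalPair ψ i K L) (h' : GalPair ψ' i' K' L') :
    Nonempty (↥(K ⊔ L) ≃ₐ[ℚ] ↥(K' ⊔ L')) ↔ L = L' ∧ Nonempty (K ≃ₐ[ℚ] K') := by
  rw [_root_.nonempty_algEquiv_iff, _root_.nonempty_algEquiv_iff]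
  constructor
  · rintro ⟨σ, hσ⟩
    have hL : ∀ τ, (ψ τ).2 = 1 → (ψ' τ).2 = 1 := fun τ => by
      rw [← normalClosure_eq_ker h.1 h.mem_sup, ← normalClosure_eq_ker h'.1 h'.mem_sup]
      have hn := Subgroup.normalClosure_normal (s := ((K' ⊔ L').fixingSubgroup : Set Gal(Qbar/ℚ)))
      refine fun hτ => Subgroup.normalClosure_le_normal (fun τ hτ => ?_) hτ
      have h1 : σ * τ * σ⁻¹ ∈ (K' ⊔ L').fixingSubgroup := by
        rw [hσ]
        simpa [mul_assoc] using hτ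
      simpa [mul_assoc] using hn.conj_mem _ (Subgroup.subset_normalClosure h1) σ⁻¹
    have hL' : ∀ τ, (ψ' τ).2 = 1 → (ψ τ).2 = 1 := fun τ => by
      rw [← normalClosure_eq_ker h.1 h.mem_sup, ← normalClosure_eq_ker h'.1 h'.mem_sup]
      have hn := Subgroup.normalClosure_normal (s := ((K ⊔ L).fixingSubgroup : Set Gal(Qbar/ℚ)))
      refine fun hτ => Subgroup.normalClosure_le_normal (fun τ hτ => ?_) hτ
      have h1 := (hσ _).1 hτ
      simpa [mul_assoc] using hn.conj_mem _ (Subgroup.subset_normalClosure h1) σ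
    refine ⟨?_, σ, fun τ => ?_⟩
    · rw [← InfiniteGalois.fixedField_fixingSubgroup L,
        ← InfiniteGalois.fixedField_fixingSubgroup L']
      congr 1
      ext τ
      rw [h.2.2, h'.2.2]
      exact ⟨hL τ, hL' τ⟩
    · rw [h.2.1, h'.2.1, ← mem_normalizer_iff_fixes h.1 h.mem_sup,
        ← mem_normalizer_iff_fixes h'.1 h'.mem_sup]
      simp only [hσ]
      constructor
      · intro H ρ
        have := H (σ * ρ * σ⁻¹)
        simpa [mul_assoc] using this
      · intro H ρ
        have := H (σ⁻¹ * ρ * σ)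
        simpa [mul_assoc] using this
  · rintro ⟨rfl, σ, hσ⟩
    refine ⟨σ, fun τ => ?_⟩
    rw [fixingSubgroup_sup, fixingSubgroup_sup, Subgroup.mem_inf, Subgroup.mem_inf, hσ, h.2.2, h.2.2]
    simp [mul_comm]

end Galois

section GaloisPair

open IntermediateField

variable {A : Type*} [CommGroup A] {K L F : Fld}
  {ψ : Gal(Qbar/ℚ) →* Equiv.Perm (Fin 3) × A} {i : Fin 3}

/-- A non-Galois cubic field. -/
def IsCubNG (K : Fld) : Prop := finrank ℚ K = 3 ∧ ¬ IsGalois ℚ K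

/-- A Galois field with group `A`. -/
def IsGalA (A : Type*) [CommGroup A] (L : Fld) : Prop :=
  FiniteDimensional ℚ L ∧ IsGalois ℚ L ∧ Nonempty (Gal(L/ℚ) ≃* A)

/-- The inclusion as a homomorphism of `ℚ`-algebras. -/
def valHom (F : Fld) : F →ₐ[ℚ] Qbar := F.val

lemma IsGalA.finrank_eq (h : IsGalA A L) : finrank ℚ L = Nat.card A := by
  obtain ⟨h1, h2, ⟨e⟩⟩ := h
  rw [← IsGalois.card_aut_eq_finrank, Nat.card_congr e.toEquiv]

lemma GalPair.isCubNG (h : GalPair ψ i K L) : IsCubNG K := by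
  have hK : K.fixingSubgroup = (MulAction.stabilizer (Equiv.Perm (Fin 3)) i).comap
      ((MonoidHom.fst _ A).comp ψ) := by
    ext σ
    rw [h.2.1]
    rfl
  constructor
  · rw [finrank_eq_fixingSubgroup_index, hK, Subgroup.index_comap_of_surjective _
      (Prod.fst_surjective.comp h.1), MulAction.index_stabilizer_of_transitive, Nat.card_fin]
  · intro hg
    have hn : K.fixingSubgroup.Normal := (InfiniteGalois.normal_iff_isGalois K).2 hg
    obtain ⟨g, hg, hj⟩ := exists_swap_fixing i
    obtain ⟨s, hs⟩ := h.1 (g, 1)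
    obtain ⟨t, ht⟩ := h.1 (Equiv.swap i (i + 1), 1)
    have h1 := (h.2.1 _).1 (hn.conj_mem s ((h.2.1 s).2 (by rw [hs]; exact hg)) t⁻¹)
    simp only [map_mul, map_inv, hs, ht, Prod.fst_mul, Prod.fst_inv, Equiv.Perm.mul_apply,
      Equiv.Perm.inv_eq_iff_eq, inv_inv, Equiv.swap_apply_left] at h1
    exact absurd (hj _ h1) (by fin_cases i <;> decide)

lemma GalPair.isGalA [Finite A] (h : GalPair ψ i K L) : IsGalA A L := by
  have hL : L.fixingSubgroup = ((MonoidHom.snd _ A).comp ψ).ker := by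
    ext σ
    rw [h.2.2]
    rfl
  have hs : Function.Surjective ((MonoidHom.snd _ A).comp ψ) := Prod.snd_surjective.comp h.1
  have hf : FiniteDimensional ℚ L := by
    refine FiniteDimensional.of_finrank_pos ?_
    rw [finrank_eq_fixingSubgroup_index, hL, Subgroup.index_ker,
      MonoidHom.range_eq_top_of_surjective _ hs, Subgroup.card_top]
    exact Nat.card_pos
  have hg : IsGalois ℚ L := (InfiniteGalois.normal_iff_isGalois L).1 (by
    rw [hL]
    infer_instance)
  refine ⟨hf, hg, ⟨?_⟩⟩
  have h1 : (AlgEquiv.restrictNormalHom L : Gal(Qbar/ℚ) →* Gal(L/ℚ)).ker =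
      ((MonoidHom.snd _ A).comp ψ).ker := by rw [ker_restrictNormalHom, hL]
  exact ((QuotientGroup.quotientKerEquivOfSurjective _
    (AlgEquiv.restrictNormalHom_surjective Qbar)).symm.trans
    (QuotientGroup.quotientMulEquivOfEq h1)).trans (QuotientGroup.quotientKerEquivOfSurjective _ hs)

lemma IsS3xAField.exists_galPair [Fintype A] (h : IsS3xAField A F) :
    ∃ (ψ : Gal(Qbar/ℚ) →* Equiv.Perm (Fin 3) × A) (i : Fin 3) (K L : Fld),
      GalPair ψ i K L ∧ F = K ⊔ L := by
  obtain ⟨hd, e, φ, hφ⟩ := h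
  have : FiniteDimensional ℚ F := FiniteDimensional.of_finrank_pos (by
    rw [hd]
    exact Nat.mul_pos (by norm_num) Fintype.card_pos)
  set ψ := φ.symm.toMonoidHom.comp (galPermHom F).rangeRestrict with hψ
  have hs : Function.Surjective ψ := φ.symm.surjective.comp (galPermHom F).rangeRestrict_surjective
  have hact : ∀ σ, e (galPerm F σ (valHom F)) = ((ψ σ).1 (e (valHom F)).1, (ψ σ).2 * (e (valHom F)).2) := by
    intro σ
    rw [← hφ]
    congr 2
    have : φ (ψ σ) = (galPermHom F).rangeRestrict σ := φ.apply_symm_apply _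
    rw [this]
    rfl
  have hF : ∀ σ, σ ∈ F.fixingSubgroup ↔ (ψ σ).1 (e (valHom F)).1 = (e (valHom F)).1 ∧ (ψ σ).2 = 1 := by
    intro σ
    have h1 : σ ∈ F.fixingSubgroup ↔ galPerm F σ (valHom F) = valHom F := by
      rw [IntermediateField.mem_fixingSubgroup_iff, AlgHom.ext_iff]
      exact ⟨fun h x => h x x.2, fun h x hx => h ⟨x, hx⟩⟩
    rw [h1, ← e.injective.eq_iff, hact, Prod.ext_iff]
    simp
  have hK := fixingSubgroup_fixedField_of_le F (H := (MulAction.stabilizer (Equiv.Perm (Fin 3))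
    (e (valHom F)).1).comap ((MonoidHom.fst _ A).comp ψ)) fun σ hσ => ((hF σ).1 hσ).1
  have hL := fixingSubgroup_fixedField_of_le F (H := ((MonoidHom.snd _ A).comp ψ).ker)
    fun σ hσ => ((hF σ).1 hσ).2
  have hp : GalPair ψ (e (valHom F)).1 (fixedField ((MulAction.stabilizer (Equiv.Perm (Fin 3))
    (e (valHom F)).1).comap ((MonoidHom.fst _ A).comp ψ)))
    (fixedField ((MonoidHom.snd _ A).comp ψ).ker) := by
    refine ⟨hs, fun σ => ?_, fun σ => ?_⟩
    · rw [hK]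
      rfl
    · rw [hL]
      rfl
  have hF' : F.fixingSubgroup = (fixedField ((MulAction.stabilizer (Equiv.Perm (Fin 3))
      (e (valHom F)).1).comap ((MonoidHom.fst _ A).comp ψ)) ⊔
      fixedField ((MonoidHom.snd _ A).comp ψ).ker).fixingSubgroup := by
    ext σ
    rw [hF, hp.mem_sup]
  refine ⟨ψ, _, _, _, hp, (InfiniteGalois.fixedField_fixingSubgroup F).symm.trans ?_⟩
  rw [hF', InfiniteGalois.fixedField_fixingSubgroup]

lemma GalPair.isS3xAField [Fintype A] (h : GalPair ψ i K L) : IsS3xAField A (K ⊔ L) := by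
  have := h.isGalA.1
  have h3 := h.isCubNG.1
  have : FiniteDimensional ℚ K := FiniteDimensional.of_finrank_pos (by omega)
  choose ext hext using fun f : ↥(K ⊔ L) →ₐ[ℚ] Qbar => exists_extend f
  have heq : ∀ σ τ : Gal(Qbar/ℚ), (∀ x : ↥(K ⊔ L), σ x = τ x) ↔
      (ψ σ).1 i = (ψ τ).1 i ∧ (ψ σ).2 = (ψ τ).2 := fun σ τ => by
    have h1 : (∀ x : ↥(K ⊔ L), σ x = τ x) ↔ τ⁻¹ * σ ∈ (K ⊔ L).fixingSubgroup := by
      rw [IntermediateField.mem_fixingSubgroup_iff]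
      exact ⟨fun h x hx => (AlgEquiv.symm_apply_eq τ).2 (h ⟨x, hx⟩),
        fun h x => (AlgEquiv.symm_apply_eq τ).1 (h x x.2)⟩
    rw [h1, h.mem_sup]
    simp only [map_mul, map_inv, Prod.fst_mul, Prod.fst_inv, Equiv.Perm.mul_apply,
      Equiv.Perm.inv_eq_iff_eq, Prod.snd_mul, Prod.snd_inv, inv_mul_eq_one]
    exact and_congr_right fun _ => eq_comm
  let E : (↥(K ⊔ L) →ₐ[ℚ] Qbar) → Fin 3 × A := fun f => ((ψ (ext f)).1 i, (ψ (ext f)).2)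
  have hE : ∀ f (σ : Gal(Qbar/ℚ)), (∀ x : ↥(K ⊔ L), σ x = f x) → E f = ((ψ σ).1 i, (ψ σ).2) :=
    fun f σ hσ => Prod.ext_iff.2 ((heq _ σ).1 fun x => by rw [hext, hσ])
  have hbij : Function.Bijective E := by
    constructor
    · intro f g hfg
      ext x
      rw [← hext, ← hext, (heq _ _).2 (Prod.ext_iff.1 hfg)]
    · rintro ⟨j, a⟩
      obtain ⟨σ, hσ⟩ := h.1 (Equiv.swap i j, a)
      refine ⟨σ.toAlgHom.comp (valHom (K ⊔ L)), ?_⟩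
      rw [hE _ σ fun x => rfl, hσ]
      simp
  let e := Equiv.ofBijective E hbij
  have he : ∀ σ f, e (galPerm _ σ f) = ((ψ σ).1 (e f).1, (ψ σ).2 * (e f).2) := fun σ f => by
    refine (hE _ (σ * ext f) fun x => ?_).trans (by rw [map_mul]; rfl)
    rw [AlgEquiv.mul_apply, hext]
    rfl
  refine ⟨?_, e, ?_⟩
  · rw [← AlgHom.card ℚ _ Qbar, Fintype.card_congr e, Fintype.card_prod, Fintype.card_fin]
  · let T : Equiv.Perm (Fin 3) × A →* Equiv.Perm (↥(K ⊔ L) →ₐ[ℚ] Qbar) :=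
      { toFun := fun g => (e.trans (g.1.prodCongr (Equiv.mulLeft g.2))).trans e.symm
        map_one' := by ext1 f; simp
        map_mul' := fun g g' => by ext1 f; simp [Prod.map] }
    have hT : ∀ g f, e (T g f) = (g.1 (e f).1, g.2 * (e f).2) := fun g f => e.apply_symm_apply _
    have hinj : Function.Injective T := fun g g' hg => by
      have h1 : ∀ x : Fin 3 × A, (g.1 x.1, g.2 * x.2) = (g'.1 x.1, g'.2 * x.2) := fun x => by
        have := hT g (e.symm x)
        rw [hg, hT, e.apply_symm_apply] at this
        exact this.symm
      refine Prod.ext (Equiv.ext fun j => (Prod.ext_iff.1 (h1 (j, 1))).1) ?_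
      simpa using (Prod.ext_iff.1 (h1 (0, 1))).2
    have hTψ : ∀ σ, T (ψ σ) = galPermHom (K ⊔ L) σ := fun σ =>
      Equiv.ext fun f => e.injective (by rw [hT]; exact (he σ f).symm)
    have hr : T.range = (galPermHom (K ⊔ L)).range := by
      ext x
      constructor
      · rintro ⟨g, rfl⟩
        obtain ⟨σ, rfl⟩ := h.1 g
        exact ⟨σ, (hTψ σ).symm⟩
      · rintro ⟨σ, rfl⟩
        exact ⟨ψ σ, hTψ σ⟩
    exact ⟨(MonoidHom.ofInjective hinj).trans (MulEquiv.subgroupCongr hr), hT⟩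

lemma exists_galPair [Fintype A] (hA : Odd (Fintype.card A)) (hK : IsCubNG K) (hL : IsGalA A L) :
    ∃ (ψ : Gal(Qbar/ℚ) →* Equiv.Perm (Fin 3) × A) (i : Fin 3), GalPair ψ i K L := by
  obtain ⟨h3, hng⟩ := hK
  have : FiniteDimensional ℚ K := FiniteDimensional.of_finrank_pos (by omega)
  have := hL.2.1
  obtain ⟨X, hX, hXs⟩ := exists_hom_ker_eq L hL.2.2
  have hc : Fintype.card (K →ₐ[ℚ] Qbar) = 3 := by rw [AlgHom.card, h3]
  let e := Fintype.equivFinOfCardEq hc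
  let P : Gal(Qbar/ℚ) →* Equiv.Perm (Fin 3) := e.permCongrHom.toMonoidHom.comp (galPermHom K)
  have hP : ∀ σ f, P σ (e f) = e (galPerm K σ f) := fun σ f =>
    congrArg (fun g => e (galPerm K σ g)) (e.symm_apply_apply f)
  have hfix : ∀ σ, σ ∈ K.fixingSubgroup ↔ P σ (e (valHom K)) = e (valHom K) := fun σ => by
    rw [hP, e.injective.eq_iff, IntermediateField.mem_fixingSubgroup_iff, AlgHom.ext_iff]
    exact ⟨fun h x => h x x.2, fun h x hx => h ⟨x, hx⟩⟩
  have htr : ∀ j, ∃ σ, P σ (e (valHom K)) = j := fun j => by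
    obtain ⟨σ, hσ⟩ := exists_extend (e.symm j)
    refine ⟨σ, ?_⟩
    rw [hP, ← Equiv.eq_symm_apply]
    exact AlgHom.ext hσ
  obtain ⟨s, hs, hs1⟩ : ∃ s, P s (e (valHom K)) = e (valHom K) ∧ P s ≠ 1 := by
    by_contra! hcon
    refine hng ((InfiniteGalois.normal_iff_isGalois K).1 ?_)
    have : K.fixingSubgroup = P.ker := by
      ext σ
      rw [hfix, MonoidHom.mem_ker]
      exact ⟨hcon σ, fun h => by rw [h]; rfl⟩
    rw [this]
    infer_instance
  have hPs : Function.Surjective P := fun x => by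
    obtain ⟨t, ht⟩ := htr (x (e (valHom K)))
    have h1 : ((P t)⁻¹ * x) (e (valHom K)) = e (valHom K) := by
      rw [Equiv.Perm.mul_apply, Equiv.Perm.inv_eq_iff_eq, ht]
    rcases eq_one_or_eq_of_fixing _ _ _ hs hs1 h1 with h2 | h2
    · exact ⟨t, (inv_mul_eq_one.1 h2)⟩
    · exact ⟨t * s, by rw [map_mul, ← h2, mul_inv_cancel_left]⟩
  have hinv : ∀ x : Equiv.Perm (Fin 3), x * x = 1 → ∃ σ, (P.prod X) σ = (x, 1) := fun x hx => by
    obtain ⟨σ, hσ⟩ := hPs x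
    obtain ⟨k, hk⟩ := hA
    refine ⟨σ ^ Fintype.card A, Prod.ext ?_ ?_⟩
    · rw [map_pow, Prod.pow_fst, MonoidHom.prod_apply, hσ, hk, pow_succ, pow_mul, pow_two, hx,
        one_pow, one_mul]
    · rw [map_pow, Prod.pow_snd, pow_card_eq_one]
  refine ⟨P.prod X, e (valHom K), fun ⟨x, a⟩ => ?_, hfix, fun σ => ?_⟩
  · obtain ⟨t, ht⟩ := hXs a
    obtain ⟨y, z, hy, hz, hyz⟩ := exists_involutions (x * (P t)⁻¹)
    obtain ⟨u, hu⟩ := hinv y hy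
    obtain ⟨v, hv⟩ := hinv z hz
    refine ⟨u * v * t, ?_⟩
    rw [map_mul, map_mul, hu, hv]
    refine Prod.ext ?_ ?_
    · change y * z * P t = x
      rw [← hyz, inv_mul_cancel_right]
    · change 1 * 1 * X t = a
      rw [ht, one_mul, one_mul]
  · rw [← hX]
    rfl

end GaloisPair

section Admissible

variable {A : Type*} [CommGroup A] [Fintype A] {K L : Fld}
  {Z : ℝ}

variable (A) in
/-- `f` is a reduced index form of a non-Galois cubic field whose compositum with the `A`-field `L`
has discriminant at most `Z ^ |A|`. -/
def Adm (Z : ℝ) (f : Form) (L : Fld) : Prop :=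
  CRed ⟬f⟭ ∧ IsGalA A L ∧ ∃ K : Fld, IsCubNG K ∧ IsIdx f K ∧
    (absDisc (K ⊔ L) : ℝ) ≤ Z ^ Fintype.card A

lemma sred_neg_iff : SRed (fun i => -f i) ↔ SRed f := by
  have h : fdisc (fun i => -f i) = fdisc f := by simp only [fdisc]; ring
  have h' : matB (fun i => -f i) = matB f := by simp only [matB]; ring
  simp [SRed, h, h', hesA, hesB, hesC, matA, matC]

lemma IsCubNG.numberField (h : IsCubNG K) : NumberField K :=
  have : FiniteDimensional ℚ K := FiniteDimensional.of_finrank_pos (by rw [h.1]; norm_num)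
  ⟨⟩

lemma IsGalA.finrank (h : IsGalA A L) : finrank ℚ L = Fintype.card A := by
  rw [h.finrank_eq, Nat.card_eq_fintype_card]

lemma IsCubNG.finrank_sup (hA : Odd (Fintype.card A)) (hK : IsCubNG K) (hL : IsGalA A L) :
    finrank ℚ ↥(K ⊔ L) = 3 * Fintype.card A := by
  obtain ⟨ψ, i, h⟩ := exists_galPair hA hK hL
  exact h.isS3xAField.1

lemma IsCubNG.numberField_sup (hA : Odd (Fintype.card A)) (hK : IsCubNG K) (hL : IsGalA A L) :
    NumberField ↥(K ⊔ L) :=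
  have : FiniteDimensional ℚ ↥(K ⊔ L) := FiniteDimensional.of_finrank_pos (by
    rw [hK.finrank_sup hA hL]
    exact Nat.mul_pos (by norm_num) Fintype.card_pos)
  ⟨⟩

lemma Adm.irrF (h : Adm A Z f L) : IrrF f := by
  obtain ⟨-, -, K, h3, h, -⟩ := h
  have := h3.numberField
  exact h.irrF

lemma Adm.one_le_and_abs_fdisc_le (hA : Odd (Fintype.card A)) (h : Adm A Z f L) :
    1 ≤ |Δ f| ∧ (0 ≤ Z → |Δ f| ≤ Z) := by
  obtain ⟨-, hL, K, hK, hf, h⟩ := h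
  have := hL.1
  obtain ⟨c, hc, -, H⟩ := exists_localFactor L
  rw [H K f hK.1 (by rw [hK.finrank_sup hA hL, hL.finrank]) hf, hL.finrank] at h
  constructor
  · have := hK.numberField
    rw [← hf.discr hK.1]
    exact_mod_cast Int.one_le_abs (NumberField.discr_ne_zero K)
  · exact fun hZ => le_of_pow_le_pow_left₀ Fintype.card_ne_zero hZ
      ((le_mul_of_one_le_right (by positivity) (hc f)).trans h)

lemma finite_adm (hA : Odd (Fintype.card A)) (hZ : 1 ≤ Z) :
    {p : Form × Fld | Adm A Z p.1 p.2}.Finite := by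
  obtain ⟨c, -, h⟩ := exists_card_env_total one_pos
  refine ((Set.finite_of_forall_card_le (S := {f | (CRed ⟬f⟭) ∧ IrrF f ∧
    |Δ f| ≤ Z}) (N := c * Z ^ (1 + 1 : ℝ)) fun s hs => ?_).1.prod
      (finite_absDisc_le ⌊Z ^ Fintype.card A⌋₊)).subset ?_
  · exact h Z s hZ fun f hf => exists_envB (hs f hf).1 (hs f hf).2.1 (hs f hf).2.2
  · rintro ⟨f, L⟩ h
    have h0 : Adm A Z f L := h
    refine ⟨⟨h0.1, h0.irrF, (h0.one_le_and_abs_fdisc_le hA).2 (by linarith)⟩, h0.2.1.1,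
      Nat.le_floor (le_trans ?_ h0.2.2.choose_spec.2.2)⟩
    obtain ⟨hK, -, -⟩ := h0.2.2.choose_spec
    set K := h0.2.2.choose
    have hL := h0.2.1
    have := hL.1
    have : NumberField L := ⟨⟩
    have h1 := hK.finrank_sup hA hL
    have := hK.numberField_sup hA hL
    obtain ⟨d, hd⟩ := exists_tower (le_sup_right : L ≤ K ⊔ L)
    rw [h1, hL.finrank, Nat.mul_div_cancel _ Fintype.card_pos] at hd
    have h2 := absDisc_pos (K ⊔ L)
    rw [hd] at h2 ⊢
    exact_mod_cast (Nat.le_self_pow (by norm_num) _).trans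
      (Nat.le_mul_of_pos_left _ (Nat.pos_of_mul_pos_right h2))

lemma abs_NS3A_sub_le (hA : Odd (Fintype.card A)) (hZ : 1 ≤ Z) :
    |(NS3A A (Z ^ Fintype.card A) : ℝ) - 1 / 2 *
      ({p : Form × Fld | Adm A Z p.1 p.2 ∧ SRed p.1}.ncard : ℝ)| ≤
    ({p : Form × Fld | Adm A Z p.1 p.2 ∧ ¬ SRed p.1}.ncard : ℝ) := by
  set T := (finite_adm hA hZ).toFinset with hT
  have hmem : ∀ p, p ∈ T ↔ Adm A Z p.1 p.2 := fun p => Set.Finite.mem_toFinset _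
  have hc : ∀ P : Form → Prop, {p : Form × Fld |
      Adm A Z p.1 p.2 ∧ P p.1}.ncard = (T.filter fun p => P p.1).card := fun P => by
    rw [← Set.ncard_coe_finset]
    congr 1
    ext p
    simp [hmem]
  have hc' : {p : Form × Fld | Adm A Z p.1 p.2 ∧ ¬ SRed p.1}.ncard =
      (T.filter fun p => ¬ SRed p.1).card := by convert hc fun f => ¬ SRed f
  rw [hc SRed, hc']
  have hK : ∀ p : Form × Fld, ∃ K : Fld,
      p ∈ T → IsCubNG K ∧ IsIdx p.1 K ∧ (absDisc (K ⊔ p.2) : ℝ) ≤ Z ^ Fintype.card A := fun p => by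
    by_cases h : p ∈ T
    · obtain ⟨-, -, K, h⟩ := (hmem p).1 h
      exact ⟨K, fun _ => h⟩
    · exact ⟨⊥, fun h' => absurd h' h⟩
  choose κ hκ using hK
  let Ψ : Form × Fld → Quotient isoSetoid := fun p => Quotient.mk isoSetoid (κ p ⊔ p.2)
  have hL : ∀ p ∈ T, IsGalA A p.2 := fun p hp => ((hmem p).1 hp).2.1
  have hiso : ∀ {K K' L L' : Fld}, IsCubNG K → IsCubNG K' → IsGalA A L →
      IsGalA A L' → (Quotient.mk isoSetoid (K ⊔ L) = Quotient.mk isoSetoid (K' ⊔ L') ↔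
        L = L' ∧ Nonempty (K ≃ₐ[ℚ] K')) := fun {K K' L L'} h1 h2 h3 h4 => by
    obtain ⟨ψ, i, h⟩ := exists_galPair hA h1 h3
    obtain ⟨ψ', i', h'⟩ := exists_galPair hA h2 h4
    rw [← h.nonempty_algEquiv_iff h']
    exact Quotient.eq (r := isoSetoid)
  have hN : NS3A A (Z ^ Fintype.card A) = (T.image Ψ).card := by
    let S := {F : Fld // IsS3xAField A F ∧ (absDisc F : ℝ) ≤ Z ^ Fintype.card A}
    let j : Quotient (Setoid.comap (Subtype.val : S → _) isoSetoid) → Quotient isoSetoid :=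
      Quotient.lift (fun F => Quotient.mk isoSetoid F.1)
        fun F F' h => Quotient.sound (s := isoSetoid) h
    have hj : Function.Injective j := by
      rintro ⟨F⟩ ⟨F'⟩ h
      exact Quotient.sound (s := Setoid.comap _ isoSetoid) (Quotient.exact (s := isoSetoid) h)
    have hr : Set.range j = ↑(T.image Ψ) := by
      ext q
      rw [mem_coe, mem_image]
      constructor
      · rintro ⟨⟨F, hF, hd⟩, rfl⟩
        obtain ⟨ψ, i, K, L, h, rfl⟩ := hF.exists_galPair
        have h3 := h.isCubNG
        have := h3.numberField
        obtain ⟨f, hf, hr⟩ := exists_idx_cred h3.1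
        have hT : (f, L) ∈ T := (hmem _).2 ⟨hr, h.isGalA, K, h3, hf, hd⟩
        obtain ⟨h4, h5, -⟩ := hκ _ hT
        have := h4.numberField
        exact ⟨(f, L), hT, (hiso h4 h3 h.isGalA h.isGalA).2
          ⟨rfl, h5.nonempty_algEquiv hf h4.1 h3.1⟩⟩
      · rintro ⟨p, hp, rfl⟩
        obtain ⟨h4, h5, h6⟩ := hκ _ hp
        obtain ⟨ψ, i, h⟩ := exists_galPair hA h4 (hL p hp)
        exact ⟨Quotient.mk _ ⟨_, h.isS3xAField, h6⟩, rfl⟩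
    rw [← Set.ncard_coe_finset, ← hr]
    exact Nat.card_congr (Equiv.ofInjective j hj)
  have h2 : (T.filter fun p => SRed p.1).card =
      2 * ((T.filter fun p => SRed p.1).image Ψ).card := by
    rw [card_eq_sum_card_image Ψ, sum_const_nat (m := 2), mul_comm]
    intro q hq
    obtain ⟨p, hp, rfl⟩ := mem_image.1 hq
    obtain ⟨hp, hs⟩ := mem_filter.1 hp
    obtain ⟨h4, h5, h6⟩ := hκ _ hp
    have := h4.numberField
    have hs' := sred_neg_iff.2 hs
    have hn : ((fun i => -p.1 i, p.2) : Form × Fld) ∈ T :=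
      (hmem _).2 ⟨((sred_intCast _).2 hs').cRed, hL p hp, κ p, h4, h5.neg, h6⟩
    rw [show filter (fun a => Ψ a = Ψ p) (T.filter fun p => SRed p.1) =
      {p, (fun i => -p.1 i, p.2)} from ?_, card_pair]
    · intro h
      refine hs.fdisc_ne_zero ?_
      have h7 : ∀ i, p.1 i = 0 := fun i => by
        have := congrFun (congrArg Prod.fst h) i
        dsimp at this
        omega
      simp [fdisc, h7]
    · ext r
      simp only [mem_filter, mem_insert, mem_singleton]
      constructor
      · rintro ⟨⟨hr, hrs⟩, he⟩
        obtain ⟨h7, h8, -⟩ := hκ _ hr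
        have := h7.numberField
        obtain ⟨h9, ⟨e⟩⟩ := (hiso h7 h4 (hL r hr) (hL p hp)).1 he
        refine (h5.eq_or_eq_neg (h8.of_algEquiv e) ((sred_intCast _).2 hs)
          ((sred_intCast _).2 hrs)).imp (fun h => Prod.ext h h9) fun h => Prod.ext h h9
      · rintro (rfl | rfl)
        · exact ⟨⟨hp, hs⟩, rfl⟩
        · obtain ⟨h7, h8, -⟩ := hκ _ hn
          have := h7.numberField
          exact ⟨⟨hn, hs'⟩, (hiso h7 h4 (hL p hp) (hL p hp)).2
            ⟨rfl, h8.nonempty_algEquiv h5.neg h7.1 h4.1⟩⟩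
  have h3 : T.image Ψ = (T.filter fun p => SRed p.1).image Ψ ∪
      (T.filter fun p => ¬ SRed p.1).image Ψ := by
    rw [← image_union, filter_union_filter_not_eq]
  have h4 : ((T.filter fun p => SRed p.1).image Ψ).card ≤ (T.image Ψ).card :=
    card_le_card (by rw [h3]; exact subset_union_left)
  have h5 : (T.image Ψ).card ≤ ((T.filter fun p => SRed p.1).image Ψ).card +
      (T.filter fun p => ¬ SRed p.1).card := by
    rw [h3]
    exact (card_union_le _ _).trans (Nat.add_le_add_left card_image_le _)
  rw [hN, h2]
  have h4' : (((T.filter fun p => SRed p.1).image Ψ).card : ℝ) ≤ (T.image Ψ).card := by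
    exact_mod_cast h4
  have h5' : ((T.image Ψ).card : ℝ) ≤ ((T.filter fun p => SRed p.1).image Ψ).card +
      (T.filter fun p => ¬ SRed p.1).card := mod_cast h5
  rw [Nat.cast_mul, Nat.cast_ofNat, abs_le]
  constructor <;> linarith

lemma IsIdx.isCubNG (hf : IsIdx f K) (h3 : finrank ℚ K = 3) (hs : SRed f) : IsCubNG K := by
  refine ⟨h3, fun hg => ?_⟩
  have : FiniteDimensional ℚ K := FiniteDimensional.of_finrank_pos (by omega)
  have : NumberField K := ⟨⟩
  have hc := IsGalois.card_aut_eq_finrank ℚ K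
  rw [h3] at hc
  have : Nontrivial Gal(K/ℚ) := Finite.one_lt_card_iff_nontrivial.1 (by omega)
  obtain ⟨σ, hσ⟩ := exists_ne (1 : Gal(K/ℚ))
  exact hf.not_sred_of_aut h3 σ hσ ((sred_intCast _).2 hs)

lemma exists_sred_asymp (hA : Odd (Fintype.card A)) :
    ∃ K δ : ℝ, 0 < K ∧ 0 < δ ∧ ∀ L, IsGalA A L → ∃ C : ℝ, ∀ Z : ℝ, 1 ≤ Z →
      |({f | Adm A Z f L ∧ SRed f}.ncard : ℝ) - C * Z| ≤
        K * (absDisc L : ℝ) ^ (39 * Fintype.card A) * Z ^ (1 - δ) := by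
  obtain ⟨K, δ, hK, hδ, hδ1, H⟩ := exists_maxSet_asymp
  refine ⟨K, δ, hK, hδ, fun L hL => ?_⟩
  have := hL.1
  obtain ⟨c, hc1, hc, hdisc⟩ := exists_localFactor L
  have hm : Fintype.card A ≠ 0 := Fintype.card_ne_zero
  rw [hL.finrank] at hc hdisc
  set m := Fintype.card A
  set M := absDisc L ^ (3 * m) with hM
  have hM0 : 0 < M := pow_pos (absDisc_pos L) _
  choose C hC using fun v => H M v hM0
  set t : Form → ℝ := fun w => c w ^ ((m : ℝ)⁻¹) with ht
  have ht1 : ∀ w, 1 ≤ t w := fun w => one_le_rpow (hc1 w) (by positivity)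
  have htm : ∀ w, t w ^ m = c w := fun w => rpow_inv_natCast_pow (zero_le_one.trans (hc1 w)) hm
  refine ⟨∑ w ∈ resBox M, C w / t w, fun Z hZ => ?_⟩
  have hset : ∀ w, {f | f ∈ {f | Adm A Z f L ∧ SRed f} ∧ ∀ i, (M : ℤ) ∣ f i - w i} =
      maxSet M w (Z / t w) := fun w => by
    have hd : ∀ f, (∀ i, (M : ℤ) ∣ f i - w i) → (|Δ f| ≤ Z / t w ↔
        |Δ f| ^ m * c f ≤ Z ^ m) := fun f hf => by
      rw [hc f w hf, ← htm, ← mul_pow, pow_le_pow_iff_left₀ (mul_nonneg (abs_nonneg _)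
        (zero_le_one.trans (ht1 w))) (by linarith) hm, le_div_iff₀ (zero_lt_one.trans_le (ht1 w))]
    ext f
    constructor
    · rintro ⟨⟨ha, hs⟩, hf⟩
      obtain ⟨-, -, F, hF, hi, hb⟩ := id ha
      have := hF.numberField
      rw [hdisc F f hF.1 (hF.finrank_sup hA hL) hi] at hb
      exact ⟨⟨hf, hs, ha.irrF, (hd f hf).2 hb⟩, fun p hp => hi.not_nm hF.1 hp⟩
    · rintro ⟨⟨hf, hs, hi, hb⟩, hn⟩
      obtain ⟨F, h3, hF⟩ := exists_field_of_maximal hi hn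
      have hF' := hF.isCubNG h3 hs
      refine ⟨⟨⟨((sred_intCast _).2 hs).cRed, hL, F, hF', hF, ?_⟩, hs⟩, hf⟩
      rw [hdisc F f h3 (hF'.finrank_sup hA hL) hF]
      exact (hd f hf).1 hb
  have hfin : {f | Adm A Z f L ∧ SRed f}.Finite :=
    ((finite_adm hA hZ).image Prod.fst).subset fun f hf => ⟨(f, L), hf.1, rfl⟩
  rw [ncard_eq_sum_resBox hfin hM0, sum_mul]
  push_cast
  rw [← sum_sub_distrib]
  refine (abs_sum_le_sum_abs _ _).trans ((sum_le_card_nsmul _ _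
    (K * M ^ 9 * Z ^ (1 - δ)) fun w _ => ?_).trans (le_of_eq ?_))
  · have h0 := zero_lt_one.trans_le (ht1 w)
    rw [hset, div_mul_eq_mul_div, ← mul_div_assoc']
    refine (hC w _ (by positivity)).trans (mul_le_mul_of_nonneg_left ?_ (by positivity))
    exact rpow_le_rpow (by positivity) (div_le_self (by linarith) (ht1 w)) (by linarith)
  · rw [card_resBox, nsmul_eq_mul, hM]
    push_cast
    rw [← pow_mul, ← pow_mul]
    ring

open UniqueFactorizationMonoid

lemma Adm.exists_factor (hA : Odd (Fintype.card A)) (hZ : 0 ≤ Z) (h : Adm A Z f L) :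
    ∃ q r : ℕ, q * r = radical (absDisc L) ∧ Squarefree q ∧ (q : ℤ) ∣ hesA f ∧ (q : ℤ) ∣ hesB f ∧
      |Δ f| ^ 3 * (r : ℝ) ^ 4 ≤ Z ^ 3 := by
  obtain ⟨-, hL, K, hK, hf, h⟩ := h
  have := hL.1
  have := hL.2.1
  have := hK.numberField
  have : NumberField L := ⟨⟩
  have h1 := hK.finrank_sup hA hL
  have := hK.numberField_sup hA hL
  set S := (absDisc L).primeFactors with hS
  have hpr : ∀ p ∈ S, p.Prime := fun p hp => Nat.prime_of_mem_primeFactors hp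
  set q := ∏ p ∈ S.filter fun p => TotRam p K, p with hq
  set r := ∏ p ∈ S.filter fun p => ¬ TotRam p K, p with hr
  have hqr : q * r = radical (absDisc L) := by
    rw [hq, hr, prod_filter_mul_prod_filter_not, Nat.radical_eq_prod_primeFactors]
  have hsq : Squarefree (q * r) := hqr ▸ squarefree_radical
  have hqd : ∀ z : ℤ, (∀ p ∈ S, TotRam p K → (p : ℤ) ∣ z) → (q : ℤ) ∣ z := fun z hz => by
    refine Int.natCast_dvd.2 (prod_primes_dvd _ (fun p hp => ?_) fun p hp => ?_)
    · exact (hpr p (mem_filter.1 hp).1).prime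
    · exact Int.natCast_dvd.1 (hz p (mem_filter.1 hp).1 (mem_filter.1 hp).2)
  refine ⟨q, r, hqr, hsq.of_mul_left, hqd _ fun p hp ht => (ht.dvd_hes (hpr p hp) hK.1 hf).1,
    hqd _ fun p hp ht => (ht.dvd_hes (hpr p hp) hK.1 hf).2, ?_⟩
  let _ : Algebra K ↥(K ⊔ L) := (IntermediateField.inclusion le_sup_left).toAlgebra
  let _ : Algebra L ↥(K ⊔ L) := (IntermediateField.inclusion le_sup_right).toAlgebra
  have h2 := discr_pow_mul_radical_pow_le (F := K) (E := ↥(K ⊔ L)) (L := L) hK.1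
    (by rwa [hL.finrank]) (by rw [h1, hL.finrank]) (r := r) hsq.of_mul_right fun p hp hpr' => by
      have h3 : p ∈ S.filter fun p => ¬ TotRam p K := by
        rwa [← Nat.primeFactors_prod fun p hp => hpr p (mem_filter.1 hp).1,
          Nat.mem_primeFactors_of_ne_zero hsq.of_mul_right.ne_zero, and_iff_right hp]
      obtain ⟨h4, h5⟩ := mem_filter.1 h3
      refine ⟨Int.natCast_dvd.2 ?_, h5⟩
      rw [← absDisc_eq]
      exact Nat.dvd_of_mem_primeFactors h4
  rw [← absDisc_eq (K ⊔ L), hf.discr hK.1, hL.finrank] at h2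
  have h3 : ((fdisc f).natAbs : ℝ) ^ (3 * Fintype.card A) * (r : ℝ) ^ (4 * Fintype.card A) ≤
      (absDisc (K ⊔ L) : ℝ) ^ 3 := mod_cast h2
  rw [Nat.cast_natAbs, Int.cast_abs] at h3
  refine le_of_pow_le_pow_left₀ (n := Fintype.card A) Fintype.card_ne_zero (by positivity) ?_
  rw [mul_pow, ← pow_mul, ← pow_mul, ← pow_mul, mul_comm 3 (Fintype.card A), pow_mul Z]
  refine le_trans (le_of_eq ?_) (h3.trans (pow_le_pow_left₀ (by positivity) h 3))
  ring

variable (A) in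
lemma exists_card_radical_eq (hε : 0 < ε) : ∃ c : ℝ, 0 < c ∧ ∀ n : ℕ, n ≠ 0 → ∀ s : Finset Fld,
      (∀ L ∈ s, IsGalA A L ∧ radical (absDisc L) = n) → (#s : ℝ) ≤ c * (n : ℝ) ^ ε := by
  obtain ⟨C, hC⟩ := exists_card_galois_le A
  obtain ⟨c, hc, H⟩ := exists_pow_primeFactors_le hε (Nat.card A)
  refine ⟨(C + 1) * c, by positivity, fun n hn s hs => ?_⟩
  have h1 := hC n hn s fun L hL => by
    obtain ⟨⟨h1, h2, h3⟩, h4⟩ := hs L hL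
    refine ⟨h1, h2, h3, fun p hp hd => ?_⟩
    rw [← h4]
    exact (dvd_radical_iff_of_irreducible hp (absDisc_pos L).ne').2 hd
  have h2 : (#s : ℝ) ≤ C * (Nat.card A : ℝ) ^ #n.primeFactors := mod_cast h1
  have h3 := H n hn
  have h4 : (0 : ℝ) ≤ (Nat.card A : ℝ) ^ #n.primeFactors := by positivity
  rw [mul_assoc]
  exact h2.trans (mul_le_mul (by linarith) h3 h4 (by positivity))

variable (A) in
lemma exists_card_radical_le : ∃ c : ℝ, 0 < c ∧ ∀ (Y : ℕ) (s : Finset Fld),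
      (∀ L ∈ s, IsGalA A L ∧ radical (absDisc L) ≤ Y) → (#s : ℝ) ≤ c * (Y : ℝ) ^ 2 := by
  obtain ⟨c, hc, H⟩ := exists_card_radical_eq A one_pos
  refine ⟨c, hc, fun Y s hs => ?_⟩
  rw [card_eq_sum_card_fiberwise (f := fun L => radical (absDisc L)) (t := Icc 1 Y)
    fun L hL => mem_coe.2 (mem_Icc.2 ⟨Nat.pos_of_ne_zero radical_ne_zero,
      (hs L hL).2⟩), Nat.cast_sum]
  refine (sum_le_card_nsmul _ _ (c * Y) fun n hn => ?_).trans (le_of_eq ?_)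
  · obtain ⟨h1, h2⟩ := mem_Icc.1 hn
    refine (H n (by omega) _ fun L hL => ⟨(hs L (mem_filter.1 hL).1).1,
      (mem_filter.1 hL).2⟩).trans ?_
    rw [rpow_one]
    exact mul_le_mul_of_nonneg_left (mod_cast h2) hc.le
  · rw [Nat.card_Icc, nsmul_eq_mul, Nat.add_sub_cancel]
    ring

lemma IsGalA.absDisc_le (h : IsGalA A L) :
    absDisc L ≤ (Fintype.card A * radical (absDisc L)) ^ Fintype.card A := by
  have := h.1
  have := h.2.1
  exact absDisc_le_of_primeFactors L radical_ne_zero h.finrank.le fun p hp hd =>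
    (dvd_radical_iff_of_irreducible hp (absDisc_pos L).ne').2 hd

/-- The part of the radical of `absDisc L` prime to `r` divides the Hessian of `f`, and `r`
saves a factor in the discriminant of `f`. -/
def RamSplit (Z : ℝ) (r : ℕ) (f : Form) (L : Fld) : Prop :=
  ∃ q : ℕ, q * r = radical (absDisc L) ∧ Squarefree q ∧ (q : ℤ) ∣ hesA f ∧ (q : ℤ) ∣ hesB f ∧
    |Δ f| ^ 3 * (r : ℝ) ^ 4 ≤ Z ^ 3

lemma exists_card_ramSplit_fiber (hA : Odd (Fintype.card A)) (hε : 0 < ε) :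
    ∃ c : ℝ, 0 < c ∧ ∀ (Z : ℝ) (r : ℕ) (f : Form) (s : Finset Fld),
      1 ≤ Z → (∀ L ∈ s, Adm A Z f L ∧ RamSplit Z r f L) → (#s : ℝ) ≤ c * Z ^ (3 * ε) := by
  obtain ⟨c₀, hc₀, H₀⟩ := exists_card_divisors_le hε
  obtain ⟨c₁, hc₁, H₁⟩ := exists_card_radical_eq A hε
  refine ⟨c₀ * c₁ * 9 ^ ε, by positivity, fun Z r f s hZ hs => ?_⟩
  have hZ0 : 0 < Z := by linarith
  rcases s.eq_empty_or_nonempty with rfl | ⟨L₀, hL₀⟩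
  · rw [card_empty, Nat.cast_zero]
    positivity
  obtain ⟨ha, q, -, -, -, -, hd⟩ := hs L₀ hL₀
  obtain ⟨hd1, hdZ⟩ := ha.one_le_and_abs_fdisc_le hA
  have hr : (r : ℝ) ≤ Z := by
    refine le_of_pow_le_pow_left₀ (n := 4) (by norm_num) hZ0.le ?_
    calc (r : ℝ) ^ 4 ≤ |Δ f| ^ 3 * (r : ℝ) ^ 4 :=
          le_mul_of_one_le_left (by positivity) (one_le_pow₀ hd1)
      _ ≤ Z ^ 3 := hd
      _ ≤ Z ^ 4 := pow_le_pow_right₀ hZ (by norm_num)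
  set N := (3 * fdisc f).natAbs with hN
  have hNZ : (N : ℝ) ≤ 3 * Z := by
    rw [hN, Nat.cast_natAbs]
    push_cast
    rw [abs_mul, abs_of_pos (by norm_num : (0 : ℝ) < 3)]
    linarith [hdZ hZ0.le]
  have hN0 : N ≠ 0 := by
    rw [hN, Int.natAbs_ne_zero]
    refine mul_ne_zero (by norm_num) fun h => ?_
    rw [h] at hd1
    norm_num at hd1
  have hmaps : ∀ L ∈ s, radical (absDisc L) ∈ N.divisors.image (· * r) := fun L hL => by
    obtain ⟨-, q, hq, -, h1, h2, -⟩ := hs L hL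
    refine mem_image.2 ⟨q, Nat.mem_divisors.2 ⟨Int.natCast_dvd.1 ?_, hN0⟩, hq⟩
    rw [← hes_disc]
    exact ((h1.mul_left 4).mul_right _).sub (h2.trans (dvd_pow_self _ (by norm_num)))
  rw [card_eq_sum_card_fiberwise hmaps, Nat.cast_sum]
  refine (sum_le_card_nsmul _ _ (c₁ * (3 * Z * Z) ^ ε) fun n hn => ?_).trans ?_
  · obtain ⟨q, hq, rfl⟩ := mem_image.1 hn
    rcases (s.filter fun L => radical (absDisc L) = q * r).eq_empty_or_nonempty with h | ⟨L, hL⟩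
    · rw [h, card_empty, Nat.cast_zero]
      positivity
    have h0 : q * r ≠ 0 := by
      rw [← (mem_filter.1 hL).2]
      exact radical_ne_zero
    refine (H₁ _ h0 _ fun L hL => ⟨(hs L (mem_filter.1 hL).1).1.2.1,
      (mem_filter.1 hL).2⟩).trans (mul_le_mul_of_nonneg_left ?_ hc₁.le)
    refine rpow_le_rpow (by positivity) ?_ hε.le
    push_cast
    refine mul_le_mul (le_trans ?_ hNZ) hr (by positivity) (by positivity)
    exact_mod_cast Nat.divisor_le hq
  · rw [nsmul_eq_mul]
    calc ((N.divisors.image (· * r)).card : ℝ) * (c₁ * (3 * Z * Z) ^ ε) ≤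
        (c₀ * (3 * Z) ^ ε) * (c₁ * (3 * Z * Z) ^ ε) := by
          refine mul_le_mul_of_nonneg_right ?_ (by positivity)
          refine (Nat.cast_le.2 card_image_le).trans ((H₀ N hN0).trans ?_)
          exact mul_le_mul_of_nonneg_left (rpow_le_rpow (by positivity) hNZ hε.le) (by linarith)
      _ = c₀ * c₁ * 9 ^ ε * Z ^ (3 * ε) := by
          rw [mul_mul_mul_comm, ← mul_rpow (by positivity) (by positivity),
            show 3 * Z * (3 * Z * Z) = 9 * Z ^ (3 : ℝ) by norm_cast; ring,
            mul_rpow (by norm_num) (by positivity), ← rpow_mul hZ0.le]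
          ring

lemma exists_card_ramSplit (hA : Odd (Fintype.card A)) (hε : 0 < ε) :
    ∃ c : ℝ, 0 < c ∧ ∀ (Z Y : ℝ) (r : ℕ) (s : Finset (Form × Fld)),
      1 ≤ Z → 1 ≤ Y → 1 ≤ r → (∀ p ∈ s, Adm A Z p.1 p.2 ∧ RamSplit Z r p.1 p.2 ∧
        Y < radical (absDisc p.2)) →
      (#s : ℝ) ≤ c * Z ^ (4 * ε) * (Z * Y ^ (-(1 / 3) : ℝ) + Z ^ (3 / 4 : ℝ)) * (r : ℝ)⁻¹ := by
  obtain ⟨c₀, hc₀, H₀⟩ := exists_card_ramSplit_fiber hA hε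
  obtain ⟨c₁, hc₁, H₁⟩ := exists_card_ram_tail hε
  refine ⟨c₀ * c₁, by positivity, fun Z Y r s hZ hY hr hs => ?_⟩
  have hZ0 : 0 < Z := by linarith
  have hY0 : 0 < Y := by linarith
  have hr0 : (0 : ℝ) < r := mod_cast hr
  have hr1 : (1 : ℝ) ≤ r := mod_cast hr
  rcases s.eq_empty_or_nonempty with rfl | ⟨p₀, hp₀⟩
  · rw [card_empty, Nat.cast_zero]
    positivity
  set a := (r : ℝ) ^ (1 / 3 : ℝ) with ha
  have ha1 : 1 ≤ a := one_le_rpow hr1 (by norm_num)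
  have ha3 : a ^ 3 = r := by
    rw [ha, ← rpow_natCast, ← rpow_mul hr0.le]
    norm_num
  have ha0 : 0 < a := by linarith
  set W := Z / a ^ 4 with hW
  set Q := max 1 (Y / r) with hQ
  have hdW : ∀ p ∈ s, |((fdisc p.1 : ℤ) : ℝ)| ≤ W := fun p hp => by
    obtain ⟨-, ⟨q, -, -, -, -, h⟩, -⟩ := hs p hp
    rw [hW, le_div_iff₀ (by positivity)]
    refine le_of_pow_le_pow_left₀ (n := 3) (by norm_num) hZ0.le (le_trans (le_of_eq ?_) h)
    rw [← ha3]
    ring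
  have hW1 : 1 ≤ W := ((hs p₀ hp₀).1.one_le_and_abs_fdisc_le hA).1.trans (hdW p₀ hp₀)
  have hW0 : 0 < W := by linarith
  have h1 := H₁ W Q (s.image Prod.fst) hW1 (le_max_left _ _) fun f hf => by
    obtain ⟨p, hp, rfl⟩ := mem_image.1 hf
    obtain ⟨h1, ⟨q, hq, hsq, h2, h3, -⟩, h4⟩ := hs p hp
    refine ⟨exists_envB h1.1 h1.irrF (hdW p hp), q, hsq, max_le ?_ ?_, h2, h3⟩
    · exact_mod_cast Nat.pos_of_ne_zero hsq.ne_zero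
    · rw [div_le_iff₀ hr0]
      rw [← hq] at h4
      exact_mod_cast h4.le
  set y := Y ^ (-(1 / 3) : ℝ) with hy
  have hy0 : 0 < y := by positivity
  have hQ1 : 1 / Q ≤ a * y := by
    have hu3 : (a * y) ^ 3 * (Y / r) = 1 := by
      rw [mul_pow, ha3, hy, ← rpow_natCast, ← rpow_mul hY0.le]
      norm_num
      rw [rpow_neg_one]
      field_simp
    have hu0 : 0 < a * y := by positivity
    rw [div_le_iff₀ (zero_lt_one.trans_le (le_max_left _ _))]
    rcases le_total 1 (a * y) with h | h
    · exact one_le_mul_of_one_le_of_one_le h (le_max_left _ _)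
    · rw [← hu3]
      refine mul_le_mul ?_ (le_max_right _ _) (by positivity) hu0.le
      exact pow_le_of_le_one hu0.le h (by norm_num)
  have hWZ : W ^ ε ≤ Z ^ ε := rpow_le_rpow hW0.le (div_le_self hZ0.le (one_le_pow₀ ha1)) hε.le
  have h2 : W ^ (1 + ε) / Q + W ^ (3 / 4 + ε) ≤ Z ^ ε * (Z * y + Z ^ (3 / 4 : ℝ)) * (r : ℝ)⁻¹ := by
    have h3 : W ^ (3 / 4 : ℝ) = Z ^ (3 / 4 : ℝ) * (r : ℝ)⁻¹ := by
      rw [hW, div_rpow hZ0.le (by positivity), ← ha3, ← rpow_natCast a 4,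
        ← rpow_mul ha0.le, div_eq_mul_inv]
      norm_num
    have h4 : W / Q ≤ Z * y * (r : ℝ)⁻¹ := by
      rw [div_eq_mul_one_div]
      refine (mul_le_mul_of_nonneg_left hQ1 hW0.le).trans (le_of_eq ?_)
      rw [hW, ← ha3]
      field_simp
    rw [rpow_add hW0, rpow_add hW0, rpow_one, h3]
    calc W * W ^ ε / Q + Z ^ (3 / 4 : ℝ) * (r : ℝ)⁻¹ * W ^ ε
        = W ^ ε * (W / Q + Z ^ (3 / 4 : ℝ) * (r : ℝ)⁻¹) := by ring
      _ ≤ Z ^ ε * (Z * y * (r : ℝ)⁻¹ + Z ^ (3 / 4 : ℝ) * (r : ℝ)⁻¹) := by gcongr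
      _ = _ := by ring
  have h5 : (#s : ℝ) ≤ (c₀ * Z ^ (3 * ε)) * (s.image Prod.fst).card := by
    rw [card_eq_sum_card_image Prod.fst s, Nat.cast_sum, mul_comm, ← nsmul_eq_mul]
    refine sum_le_card_nsmul _ _ _ fun f hf => ?_
    rw [← card_image_of_injOn (f := Prod.snd) fun p hp p' hp' h => Prod.ext
      ((mem_filter.1 hp).2.trans (mem_filter.1 hp').2.symm) h]
    refine H₀ Z r f _ hZ fun L hL => ?_
    obtain ⟨p, hp, rfl⟩ := mem_image.1 hL
    obtain ⟨hp', hpf⟩ := mem_filter.1 hp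
    rw [← hpf]
    exact ⟨(hs p hp').1, (hs p hp').2.1⟩
  calc (#s : ℝ) ≤ (c₀ * Z ^ (3 * ε)) * (c₁ * (Z ^ ε * (Z * y + Z ^ (3 / 4 : ℝ)) * (r : ℝ)⁻¹)) :=
        h5.trans (mul_le_mul_of_nonneg_left (h1.trans (mul_le_mul_of_nonneg_left h2 hc₁.le))
          (by positivity))
    _ = _ := by
        rw [show 4 * ε = 3 * ε + ε by ring, rpow_add hZ0]
        ring

lemma exists_card_adm_tail (hA : Odd (Fintype.card A)) (hε : 0 < ε) :
    ∃ c : ℝ, 0 < c ∧ ∀ (Z Y : ℝ) (s : Finset (Form × Fld)),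
      1 ≤ Z → 1 ≤ Y → (∀ p ∈ s, Adm A Z p.1 p.2 ∧ Y < radical (absDisc p.2)) →
      (#s : ℝ) ≤ c * Z ^ (5 * ε) * (Z * Y ^ (-(1 / 3) : ℝ) + Z ^ (3 / 4 : ℝ)) := by
  obtain ⟨c₀, hc₀, H₀⟩ := exists_card_ramSplit hA hε
  obtain ⟨c₁, hc₁, hlog⟩ := exists_log_le hε
  refine ⟨c₀ * c₁, by positivity, fun Z Y s hZ hY hs => ?_⟩
  have hZ0 : 0 < Z := by linarith
  set B := c₀ * Z ^ (4 * ε) * (Z * Y ^ (-(1 / 3) : ℝ) + Z ^ (3 / 4 : ℝ)) with hB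
  have hB0 : 0 ≤ B := by positivity
  have h1 : s ⊆ (Icc 1 ⌊Z⌋₊).biUnion fun r => s.filter fun p => RamSplit Z r p.1 p.2 := by
    intro p hp
    obtain ⟨ha, hY⟩ := hs p hp
    obtain ⟨q, r, hqr, hsp⟩ := ha.exists_factor hA hZ0.le
    have hd1 := (ha.one_le_and_abs_fdisc_le hA).1
    refine mem_biUnion.2 ⟨r, mem_Icc.2 ⟨Nat.pos_of_ne_zero fun h => ?_,
      Nat.le_floor ?_⟩, mem_filter.2 ⟨hp, q, hqr, hsp⟩⟩
    · rw [h, mul_zero] at hqr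
      exact radical_ne_zero hqr.symm
    · refine le_of_pow_le_pow_left₀ (n := 4) (by norm_num) hZ0.le ?_
      calc (r : ℝ) ^ 4 ≤ |((fdisc p.1 : ℤ) : ℝ)| ^ 3 * (r : ℝ) ^ 4 :=
            le_mul_of_one_le_left (by positivity) (one_le_pow₀ hd1)
        _ ≤ Z ^ 3 := hsp.2.2.2
        _ ≤ Z ^ 4 := pow_le_pow_right₀ hZ (by norm_num)
  have h2 : (#s : ℝ) ≤ ∑ r ∈ Icc 1 ⌊Z⌋₊, B * (r : ℝ)⁻¹ := by
    refine (Nat.cast_le.2 ((card_le_card h1).trans card_biUnion_le)).trans ?_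
    rw [Nat.cast_sum]
    refine sum_le_sum fun r hr => H₀ Z Y r _ hZ hY (mem_Icc.1 hr).1 fun p hp => ?_
    obtain ⟨hp, h⟩ := mem_filter.1 hp
    exact ⟨(hs p hp).1, h, (hs p hp).2⟩
  have h3 := harmonic_floor_le_one_add_log Z hZ
  rw [harmonic_eq_sum_Icc] at h3
  push_cast at h3
  rw [← mul_sum] at h2
  refine h2.trans ((mul_le_mul_of_nonneg_left (h3.trans (hlog Z Z hZ hZ (by linarith)))
    hB0).trans (le_of_eq ?_))
  rw [hB, show 5 * ε = 4 * ε + ε by ring, rpow_add hZ0 (4 * ε)]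
  ring

lemma exists_adm_truncated (hA : Odd (Fintype.card A)) : ∃ b K δ : ℝ, 0 < b ∧ 0 < K ∧ 0 < δ ∧
    δ ≤ 1 / 8 ∧ ∀ Y : ℕ, 1 ≤ Y → ∃ C : ℝ, ∀ (Z : ℝ), 1 ≤ Z → ∀ T : Finset (Form × Fld),
      (∀ p, p ∈ T ↔ Adm A Z p.1 p.2 ∧ radical (absDisc p.2) ≤ Y) →
      |1 / 2 * ((T.filter fun p => SRed p.1).card : ℝ) - C * Z| +
        ((T.filter fun p => ¬ SRed p.1).card : ℝ) ≤ K * ((Y : ℝ) ^ b * Z ^ (1 - δ)) := by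
  obtain ⟨K₁, δ₁, hK₁, hδ₁, H₁⟩ := exists_card_wall
  obtain ⟨K₂, δ₂, hK₂, hδ₂, H₂⟩ := exists_sred_asymp hA
  obtain ⟨c, hc, Hc⟩ := exists_card_radical_le A
  set m := Fintype.card A with hm
  set δ := min (min δ₁ δ₂) (1 / 8) with hδ
  refine ⟨(2 + m * (39 * m) : ℕ), c * (1 / 2 * (K₂ * (m ^ (m * (39 * m)) : ℕ)) + K₁), δ,
    by positivity, by positivity, lt_min (lt_min hδ₁ hδ₂) (by norm_num), min_le_right _ _,
    fun Y hY => ?_⟩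
  have hfin := Set.finite_of_forall_card_le (S := {L | IsGalA A L ∧ radical (absDisc L) ≤ Y})
    fun s hs => Hc Y s hs
  set 𝓛 := hfin.1.toFinset with h𝓛
  have hmem : ∀ L, L ∈ 𝓛 ↔ IsGalA A L ∧ radical (absDisc L) ≤ Y := fun L =>
    Set.Finite.mem_toFinset _
  have hcard : (#𝓛 : ℝ) ≤ c * (Y : ℝ) ^ 2 := Hc Y 𝓛 fun L hL => (hmem L).1 hL
  have hC : ∀ L, ∃ C : ℝ, IsGalA A L → ∀ Z : ℝ, 1 ≤ Z →
      |({f | Adm A Z f L ∧ SRed f}.ncard : ℝ) - C * Z| ≤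
        K₂ * (absDisc L : ℝ) ^ (39 * m) * Z ^ (1 - δ₂) := fun L => by
    by_cases hL : IsGalA A L
    · obtain ⟨C, h⟩ := H₂ L hL
      exact ⟨C, fun _ => h⟩
    · exact ⟨0, fun h => (hL h).elim⟩
  choose C hC using hC
  refine ⟨1 / 2 * ∑ L ∈ 𝓛, C L, fun Z hZ T hT => ?_⟩
  have hfib : ∀ P : Form → Prop, ((T.filter fun p => P p.1).card : ℝ) =
      ∑ L ∈ 𝓛, ({f | Adm A Z f L ∧ P f}.ncard : ℝ) := fun P => by
    rw [card_eq_sum_card_fiberwise (f := Prod.snd) (t := 𝓛) fun p hp => by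
      obtain ⟨h1, h2⟩ := (hT p).1 (mem_filter.1 hp).1
      exact (hmem _).2 ⟨h1.2.1, h2⟩, Nat.cast_sum]
    refine sum_congr rfl fun L hL => ?_
    rw [← card_image_of_injOn (f := Prod.fst) fun p hp p' hp' h => Prod.ext h
      ((mem_filter.1 hp).2.trans (mem_filter.1 hp').2.symm), ← Set.ncard_coe_finset]
    congr 2
    ext f
    simp only [coe_image, coe_filter, mem_filter, Set.mem_image, Set.mem_setOf_eq, hT]
    constructor
    · rintro ⟨p, ⟨⟨h1, h2⟩, rfl⟩, rfl⟩
      exact ⟨h1.1, h2⟩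
    · rintro ⟨h1, h2⟩
      exact ⟨(f, L), ⟨⟨⟨h1, ((hmem L).1 hL).2⟩, h2⟩, rfl⟩, rfl⟩
  have hZδ : ∀ {d : ℝ}, δ ≤ d → Z ^ (1 - d) ≤ Z ^ (1 - δ) := fun h =>
    rpow_le_rpow_of_exponent_le hZ (by linarith)
  have hs : |((T.filter fun p => SRed p.1).card : ℝ) - (∑ L ∈ 𝓛, C L) * Z| ≤
      #𝓛 * (K₂ * (m ^ (m * (39 * m)) : ℕ) * (Y : ℝ) ^ (m * (39 * m)) * Z ^ (1 - δ)) := by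
    rw [hfib, sum_mul, ← sum_sub_distrib, ← nsmul_eq_mul]
    refine (abs_sum_le_sum_abs _ _).trans (sum_le_card_nsmul _ _ _ fun L hL => ?_)
    obtain ⟨h1, h2⟩ := (hmem L).1 hL
    refine (hC L h1 Z hZ).trans ?_
    have h3 : (absDisc L : ℝ) ^ (39 * m) ≤ (m ^ (m * (39 * m)) : ℕ) * (Y : ℝ) ^ (m * (39 * m)) := by
      have h4 := Nat.pow_le_pow_left (h1.absDisc_le.trans
        (Nat.pow_le_pow_left (Nat.mul_le_mul_left _ h2) _)) (39 * m)
      rw [← pow_mul, mul_pow] at h4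
      exact_mod_cast h4
    refine mul_le_mul ?_ (hZδ ((min_le_left _ _).trans (min_le_right _ _)))
      (rpow_nonneg (by linarith) _) (by positivity)
    rw [mul_assoc]
    exact mul_le_mul_of_nonneg_left h3 hK₂.le
  have hw : ((T.filter fun p => ¬ SRed p.1).card : ℝ) ≤ #𝓛 * (K₁ * Z ^ (1 - δ)) := by
    refine le_of_eq_of_le (by convert hfib fun f => ¬ SRed f) ?_
    rw [← nsmul_eq_mul]
    refine sum_le_card_nsmul _ _ _ fun L _ => ?_
    refine (Set.finite_of_forall_card_le fun s hs => (H₁ Z s hZ fun f hf => ?_).trans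
      (mul_le_mul_of_nonneg_left (hZδ ((min_le_left _ _).trans (min_le_left _ _))) hK₁.le)).2
    obtain ⟨h1, h2⟩ := hs f hf
    exact ⟨h1.1, h2, h1.irrF, (h1.one_le_and_abs_fdisc_le hA).2 (by linarith)⟩
  have hZ0 : 0 ≤ Z ^ (1 - δ) := rpow_nonneg (by linarith) _
  have hY1 : (1 : ℝ) ≤ (Y : ℝ) ^ (m * (39 * m)) := one_le_pow₀ (mod_cast hY)
  rw [mul_assoc (1 / 2 : ℝ), ← mul_sub, abs_mul, abs_of_pos (by norm_num : (0 : ℝ) < 1 / 2),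
    rpow_natCast]
  calc _ ≤ 1 / 2 * (#𝓛 * (K₂ * (m ^ (m * (39 * m)) : ℕ) * (Y : ℝ) ^ (m * (39 * m)) *
        Z ^ (1 - δ))) + #𝓛 * (K₁ * Z ^ (1 - δ) * (Y : ℝ) ^ (m * (39 * m))) := by
        refine add_le_add (by gcongr) (hw.trans ?_)
        exact mul_le_mul_of_nonneg_left (le_mul_of_one_le_right (by positivity) hY1)
          (Nat.cast_nonneg _)
    _ = #𝓛 * ((1 / 2 * (K₂ * (m ^ (m * (39 * m)) : ℕ)) + K₁) * ((Y : ℝ) ^ (m * (39 * m)) *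
        Z ^ (1 - δ))) := by ring
    _ ≤ c * (Y : ℝ) ^ 2 * ((1 / 2 * (K₂ * (m ^ (m * (39 * m)) : ℕ)) + K₁) *
        ((Y : ℝ) ^ (m * (39 * m)) * Z ^ (1 - δ))) := by gcongr
    _ = _ := by ring

lemma exists_NS3A_asymp (hA : Odd (Fintype.card A)) : ∃ C K δ : ℝ, 0 < δ ∧ ∀ Z : ℝ, 1 ≤ Z →
    |(NS3A A (Z ^ Fintype.card A) : ℝ) - C * Z| ≤ K * Z ^ (1 - δ) := by
  obtain ⟨b, K, δ, hb, hK, hδ, hδ8, H⟩ := exists_adm_truncated hA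
  obtain ⟨δ', c', hδ', -, H'⟩ := exists_asymp_of_truncated hb hδ (by norm_num : (0 : ℝ) < 1 / 3)
  have hη : 0 < 1 / 3 * δ / (4 * b) := by positivity
  set e := min (1 / 8) (1 / 3 * δ / (4 * b)) with he
  have he0 : 0 < e := lt_min (by norm_num) hη
  have he8 : e ≤ 1 / 8 := min_le_left _ _
  have heη : e ≤ 1 / 3 * δ / (4 * b) := min_le_right _ _
  obtain ⟨c, hc, Hc⟩ := exists_card_adm_tail hA (by positivity : 0 < e / 5)
  have hk : ∀ k : ℕ, 1 ≤ 2 ^ k := fun k => Nat.one_le_two_pow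
  choose C hC using fun k => H (2 ^ k) (hk k)
  obtain ⟨C₀, h₀⟩ := H' (fun Z => NS3A A (Z ^ Fintype.card A)) C (K + 2 * c) (by positivity)
    fun Z hZ k => by
      have hZ0 : 0 < Z := by linarith
      set U := (finite_adm hA hZ).toFinset with hU
      have hmem : ∀ p, p ∈ U ↔ Adm A Z p.1 p.2 := fun p => Set.Finite.mem_toFinset _
      set Q : Form × Fld → Prop := fun p => radical (absDisc p.2) ≤ 2 ^ k with hQ
      have h1 := hC k Z hZ (U.filter Q) fun p => by rw [mem_filter, hmem]
      have h2 := Hc Z (2 ^ k) (U.filter fun p => ¬ Q p) hZ (mod_cast hk k) fun p hp => by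
        obtain ⟨h3, h4⟩ := mem_filter.1 hp
        exact ⟨(hmem p).1 h3, mod_cast not_le.1 h4⟩
      have hsplit : ∀ P : Form → Prop, ({p : Form × Fld |
          Adm A Z p.1 p.2 ∧ P p.1}.ncard : ℝ) = ((U.filter Q).filter fun p => P p.1).card +
            ((U.filter fun p => ¬ Q p).filter fun p => P p.1).card := fun P => by
        rw [filter_comm, filter_comm (s := U) (p := fun p => ¬ Q p), ← Nat.cast_add,
          card_filter_add_card_filter_not, ← Set.ncard_coe_finset]
        congr 2
        ext p
        simp [hmem]
      have h3 := abs_NS3A_sub_le hA hZ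
      rw [hsplit, show ({p : Form × Fld | Adm A Z p.1 p.2 ∧
        ¬ SRed p.1}.ncard : ℝ) = ((U.filter Q).filter fun p => ¬ SRed p.1).card +
          ((U.filter fun p => ¬ Q p).filter fun p => ¬ SRed p.1).card by
            convert hsplit fun f => ¬ SRed f] at h3
      have h4 := card_filter_add_card_filter_not (s := U.filter fun p => ¬ Q p) fun p => SRed p.1
      have h4' : (((U.filter fun p => ¬ Q p).filter fun p => SRed p.1).card : ℝ) +
        ((U.filter fun p => ¬ Q p).filter fun p => ¬ SRed p.1).card =
          (U.filter fun p => ¬ Q p).card := mod_cast h4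
      have h5 : (0 : ℝ) ≤ ((U.filter fun p => ¬ Q p).filter fun p => SRed p.1).card :=
        Nat.cast_nonneg _
      have h6 : |(NS3A A (Z ^ Fintype.card A) : ℝ) - C k * Z| ≤
          K * ((2 ^ k : ℕ) ^ b * Z ^ (1 - δ)) + (U.filter fun p => ¬ Q p).card := by
        rw [abs_le] at h3 ⊢
        have h7 := neg_abs_le (1 / 2 * (((U.filter Q).filter fun p => SRed p.1).card : ℝ) - C k * Z)
        have h8 := le_abs_self (1 / 2 * (((U.filter Q).filter fun p => SRed p.1).card : ℝ) - C k * Z)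
        constructor <;> linarith
      push_cast at h6
      have hy : (1 : ℝ) ≤ ((2 : ℝ) ^ k) ^ b := one_le_rpow (one_le_pow₀ (by norm_num)) hb.le
      have h9 : Z ^ e * Z ^ (3 / 4 : ℝ) ≤ ((2 : ℝ) ^ k) ^ b * Z ^ (1 - δ) := by
        rw [← rpow_add hZ0]
        exact (rpow_le_rpow_of_exponent_le hZ (by linarith)).trans (le_mul_of_one_le_left (by positivity) hy)
      have h10 : Z ^ e * Z ≤ Z ^ (1 + 1 / 3 * δ / (4 * b)) := by
        rw [← rpow_add_one hZ0.ne']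
        exact rpow_le_rpow_of_exponent_le hZ (by linarith)
      rw [show 5 * (e / 5) = e by ring] at h2
      have hX : (0 : ℝ) ≤ ((2 : ℝ) ^ k) ^ (-(1 / 3) : ℝ) := by positivity
      have hX' : (0 : ℝ) ≤ Z ^ (1 + 1 / 3 * δ / (4 * b)) * ((2 : ℝ) ^ k) ^ (-(1 / 3) : ℝ) := by
        positivity
      have h11 := mul_le_mul_of_nonneg_left (add_le_add (mul_le_mul_of_nonneg_right h10 hX) h9) hc.le
      have h12 : (0 : ℝ) ≤ ((2 : ℝ) ^ k) ^ b * Z ^ (1 - δ) := by positivity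
      calc _ ≤ _ := h6
        _ ≤ _ := add_le_add_right h2 _
        _ ≤ _ := by nlinarith [mul_nonneg hK.le hX', mul_nonneg hc.le h12, mul_nonneg hc.le hX']
  exact ⟨C₀, _, δ', hδ', h₀⟩

end Admissible

/-- **Power-saving error term for `S3 × A` extensions** (Theorem 1.4).  Let `A` be a finite
abelian group of odd order.  Then there are a real constant `C` and a `δ > 0` such that
`N_ℚ(S3 × A, X) = C·X^{1/|A|} + O(X^{1/|A| - δ})` as `X → ∞`. -/
theorem power_saving_S3xA (A : Type*) [CommGroup A] [Fintype A] (hA : Odd (Fintype.card A)) :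
    ∃ C δ : ℝ, 0 < δ ∧ (fun X : ℝ => (NS3A A X : ℝ) - C * X ^ ((1 : ℝ) / (Fintype.card A : ℝ)))
        =O[atTop]
      (fun X : ℝ => X ^ ((1 : ℝ) / (Fintype.card A : ℝ) - δ)) := by
  obtain ⟨C, K, δ, hδ, H⟩ := exists_NS3A_asymp hA
  have hm : 0 < (Fintype.card A : ℝ) := mod_cast Fintype.card_pos
  refine ⟨C, δ / Fintype.card A, by positivity, IsBigO.of_bound K ?_⟩
  filter_upwards [eventually_ge_atTop 1] with X hX
  have hX0 : 0 ≤ X := by linarith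
  have h := H (X ^ ((1 : ℝ) / (Fintype.card A : ℝ))) (one_le_rpow hX (by positivity))
  rw [← rpow_natCast, ← rpow_mul hX0, one_div_mul_cancel hm.ne', rpow_one, ← rpow_mul hX0] at h
  rwa [norm_eq_abs, norm_of_nonneg (by positivity),
    show 1 / (Fintype.card A : ℝ) - δ / Fintype.card A = 1 / (Fintype.card A : ℝ) * (1 - δ) by ring]
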